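/- There exists a constant γ > 0 with the following property: for every odd positive integer m and every integer k with 1 ≤ k ≤ 1 + γ·m/2, there exist a real number μ with m + 2k − 2 ≤ μ ≤ m + 2k − 1, a real number σ ∈ (0, 1), and a nontrivial μ-homogeneous solution u of the thin obstacle problem in ℝ³ whose contact set is exactly Z(u) = {(r·cos θ, r·sin θ, 0) : r ≥ 0, θ ∈ ℝ, and |θ − 2πk'/m| ≤ σπ/m for some integer k'}. -/

import Mathlib

open Real Set Filter

/-- Partial derivative of `f : ℝⁿ → ℝ` in the `i`-th coordinate direction. -/
noncomputable def pd {n : ℕ} (i : Fin n) (f : (Fin n → ℝ) → ℝ) (x : Fin n → ℝ) : ℝ :=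
  fderiv ℝ f x (Pi.single i 1)

/-- The Laplacian of `f : ℝⁿ → ℝ`. -/
noncomputable def lap {n : ℕ} (f : (Fin n → ℝ) → ℝ) (x : Fin n → ℝ) : ℝ :=
  ∑ i, pd i (pd i f) x

/-- The contact set `Z(u) = {xᵢ = 0} ∩ {u = 0}`, `i` being the distinguished coordinate. -/
def contactSet {n : ℕ} (u : (Fin n → ℝ) → ℝ) (i : Fin n) : Set (Fin n → ℝ) :=
  {x | x i = 0 ∧ u x = 0}

/-- `d` is the one-sided derivative `∂ᵢ⁺u(x) = lim_{t→0⁺} (u(x+t eᵢ) - u(x))/t`. -/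
def HasUpperDeriv {n : ℕ} (u : (Fin n → ℝ) → ℝ) (i : Fin n) (x : Fin n → ℝ) (d : ℝ) : Prop :=
  Filter.Tendsto (fun t : ℝ => (u (x + t • (Pi.single i 1 : Fin n → ℝ)) - u x) / t)
    (nhdsWithin 0 (Set.Ioi 0)) (nhds d)

/-- `u` is a `μ`-homogeneous solution of the thin obstacle problem in `ℝⁿ`,
with thin space `{xᵢ = 0}`. -/
structure IsTOPSol {n : ℕ} (μ : ℝ) (u : (Fin n → ℝ) → ℝ) (i : Fin n) : Prop where
  cont : Continuous u
  symm : ∀ x, u (Function.update x i (-(x i))) = u x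
  homog : ∀ r : ℝ, 0 < r → ∀ x, u (r • x) = r ^ μ * u x
  smooth : ContDiffOn ℝ 2 u (contactSet u i)ᶜ
  harm : ∀ x ∈ (contactSet u i)ᶜ, lap u x = 0
  nonneg : ∀ x, x i = 0 → 0 ≤ u x
  upper : ∀ x, x i = 0 → ∃ d, d ≤ 0 ∧ HasUpperDeriv u i x d


/-- The closed cone in the thin space consisting of `2m` evenly spaced slits of
angular half-width `σπ/m`. -/
def slitCone (m : ℕ) (σ : ℝ) : Set (Fin 3 → ℝ) :=
  {x | ∃ r : ℝ, 0 ≤ r ∧ ∃ θ : ℝ, (∃ k : ℤ, |θ - 2 * π * k / m| ≤ σ * π / m) ∧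
      x = ![r * Real.cos θ, r * Real.sin θ, 0]}


open Real Set Filter

namespace TO

/-! ### Part A : coefficients -/

/-- Fourier coefficients of `((1+cos θ)/2)^n`. -/
noncomputable def bt : ℕ → ℤ → ℝ
  | 0, v => if v = 0 then 1 else 0
  | n+1, v => (1/2) * bt n v + (1/4) * bt n (v+1) + (1/4) * bt n (v-1)

lemma bt_succ (n : ℕ) (v : ℤ) :
    bt (n+1) v = (1/2) * bt n v + (1/4) * bt n (v+1) + (1/4) * bt n (v-1) := rfl

lemma bt_nonneg (n : ℕ) : ∀ v, 0 ≤ bt n v := by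
  induction n with
  | zero => intro v; simp only [bt]; split_ifs <;> norm_num
  | succ n ih => intro v; rw [bt_succ]; have := ih v; have := ih (v+1); have := ih (v-1); linarith

lemma bt_neg (n : ℕ) : ∀ v, bt n (-v) = bt n v := by
  induction n with
  | zero => intro v; simp [bt]
  | succ n ih =>
    intro v; rw [bt_succ, bt_succ, ih v, ← ih (v+1), ← ih (v-1)]
    rw [show -v + 1 = -(v-1) by ring, show -v - 1 = -(v+1) by ring]; ring

lemma bt_zero_of_lt (n : ℕ) : ∀ v : ℤ, (n:ℤ) < v → bt n v = 0 := by
  induction n with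
  | zero => intro v hv; simp only [bt]; rw [if_neg]; rintro rfl; simp at hv
  | succ n ih =>
    intro v hv; push_cast at hv
    rw [bt_succ, ih v (by linarith), ih (v+1) (by linarith), ih (v-1) (by linarith)]; ring

lemma bt_self_pos (n : ℕ) : 0 < bt n n := by
  induction n with
  | zero => simp [bt]
  | succ n ih =>
    rw [bt_succ]; push_cast
    rw [bt_zero_of_lt n (n+1) (by linarith), bt_zero_of_lt n (n+1+1) (by linarith)]
    simp only [add_sub_cancel_right]; linarith

lemma bt_I1 (n : ℕ) : ∀ v : ℤ, ((n:ℝ) + v + 1) * bt n (v+1) = (n - v) * bt n v := by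
  induction n with
  | zero =>
    intro v; simp only [bt]
    by_cases h : v = 0
    · subst h; simp
    · by_cases h' : v + 1 = 0
      · have : (v:ℝ) + 1 = 0 := by exact_mod_cast h'
        simp [h, h', this]
      · simp [h, h']
  | succ n ih =>
    intro v
    rw [bt_succ, bt_succ]
    have h1 := ih (v+1); have h2 := ih v; have h3 := ih (v-1)
    rw [show v - 1 + 1 = v by ring] at h3
    rw [show v + 1 - 1 = v by ring]
    push_cast at *
    linear_combination (1/4) * h1 + (1/2) * h2 + (1/4) * h3

lemma bt_I2 (n : ℕ) (v : ℤ) :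
    ((n:ℝ)+1) * (bt n (v-1) - bt n (v+1)) = 4 * v * bt (n+1) v := by
  have h2 := bt_I1 n v; have h3 := bt_I1 n (v-1)
  rw [show v - 1 + 1 = v by ring] at h3
  rw [bt_succ]; push_cast at *
  linear_combination (-1) * h2 - h3

lemma bt_anti (n : ℕ) (v : ℕ) : bt n ((v:ℤ)+1) ≤ bt n v := by
  have h := bt_I1 n v
  have h0 := bt_nonneg n v
  have h1 := bt_nonneg n (v+1)
  push_cast at h
  have hv : (0:ℝ) ≤ v := Nat.cast_nonneg v
  have hn : (0:ℝ) ≤ n := Nat.cast_nonneg n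
  by_contra hc
  push Not at hc
  nlinarith

lemma bt_zero_succ (n : ℕ) : bt (n+1) 0 = bt n 0 * ((2*n+1)/(2*n+2)) := by
  have h := bt_I1 n 0
  have h2 := bt_neg n 1
  rw [bt_succ]
  simp only [zero_add, zero_sub, h2] at *
  have hn : (0:ℝ) ≤ n := Nat.cast_nonneg n
  push_cast at h
  field_simp
  linear_combination 4 * h

lemma bt_zero_sq (n : ℕ) : (bt n 0)^2 * (2*n+1) ≤ 1 := by
  induction n with
  | zero => simp [bt]
  | succ n ih =>
    rw [bt_zero_succ]
    have hn : (0:ℝ) ≤ n := Nat.cast_nonneg n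
    push_cast
    have : (bt n 0 * ((2*n+1)/(2*n+2)))^2 * (2*(n+1)+1)
        = ((bt n 0)^2 * (2*n+1)) * ((2*n+1)*(2*n+3)/(2*n+2)^2) := by field_simp; ring
    rw [this]
    have h1 : ((2*n+1)*(2*n+3)/(2*n+2)^2 : ℝ) ≤ 1 := by
      rw [div_le_one (by positivity)]; nlinarith
    calc _ ≤ 1 * (1:ℝ) := by gcongr
      _ = 1 := by norm_num

lemma bt_le_zero (n : ℕ) (v : ℕ) : bt n v ≤ bt n 0 := by
  induction v with
  | zero => simp
  | succ v ih => push_cast; exact (bt_anti n v).trans ih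

lemma bt_zero_le (n : ℕ) : bt n 0 ≤ 1 / Real.sqrt (n+1) := by
  have h := bt_zero_sq n
  have h0 := bt_nonneg n 0
  have hn : (0:ℝ) ≤ n := Nat.cast_nonneg n
  rw [le_div_iff₀ (by positivity)]
  rw [← Real.sqrt_sq h0, ← Real.sqrt_mul (sq_nonneg _)]
  rw [Real.sqrt_le_iff]
  refine ⟨by norm_num, ?_⟩
  nlinarith [sq_nonneg (bt n 0)]

/-- coefficients of the kernel -/
noncomputable def cc (μ : ℝ) : ℕ → ℝ
  | 0 => 1
  | n+1 => cc μ n * ((n*(n+1) - μ*(μ+1)) / (n+1)^2)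

lemma cc_succ (μ : ℝ) (n : ℕ) :
    cc μ (n+1) = cc μ n * ((n*(n+1) - μ*(μ+1)) / (n+1)^2) := rfl

lemma cc_rec (μ : ℝ) (n : ℕ) :
    ((n:ℝ)+1)^2 * cc μ (n+1) = (n*(n+1) - μ*(μ+1)) * cc μ n := by
  rw [cc_succ]; field_simp

lemma cc_continuous (n : ℕ) : Continuous (fun μ => cc μ n) := by
  induction n with
  | zero => simpa [cc] using continuous_const
  | succ n ih => simp only [cc_succ]; fun_prop

/-- n|c_n| is nonincreasing from M+1 on -/
lemma cc_abs_step {M : ℕ} {μ : ℝ} (h1 : (M:ℝ) ≤ μ) (h2 : μ ≤ M+1) {n : ℕ} (hn : M+1 ≤ n) :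
    ((n:ℝ)+1) * |cc μ (n+1)| ≤ n * |cc μ n| := by
  have hn' : (M:ℝ)+1 ≤ n := by exact_mod_cast hn
  have hM : (0:ℝ) ≤ M := Nat.cast_nonneg M
  have hq : 0 ≤ (n:ℝ)*(n+1) - μ*(μ+1) := by nlinarith
  rw [cc_succ, abs_mul, abs_of_nonneg (div_nonneg hq (by positivity))]
  have : ((n:ℝ)+1) * (|cc μ n| * ((n*(n+1) - μ*(μ+1)) / (n+1)^2))
     = |cc μ n| * ((n*(n+1) - μ*(μ+1)) / (n+1)) := by field_simp
  rw [this, mul_comm (n:ℝ) |cc μ n|]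
  refine mul_le_mul_of_nonneg_left ?_ (abs_nonneg _)
  rw [div_le_iff₀ (by positivity)]
  nlinarith

lemma cc_bound (M : ℕ) : ∃ C : ℝ, 0 < C ∧ ∀ μ : ℝ, (M:ℝ) ≤ μ → μ ≤ M+1 → ∀ n : ℕ,
    |cc μ n| ≤ C / (n+1) := by
  have hb : ∀ n : ℕ, ∃ C : ℝ, 0 < C ∧ ∀ μ : ℝ, (M:ℝ) ≤ μ → μ ≤ M+1 → |cc μ n| ≤ C := by
    intro n
    obtain ⟨C, hC⟩ := (isCompact_Icc (a := (M:ℝ)) (b := M+1)).exists_bound_of_continuousOn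
      (cc_continuous n).continuousOn
    exact ⟨|C|+1, by positivity, fun μ h1 h2 => ((hC μ ⟨h1, h2⟩).trans (le_abs_self C)).trans
      (by linarith)⟩
  choose B hB0 hB using hb
  refine ⟨(∑ i ∈ Finset.range (M+2), B i) * (M+2) * 2, ?_, ?_⟩
  · have : 0 < ∑ i ∈ Finset.range (M+2), B i :=
      Finset.sum_pos (fun i _ => hB0 i) ⟨0, by simp⟩
    positivity
  intro μ h1 h2 n
  have hS : ∀ i, i < M+2 → B i ≤ ∑ i ∈ Finset.range (M+2), B i := fun i hi =>
    Finset.single_le_sum (fun j _ => (hB0 j).le) (Finset.mem_range.2 hi)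
  have hS0 : 0 < ∑ i ∈ Finset.range (M+2), B i := (hB0 0).trans_le (hS 0 (by omega))
  set S := ∑ i ∈ Finset.range (M+2), B i
  have hM : (0:ℝ) ≤ M := Nat.cast_nonneg M
  have key : ∀ n, M+1 ≤ n → (n:ℝ) * |cc μ n| ≤ (M+1) * S := by
    intro n hn
    induction n, hn using Nat.le_induction with
    | base => push_cast; gcongr; exact (hB _ μ h1 h2).trans (hS _ (by omega))
    | succ n hn ih => push_cast; exact (cc_abs_step h1 h2 hn).trans ih
  rw [le_div_iff₀ (by positivity)]
  have hn0 : (0:ℝ) ≤ n := Nat.cast_nonneg n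
  rcases Nat.lt_or_ge n (M+1) with hn | hn
  · have hn' : (n:ℝ) + 1 ≤ M+1 := by exact_mod_cast hn
    calc |cc μ n| * (n+1) ≤ S * (M+1) := by
          gcongr; exact (hB n μ h1 h2).trans (hS n (by omega))
      _ ≤ S * (M+2) * 2 := by nlinarith
  · have hn' : (M:ℝ) + 1 ≤ n := by exact_mod_cast hn
    have := key n hn
    have h3 : |cc μ n| * (n+1) ≤ 2 * (n * |cc μ n|) := by
      have := abs_nonneg (cc μ n); nlinarith
    nlinarith

lemma cc_sign {M : ℕ} (hM : Odd M) {μ : ℝ} (h1 : (M:ℝ) < μ) (h2 : μ < M+1) :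
    ∀ n, M + 1 ≤ n → 0 < cc μ n := by
  have hM0 : (0:ℝ) ≤ M := Nat.cast_nonneg M
  have hneg : ∀ n, n ≤ M+1 → 0 < (-1)^n * cc μ n := by
    intro n
    induction n with
    | zero => intro _; simp [cc]
    | succ n ih =>
      intro hn
      have hn' : (n:ℝ) ≤ M := by exact_mod_cast (by omega : n ≤ M)
      have hn0 : (0:ℝ) ≤ n := Nat.cast_nonneg n
      have := ih (by omega)
      rw [cc_succ, pow_succ]
      have hq : 0 < -(((n:ℝ)*(n+1) - μ*(μ+1)) / (n+1)^2) := by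
        rw [← neg_div]; apply div_pos _ (by positivity); nlinarith
      have := mul_pos this hq
      linarith
  intro n hn
  induction n, hn using Nat.le_induction with
  | base => 
    have := hneg (M+1) le_rfl
    rwa [Even.neg_one_pow (by exact hM.add_one), one_mul] at this
  | succ n hn ih =>
    rw [cc_succ]
    apply mul_pos ih
    have hn' : (M:ℝ)+1 ≤ n := by exact_mod_cast hn
    apply div_pos _ (by positivity); nlinarith

/-- the series `s_ν` -/
noncomputable def ss (μ : ℝ) (v : ℤ) : ℝ := ∑' n, cc μ n * bt n v

lemma summable_bd (C : ℝ) : Summable (fun n : ℕ => C / ((n:ℝ)+1) * (1 / Real.sqrt (n+1))) := by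
  have h : Summable (fun n : ℕ => 1 / ((n:ℝ)+1) ^ (3/2 : ℝ)) := by
    have := (Real.summable_one_div_nat_rpow (p := 3/2)).2 (by norm_num)
    have := (summable_nat_add_iff 1).2 this
    simpa using this
  refine (h.mul_left C).congr ?_
  intro n
  have hp : (0:ℝ) < n + 1 := by positivity
  rw [show (3/2:ℝ) = 1 + 1/2 by norm_num, Real.rpow_add hp, Real.rpow_one, ← Real.sqrt_eq_rpow]
  field_simp

lemma bt_abs_le (n : ℕ) (v : ℤ) : bt n v ≤ 1 / Real.sqrt (n+1) := by
  rcases Int.natAbs_eq v with h | h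
  · rw [h]; exact (bt_le_zero n _).trans (bt_zero_le n)
  · rw [h, bt_neg]; exact (bt_le_zero n _).trans (bt_zero_le n)

lemma term_bound {M : ℕ} {C : ℝ} (hC : ∀ μ : ℝ, (M:ℝ) ≤ μ → μ ≤ M+1 → ∀ n : ℕ,
    |cc μ n| ≤ C / (n+1)) {μ : ℝ} (h1 : (M:ℝ) ≤ μ) (h2 : μ ≤ M+1) (v : ℤ) (n : ℕ) :
    ‖cc μ n * bt n v‖ ≤ C / ((n:ℝ)+1) * (1 / Real.sqrt (n+1)) := by
  rw [Real.norm_eq_abs, abs_mul, abs_of_nonneg (bt_nonneg n v)]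
  have := hC μ h1 h2 n
  exact mul_le_mul this (bt_abs_le n v) (bt_nonneg n v) ((abs_nonneg _).trans this)

lemma ss_summable {M : ℕ} {μ : ℝ} (h1 : (M:ℝ) ≤ μ) (h2 : μ ≤ M+1) (v : ℤ) :
    Summable (fun n => cc μ n * bt n v) := by
  obtain ⟨C, _, hC⟩ := cc_bound M
  exact Summable.of_norm_bounded (summable_bd C) (term_bound hC h1 h2 v)

lemma ss_continuousOn (M : ℕ) (v : ℤ) : ContinuousOn (fun μ => ss μ v) (Icc (M:ℝ) (M+1)) := by
  obtain ⟨C, _, hC⟩ := cc_bound M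
  refine continuousOn_tsum (fun n => ((cc_continuous n).mul continuous_const).continuousOn)
    (summable_bd C) (fun n μ hμ => term_bound hC hμ.1 hμ.2 v n)

noncomputable def qq (μ : ℝ) (v : ℝ) : ℝ := v * (v+1) - μ*(μ+1)

lemma ss_rec {M : ℕ} {μ : ℝ} (h1 : (M:ℝ) ≤ μ) (h2 : μ ≤ M+1) (v : ℤ) :
    qq μ (v-1) * ss μ (v-1) = qq μ v * ss μ (v+1) := by
  have ha := (ss_summable h1 h2 (v-1)).hasSum
  have hb := (ss_summable h1 h2 (v+1)).hasSum
  have hs := ((ha.mul_left (qq μ (v-1))).sub (hb.mul_left (qq μ v))).tendsto_sum_nat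
  have ht : ∀ N : ℕ, ∑ n ∈ Finset.range N, (qq μ (v-1) * (cc μ n * bt n (v-1)) -
      qq μ v * (cc μ n * bt n (v+1))) = 4 * v * (N * cc μ N * bt N v) := by
    intro N
    induction N with
    | zero => simp
    | succ n ih =>
      rw [Finset.sum_range_succ, ih]
      have h1 := bt_I1 n v; have h2 := bt_I1 n (v-1)
      rw [show v - 1 + 1 = v by ring] at h2
      have h3 := bt_I2 n v
      have h4 := cc_rec μ n
      simp only [qq]; push_cast at *
      have e1 : 4 * (v:ℝ) * ((n+1) * cc μ (n+1) * bt (n+1) v)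
        = ((n+1)^2 * cc μ (n+1)) * (bt n (v-1) - bt n (v+1)) := by
        linear_combination (-(n+1:ℝ)) * cc μ (n+1) * h3
      rw [e1, h4]
      linear_combination ((n:ℝ) + v) * cc μ n * h2 + ((n:ℝ) - v) * cc μ n * h1
  have hz : Tendsto (fun N : ℕ => 4 * (v:ℝ) * (N * cc μ N * bt N v)) atTop (nhds 0) := by
    obtain ⟨C, hC0, hC⟩ := cc_bound M
    have hb : Tendsto (fun N : ℕ => C * (1 / Real.sqrt ((N:ℝ)+1))) atTop (nhds 0) := by
      rw [← mul_zero C]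
      refine Tendsto.const_mul C ?_
      simp only [one_div]
      exact (Real.tendsto_sqrt_atTop.comp
        (tendsto_atTop_add_const_right _ 1 tendsto_natCast_atTop_atTop)).inv_tendsto_atTop
    rw [← mul_zero (4 * (v:ℝ))]
    refine Tendsto.const_mul _ (squeeze_zero_norm (fun N => ?_) hb)
    rw [norm_mul, Real.norm_eq_abs, Real.norm_eq_abs, abs_of_nonneg (bt_nonneg N v)]
    refine mul_le_mul ?_ (bt_abs_le N v) (bt_nonneg N v) hC0.le
    rw [abs_mul, Nat.abs_cast]
    have := hC μ h1 h2 N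
    have hp : (0:ℝ) < N + 1 := by positivity
    rw [le_div_iff₀ hp] at this
    nlinarith [abs_nonneg (cc μ N)]
  have hu := tendsto_nhds_unique (hs.congr ht) hz
  simp only [ss]
  linarith

lemma ss_pos {M : ℕ} (hM : Odd M) {μ : ℝ} (h1 : (M:ℝ) < μ) (h2 : μ < M+1) {v : ℕ}
    (hv : M+1 ≤ v) : 0 < ss μ v := by
  refine (ss_summable h1.le h2.le v).tsum_pos ?_ v ?_
  · intro n
    rcases Nat.lt_or_ge n v with h | h
    · rw [bt_zero_of_lt n v (by exact_mod_cast h), mul_zero]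
    · exact mul_nonneg (cc_sign hM h1 h2 n (by omega)).le (bt_nonneg _ _)
  · exact mul_pos (cc_sign hM h1 h2 v hv) (bt_self_pos v)

lemma ss_anti {M : ℕ} (hM : Odd M) {μ : ℝ} (h1 : (M:ℝ) < μ) (h2 : μ < M+1) {v : ℕ}
    (hv : M+1 ≤ v) : ss μ (v+1) ≤ ss μ v := by
  refine (ss_summable h1.le h2.le _).tsum_le_tsum ?_ (ss_summable h1.le h2.le _)
  intro n
  rcases Nat.lt_or_ge n v with h | h
  · rw [bt_zero_of_lt n v (by exact_mod_cast h), bt_zero_of_lt n (v+1) (by omega)]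
  · exact mul_le_mul_of_nonneg_left (bt_anti n v) (cc_sign hM h1 h2 n (by omega)).le

lemma qq_pos {M : ℕ} {μ : ℝ} (h1 : (M:ℝ) < μ) (h2 : μ < M+1) {v : ℕ}
    (hv : M+1 ≤ v) : 0 < qq μ v := by
  have hv' : (M:ℝ)+1 ≤ v := by exact_mod_cast hv
  have : (0:ℝ) ≤ M := Nat.cast_nonneg M
  simp only [qq]; nlinarith

lemma qq_neg {M : ℕ} {μ : ℝ} (h1 : (M:ℝ) < μ) {v : ℕ}
    (hv : v ≤ M) : qq μ v < 0 := by
  have hv' : (v:ℝ) ≤ M := by exact_mod_cast hv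
  have : (0:ℝ) ≤ v := Nat.cast_nonneg v
  simp only [qq]; nlinarith

lemma qq_ne {M : ℕ} {μ : ℝ} (h1 : (M:ℝ) < μ) (h2 : μ < M+1) (v : ℕ) : qq μ v ≠ 0 := by
  rcases Nat.lt_or_ge v (M+1) with h | h
  · exact (qq_neg h1 (by omega)).ne
  · exact (qq_pos h1 h2 h).ne'

lemma ss_rec' {M : ℕ} {μ : ℝ} (h1 : (M:ℝ) ≤ μ) (h2 : μ ≤ M+1) (v : ℕ) :
    qq μ v * ss μ v = qq μ ((v:ℝ)+1) * ss μ ((v:ℤ)+2) := by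
  have := ss_rec h1 h2 ((v:ℤ)+1)
  push_cast at this
  simpa [add_assoc] using this

lemma ss_ne {M : ℕ} (hM : Odd M) {μ : ℝ} (h1 : (M:ℝ) < μ) (h2 : μ < M+1) (v : ℕ) :
    ss μ v ≠ 0 := by
  have key : ∀ d : ℕ, ∀ v : ℕ, M + 1 ≤ v + d → ss μ v ≠ 0 := by
    intro d
    induction d with
    | zero => intro v hv; exact (ss_pos hM h1 h2 hv).ne'
    | succ d ih =>
      intro v hv h0
      have := ss_rec' h1.le h2.le v
      rw [h0, mul_zero] at this
      have hq := qq_ne h1 h2 (v+1)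
      push_cast at hq
      have h3 := ih (v+2) (by omega)
      push_cast at h3
      exact (mul_ne_zero hq h3) this.symm
  exact key (M+1) v (by omega)

/-- κ -/
noncomputable def kap (μ : ℝ) : ℝ := ss μ 0 * ss μ 1 * qq μ 0

lemma kap_eq {M : ℕ} {μ : ℝ} (h1 : (M:ℝ) ≤ μ) (h2 : μ ≤ M+1) (v : ℕ) :
    ss μ v * ss μ ((v:ℤ)+1) * qq μ v = kap μ := by
  induction v with
  | zero => simp [kap]
  | succ v ih =>
    rw [← ih]
    have := ss_rec' h1 h2 v
    push_cast
    rw [show ((v:ℤ)+1+1) = v+2 by ring]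
    linear_combination (-1) * ss μ ((v:ℤ)+1) * this

lemma kap_pos {M : ℕ} (hM : Odd M) {μ : ℝ} (h1 : (M:ℝ) < μ) (h2 : μ < M+1) : 0 < kap μ := by
  rw [← kap_eq h1.le h2.le (M+1)]
  have a := ss_pos hM h1 h2 (v := M+1) le_rfl
  have b := ss_pos hM h1 h2 (v := M+1+1) (by omega)
  have c := qq_pos h1 h2 (v := M+1) le_rfl
  have b' : ((M+1:ℕ):ℤ) + 1 = ((M+1+1:ℕ):ℤ) := by push_cast; ring
  rw [b']
  positivity

noncomputable def ell (μ : ℝ) (v : ℕ) : ℝ := Real.sqrt (kap μ) / ss μ v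

lemma ell_mul_ss {M : ℕ} (hM : Odd M) {μ : ℝ} (h1 : (M:ℝ) < μ) (h2 : μ < M+1) (v : ℕ) :
    ell μ v * ss μ v = Real.sqrt (kap μ) := by
  rw [ell, div_mul_cancel₀ _ (ss_ne hM h1 h2 v)]

lemma ell_mul {M : ℕ} (hM : Odd M) {μ : ℝ} (h1 : (M:ℝ) < μ) (h2 : μ < M+1) (v : ℕ) :
    ell μ v * ell μ (v+1) = qq μ v := by
  have a := ss_ne hM h1 h2 v
  have b := ss_ne hM h1 h2 (v+1)
  rw [ell, ell, div_mul_div_comm, Real.mul_self_sqrt (kap_pos hM h1 h2).le,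
    div_eq_iff (mul_ne_zero a b), ← kap_eq h1.le h2.le v]
  push_cast; ring

lemma ell_pos {M : ℕ} (hM : Odd M) {μ : ℝ} (h1 : (M:ℝ) < μ) (h2 : μ < M+1) {v : ℕ}
    (hv : M+1 ≤ v) : 0 < ell μ v :=
  div_pos (Real.sqrt_pos.2 (kap_pos hM h1 h2)) (ss_pos hM h1 h2 hv)

lemma ell_mono {M : ℕ} (hM : Odd M) {μ : ℝ} (h1 : (M:ℝ) < μ) (h2 : μ < M+1) {v : ℕ}
    (hv : M+1 ≤ v) : ell μ v ≤ ell μ (v+1) := by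
  have b := ss_pos hM h1 h2 (v := v+1) (by omega)
  refine div_le_div_of_nonneg_left (Real.sqrt_nonneg _) b ?_
  push_cast; exact ss_anti hM h1 h2 hv

lemma ell_continuousOn {M : ℕ} (hM : Odd M) (v : ℕ) :
    ContinuousOn (fun μ => ell μ v) (Ioo (M:ℝ) (M+1)) := by
  have hs : ∀ v : ℤ, ContinuousOn (fun μ => ss μ v) (Ioo (M:ℝ) (M+1)) := fun v =>
    (ss_continuousOn M v).mono Ioo_subset_Icc_self
  refine ContinuousOn.div ?_ (hs v) (fun μ hμ => ss_ne hM hμ.1 hμ.2 v)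
  refine Real.continuous_sqrt.comp_continuousOn ?_
  refine ((hs 0).mul (hs 1)).mul ?_
  simp only [qq]; fun_prop

end TO

open Real Set Filter

namespace TO

lemma lim_aux (D A B : ℝ) :
    Tendsto (fun w : ℕ => ((w:ℝ) - D/w - A/(w:ℝ)^3 - B/(w:ℝ)^5) / w) atTop (nhds 1) := by
  have hinv : Tendsto (fun v : ℕ => ((v:ℝ))⁻¹) atTop (nhds 0) :=
    tendsto_inv_atTop_zero.comp tendsto_natCast_atTop_atTop
  have h2 : Tendsto (fun w : ℕ => D*((w:ℝ)⁻¹)^2) atTop (nhds (D*0^2)) := (hinv.pow 2).const_mul D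
  have h4 : Tendsto (fun w : ℕ => A*((w:ℝ)⁻¹)^4) atTop (nhds (A*0^4)) := (hinv.pow 4).const_mul A
  have h6 : Tendsto (fun w : ℕ => B*((w:ℝ)⁻¹)^6) atTop (nhds (B*0^6)) := (hinv.pow 6).const_mul B
  have h0 : Tendsto (fun _ : ℕ => (1:ℝ)) atTop (nhds 1) := tendsto_const_nhds
  have := ((h0.sub h2).sub h4).sub h6
  have e : 1 - D*0^2 - A*0^4 - B*0^6 = 1 := by ring
  rw [e] at this
  refine Tendsto.congr' ?_ this
  filter_upwards [eventually_ge_atTop 1] with w hw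
  have hw : (w:ℝ) ≠ 0 := by positivity
  field_simp


section
variable {M : ℕ} (hM : Odd M) {μ : ℝ} (h1 : (M:ℝ) < μ) (h2 : μ < M+1)
include hM h1 h2

lemma ell_sq_le {v : ℕ} (hv : M+1 ≤ v) : ell μ v ^ 2 ≤ qq μ v := by
  rw [← ell_mul hM h1 h2 v, sq]
  exact mul_le_mul_of_nonneg_left (ell_mono hM h1 h2 hv) (ell_pos hM h1 h2 hv).le

lemma le_ell_sq {v : ℕ} (hv : M+1 ≤ v) : qq μ v ≤ ell μ (v+1) ^ 2 := by
  rw [← ell_mul hM h1 h2 v, sq]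
  exact mul_le_mul_of_nonneg_right (ell_mono hM h1 h2 hv) (ell_pos hM h1 h2 (by omega)).le

lemma ell_le {v : ℕ} (hv : M+1 ≤ v) : ell μ v ≤ v + 1 := by
  have h := ell_sq_le hM h1 h2 hv
  have : (0:ℝ) ≤ M := Nat.cast_nonneg M
  have hv0 : (0:ℝ) ≤ v := Nat.cast_nonneg v
  refine abs_le_of_sq_le_sq' (h.trans ?_) (by positivity) |>.2
  simp only [qq]; nlinarith

lemma ell_ratio (v : ℕ) : ell μ (v+2) * qq μ v = ell μ v * qq μ ((v:ℝ)+1) := by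
  have a := ell_mul hM h1 h2 v
  have b := ell_mul hM h1 h2 (v+1)
  push_cast at b
  rw [← a, ← b]; ring

lemma ell_ne (v : ℕ) : ell μ v ≠ 0 := by
  intro h
  have a := ell_mul hM h1 h2 v
  rw [h, zero_mul] at a
  exact qq_ne h1 h2 v a.symm

lemma ell_sign {v : ℕ} (hv : v ≤ M+1) : 0 < (-1)^v * ell μ v := by
  induction hv using Nat.decreasingInduction with
  | self =>
    rw [Even.neg_one_pow (by exact hM.add_one), one_mul]; exact ell_pos hM h1 h2 le_rfl
  | of_succ k hk ih =>
    have a := ell_mul hM h1 h2 k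
    have b := qq_neg h1 (v := k) (by omega)
    rw [← a] at b
    rw [pow_succ] at ih
    have hs : ((-1:ℝ)^k)^2 = 1 := by rw [← pow_mul, mul_comm, pow_mul]; norm_num
    by_contra hc
    push Not at hc
    have := mul_nonneg (neg_nonneg.2 hc) ih.le
    have e : -((-1)^k * ell μ k) * ((-1:ℝ)^k * -1 * ell μ (k+1)) = ((-1:ℝ)^k)^2 * (ell μ k * ell μ (k+1)) := by ring
    rw [e, hs] at this
    linarith

lemma ell_abs_anti {v : ℕ} (hv : v + 1 ≤ M) : |ell μ (v+2)| ≤ |ell μ v| := by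
  have h := congrArg abs (ell_ratio hM h1 h2 v)
  rw [abs_mul, abs_mul] at h
  have a := qq_neg h1 (v := v) (by omega)
  have b := qq_neg h1 (v := v+1) (by omega)
  push_cast at b
  rw [abs_of_neg a, abs_of_neg b] at h
  have hv0 : (0:ℝ) ≤ v := Nat.cast_nonneg v
  have hab : qq μ v ≤ qq μ ((v:ℝ)+1) := by simp only [qq]; nlinarith
  have := abs_nonneg (ell μ v)
  by_contra hc
  push Not at hc
  nlinarith

lemma ell_abs_anti' {v d : ℕ} (hv : v + 2*d ≤ M+1) : |ell μ (v+2*d)| ≤ |ell μ v| := by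
  induction d with
  | zero => simp
  | succ d ih =>
    have := ell_abs_anti hM h1 h2 (v := v + 2*d) (by omega)
    rw [show v + 2*(d+1) = v+2*d+2 by ring]
    exact this.trans (ih (by omega))

lemma ell_zero_mul_one : ell μ 0 * |ell μ 1| = μ*(μ+1) := by
  have a := ell_mul hM h1 h2 0
  have s1 := ell_sign hM h1 h2 (v := 1) (by omega)
  simp only [pow_one] at s1
  rw [abs_of_neg (by linarith)]
  simp only [qq] at a; push_cast at a; simp only [zero_add] at a
  linarith

lemma ell_zero_pos : 0 < ell μ 0 := by simpa using ell_sign hM h1 h2 (v := 0) (by omega)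

lemma ell_odd_neg {m : ℕ} (hm : Odd m) (hmM : m ≤ M) : ell μ m < 0 := by
  have := ell_sign hM h1 h2 (v := m) (by omega)
  rw [hm.neg_one_pow] at this; linarith

lemma ell_abs_le_one {m : ℕ} (hm : Odd m) (hmM : m ≤ M) : |ell μ m| ≤ |ell μ 1| := by
  obtain ⟨d, rfl⟩ := hm
  have := ell_abs_anti' hM h1 h2 (v := 1) (d := d) (by omega)
  rwa [add_comm] at this

lemma ell_M_le_abs {m : ℕ} (hm : Odd m) (hmM : m ≤ M) : |ell μ M| ≤ |ell μ m| := by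
  have : ∃ d, M = m + 2*d := by
    obtain ⟨a, rfl⟩ := hm; obtain ⟨b, rfl⟩ := hM; exact ⟨b - a, by omega⟩
  obtain ⟨d, hd⟩ := this
  have := ell_abs_anti' hM h1 h2 (v := m) (d := d) (by omega)
  rwa [← hd] at this

end

set_option maxHeartbeats 1600000 in
/-- good left end -/
lemma left_end {M : ℕ} (hM : Odd M) {m : ℕ} (hm : Odd m) (hmM : m ≤ M) :
    ∀ ε μ : ℝ, ε = 1/(8*(M+2)) → μ = M + ε →
    (M:ℝ) < μ ∧ μ < M+1 ∧ 2 * |ell μ m| < ell μ 0 := by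
  intro ε μ hε hμ
  have hM1 : (1:ℝ) ≤ M := by exact_mod_cast hM.pos
  have hε0 : 0 < ε := by rw [hε]; positivity
  have hε1 : ε ≤ 1/24 := by
    rw [hε]; apply one_div_le_one_div_of_le <;> linarith
  have h1 : (M:ℝ) < μ := by linarith
  have h2 : μ < M+1 := by linarith
  refine ⟨h1, h2, ?_⟩
  have a := ell_zero_mul_one hM h1 h2
  have b := ell_abs_le_one hM h1 h2 hm hmM
  have p0 := ell_zero_pos hM h1 h2
  obtain ⟨t, ht⟩ := hM
  have hM : Odd M := ⟨t, ht⟩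
  have c := ell_abs_anti' hM h1 h2 (v := 0) (d := t) (by omega)
  rw [abs_of_pos p0, zero_add] at c
  have r := congrArg abs (ell_ratio hM h1 h2 (2*t))
  have et : ((2*t:ℕ):ℝ) = M - 1 := by rw [ht]; push_cast; ring
  rw [abs_mul, abs_mul, et, show 2*t+2 = M+1 by omega] at r
  have hq1 : qq μ ((M:ℝ)-1) ≤ - (2*M) := by
    simp only [qq]; nlinarith
  have hq2 : qq μ ((M:ℝ)-1+1) = - (ε * (2*M+1+ε)) := by simp only [qq]; rw [hμ]; ring
  rw [hq2, abs_neg, abs_of_pos (by positivity : 0 < ε * (2*M+1+ε)),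
    abs_of_nonpos (by linarith : qq μ ((M:ℝ)-1) ≤ 0), abs_of_pos (ell_pos hM h1 h2 le_rfl)] at r
  -- lower bound of ell (M+1)
  have d := ell_mul hM h1 h2 (M+1)
  have e := ell_le hM h1 h2 (v := M+1+1) (by omega)
  have f := ell_pos hM h1 h2 (v := M+1) (by omega)
  have g : (M:ℝ) + 1 ≤ qq μ ((M+1:ℕ):ℝ) := by
    simp only [qq]; push_cast; nlinarith
  push_cast at e g d
  have hl : 1/2 ≤ ell μ (M+1) := by
    rw [← d] at g
    have : ell μ (M+1) * ell μ (M+1+1) ≤ ell μ (M+1) * (M+3) := by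
      apply mul_le_mul_of_nonneg_left _ f.le; linarith
    by_contra hc; push Not at hc; nlinarith
  -- |ell (2t)| ≥ 1/(4ε)
  have hk : (M:ℝ) ≤ |ell μ (2*t)| * (ε * (2*M+1+ε)) := by
    rw [← r]; nlinarith
  have hε' : ε * (M+2) = 1/8 := by rw [hε]; field_simp
  have hk2 : ε * (2*M+1+ε) ≤ 1/4 := by nlinarith
  have hk3 : 2 * ((M:ℝ)+2) ≤ |ell μ (2*t)| := by
    by_contra hc; push Not at hc
    have p := abs_nonneg (ell μ (2*t))
    have q1 : ε * (2*M+1+ε) ≤ ε * (2*M+2) := by nlinarith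
    have : |ell μ (2*t)| * (ε * (2*M+1+ε)) ≤ 2 * ((M:ℝ)+2) * (ε * (2*M+2)) := by
      gcongr
    have e3 : 2 * ((M:ℝ)+2) * (ε * (2*M+2)) = (1/4) * (2*M+2) := by
      rw [← mul_assoc]; congr 1; linear_combination 2 * hε'
    nlinarith
  have hΛ : 2 * (μ*(μ+1)) < (2 * ((M:ℝ)+2))^2 := by nlinarith
  have hL : 2 * (M+2) ≤ ell μ 0 := hk3.trans c
  by_contra hc; push Not at hc
  have hc2 : ell μ 0 ≤ 2 * |ell μ 1| := by linarith
  have : ell μ 0 * ell μ 0 ≤ 2 * (μ*(μ+1)) := by rw [← a]; nlinarith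
  nlinarith

/-- good right end -/
lemma right_end {M : ℕ} (hM : Odd M) {m : ℕ} (hm : Odd m) (hmM : m ≤ M) :
    ∀ ε μ : ℝ, ε = 1/(100*(M+2)^3) → μ = M + 1 - ε →
    (M:ℝ) + 1/(8*(M+2)) < μ ∧ μ < M+1 ∧ ell μ 0 + (1/2) * ell μ m < 0 := by
  intro ε μ hε hμ
  have hM1 : (1:ℝ) ≤ M := by exact_mod_cast hM.pos
  have hε0 : 0 < ε := by rw [hε]; positivity
  have hε' : ε * (M+2)^3 = 1/100 := by rw [hε]; field_simp
  have hε1 : ε ≤ 1/100 := by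
    have : 1 ≤ ((M:ℝ)+2)^3 := one_le_pow₀ (by linarith)
    nlinarith
  have h8 : 1/(8*((M:ℝ)+2)) ≤ 1/24 := by
    apply one_div_le_one_div_of_le <;> linarith
  have h1 : (M:ℝ) < μ := by linarith
  have h2 : μ < M+1 := by linarith
  refine ⟨by linarith, h2, ?_⟩
  have a := ell_zero_mul_one hM h1 h2
  have b := ell_abs_le_one hM h1 h2 (m := M) hM le_rfl
  have b' := ell_M_le_abs hM h1 h2 hm hmM
  have p0 := ell_zero_pos hM h1 h2
  have sq1 := ell_sq_le hM h1 h2 (v := M+1) le_rfl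
  have hq : qq μ ((M+1:ℕ):ℝ) ≤ ε * (2*M+3) := by simp only [qq]; push_cast; rw [hμ]; nlinarith
  have f := ell_pos hM h1 h2 (v := M+1) (by omega)
  have d := ell_mul hM h1 h2 M
  have hn := ell_odd_neg hM h1 h2 (m := M) hM le_rfl
  have hq2 : qq μ (M:ℝ) ≤ -(M+1) := by simp only [qq]; rw [hμ]; nlinarith
  have hl : ell μ (M+1) ≤ 1/(5*(M+2)) := by
    refine abs_le_of_sq_le_sq' (sq1.trans (hq.trans ?_)) (by positivity) |>.2
    rw [div_pow, one_pow, le_div_iff₀ (by positivity)]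
    have : ε * (2*M+3) * (5*((M:ℝ)+2))^2 ≤ 50 * (ε * (M+2)^3) := by
      have : ε * (2*M+3) * (5*((M:ℝ)+2))^2 = 25 * (ε * (M+2)^2) * (2*M+3) := by ring
      rw [this]
      have : 50 * (ε * ((M:ℝ)+2)^3) = 25 * (ε * (M+2)^2) * (2*M+4) := by ring
      rw [this]; gcongr; norm_num
    linarith
  have hk : 5*((M:ℝ)+2) ≤ |ell μ M| := by
    rw [abs_of_neg hn]
    rw [le_div_iff₀ (by positivity)] at hl
    have : (M:ℝ) + 1 ≤ (-ell μ M) * ell μ (M+1) := by linarith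
    by_contra hc; push Not at hc
    have : (-ell μ M) * ell μ (M+1) ≤ 5*((M:ℝ)+2) * ell μ (M+1) := by nlinarith
    linarith
  have hm' := ell_odd_neg hM h1 h2 hm hmM
  rw [abs_of_neg hm'] at b'
  have hΛ : 2 * (μ*(μ+1)) < (5 * ((M:ℝ)+2))^2 := by nlinarith
  by_contra hc; push Not at hc
  have hc2 : |ell μ M| ≤ 2 * ell μ 0 := by linarith
  have : |ell μ M| * |ell μ M| ≤ 2 * (μ*(μ+1)) := by rw [← a]; nlinarith [abs_nonneg (ell μ M)]
  nlinarith

/-- sandwich -/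
lemma poly_low {t L : ℝ} (ht : 7 ≤ t) (hL : 12 ≤ L) :
    0 ≤ (t-1 - (L/2)/(t-1) - (L*(L-2)/8)/(t-1)^3) * (t^2+t-L)
      - (t+1 - (L/2)/(t+1) - (L*(L-2)/8)/(t+1)^3) * (t^2-t-L) := by
  have e : (t-1 - (L/2)/(t-1) - (L*(L-2)/8)/(t-1)^3) * (t^2+t-L)
      - (t+1 - (L/2)/(t+1) - (L*(L-2)/8)/(t+1)^3) * (t^2-t-L)
      = ((3/4*L^3 - 9/2*L^2+6*L)*t^2 + (1/4*L^3+1/2*L^2-2*L)) / ((t-1)^3*(t+1)^3) := by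
    have : t - 1 ≠ 0 := by linarith
    have : t + 1 ≠ 0 := by linarith
    field_simp; ring
  rw [e]
  have : 0 < t - 1 := by linarith
  have a1 : 0 ≤ 3/4*L^3 - 9/2*L^2+6*L := by nlinarith [sq_nonneg L, mul_nonneg (by linarith : 0 ≤ L) (by linarith: 0 ≤ L-12)]
  have a2 : 0 ≤ 1/4*L^3+1/2*L^2-2*L := by nlinarith [sq_nonneg L, mul_nonneg (by linarith : 0 ≤ L) (by linarith: 0 ≤ L-12)]
  positivity

lemma poly_high {t L : ℝ} (ht : 7 ≤ t) (hL : 12 ≤ L) (hLt : L ≤ 5/9*t^2) :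
    0 ≤ (t+1 - (L/2)/(t+1) - (L*(L-2)/8)/(t+1)^3 - (L^3/8)/(t+1)^5) * (t^2-t-L)
      - (t-1 - (L/2)/(t-1) - (L*(L-2)/8)/(t-1)^3 - (L^3/8)/(t-1)^5) * (t^2+t-L) := by
  have e : (t+1 - (L/2)/(t+1) - (L*(L-2)/8)/(t+1)^3 - (L^3/8)/(t+1)^5) * (t^2-t-L)
      - (t-1 - (L/2)/(t-1) - (L*(L-2)/8)/(t-1)^3 - (L^3/8)/(t-1)^5) * (t^2+t-L)
      = L * ((3/4*L^2 + 9/2*L-6)*(t^2)^3 + (-5/4*L^3+25/4*L^2-19/2*L+14)*(t^2)^2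
        + (-5/2*L^3+5/4*L^2+11/2*L-10)*t^2 + (-1/4*L^3-1/4*L^2-1/2*L+2)) / ((t-1)^5*(t+1)^5) := by
    have : t - 1 ≠ 0 := by linarith
    have : t + 1 ≠ 0 := by linarith
    field_simp; ring
  rw [e]
  have : 0 < t - 1 := by linarith
  have hT : 49 ≤ t^2 := by nlinarith
  set T := t^2
  have hL0 : 0 ≤ L := by linarith
  have key : 0 ≤ (3/4*L^2 + 9/2*L-6)*T^3 + (-5/4*L^3+25/4*L^2-19/2*L+14)*T^2
        + (-5/2*L^3+5/4*L^2+11/2*L-10)*T + (-1/4*L^3-1/4*L^2-1/2*L+2) := by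
    have b1 : L^3*T^2 ≤ 5/9*(L^2*T^3) := by
      calc L^3*T^2 = (L^2*T^2)*L := by ring
        _ ≤ (L^2*T^2)*(5/9*T) := by gcongr
        _ = _ := by ring
    have b2 : L^3*T ≤ 5/9*(L^2*T^2) := by
      calc L^3*T = (L^2*T)*L := by ring
        _ ≤ (L^2*T)*(5/9*T) := by gcongr
        _ = _ := by ring
    have b3 : L^3 ≤ 5/9*(L^2*T) := by
      calc L^3 = (L^2)*L := by ring
        _ ≤ (L^2)*(5/9*T) := by gcongr
        _ = _ := by ring
    have b4 : 49*(L*T^2) ≤ L*T^3 := by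
      calc 49*(L*T^2) ≤ T*(L*T^2) := by gcongr
        _ = _ := by ring
    have b5 : 12*T^3 ≤ L*T^3 := by gcongr
    have b6 : 12*(L*T) ≤ L^2*T := by
      calc 12*(L*T) ≤ L*(L*T) := by gcongr
        _ = _ := by ring
    have b7 : 49*(L^2*T) ≤ L^2*T^2 := by
      calc 49*(L^2*T) ≤ T*(L^2*T) := by gcongr
        _ = _ := by ring
    have b8 : 49 * L^2 ≤ L^2*T := by
      calc 49*(L^2) ≤ T*(L^2) := by gcongr
        _ = _ := by ring
    have b9 : 12 * L ≤ L^2 := by nlinarith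
    have c1 : 0 ≤ L^2*T^3 := by positivity
    have c2 : 0 ≤ L*T := by positivity
    have c3 : 0 ≤ T^2 := by positivity
    have c4 : 0 ≤ L * T^3 := by positivity
    have b10 : 12 * T ≤ L * T := by gcongr
    nlinarith
  positivity

section
variable {M : ℕ} (hM : Odd M) {μ : ℝ} (h1 : (M:ℝ) < μ) (h2 : μ < M+1)
include hM h1 h2

lemma ell_div_tendsto : Tendsto (fun v : ℕ => ell μ v / v) atTop (nhds 1) := by
  have hsq : Tendsto (fun v : ℕ => (ell μ v / v)^2) atTop (nhds 1) := by
    have hinv : Tendsto (fun v : ℕ => ((v:ℝ))⁻¹) atTop (nhds 0) :=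
      tendsto_inv_atTop_zero.comp tendsto_natCast_atTop_atTop
    have lo : Tendsto (fun v : ℕ => 1 - (v:ℝ)⁻¹ - μ*(μ+1)*((v:ℝ)⁻¹)^2) atTop (nhds 1) := by
      have := (tendsto_const_nhds (x := (1:ℝ))).sub hinv |>.sub ((hinv.pow 2).const_mul (μ*(μ+1)))
      simpa using this
    have hi : Tendsto (fun v : ℕ => 1 + (v:ℝ)⁻¹) atTop (nhds 1) := by
      have := (tendsto_const_nhds (x := (1:ℝ))).add hinv
      simpa using this
    refine tendsto_of_tendsto_of_tendsto_of_le_of_le' lo hi ?_ ?_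
    · filter_upwards [eventually_ge_atTop (M+2)] with v hv
      obtain ⟨w, rfl⟩ : ∃ w, v = w+1 := ⟨v-1, by omega⟩
      have := le_ell_sq hM h1 h2 (v := w) (by omega)
      have hw : (0:ℝ) ≤ w := Nat.cast_nonneg w
      rw [div_pow, le_div_iff₀ (by positivity)]
      refine le_trans (le_of_eq ?_) this
      simp only [qq]; push_cast; field_simp; ring
    · filter_upwards [eventually_ge_atTop (M+2)] with v hv
      have := ell_sq_le hM h1 h2 (v := v) (by omega)
      have hv0 : (0:ℝ) < v := by exact_mod_cast (by omega : 0 < v)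
      have hM0 : (0:ℝ) ≤ M := Nat.cast_nonneg M
      rw [div_pow, div_le_iff₀ (by positivity)]
      refine this.trans ?_
      simp only [qq]
      have : (1 + (v:ℝ)⁻¹) * (v:ℝ)^2 = v*(v+1) := by field_simp
      rw [this]; nlinarith
  have := (Real.continuous_sqrt.tendsto 1).comp hsq
  rw [Real.sqrt_one] at this
  refine this.congr' ?_
  filter_upwards [eventually_ge_atTop (M+1)] with v hv
  simp only [Function.comp]
  rw [Real.sqrt_sq]
  have := ell_pos hM h1 h2 hv
  positivity

/-- comparision of a sequence with ell: if p(v+2)/ell(v+2) ≥ p v / ell v and p(v)/v → 1 -/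
lemma ell_ge_of_ratio (p : ℝ → ℝ) (hp : Tendsto (fun v : ℕ => p v / v) atTop (nhds 1)) {v : ℕ}
    (hv : M+1 ≤ v)
    (hr : ∀ w : ℕ, v ≤ w → p w * qq μ ((w:ℝ)+1) ≤ p ((w:ℝ)+2) * qq μ w) : p v ≤ ell μ v := by
  have hstep : ∀ w : ℕ, v ≤ w → p w / ell μ w ≤ p ((w+2:ℕ):ℝ) / ell μ (w+2) := by
    intro w hw
    have e1 := ell_pos hM h1 h2 (v := w) (by omega)
    have e2 := ell_pos hM h1 h2 (v := w+2) (by omega)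
    have q1 := qq_pos h1 h2 (v := w) (by omega)
    have r := ell_ratio hM h1 h2 w
    have h := hr w hw
    push_cast
    rw [div_le_div_iff₀ e1 e2]
    have : p w * ell μ (w+2) * qq μ w ≤ p (w+2) * ell μ w * qq μ w := by
      calc p w * ell μ (w+2) * qq μ w = (p w * qq μ ((w:ℝ)+1)) * ell μ w := by
            rw [mul_assoc, r]; ring
        _ ≤ (p (w+2) * qq μ w) * ell μ w := by gcongr
        _ = _ := by ring
    exact le_of_mul_le_mul_right this q1
  have hall : ∀ k : ℕ, p v / ell μ v ≤ p ((v+2*k:ℕ):ℝ) / ell μ (v+2*k) := by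
    intro k
    induction k with
    | zero => simp
    | succ k ih => exact ih.trans (hstep (v+2*k) (by omega))
  have hlim : Tendsto (fun w : ℕ => p w / ell μ w) atTop (nhds 1) := by
    have := hp.div (ell_div_tendsto hM h1 h2) one_ne_zero
    rw [div_one] at this
    refine this.congr' ?_
    filter_upwards [eventually_ge_atTop 1] with w hw
    have hw : (w:ℝ) ≠ 0 := by positivity
    simp only [Pi.div_apply]
    rw [div_div_div_cancel_right₀ hw]
  have hsub : Tendsto (fun k : ℕ => v + 2*k) atTop atTop :=
    tendsto_atTop_mono (fun k => by simp only [id]; omega) tendsto_id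
  have := ge_of_tendsto' (hlim.comp hsub) hall
  rwa [div_le_one (ell_pos hM h1 h2 hv)] at this

lemma ell_le_of_ratio (p : ℝ → ℝ) (hp : Tendsto (fun v : ℕ => p v / v) atTop (nhds 1)) {v : ℕ}
    (hv : M+1 ≤ v)
    (hr : ∀ w : ℕ, v ≤ w → p ((w:ℝ)+2) * qq μ w ≤ p w * qq μ ((w:ℝ)+1)) : ell μ v ≤ p v := by
  have hstep : ∀ w : ℕ, v ≤ w → p ((w+2:ℕ):ℝ) / ell μ (w+2) ≤ p w / ell μ w := by
    intro w hw
    have e1 := ell_pos hM h1 h2 (v := w) (by omega)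
    have e2 := ell_pos hM h1 h2 (v := w+2) (by omega)
    have q1 := qq_pos h1 h2 (v := w) (by omega)
    have r := ell_ratio hM h1 h2 w
    have h := hr w hw
    push_cast
    rw [div_le_div_iff₀ e2 e1]
    have : p (w+2) * ell μ w * qq μ w ≤ p w * ell μ (w+2) * qq μ w := by
      calc p (w+2) * ell μ w * qq μ w = (p (w+2) * qq μ w) * ell μ w := by ring
        _ ≤ (p w * qq μ ((w:ℝ)+1)) * ell μ w := by gcongr
        _ = p w * ell μ (w+2) * qq μ w := by rw [mul_assoc (p w) (ell μ _), r]; ring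
    exact le_of_mul_le_mul_right this q1
  have hall : ∀ k : ℕ, p ((v+2*k:ℕ):ℝ) / ell μ (v+2*k) ≤ p v / ell μ v := by
    intro k
    induction k with
    | zero => simp
    | succ k ih => exact (hstep (v+2*k) (by omega)).trans ih
  have hlim : Tendsto (fun w : ℕ => p w / ell μ w) atTop (nhds 1) := by
    have := hp.div (ell_div_tendsto hM h1 h2) one_ne_zero
    rw [div_one] at this
    refine this.congr' ?_
    filter_upwards [eventually_ge_atTop 1] with w hw
    have hw : (w:ℝ) ≠ 0 := by positivity
    simp only [Pi.div_apply]
    rw [div_div_div_cancel_right₀ hw]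
  have hsub : Tendsto (fun k : ℕ => v + 2*k) atTop atTop :=
    tendsto_atTop_mono (fun k => by simp only [id]; omega) tendsto_id
  have := le_of_tendsto' (hlim.comp hsub) hall
  rwa [one_le_div (ell_pos hM h1 h2 hv)] at this



lemma sand_hi {v : ℕ} (hv : M+1 ≤ v) (h6 : 6 ≤ v) {L : ℝ} (hLe : L = μ*(μ+1)) (hL : 12 ≤ L) :
    ell μ v ≤ (v:ℝ) - (L/2)/v - (L*(L-2)/8)/(v:ℝ)^3 - 0/(v:ℝ)^5 := by
  have hv0 : (6:ℝ) ≤ v := by exact_mod_cast h6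
  refine ell_le_of_ratio hM h1 h2 (fun x : ℝ => x - (L/2)/x - (L*(L-2)/8)/x^3 - 0/x^5)
    (lim_aux (L/2) (L*(L-2)/8) 0) hv ?_
  intro w hw
  have hw' : (v:ℝ) ≤ w := by exact_mod_cast hw
  have := poly_low (t := (w:ℝ)+1) (L := L) (by linarith) hL
  simp only [add_sub_cancel_right] at this
  simp only [qq, zero_div, sub_zero]
  rw [show (w:ℝ)+1+1 = w+2 by ring] at this ⊢
  have e1 : ((w:ℝ)+1)^2 - (w+1) - L = w*(w+1) - μ*(μ+1) := by rw [hLe]; ring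
  have e2 : ((w:ℝ)+1)^2 + (w+1) - L = (w+1)*(w+2) - μ*(μ+1) := by rw [hLe]; ring
  rw [e1, e2] at this
  linarith

lemma sand_lo {v : ℕ} (hv : M+1 ≤ v) (h6 : 6 ≤ v) {L : ℝ} (hLe : L = μ*(μ+1)) (hL : 12 ≤ L)
    (hLv : L ≤ 5/9*(v:ℝ)^2) :
    (v:ℝ) - (L/2)/v - (L*(L-2)/8)/(v:ℝ)^3 - (L^3/8)/(v:ℝ)^5 ≤ ell μ v := by
  have hv0 : (6:ℝ) ≤ v := by exact_mod_cast h6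
  refine ell_ge_of_ratio hM h1 h2 (fun x : ℝ => x - (L/2)/x - (L*(L-2)/8)/x^3 - (L^3/8)/x^5)
    (lim_aux (L/2) (L*(L-2)/8) (L^3/8)) hv ?_
  intro w hw
  have hw' : (v:ℝ) ≤ w := by exact_mod_cast hw
  have hq : L ≤ 5/9*((w:ℝ)+1)^2 := by
    have : (v:ℝ)^2 ≤ ((w:ℝ)+1)^2 := pow_le_pow_left₀ (by linarith) (by linarith) 2
    linarith
  have := poly_high (t := (w:ℝ)+1) (L := L) (by linarith) hL hq
  simp only [add_sub_cancel_right] at this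
  simp only [qq]
  rw [show (w:ℝ)+1+1 = w+2 by ring] at this ⊢
  have e1 : ((w:ℝ)+1)^2 - (w+1) - L = w*(w+1) - μ*(μ+1) := by rw [hLe]; ring
  have e2 : ((w:ℝ)+1)^2 + (w+1) - L = (w+1)*(w+2) - μ*(μ+1) := by rw [hLe]; ring
  rw [e1, e2] at this
  linarith

/-- two-sided bound for `ν² - ν ℓ_ν`. -/
lemma ell_sandwich {v : ℕ} (hv : M+1 ≤ v) (h6 : 6 ≤ v) {L : ℝ} (hLe : L = μ*(μ+1)) (hL : 12 ≤ L)
    (hLv : L ≤ 5/9*(v:ℝ)^2) :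
    L/2 + (L*(L-2)/8)/(v:ℝ)^2 ≤ (v:ℝ)^2 - v * ell μ v ∧
    (v:ℝ)^2 - v * ell μ v ≤ L/2 + (L*(L-2)/8)/(v:ℝ)^2 + (L^3/8)/(v:ℝ)^4 := by
  have hi := sand_hi hM h1 h2 hv h6 hLe hL
  have lo := sand_lo hM h1 h2 hv h6 hLe hL hLv
  have hvp : (0:ℝ) < v := by
    have : 0 < v := by omega
    exact_mod_cast this
  constructor
  · have := mul_le_mul_of_nonneg_left hi hvp.le
    have e : (v:ℝ) * ((v:ℝ) - (L/2)/v - (L*(L-2)/8)/(v:ℝ)^3 - 0/(v:ℝ)^5)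
       = (v:ℝ)^2 - L/2 - (L*(L-2)/8)/(v:ℝ)^2 := by field_simp; ring
    rw [e] at this; linarith
  · have := mul_le_mul_of_nonneg_left lo hvp.le
    have e : (v:ℝ) * ((v:ℝ) - (L/2)/v - (L*(L-2)/8)/(v:ℝ)^3 - (L^3/8)/(v:ℝ)^5)
       = (v:ℝ)^2 - L/2 - (L*(L-2)/8)/(v:ℝ)^2 - (L^3/8)/(v:ℝ)^4 := by field_simp
    rw [e] at this; linarith

end
end TO

open Real Set Filter

namespace TO

/-- the Poisson denominator -/
noncomputable def Dn (r t : ℝ) : ℝ := 1 - 2*r*cos t + r^2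

lemma Dn_ge {r t : ℝ} (h0 : 0 ≤ r) : (1-r)^2 ≤ Dn r t := by
  unfold Dn; nlinarith [mul_le_mul_of_nonneg_left (cos_le_one t) h0]

lemma Dn_pos {r t : ℝ} (h0 : 0 ≤ r) (h1 : r < 1) : 0 < Dn r t :=
  lt_of_lt_of_le (by nlinarith) (Dn_ge h0)

lemma one_sub_pos' {r t : ℝ} (h0 : 0 ≤ r) (h1 : r < 1) : 0 < 1 - r * cos t := by
  nlinarith [mul_le_mul_of_nonneg_left (cos_le_one t) h0]

noncomputable def AA (r t : ℝ) : ℝ := arctan (r * sin t / (1 - r * cos t))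
noncomputable def PP (r t : ℝ) : ℝ := (1-r^2) / Dn r t

noncomputable def zz (r t : ℝ) : ℂ := r * Complex.exp (t * Complex.I)

lemma zz_pow (r t : ℝ) (n : ℕ) : zz r t ^ n = zz (r^n) (n*t) := by
  unfold zz; rw [mul_pow, ← Complex.exp_nat_mul]; push_cast; ring_nf

lemma zz_re (r t : ℝ) : (zz r t).re = r * cos t := by
  unfold zz; rw [Complex.re_ofReal_mul, Complex.exp_ofReal_mul_I_re]

lemma zz_im (r t : ℝ) : (zz r t).im = r * sin t := by
  unfold zz; rw [Complex.im_ofReal_mul, Complex.exp_ofReal_mul_I_im]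

lemma zz_norm {r t : ℝ} (h0 : 0 ≤ r) : ‖zz r t‖ = r := by
  unfold zz; rw [norm_mul, Complex.norm_exp_ofReal_mul_I]; simp [abs_of_nonneg h0]

lemma hasSum_cos {r : ℝ} (h0 : 0 ≤ r) (h1 : r < 1) (t : ℝ) :
    HasSum (fun n : ℕ => r^n * cos (n*t)) ((PP r t + 1)/2) := by
  have hz : ‖zz r t‖ < 1 := by rwa [zz_norm h0]
  have := Complex.hasSum_re (hasSum_geometric_of_norm_lt_one hz)
  have hD := Dn_pos (t := t) h0 h1
  have hn : Complex.normSq (1 - zz r t) = Dn r t := by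
    rw [Complex.normSq_apply]
    simp only [Complex.sub_re, Complex.sub_im, Complex.one_re, Complex.one_im, zz_re, zz_im]
    unfold Dn; nlinarith [sin_sq_add_cos_sq t]
  convert this using 1
  · ext n; rw [zz_pow, zz_re]
  · rw [Complex.inv_re, hn, Complex.sub_re, zz_re, Complex.one_re]
    unfold PP
    field_simp
    unfold Dn; ring

lemma hasSum_cos_div {r : ℝ} (h0 : 0 ≤ r) (h1 : r < 1) (t : ℝ) :
    HasSum (fun n : ℕ => r^n * cos (n*t) / n) (- (1/2) * log (Dn r t)) := by
  have hz : ‖zz r t‖ < 1 := by rwa [zz_norm h0]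
  have := Complex.hasSum_re (Complex.hasSum_taylorSeries_neg_log hz)
  have hD := Dn_pos (t := t) h0 h1
  have hn : Complex.normSq (1 - zz r t) = Dn r t := by
    rw [Complex.normSq_apply]
    simp only [Complex.sub_re, Complex.sub_im, Complex.one_re, Complex.one_im, zz_re, zz_im]
    unfold Dn; nlinarith [sin_sq_add_cos_sq t]
  convert this using 1
  · ext n; rw [zz_pow, Complex.div_natCast_re, zz_re]
  · rw [Complex.neg_re, Complex.log_re, ← hn, Complex.normSq_eq_norm_sq, Real.log_pow]
    push_cast; ring

lemma hasSum_sin_div {r : ℝ} (h0 : 0 ≤ r) (h1 : r < 1) (t : ℝ) :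
    HasSum (fun n : ℕ => r^n * sin (n*t) / n) (AA r t) := by
  have hz : ‖zz r t‖ < 1 := by rwa [zz_norm h0]
  have := Complex.hasSum_im (Complex.hasSum_taylorSeries_neg_log hz)
  have hre : 0 < (1 - zz r t).re := by
    simpa [zz_re] using one_sub_pos' (t := t) h0 h1
  convert this using 1
  · ext n; rw [zz_pow, Complex.div_natCast_im, zz_im]
  · rw [Complex.neg_im, Complex.log_im]
    have h := Complex.tan_arg (1 - zz r t)
    have hb : |(1 - zz r t).arg| < π/2 := Complex.abs_arg_lt_pi_div_two_iff.2 (Or.inl hre)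
    rw [abs_lt] at hb
    have h2 := Real.arctan_tan hb.1 hb.2
    rw [h] at h2
    rw [← h2, ← Real.arctan_neg]
    unfold AA
    simp [zz_re, zz_im, neg_div]

lemma AA_hasDerivAt {r : ℝ} (h0 : 0 ≤ r) (h1 : r < 1) (t : ℝ) :
    HasDerivAt (AA r) ((PP r t - 1)/2) t := by
  have hp := one_sub_pos' (t := t) h0 h1
  have hD := Dn_pos (t := t) h0 h1
  have hu : HasDerivAt (fun t => r * sin t / (1 - r * cos t))
      ((r * cos t * (1 - r * cos t) - r * sin t * (-(r * (-sin t)))) / (1 - r * cos t)^2) t :=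
    ((hasDerivAt_sin t).const_mul r).div (((hasDerivAt_cos t).const_mul r).const_sub 1) hp.ne'
  refine hu.arctan.congr_deriv ?_
  have e : 1 + (r * sin t / (1 - r * cos t))^2 = Dn r t / (1 - r*cos t)^2 := by
    field_simp; unfold Dn; nlinarith [sin_sq_add_cos_sq t]
  rw [e]; unfold PP
  field_simp
  unfold Dn
  linear_combination (-2*r^2) * (sin_sq_add_cos_sq t)

lemma AA_abs_lt (r t : ℝ) : |AA r t| < π/2 := by
  unfold AA; rw [abs_lt]; exact ⟨neg_pi_div_two_lt_arctan _, arctan_lt_pi_div_two _⟩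

lemma PP_pos {r : ℝ} (h0 : 0 ≤ r) (h1 : r < 1) (t : ℝ) : 0 < PP r t :=
  div_pos (by nlinarith) (Dn_pos h0 h1)

lemma AA_tendsto {t : ℝ} (h0 : 0 < t) (h2 : t < 2*π) :
    Tendsto (fun r => AA r t) (nhdsWithin 1 (Iio 1)) (nhds ((π - t)/2)) := by
  have hc : cos t ≠ 1 := by
    intro h
    rw [Real.cos_eq_one_iff_of_lt_of_lt (by linarith [pi_pos]) h2] at h
    exact h0.ne' h
  have hc' : 1 - 1 * cos t ≠ 0 := by rw [one_mul]; exact sub_ne_zero.2 (Ne.symm hc)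
  have hcont : ContinuousAt (fun r => AA r t) 1 := by
    unfold AA
    exact continuous_arctan.continuousAt.comp (ContinuousAt.div (by fun_prop) (by fun_prop) hc')
  have : AA 1 t = (π - t)/2 := by
    unfold AA
    rw [one_mul, one_mul]
    have hs : sin (t/2) ≠ 0 := (sin_pos_of_pos_of_lt_pi (by linarith) (by linarith)).ne'
    have e : sin t / (1 - cos t) = tan (π/2 - t/2) := by
      rw [tan_pi_div_two_sub, tan_eq_sin_div_cos, inv_div]
      have h1 : sin t = 2 * sin (t/2) * cos (t/2) := by rw [← sin_two_mul]; ring_nf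
      have h2 : 1 - cos t = 2 * sin (t/2)^2 := by
        have := cos_sq (t/2); rw [show 2*(t/2) = t by ring] at this
        rw [sin_sq, this]; ring
      rw [h1, h2]; field_simp
    rw [e, arctan_tan (by linarith) (by linarith)]; ring
  rw [← this]
  exact hcont.tendsto.mono_left nhdsWithin_le_nhds

/-! ### the logarithmic kernel -/

noncomputable def LQ (r x s : ℝ) : ℝ :=
  1/4 * log (1 + 4 * sin x * sin s * (r / Dn r (x - s)))

lemma Dn_diff (r x s : ℝ) : Dn r (x+s) = Dn r (x-s) + 4 * sin x * sin s * r := by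
  unfold Dn; rw [cos_add, cos_sub]; ring

lemma LQ_eq {r : ℝ} (h0 : 0 ≤ r) (h1 : r < 1) (x s : ℝ) :
    LQ r x s = 1/4 * (log (Dn r (x+s)) - log (Dn r (x-s))) := by
  have hD := Dn_pos (t := x-s) h0 h1
  have hN := Dn_pos (t := x+s) h0 h1
  unfold LQ
  rw [← Real.log_div hN.ne' hD.ne', Dn_diff]
  congr 2; field_simp

lemma hasSum_LQ {r : ℝ} (h0 : 0 ≤ r) (h1 : r < 1) (x s : ℝ) :
    HasSum (fun n : ℕ => r^n * (sin (n*x) * sin (n*s)) / n) (LQ r x s) := by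
  rw [LQ_eq h0 h1]
  have := ((hasSum_cos_div h0 h1 (x-s)).sub (hasSum_cos_div h0 h1 (x+s))).mul_left (1/2)
  have e : 1/4 * (log (Dn r (x+s)) - log (Dn r (x-s))) =
      1 / 2 * (-(1 / 2) * log (Dn r (x - s)) - -(1 / 2) * log (Dn r (x + s))) := by ring
  rw [e]
  refine Eq.mp (congrArg (fun f : ℕ → ℝ => HasSum f _) (funext fun n => ?_)) this
  rw [mul_sub (n:ℝ), mul_add (n:ℝ), cos_add, cos_sub]; ring

lemma ratio_mono {r r' c : ℝ} (h0 : 0 ≤ r) (h : r ≤ r') (h1 : r' ≤ 1)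
    (hD : 0 < 1 - 2*r*c + r^2) (hD' : 0 < 1 - 2*r'*c + r'^2) :
    r / (1 - 2*r*c + r^2) ≤ r' / (1 - 2*r'*c + r'^2) := by
  rw [div_le_div_iff₀ hD hD']
  nlinarith [mul_nonneg (sub_nonneg.2 h) (by nlinarith : 0 ≤ 1 - r*r')]

lemma LQ_mono {r r' x s : ℝ} (h0 : 0 ≤ r) (h : r ≤ r') (h1 : r' ≤ 1)
    (hs : 0 ≤ sin x * sin s) (hD : 0 < Dn r (x-s)) (hD' : 0 < Dn r' (x-s)) :
    LQ r x s ≤ LQ r' x s := by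
  unfold LQ
  have h2 : 0 ≤ r / Dn r (x-s) := div_nonneg h0 hD.le
  have : r / Dn r (x-s) ≤ r' / Dn r' (x-s) := ratio_mono h0 h h1 hD hD'
  apply mul_le_mul_of_nonneg_left _ (by norm_num)
  apply Real.log_le_log
  · nlinarith [mul_nonneg hs h2]
  · nlinarith [mul_le_mul_of_nonneg_left this hs]

lemma LQ_nonneg {r x s : ℝ} (h0 : 0 ≤ r) (hs : 0 ≤ sin x * sin s) : 0 ≤ LQ r x s := by
  unfold LQ
  have h2 : 0 ≤ r / Dn r (x-s) := div_nonneg h0 ((sq_nonneg _).trans (Dn_ge h0))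
  have := log_nonneg (x := 1 + 4 * sin x * sin s * (r / Dn r (x - s)))
    (by nlinarith [mul_nonneg hs h2])
  positivity

lemma LQ_lower {r x s : ℝ} (h0 : 0 ≤ r) (h1 : r < 1) (hs : 0 ≤ sin x * sin s) :
    r / 4 * (sin x * sin s) ≤ LQ r x s := by
  have hD := Dn_pos (t := x-s) h0 h1
  have hN := Dn_pos (t := x+s) h0 h1
  rw [LQ_eq h0 h1]
  have hN4 : Dn r (x+s) ≤ 4 := by
    unfold Dn; nlinarith [neg_one_le_cos (x+s)]
  have := Real.one_sub_inv_le_log_of_pos (div_pos hN hD)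
  rw [Real.log_div hN.ne' hD.ne', inv_div] at this
  have e : 1 - Dn r (x-s) / Dn r (x+s) = 4 * sin x * sin s * r / Dn r (x+s) := by
    field_simp; rw [Dn_diff]; ring
  have f : r * (sin x * sin s) ≤ 4 * sin x * sin s * r / Dn r (x+s) := by
    rw [le_div_iff₀ hN]
    nlinarith [mul_le_mul_of_nonneg_left hN4 (mul_nonneg h0 hs)]
  linarith

end TO

open Real Set Filter

namespace TO

section sine
variable {b : ℕ → ℝ} (hb : Summable fun j : ℕ => (j:ℝ)^2 * |b j|)
include hb

lemma sine_summable (hb0 : b 0 = 0) : Summable b := by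
  refine Summable.of_norm_bounded hb (fun j => ?_)
  rw [norm_eq_abs]
  rcases Nat.eq_zero_or_pos j with h | h
  · subst h; simp [hb0]
  · have : (1:ℝ) ≤ j := by exact_mod_cast h
    nlinarith [abs_nonneg (b j), mul_nonneg (abs_nonneg (b j)) (by nlinarith : 0 ≤ (j:ℝ)^2 - 1)]

lemma sine_hasDeriv (x : ℝ) : HasDerivAt (fun x => ∑' j : ℕ, b j * sin (j*x))
    (∑' j : ℕ, b j * (j * cos (j*x))) x := by
  refine hasDerivAt_tsum (u := fun j : ℕ => (j:ℝ)^2 * |b j|) (y₀ := 0) hb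
    (g := fun (j : ℕ) x => b j * sin (j*x)) (g' := fun (j : ℕ) x => b j * (j * cos (j*x)))
    (fun j y => ?_) (fun j y => ?_) (by simp) x
  · have := ((hasDerivAt_id y).const_mul (j:ℝ)).sin.const_mul (b j)
    simp only [id, mul_one] at this
    refine this.congr_deriv ?_; ring
  · rw [norm_eq_abs, abs_mul, abs_mul, Nat.abs_cast]
    have h1 := abs_cos_le_one (j*y)
    have h3 : (j:ℝ) * |cos (j*y)| ≤ (j:ℝ)^2 := by
      have : (j:ℝ) * |cos (j*y)| ≤ j * 1 := mul_le_mul_of_nonneg_left h1 (Nat.cast_nonneg _)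
      have h4 : (j:ℝ) ≤ (j:ℝ)^2 := by exact_mod_cast Nat.le_self_pow (by norm_num) j
      linarith
    rw [mul_comm ((j:ℝ)^2)]
    exact mul_le_mul_of_nonneg_left h3 (abs_nonneg _)

lemma cosine_hasDeriv (x : ℝ) : HasDerivAt (fun x => ∑' j : ℕ, b j * (j * cos (j*x)))
    (∑' j : ℕ, -((j:ℝ)^2 * b j * sin (j*x))) x := by
  refine hasDerivAt_tsum (u := fun j : ℕ => (j:ℝ)^2 * |b j|) (y₀ := 0) hb
    (g := fun (j : ℕ) x => b j * (j * cos (j*x))) (g' := fun (j : ℕ) x => -((j:ℝ)^2 * b j * sin (j*x)))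
    (fun j y => ?_) (fun j y => ?_) ?_ x
  · have := (((hasDerivAt_id y).const_mul (j:ℝ)).cos.const_mul (j:ℝ)).const_mul (b j)
    simp only [id, mul_one] at this
    refine this.congr_deriv ?_; ring
  · rw [norm_eq_abs, abs_neg, abs_mul, abs_mul, abs_pow, Nat.abs_cast]
    have h1 := abs_sin_le_one (j*y)
    have : 0 ≤ (j:ℝ)^2 * |b j| := by positivity
    nlinarith
  · refine Summable.of_norm_bounded hb (fun j => ?_)
    rw [norm_eq_abs, abs_mul, abs_mul, Nat.abs_cast]
    simp only [mul_zero, cos_zero, abs_one, mul_one]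
    have h4 : (j:ℝ) ≤ (j:ℝ)^2 := by exact_mod_cast Nat.le_self_pow (by norm_num) j
    rw [mul_comm ((j:ℝ)^2)]
    exact mul_le_mul_of_nonneg_left h4 (abs_nonneg _)

lemma sine_convex {c : ℝ}
    (h : ∀ x ∈ Ioo 0 π, -c * sin x ≤ ∑' j : ℕ, (j:ℝ)^2 * b j * sin (j*x)) :
    ConvexOn ℝ (Icc 0 π) (fun x => -(∑' j : ℕ, b j * sin (j*x)) - c * sin x) := by
  have hF : ∀ x, HasDerivAt (fun x => -(∑' j : ℕ, b j * sin (j*x)) - c * sin x)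
      (-(∑' j : ℕ, b j * (j * cos (j*x))) - c * cos x) x := fun x =>
    (sine_hasDeriv hb x).neg.sub ((hasDerivAt_sin x).const_mul c)
  have hF' : ∀ x, HasDerivAt (fun x => -(∑' j : ℕ, b j * (j * cos (j*x))) - c * cos x)
      (-(∑' j : ℕ, -((j:ℝ)^2 * b j * sin (j*x))) - c * (-sin x)) x := fun x =>
    (cosine_hasDeriv hb x).neg.sub ((hasDerivAt_cos x).const_mul c)
  refine convexOn_of_hasDerivWithinAt2_nonneg (convex_Icc 0 π)
    (fun x _ => (hF x).continuousAt.continuousWithinAt)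
    (fun x _ => (hF x).hasDerivWithinAt) (fun x _ => (hF' x).hasDerivWithinAt) ?_
  intro x hx
  rw [interior_Icc] at hx
  have := h x hx
  rw [tsum_neg]; linarith

end sine

lemma summable_pow_geo {r : ℝ} (h0 : 0 ≤ r) (h1 : r < 1) (C : ℝ) (k : ℕ) :
    Summable fun j : ℕ => C * ((j:ℝ)^k * r^j) :=
  (summable_pow_mul_geometric_of_norm_lt_one k (by rwa [norm_eq_abs, abs_of_nonneg h0])).mul_left C

lemma summable_of_le_geo {r : ℝ} (h0 : 0 ≤ r) (h1 : r < 1) (C : ℝ) (k : ℕ) {g : ℕ → ℝ}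
    (h : ∀ j : ℕ, |g j| ≤ C * ((j:ℝ)^k * r^j)) : Summable g :=
  Summable.of_norm_bounded (summable_pow_geo h0 h1 C k) (fun j => by rw [norm_eq_abs]; exact h j)

noncomputable def RR (r x s : ℝ) : ℝ := ∑' j : ℕ, (r^j * sin (j*s) / (j:ℝ)^3) * sin (j*x)

lemma inv_pow_le_one (j k : ℕ) : |((j:ℝ)^k)⁻¹| ≤ 1 := by
  rw [abs_of_nonneg (by positivity)]
  rcases Nat.eq_zero_or_pos j with h | h
  · subst h; rcases k with _ | k <;> simp
  · exact inv_le_one_of_one_le₀ (one_le_pow₀ (by exact_mod_cast h))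

lemma RR_coef_abs {r : ℝ} (h0 : 0 ≤ r) (s : ℝ) (j : ℕ) : |r^j * sin (j*s) / (j:ℝ)^3| ≤ r^j := by
  rw [div_eq_mul_inv, abs_mul, abs_mul, abs_of_nonneg (pow_nonneg h0 j), mul_assoc]
  exact mul_le_of_le_one_right (pow_nonneg h0 j)
    (mul_le_one₀ (abs_sin_le_one _) (abs_nonneg _) (inv_pow_le_one j 3))

lemma RR_nonneg {r : ℝ} (h0 : 0 ≤ r) (h1 : r < 1) {x s : ℝ} (hx : x ∈ Icc 0 π)
    (hs : s ∈ Icc 0 π) : 0 ≤ RR r x s := by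
  have hss := sin_nonneg_of_mem_Icc hs
  have hb : Summable fun j : ℕ => (j:ℝ)^2 * |r^j * sin (j*s) / (j:ℝ)^3| := by
    refine summable_of_le_geo h0 h1 1 2 (fun j => ?_)
    rw [abs_of_nonneg (by positivity), one_mul]
    exact mul_le_mul_of_nonneg_left (RR_coef_abs h0 s j) (by positivity)
  have hc := sine_convex hb (c := 0) (fun x hx => by
    have e : (∑' j : ℕ, (j:ℝ)^2 * (r^j * sin (j*s) / (j:ℝ)^3) * sin (j*x)) = LQ r x s := by
      rw [← (hasSum_LQ h0 h1 x s).tsum_eq]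
      refine tsum_congr (fun j => ?_)
      rcases Nat.eq_zero_or_pos j with h | h
      · subst h; simp
      · have : (j:ℝ) ≠ 0 := by positivity
        field_simp
    rw [e]
    have := LQ_nonneg (r := r) h0 (mul_nonneg (sin_nonneg_of_mem_Icc (Ioo_subset_Icc_self hx)) hss)
    linarith)
  have hpi : ∀ j : ℕ, sin (j * π) = 0 := fun j => sin_nat_mul_pi j
  have h00 := hc.2 (show (0:ℝ) ∈ Icc 0 π from ⟨le_rfl, pi_pos.le⟩)
    (show π ∈ Icc 0 π from ⟨pi_pos.le, le_rfl⟩) (show 0 ≤ 1 - x/π by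
      rw [sub_nonneg, div_le_one pi_pos]; exact hx.2) (show 0 ≤ x/π from div_nonneg hx.1 pi_pos.le)
      (by ring)
  have ex : (1 - x/π) • (0:ℝ) + (x/π) • π = x := by
    simp only [smul_eq_mul]; field_simp; ring
  rw [ex] at h00
  simp [hpi] at h00
  exact h00

lemma abs_sin_nat_mul_le {x : ℝ} (hx : x ∈ Icc 0 π) (j : ℕ) : |sin (j*x)| ≤ j * sin x := by
  have hs := sin_nonneg_of_mem_Icc hx
  induction j with
  | zero => simp
  | succ j ih =>
    push_cast
    rw [add_mul, one_mul, sin_add]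
    have h1 : |sin (j*x) * cos x| ≤ |sin (j*x)| := by
      rw [abs_mul]; exact mul_le_of_le_one_right (abs_nonneg _) (abs_cos_le_one _)
    have h2 : |cos (j*x) * sin x| ≤ sin x := by
      rw [abs_mul, abs_of_nonneg hs]; exact mul_le_of_le_one_left hs (abs_cos_le_one _)
    have := abs_add_le (sin (j*x) * cos x) (cos (j*x) * sin x)
    linarith

noncomputable def tau3 (j : ℕ) : ℝ := if 2 ≤ j then 1/(j:ℝ)^3 else 0

lemma tau3_nonneg (j : ℕ) : 0 ≤ tau3 j := by unfold tau3; split_ifs <;> positivity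

lemma tau3_partial (n : ℕ) :
    ∑ j ∈ Finset.range (n+5), tau3 j ≤ 0.21 - 1/(2*((n:ℝ)+4)*(n+5)) := by
  induction n with
  | zero => simp [Finset.sum_range_succ, tau3]; norm_num
  | succ n ih =>
    rw [show n+1+5 = (n+5)+1 by ring, Finset.sum_range_succ]
    have : tau3 (n+5) ≤ 1/(2*((n:ℝ)+4)*(n+5)) - 1/(2*((n:ℝ)+5)*(n+6)) := by
      rw [tau3, if_pos (by omega)]
      push_cast
      have e : 1/(2*((n:ℝ)+4)*(n+5)) - 1/(2*((n:ℝ)+5)*(n+6)) = 1/(((n:ℝ)+4)*(n+5)*(n+6)) := by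
        field_simp; ring
      rw [e]
      apply one_div_le_one_div_of_le (by positivity)
      have : (0:ℝ) ≤ n := Nat.cast_nonneg n
      nlinarith
    push_cast
    rw [show ((n:ℝ)+1+4) = n+5 by ring, show ((n:ℝ)+1+5) = n+6 by ring]
    linarith

lemma tau3_bound (n : ℕ) : ∑ j ∈ Finset.range n, tau3 j ≤ 0.21 := by
  have h1 : ∑ j ∈ Finset.range n, tau3 j ≤ ∑ j ∈ Finset.range (n+5), tau3 j :=
    Finset.sum_le_sum_of_subset_of_nonneg (Finset.range_mono (by omega)) (fun j _ _ => tau3_nonneg j)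
  have h2 := tau3_partial n
  have : 0 ≤ 1/(2*((n:ℝ)+4)*(n+5)) := by positivity
  linarith

lemma tau3_summable : Summable tau3 := summable_of_sum_range_le tau3_nonneg tau3_bound
lemma tau3_tsum : ∑' j, tau3 j ≤ 0.21 := tau3_summable.tsum_le_of_sum_range_le tau3_bound

/-- Abstract form of the kernel bound (K). -/
lemma kernel_bound {w : ℕ → ℝ} {D A B : ℝ} (hD : 0 ≤ D) (hA : 0 ≤ A) (hB : 0 ≤ B)
    (hw : ∀ j : ℕ, 2 ≤ j → D + A/(j:ℝ)^2 ≤ w j ∧ w j ≤ D + A/(j:ℝ)^2 + B/(j:ℝ)^4)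
    {r : ℝ} (h0 : 0 ≤ r) (h1 : r < 1) {x s : ℝ} (hx : x ∈ Icc 0 π) (hs : s ∈ Icc 0 π) :
    r * (D/4 + (w 1 - D - A) - 0.21*B) * (sin x * sin s) ≤
      ∑' j : ℕ, r^j * (w j / j) * sin (j*s) * sin (j*x) := by
  have hsx := sin_nonneg_of_mem_Icc hx
  have hss := sin_nonneg_of_mem_Icc hs
  have hp := mul_nonneg hsx hss
  set e : ℕ → ℝ := fun j => w j - D - A/(j:ℝ)^2 with he
  have hb : ∀ j : ℕ, 2 ≤ j → |e j| ≤ B/(j:ℝ)^4 := fun j hj => by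
    have := hw j hj
    rw [abs_of_nonneg (by simp only [he]; linarith)]; simp only [he]; linarith
  have hlow : ∀ j : ℕ, r * (sin x * sin s) * ((if j = 1 then e 1 else 0) - B * tau3 j) ≤
      r^j * (e j / j) * sin (j*s) * sin (j*x) := by
    intro j
    rcases Nat.lt_or_ge j 2 with hj | hj
    · interval_cases j
      · simp [tau3]
      · simp [tau3]; linarith
    · rw [if_neg (by omega), tau3, if_pos hj, zero_sub]
      have hjp : (0:ℝ) < j := by positivity
      have a1 := abs_sin_nat_mul_le hx j
      have a2 := abs_sin_nat_mul_le hs j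
      have a3 : r^j ≤ r := by
        calc r^j ≤ r^1 := pow_le_pow_of_le_one h0 h1.le (by omega)
          _ = r := pow_one r
      have a4 := hb j hj
      have : |r^j * (e j / j) * sin (j*s) * sin (j*x)| ≤
          r * (B/(j:ℝ)^4 / j) * (j * sin s) * (j * sin x) := by
        rw [abs_mul, abs_mul, abs_mul, abs_div, Nat.abs_cast, abs_of_nonneg (pow_nonneg h0 j)]
        gcongr
      have e2 : r * (B/(j:ℝ)^4 / j) * (j * sin s) * (j * sin x) =
          - (r * (sin x * sin s) * (-(B * (1/(j:ℝ)^3)))) := by field_simp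
      rw [e2] at this
      linarith [(abs_le.1 this).1]
  -- summability
  have hebd : ∀ j : ℕ, |e j / j| ≤ |e 1| + B := by
    intro j
    rcases Nat.lt_or_ge j 2 with hj | hj
    · interval_cases j
      · simp; positivity
      · simp; linarith
    · have h4 : |e j| ≤ B := (hb j hj).trans
        (div_le_self hB (one_le_pow₀ (by exact_mod_cast (by omega : 1 ≤ j))))
      rw [abs_div, Nat.abs_cast]
      have : |e j| / j ≤ |e j| := div_le_self (abs_nonneg _) (by exact_mod_cast (by omega : 1 ≤ j))
      linarith [abs_nonneg (e 1)]
  have S1 : Summable fun j : ℕ => r^j * (e j / j) * sin (j*s) * sin (j*x) := by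
    refine summable_of_le_geo h0 h1 (|e 1| + B) 0 (fun j => ?_)
    rw [abs_mul, abs_mul, abs_mul, abs_of_nonneg (pow_nonneg h0 j), pow_zero, one_mul]
    have q1 : |e j / j| * |sin (j*s)| ≤ |e 1| + B :=
      (mul_le_of_le_one_right (abs_nonneg _) (abs_sin_le_one _)).trans (hebd j)
    have q2 : |e j / j| * |sin (j*s)| * |sin (j*x)| ≤ |e 1| + B :=
      (mul_le_of_le_one_right (by positivity) (abs_sin_le_one _)).trans q1
    have := mul_le_mul_of_nonneg_left q2 (pow_nonneg h0 j)
    linarith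
  have S2 : HasSum (fun j : ℕ => r * (sin x * sin s) * ((if j = 1 then e 1 else 0) - B * tau3 j))
      (r * (sin x * sin s) * (e 1 - B * ∑' j, tau3 j)) :=
    ((hasSum_ite_eq 1 (e 1)).sub (tau3_summable.hasSum.mul_left B)).mul_left _
  have I1 := hasSum_le hlow S2 S1.hasSum
  have S3 : Summable fun j : ℕ => (r^j * sin (j*s) / (j:ℝ)^3) * sin (j*x) := by
    refine summable_of_le_geo h0 h1 1 0 (fun j => ?_)
    rw [abs_mul, pow_zero, one_mul, one_mul]
    exact (mul_le_of_le_one_right (abs_nonneg _) (abs_sin_le_one _)).trans (RR_coef_abs h0 s j)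
  have T := (((hasSum_LQ h0 h1 x s).mul_left D).add (S3.hasSum.mul_left A)).add S1.hasSum
  have e3 : ∀ j : ℕ, D * (r^j * (sin (j*x) * sin (j*s)) / j) +
      A * ((r^j * sin (j*s) / (j:ℝ)^3) * sin (j*x)) + r^j * (e j / j) * sin (j*s) * sin (j*x)
      = r^j * (w j / j) * sin (j*s) * sin (j*x) := by
    intro j
    rcases Nat.eq_zero_or_pos j with h | h
    · subst h; simp
    · have : (j:ℝ) ≠ 0 := by positivity
      simp only [he]; field_simp; ring
  rw [← tsum_congr e3, T.tsum_eq]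
  have l1 := mul_le_mul_of_nonneg_left (LQ_lower h0 h1 hp) hD
  have l2 : 0 ≤ A * (∑' j : ℕ, (r^j * sin (j*s) / (j:ℝ)^3) * sin (j*x)) :=
    mul_nonneg hA (RR_nonneg h0 h1 hx hs)
  have l3 : r * (sin x * sin s) * (B * ∑' j, tau3 j) ≤ r * (sin x * sin s) * (B * 0.21) := by
    have := tau3_tsum
    gcongr
  have e1 : e 1 = w 1 - D - A := by simp [he]
  rw [e1] at I1
  nlinarith

end TO

open Real Set Filter

namespace TO

/-- Standing numerical data. -/
structure Par (m M : ℕ) : Prop where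
  oddm : Odd m
  m3 : 3 ≤ m
  oddM : Odd M
  mM : m ≤ M
  M2 : M + 1 ≤ 2*m
  case : (m = 3 ∧ M = 3) ∨ (m = 5 ∧ M = 5) ∨ (7 ≤ m ∧ (M:ℝ) ≤ 1.01*m)

lemma par_of {m k : ℕ} (hm : Odd m) (h3 : 3 ≤ m) (hk : 1 ≤ k) (hkm : (k:ℝ) ≤ 1 + 1/100*m/2) :
    Par m (m+2*k-2) := by
  have hc : (((m+2*k-2 : ℕ)):ℝ) ≤ 1.01*m := by
    rw [Nat.cast_sub (by omega)]; push_cast; linarith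
  have h200 : 200 * k ≤ 200 + m := by
    have : 200 * (k:ℝ) ≤ 200 + m := by linarith
    exact_mod_cast this
  obtain ⟨t, ht⟩ := hm
  refine ⟨⟨t, ht⟩, h3, ⟨t + (k-1), by omega⟩, by omega, by omega, ?_⟩
  rcases Nat.lt_or_ge m 7 with h | h
  · have : m = 3 ∨ m = 5 := by omega
    rcases this with rfl | rfl
    · left; omega
    · right; left; omega
  · exact Or.inr (Or.inr ⟨h, hc⟩)

section
variable {m M : ℕ} (hP : Par m M) {μ : ℝ} (h1 : (M:ℝ) < μ) (h2 : μ < M+1)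
include hP h1 h2

lemma lam_ge : 12 ≤ μ*(μ+1) := by
  have : 3 ≤ M := hP.m3.trans hP.mM
  have : (3:ℝ) ≤ M := by exact_mod_cast this
  nlinarith

lemma lam_le : (m = 3 ∧ μ*(μ+1) ≤ 20) ∨ (m = 5 ∧ μ*(μ+1) ≤ 42) ∨
    (7 ≤ m ∧ μ*(μ+1) ≤ 1.5*(m:ℝ)^2) := by
  have h0 : (0:ℝ) ≤ M := Nat.cast_nonneg M
  rcases hP.case with ⟨a, b⟩ | ⟨a, b⟩ | ⟨a, b⟩
  · left; subst b; refine ⟨a, ?_⟩; push_cast at *; nlinarith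
  · right; left; subst b; refine ⟨a, ?_⟩; push_cast at *; nlinarith
  · right; right; refine ⟨a, ?_⟩
    have : (7:ℝ) ≤ m := by exact_mod_cast a
    have h3 : μ*(μ+1) ≤ (1.01*m+1)*(1.01*m+2) := by nlinarith
    nlinarith

lemma lam_le' {j : ℕ} (hj : 2 ≤ j) : μ*(μ+1) ≤ 5/9*((m*j:ℕ):ℝ)^2 := by
  have hj' : (2:ℝ) ≤ j := by exact_mod_cast hj
  have h3 : (3:ℝ) ≤ m := by exact_mod_cast hP.m3
  have : (2*(m:ℝ))^2 ≤ ((m*j:ℕ):ℝ)^2 := by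
    push_cast; apply pow_le_pow_left₀ (by positivity); nlinarith
  have h5 : μ*(μ+1) ≤ 20/9*(m:ℝ)^2 := by
    rcases lam_le hP h1 h2 with ⟨a, b⟩ | ⟨a, b⟩ | ⟨a, b⟩
    · subst a; push_cast; linarith
    · subst a; push_cast; linarith
    · nlinarith
  nlinarith

lemma w_bound {j : ℕ} (hj : 2 ≤ j) {L : ℝ} (hLe : L = μ*(μ+1)) :
    L/2 + (L*(L-2)/8/(m:ℝ)^2)/(j:ℝ)^2 ≤ ((m*j:ℕ):ℝ)^2 - (m*j:ℕ) * ell μ (m*j) ∧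
    ((m*j:ℕ):ℝ)^2 - (m*j:ℕ) * ell μ (m*j) ≤
      L/2 + (L*(L-2)/8/(m:ℝ)^2)/(j:ℝ)^2 + (L^3/8/(m:ℝ)^4)/(j:ℝ)^4 := by
  have h3 := hP.m3
  have hmj : 2*m ≤ m*j := by nlinarith
  have hM2 := hP.M2
  have := ell_sandwich hP.oddM h1 h2 (v := m*j) (by omega) (by omega) hLe
    (by rw [hLe]; exact lam_ge hP h1 h2) (by rw [hLe]; exact lam_le' hP h1 h2 hj)
  have e2 : ((m*j:ℕ):ℝ)^2 = (m:ℝ)^2 * (j:ℝ)^2 := by push_cast; ring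
  have e4 : ((m*j:ℕ):ℝ)^4 = (m:ℝ)^4 * (j:ℝ)^4 := by push_cast; ring
  rw [div_div, div_div _ ((m:ℝ)^4), ← e2, ← e4]
  exact this

lemma Q_bound {L : ℝ} (hLe : L = μ*(μ+1)) :
    -((m:ℝ)^2/8) < L/2/4 + (((m:ℝ)^2 - m * ell μ m) - L/2 - L*(L-2)/8/(m:ℝ)^2)
      - 0.21*(L^3/8/(m:ℝ)^4) := by
  have hneg := ell_odd_neg hP.oddM h1 h2 hP.oddm hP.mM
  have hge := lam_ge hP h1 h2
  have hle := lam_le hP h1 h2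
  rw [← hLe] at hge hle
  rcases hle with ⟨a, b⟩ | ⟨a, b⟩ | ⟨a, b⟩
  · have hM3 : M = 3 := by
      rcases hP.case with ⟨_, b⟩ | ⟨c, _⟩ | ⟨c, _⟩ <;> omega
    subst a; subst hM3
    push_cast
    rcases le_or_gt L 15.6 with hl | hl
    · have i1 : L*(L-2) ≤ 15.6*13.6 := by nlinarith
      have i2 : L^3 ≤ 15.6^3 := pow_le_pow_left₀ (by linarith) hl 3
      nlinarith
    · have i1 : L*(L-2) ≤ 20*18 := by nlinarith
      have i2 : L^3 ≤ 20^3 := pow_le_pow_left₀ (by linarith) b 3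
      have p := ell_mul hP.oddM h1 h2 3
      have q := ell_sq_le hP.oddM h1 h2 (v := 4) (by norm_num)
      have p4 := ell_pos hP.oddM h1 h2 (v := 4) (by norm_num)
      simp only [qq] at p q
      push_cast at p q
      rw [← hLe] at p q
      norm_num at p q
      have h4 : ell μ 4 ≤ 2.0977 := by
        by_contra hc; push Not at hc; nlinarith
      have h3 : ell μ 3 ≤ -1.71 := by
        by_contra hc; push Not at hc
        have : ell μ 4 * (-1.71) < ell μ 4 * ell μ 3 := mul_lt_mul_of_pos_left hc p4
        nlinarith
      norm_num at i2 ⊢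
      nlinarith
  · subst a; push_cast at *
    have i1 : L*(L-2) ≤ 42*40 := by nlinarith
    have i2 : L^3 ≤ 42^3 := pow_le_pow_left₀ (by linarith) b 3
    norm_num at i2 ⊢
    nlinarith
  · have hm : (7:ℝ) ≤ m := by exact_mod_cast a
    have hm2 : 0 < (m:ℝ)^2 := by positivity
    have i1 : L*(L-2)/8/(m:ℝ)^2 ≤ 0.28125*(m:ℝ)^2 := by
      rw [div_le_iff₀ hm2]; nlinarith
    have i2 : L^3/8/(m:ℝ)^4 ≤ 0.421875*(m:ℝ)^2 := by
      rw [div_le_iff₀ (by positivity)]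
      have : L^3 ≤ (1.5*(m:ℝ)^2)^3 := pow_le_pow_left₀ (by linarith) b 3
      nlinarith
    nlinarith

/-- `y_j = m j² - j L_j`. -/
noncomputable def yy (m : ℕ) (μ : ℝ) (j : ℕ) : ℝ := m * (j:ℝ)^2 - j * ell μ (m*j)

lemma yy_bound : ∃ C : ℝ, 0 ≤ C ∧ ∀ j, |yy m μ j| ≤ C := by
  have hm : (3:ℝ) ≤ m := by exact_mod_cast hP.m3
  set L := μ*(μ+1) with hL
  have h12 : 12 ≤ L := lam_ge hP h1 h2
  refine ⟨|yy m μ 1| + (L/2 + L*(L-2)/8/(m:ℝ)^2 + L^3/8/(m:ℝ)^4), ?_, ?_⟩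
  · have : 0 ≤ L*(L-2) := by nlinarith
    positivity
  have hA : 0 ≤ L*(L-2)/8/(m:ℝ)^2 := by
    have : 0 ≤ L*(L-2) := by nlinarith
    positivity
  have hB : 0 ≤ L^3/8/(m:ℝ)^4 := by positivity
  intro j
  rcases Nat.lt_or_ge j 2 with hj | hj
  · interval_cases j
    · simp only [yy]; simp; linarith [abs_nonneg (m - ell μ m)]
    · linarith
  · have w := w_bound hP h1 h2 hj hL
    have e : ((m*j:ℕ):ℝ)^2 - (m*j:ℕ) * ell μ (m*j) = m * yy m μ j := by
      simp only [yy]; push_cast; ring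
    rw [e] at w
    have hj1 : (1:ℝ) ≤ j := by exact_mod_cast (by omega : 1 ≤ j)
    have i1 := div_le_self hA (one_le_pow₀ hj1 (n := 2))
    have i2 := div_le_self hB (one_le_pow₀ hj1 (n := 4))
    have i3 : 0 ≤ (L*(L-2)/8/(m:ℝ)^2)/(j:ℝ)^2 := by positivity
    have hy : 0 ≤ yy m μ j := by
      by_contra hc; push Not at hc; nlinarith
    rw [abs_of_nonneg hy]
    have := abs_nonneg (yy m μ 1)
    nlinarith

lemma K_bound : ∃ c : ℝ, 0 ≤ c ∧ c < m/8 ∧ ∀ r : ℝ, 0 ≤ r → r < 1 → ∀ x ∈ Icc 0 π, ∀ s ∈ Icc 0 π,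
    -c * (sin x * sin s) ≤ ∑' j : ℕ, r^j * (yy m μ j / j) * sin (j*s) * sin (j*x) := by
  have hm : (3:ℝ) ≤ m := by exact_mod_cast hP.m3
  have hm0 : (0:ℝ) < m := by linarith
  set L := μ*(μ+1) with hL
  have h12 : 12 ≤ L := lam_ge hP h1 h2
  set Q := L/2/4 + (((m:ℝ)^2 - m * ell μ m) - L/2 - L*(L-2)/8/(m:ℝ)^2)
      - 0.21*(L^3/8/(m:ℝ)^4) with hQ
  have hQb : -((m:ℝ)^2/8) < Q := Q_bound hP h1 h2 hL
  refine ⟨max 0 (-Q/m), le_max_left _ _, max_lt (by positivity) ?_, ?_⟩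
  · rw [div_lt_iff₀ hm0]; nlinarith
  intro r hr0 hr1 x hx s hs
  have hp := mul_nonneg (sin_nonneg_of_mem_Icc hx) (sin_nonneg_of_mem_Icc hs)
  have kb := kernel_bound (w := fun j => ((m*j:ℕ):ℝ)^2 - (m*j:ℕ) * ell μ (m*j))
    (D := L/2) (A := L*(L-2)/8/(m:ℝ)^2) (B := L^3/8/(m:ℝ)^4) (by linarith)
    (by have : 0 ≤ L*(L-2) := by nlinarith
        positivity) (by positivity) (fun j hj => w_bound hP h1 h2 hj hL) hr0 hr1 hx hs
  simp only [mul_one] at kb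
  rw [← hQ] at kb
  have e : ∀ j : ℕ, r^j * ((((m*j:ℕ):ℝ)^2 - (m*j:ℕ) * ell μ (m*j)) / j) * sin (j*s) * sin (j*x)
      = m * (r^j * (yy m μ j / j) * sin (j*s) * sin (j*x)) := by
    intro j; simp only [yy]; push_cast; ring
  rw [tsum_congr e, tsum_mul_left] at kb
  have hc1 : 0 ≤ max 0 (-Q/m) := le_max_left _ _
  have hc2 : -Q ≤ m * max 0 (-Q/m) := by
    have := mul_le_mul_of_nonneg_left (le_max_right 0 (-Q/m)) hm0.le
    rwa [mul_div_cancel₀ _ hm0.ne'] at this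
  have h3 : -(m * max 0 (-Q/m)) ≤ r * Q := by
    rcases le_or_gt 0 Q with h | h
    · have : 0 ≤ r*Q := mul_nonneg hr0 h
      have : 0 ≤ m * max 0 (-Q/m) := by positivity
      linarith
    · nlinarith
  have h4 := mul_le_mul_of_nonneg_right h3 hp
  have h5 : m * (-max 0 (-Q/m) * (sin x * sin s)) ≤
      m * ∑' j : ℕ, r^j * (yy m μ j / j) * sin (j*s) * sin (j*x) := by
    refine le_trans (le_of_eq ?_) (h4.trans kb); ring
  exact le_of_mul_le_mul_left h5 hm0

end
end TO

open Real Set Filter MeasureTheory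

namespace TO

lemma int_cos_int {k : ℤ} (hk : k ≠ 0) : ∫ s in (0:ℝ)..π, cos (k*s) = 0 := by
  have hk' : (k:ℝ) ≠ 0 := by exact_mod_cast hk
  rw [intervalIntegral.integral_comp_mul_left (fun s => cos s) hk']
  simp [Real.sin_int_mul_pi]

lemma int_sin_sin {j n : ℕ} (hj : j ≠ 0) :
    ∫ s in (0:ℝ)..π, sin (j*s) * sin (n*s) = if n = j then π/2 else 0 := by
  have e : ∀ s : ℝ, sin (j*s) * sin (n*s) =
      (cos (((j:ℤ)-(n:ℤ) : ℤ)*s) - cos (((j:ℤ)+(n:ℤ) : ℤ)*s))/2 := by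
    intro s; push_cast
    rw [sub_mul, add_mul, cos_sub, cos_add]; ring
  simp_rw [e]
  rw [intervalIntegral.integral_div, intervalIntegral.integral_sub
    ((by fun_prop : Continuous _).intervalIntegrable _ _)
    ((by fun_prop : Continuous _).intervalIntegrable _ _),
    int_cos_int (k := (j:ℤ)+n) (by omega)]
  split_ifs with h
  · subst h; simp
  · rw [int_cos_int (by omega)]; simp

lemma int_cos_cos {j n : ℕ} (hj : j ≠ 0) :
    ∫ s in (0:ℝ)..π, cos (j*s) * cos (n*s) = if n = j then π/2 else 0 := by
  have e : ∀ s : ℝ, cos (j*s) * cos (n*s) =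
      (cos (((j:ℤ)-(n:ℤ) : ℤ)*s) + cos (((j:ℤ)+(n:ℤ) : ℤ)*s))/2 := by
    intro s; push_cast
    rw [sub_mul, add_mul, cos_sub, cos_add]; ring
  simp_rw [e]
  rw [intervalIntegral.integral_div, intervalIntegral.integral_add
    ((by fun_prop : Continuous _).intervalIntegrable _ _)
    ((by fun_prop : Continuous _).intervalIntegrable _ _),
    int_cos_int (k := (j:ℤ)+n) (by omega)]
  split_ifs with h
  · subst h; simp
  · rw [int_cos_int (by omega)]; simp

lemma int_id_sin {n : ℕ} (hn : n ≠ 0) :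
    ∫ s in (0:ℝ)..π, s * sin (n*s) = -π * cos (n*π) / n := by
  have hn' : (n:ℝ) ≠ 0 := by exact_mod_cast hn
  have : ∀ s ∈ uIcc 0 π, HasDerivAt (fun s : ℝ => sin (n*s)/n^2 - s*cos (n*s)/n) (s * sin (n*s)) s := by
    intro s _
    have h1 : HasDerivAt (fun s : ℝ => (n:ℝ)*s) n s := by
      simpa using (hasDerivAt_id s).const_mul (n:ℝ)
    have := ((h1.sin.div_const ((n:ℝ)^2)).sub (((hasDerivAt_id s).mul h1.cos).div_const (n:ℝ)))
    refine this.congr_deriv ?_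
    simp; field_simp; ring
  rw [intervalIntegral.integral_eq_sub_of_hasDerivAt this
    ((by fun_prop : Continuous _).intervalIntegrable _ _)]
  simp [sin_nat_mul_pi]; ring

/-- Absolutely continuous test measures with an atom at `π`. -/
lemma mix_meas {g : ℝ → ℝ} (hg : Continuous g) (h0 : ∀ s ∈ Icc 0 π, 0 ≤ g s) {c : ℝ} (hc : 0 ≤ c)
    (h1 : (∫ s in (0:ℝ)..π, g s) + c = 1) :
    ∃ q : Measure ℝ, IsProbabilityMeasure q ∧ q (Icc 0 π)ᶜ = 0 ∧
      ∀ h : ℝ → ℝ, Continuous h → ∫ s, h s ∂q = (∫ s in (0:ℝ)..π, g s * h s) + c * h π := by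
  have hpi := pi_pos
  set ν := (volume.restrict (Ioc 0 π)).withDensity (fun s => ENNReal.ofReal (g s)) with hν
  have hgm : Measurable fun s => ENNReal.ofReal (g s) := hg.measurable.ennreal_ofReal
  have hae : ∀ᵐ s ∂(volume.restrict (Ioc 0 π)), 0 ≤ g s := by
    filter_upwards [ae_restrict_mem measurableSet_Ioc] with s hs
    exact h0 s (Ioc_subset_Icc_self hs)
  have hgi : Integrable g (volume.restrict (Ioc 0 π)) :=
    (hg.integrableOn_Icc (a := 0) (b := π)).mono_set Ioc_subset_Icc_self
  have huniv : ν univ = ENNReal.ofReal (∫ s in (0:ℝ)..π, g s) := by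
    rw [hν, withDensity_apply _ MeasurableSet.univ, Measure.restrict_univ,
      intervalIntegral.integral_of_le hpi.le, ofReal_integral_eq_lintegral_ofReal hgi hae]
  have hfin : IsFiniteMeasure ν := ⟨by rw [huniv]; exact ENNReal.ofReal_lt_top⟩
  have hsup : ν (Icc 0 π)ᶜ = 0 := by
    refine withDensity_absolutelyContinuous _ _ ?_
    rw [Measure.restrict_apply measurableSet_Icc.compl]
    have : (Icc 0 π)ᶜ ∩ Ioc 0 π = ∅ := by
      ext s; simp only [mem_inter_iff, mem_compl_iff, mem_empty_iff_false, iff_false, not_and]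
      intro h1 h2; exact h1 (Ioc_subset_Icc_self h2)
    simp [this]
  refine ⟨ν + ENNReal.ofReal c • Measure.dirac π, ⟨?_⟩, ?_, ?_⟩
  · simp only [Measure.add_apply, Measure.smul_apply, measure_univ, huniv, smul_eq_mul, mul_one]
    rw [← ENNReal.ofReal_add (intervalIntegral.integral_nonneg hpi.le h0) hc, h1]; simp
  · simp only [Measure.add_apply, hsup, Measure.smul_apply, zero_add, smul_eq_mul]
    rw [Measure.dirac_apply' _ measurableSet_Icc.compl]
    simp [hpi.le]
  · intro h hh
    obtain ⟨C, hC⟩ := isCompact_Icc.exists_bound_of_continuousOn (s := Icc 0 π) hh.continuousOn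
    have i1 : Integrable h ν := by
      refine Integrable.of_bound hh.aestronglyMeasurable C ?_
      have : ∀ᵐ s ∂ν, s ∈ Icc 0 π := by
        rw [ae_iff]; exact hsup
      filter_upwards [this] with s hs using hC s hs
    have i2 : Integrable h (ENNReal.ofReal c • Measure.dirac π) :=
      (integrable_dirac (by simp)).smul_measure ENNReal.ofReal_ne_top
    rw [integral_add_measure i1 i2, integral_smul_measure, integral_dirac, hν,
      integral_withDensity_eq_integral_toReal_smul hgm (by simp),
      intervalIntegral.integral_of_le hpi.le]
    congr 1
    · refine integral_congr_ae ?_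
      filter_upwards [hae] with s hs
      simp [ENNReal.toReal_ofReal hs]
    · simp [ENNReal.toReal_ofReal hc]

/-- Cosine moments. -/
noncomputable def aco (p : Measure ℝ) (j : ℕ) : ℝ := ∫ s, 2 * sinc (j*s) ∂p

lemma cont_sinc (j : ℕ) : Continuous fun s : ℝ => 2 * sinc (j*s) :=
  continuous_const.mul (continuous_sinc.comp (by fun_prop))

lemma sinc_mul {j : ℕ} (hj : j ≠ 0) {s : ℝ} : s * (2 * sinc (j*s)) = 2 * sin (j*s) / j := by
  have hj' : (j:ℝ) ≠ 0 := by exact_mod_cast hj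
  by_cases h : s = 0
  · simp [h]
  · rw [sinc_of_ne_zero (by positivity)]; field_simp

lemma sinc_pi {j : ℕ} (hj : j ≠ 0) : sinc (j*π) = 0 := by
  have hj' : (j:ℝ) ≠ 0 := by exact_mod_cast hj
  have := pi_pos
  rw [sinc_of_ne_zero (by positivity), sin_nat_mul_pi]; simp

/-- The test measure at the right end. -/
lemma test_right : ∃ q : Measure ℝ, IsProbabilityMeasure q ∧ q (Icc 0 π)ᶜ = 0 ∧
    ∀ j, aco q j = if j = 0 then 2 else if j = 1 then 1 else 0 := by
  have hpi := pi_pos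
  have hI : ∫ s in (0:ℝ)..π, s * sin s / π = 1 := by
    have := int_id_sin one_ne_zero
    rw [intervalIntegral.integral_div]
    simp only [Nat.cast_one, one_mul] at this
    rw [this]; simp [hpi.ne']
  obtain ⟨q, h1, h2, h3⟩ := mix_meas (g := fun s => s * sin s / π) (by fun_prop)
    (fun s hs => div_nonneg (mul_nonneg hs.1 (sin_nonneg_of_mem_Icc hs)) hpi.le) (c := 0) le_rfl
    (by rw [hI]; simp)
  refine ⟨q, h1, h2, fun j => ?_⟩
  rw [aco, h3 _ (cont_sinc j)]
  split_ifs with h h'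
  · subst h
    simp only [Nat.cast_zero, zero_mul, sinc_zero]
    rw [intervalIntegral.integral_mul_const, hI]; norm_num
  all_goals
    have e : ∀ s : ℝ, s * sin s / π * (2 * sinc (j*s)) = (2/(π*j)) * (sin (j*s) * sin ((1:ℕ)*s)) := by
      intro s
      calc _ = sin s / π * (s * (2 * sinc (j*s))) := by ring
        _ = _ := by rw [sinc_mul h]; simp only [Nat.cast_one, one_mul]; field_simp
    simp_rw [e]
    rw [intervalIntegral.integral_const_mul, int_sin_sin h]
  · subst h'; simp
  · rw [if_neg (by omega)]; simp

lemma PP_cont {r : ℝ} (h0 : 0 ≤ r) (h1 : r < 1) : Continuous (PP r) := by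
  unfold PP
  refine Continuous.div continuous_const (by unfold Dn; fun_prop) (fun t => (Dn_pos h0 h1).ne')

lemma PP_diff_series {r : ℝ} (h0 : 0 ≤ r) (h1 : r < 1) (x : ℝ) {h : ℝ → ℝ} (hh : Continuous h) :
    HasSum (fun n : ℕ => 4 * r^n * sin (n*x) * ∫ s in (0:ℝ)..π, h s * sin (n*s))
      (∫ s in (0:ℝ)..π, h s * (PP r (s-x) - PP r (s+x))) := by
  obtain ⟨C, hC⟩ := isCompact_Icc.exists_bound_of_continuousOn (s := Icc 0 π) hh.continuousOn
  have hC0 : 0 ≤ C := (norm_nonneg _).trans (hC 0 ⟨le_rfl, pi_pos.le⟩)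
  have := intervalIntegral.hasSum_integral_of_dominated_convergence (μ := volume) (a := 0) (b := π)
    (F := fun n : ℕ => fun s : ℝ => 4 * r^n * sin (n*x) * (h s * sin (n*s)))
    (f := fun s => h s * (PP r (s-x) - PP r (s+x))) (fun n _ => C * 4 * r^n)
    (fun n => (by fun_prop : Continuous _).aestronglyMeasurable) ?_ ?_ ?_ ?_
  · simpa only [intervalIntegral.integral_const_mul] using this
  · intro n
    refine Eventually.of_forall fun s hs => ?_
    rw [uIoc_of_le pi_pos.le] at hs
    have e1 := hC s (Ioc_subset_Icc_self hs)
    rw [Real.norm_eq_abs] at e1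
    rw [Real.norm_eq_abs, abs_mul, abs_mul, abs_mul, abs_mul, abs_of_nonneg (pow_nonneg h0 n)]
    have e2 := abs_sin_le_one (n*x)
    have e3 := abs_sin_le_one (n*s)
    calc |(4:ℝ)| * r^n * |sin (n*x)| * (|h s| * |sin (n*s)|) ≤ |(4:ℝ)| * r^n * 1 * (C * 1) := by
          gcongr
      _ = _ := by rw [abs_of_pos (by norm_num : (0:ℝ) < 4)]; ring
  · refine Eventually.of_forall fun s hs => ?_
    exact (summable_geometric_of_lt_one h0 h1).mul_left _
  · exact continuous_const.intervalIntegrable _ _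
  · refine Eventually.of_forall fun s hs => ?_
    have := (((hasSum_cos h0 h1 (s-x)).sub (hasSum_cos h0 h1 (s+x))).mul_left (2*h s))
    have e : 2 * h s * ((PP r (s-x) + 1)/2 - (PP r (s+x) + 1)/2) = h s * (PP r (s-x) - PP r (s+x)) := by
      ring
    rw [e] at this
    refine Eq.mp (congrArg (fun f : ℕ → ℝ => HasSum f _) (funext fun n => ?_)) this
    rw [mul_add (n:ℝ) s x, mul_sub (n:ℝ) s x, cos_sub, cos_add]; ring

lemma PP_diff_nonneg {r : ℝ} (h0 : 0 ≤ r) (h1 : r < 1) {x s : ℝ} (hs : 0 ≤ sin x * sin s) :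
    0 ≤ PP r (s-x) - PP r (s+x) := by
  have a := Dn_pos h0 h1 (t := s-x)
  have : PP r (s+x) ≤ PP r (s-x) := by
    unfold PP
    refine div_le_div_of_nonneg_left (by nlinarith) a ?_
    unfold Dn; rw [cos_sub, cos_add]; nlinarith
  linarith

lemma AA_pi_add {r : ℝ} (h0 : 0 ≤ r) (h1 : r < 1) {x : ℝ} (hx : 0 ≤ x) : 0 ≤ x + 2 * AA r (x + π) := by
  have hd : ∀ t, HasDerivAt (fun x => x + 2 * AA r (x+π)) (PP r (t+π)) t := by
    intro t
    have := (hasDerivAt_id t).add (((AA_hasDerivAt h0 h1 (t+π)).comp_add_const t π).const_mul 2)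
    exact this.congr_deriv (by ring)
  have hm := monotone_of_hasDerivAt_nonneg hd (fun t => (PP_pos h0 h1 (t+π)).le)
  have := hm hx
  simpa [AA] using this

/-- Poisson test measures. -/
lemma test_poisson {r : ℝ} (h0 : 0 ≤ r) (h1 : r < 1) {x : ℝ} (hx : x ∈ Ioo 0 π) :
    ∃ q : Measure ℝ, IsProbabilityMeasure q ∧ q (Icc 0 π)ᶜ = 0 ∧
    ∀ j, aco q j = 2 * r^j * sinc (j*x) := by
  have hpi := pi_pos
  have hx0 := hx.1
  set g : ℝ → ℝ := fun s => s * (PP r (s-x) - PP r (s+x)) / (2*π*x) with hg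
  have hP := PP_cont h0 h1
  have hgc : Continuous g := by rw [hg]; fun_prop
  have hmass : (∫ s in (0:ℝ)..π, g s) = -(2/x) * AA r (x+π) := by
    rw [hg, intervalIntegral.integral_div]
    have a1 := PP_diff_series h0 h1 x continuous_id
    have a2 := (hasSum_sin_div h0 h1 (x+π)).mul_left (-4*π)
    have : ∫ s in (0:ℝ)..π, s * (PP r (s-x) - PP r (s+x)) = -4*π*AA r (x+π) := by
      refine HasSum.unique a1 (Eq.mp (congrArg (fun f : ℕ → ℝ => HasSum f _) (funext fun n => ?_)) a2)
      rcases Nat.eq_zero_or_pos n with rfl | hn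
      · simp
      · simp only [id]
        rw [int_id_sin hn.ne', mul_add, sin_add, sin_nat_mul_pi]; field_simp; ring
    rw [this]; field_simp; ring
  obtain ⟨q, h1', h2, h3⟩ := mix_meas hgc (fun s hs => by
      refine div_nonneg (mul_nonneg hs.1 (PP_diff_nonneg h0 h1 ?_)) (by positivity)
      exact mul_nonneg (sin_pos_of_mem_Ioo hx).le (sin_nonneg_of_mem_Icc hs))
    (c := 1 + (2/x) * AA r (x+π)) (by
      have := AA_pi_add h0 h1 hx0.le
      have : 1 + 2/x * AA r (x+π) = (x + 2 * AA r (x+π))/x := by field_simp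
      rw [this]; positivity) (by rw [hmass]; ring)
  refine ⟨q, h1', h2, fun j => ?_⟩
  rw [aco, h3 _ (cont_sinc j)]
  rcases Nat.eq_zero_or_pos j with rfl | hj
  · simp only [Nat.cast_zero, zero_mul, sinc_zero]
    rw [intervalIntegral.integral_mul_const, hmass]; ring
  · have hj' : (j:ℝ) ≠ 0 := by exact_mod_cast hj.ne'
    rw [sinc_pi hj.ne']
    have e : ∀ s : ℝ, g s * (2 * sinc (j*s)) =
        (1/(π*x*j)) * (sin (j*s) * (PP r (s-x) - PP r (s+x))) := by
      intro s
      calc _ = (PP r (s-x) - PP r (s+x))/(2*π*x) * (s * (2 * sinc (j*s))) := by simp only [hg]; ring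
        _ = _ := by rw [sinc_mul hj.ne']; field_simp
    simp_rw [e]
    rw [intervalIntegral.integral_const_mul]
    have a1 := PP_diff_series h0 h1 x (h := fun s => sin (j*s)) (by fun_prop)
    simp_rw [int_sin_sin hj.ne'] at a1
    have a2 := hasSum_ite_eq (α := ℝ) j (4 * r^j * sin (j*x) * (π/2))
    have := HasSum.unique a1 (Eq.mp (congrArg (fun f : ℕ → ℝ => HasSum f _) (funext fun n => ?_)) a2)
    · rw [this, sinc_of_ne_zero (by positivity)]; field_simp; ring
    · split_ifs with h
      · rw [h]
      · simp

end TO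

open Real Set Filter MeasureTheory

namespace TO

/-- Probability measures on `[0,π]`. -/
abbrev XX := ProbabilityMeasure (Icc (0:ℝ) π)

noncomputable def al (j : ℕ) (ν : XX) : ℝ := ∫ s : Icc (0:ℝ) π, 2 * sinc (j*(s:ℝ)) ∂(ν : Measure (Icc (0:ℝ) π))

lemma al_cont_aux (j : ℕ) : Continuous fun s : Icc (0:ℝ) π => 2 * sinc (j*(s:ℝ)) :=
  (cont_sinc j).comp continuous_subtype_val

lemma al_cont (j : ℕ) : Continuous (al j) :=
  ProbabilityMeasure.continuous_integral_boundedContinuousFunction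
    (BoundedContinuousFunction.mkOfCompact ⟨_, al_cont_aux j⟩)

lemma al_int (j : ℕ) (ν : Measure (Icc (0:ℝ) π)) [IsFiniteMeasure ν] :
    Integrable (fun s : Icc (0:ℝ) π => 2 * sinc (j*(s:ℝ))) ν :=
  (BoundedContinuousFunction.mkOfCompact ⟨_, al_cont_aux j⟩).integrable ν

lemma two_sinc_le (t : ℝ) : |2 * sinc t| ≤ 2 := by
  rw [abs_mul, abs_two]; linarith [abs_sinc_le_one t]

lemma al_abs (j : ℕ) (ν : XX) : |al j ν| ≤ 2 := by
  have := norm_integral_le_of_norm_le_const (μ := (ν : Measure (Icc (0:ℝ) π)))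
    (f := fun s : Icc (0:ℝ) π => 2 * sinc (j*(s:ℝ))) (C := 2)
    (Eventually.of_forall fun s => two_sinc_le _)
  simpa [al] using this

lemma al_zero (ν : XX) : al 0 ν = 2 := by simp [al]

lemma aco_toR (ν : XX) (j : ℕ) :
    aco ((ν : Measure (Icc (0:ℝ) π)).map Subtype.val) j = al j ν := by
  rw [aco, integral_map measurable_subtype_coe.aemeasurable (cont_sinc j).aestronglyMeasurable]; rfl

lemma exists_XX (q : Measure ℝ) [IsProbabilityMeasure q] (hq : q (Icc 0 π)ᶜ = 0) :
    ∃ ν : XX, ∀ j, al j ν = aco q j := by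
  have hae : ∀ᵐ s ∂q, s ∈ Icc 0 π := by rw [ae_iff]; exact hq
  have hp : IsProbabilityMeasure (q.comap (Subtype.val : Icc (0:ℝ) π → ℝ)) :=
    (MeasurableEmbedding.subtype_coe measurableSet_Icc).isProbabilityMeasure_comap (by simpa using hae)
  refine ⟨⟨_, hp⟩, fun j => ?_⟩
  have := integral_subtype_comap (μ := q) (s := Icc (0:ℝ) π) measurableSet_Icc (fun s => 2 * sinc (j*s))
  refine this.trans ?_
  rw [aco, Measure.restrict_eq_self_of_ae_mem hae]

lemma exists_comb (p q : XX) {t : ℝ} (h0 : 0 ≤ t) (h1 : t ≤ 1) :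
    ∃ ν : XX, ∀ j, al j ν = (1-t) * al j p + t * al j q := by
  have hp : IsProbabilityMeasure (ENNReal.ofReal (1-t) • (p : Measure (Icc (0:ℝ) π)) +
      ENNReal.ofReal t • (q : Measure (Icc (0:ℝ) π))) := ⟨by
    simp only [Measure.add_apply, Measure.smul_apply, measure_univ, smul_eq_mul, mul_one]
    rw [← ENNReal.ofReal_add (by linarith) h0]; simp⟩
  refine ⟨⟨_, hp⟩, fun j => ?_⟩
  change ∫ s : Icc (0:ℝ) π, 2 * sinc (j*(s:ℝ)) ∂(ENNReal.ofReal (1-t) • (p : Measure (Icc (0:ℝ) π)) +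
      ENNReal.ofReal t • (q : Measure (Icc (0:ℝ) π))) = _
  rw [integral_add_measure ((al_int j _).smul_measure ENNReal.ofReal_ne_top)
    ((al_int j _).smul_measure ENNReal.ofReal_ne_top), integral_smul_measure, integral_smul_measure,
    ENNReal.toReal_ofReal (by linarith), ENNReal.toReal_ofReal h0]
  rfl

lemma summable_mul_of_sq {w a b : ℕ → ℝ} (hw : ∀ j, 0 ≤ w j) (ha : Summable fun j => w j * a j^2)
    (hb : Summable fun j => w j * b j^2) : Summable fun j => w j * |a j * b j| := by
  refine Summable.of_nonneg_of_le (fun j => mul_nonneg (hw j) (abs_nonneg _)) (fun j => ?_) (ha.add hb)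
  rw [← mul_add]
  refine mul_le_mul_of_nonneg_left ?_ (hw j)
  rw [abs_mul]; nlinarith [sq_abs (a j), sq_abs (b j), sq_nonneg (|a j| - |b j|)]

lemma ell_unif {m M : ℕ} (hP : Par m M) {μ1 μ2 : ℝ} (h1 : (M:ℝ) < μ1) (h2 : μ2 < M+1) :
    ∃ C : ℝ, 0 ≤ C ∧ ∀ μ ∈ Icc μ1 μ2, ∀ j : ℕ, |ell μ (m*j)| ≤ C*(j+1) := by
  have hc : ∀ v, ∃ C, ∀ μ ∈ Icc μ1 μ2, ‖ell μ v‖ ≤ C := fun v =>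
    isCompact_Icc.exists_bound_of_continuousOn
      ((ell_continuousOn hP.oddM v).mono fun μ hμ => ⟨h1.trans_le hμ.1, hμ.2.trans_lt h2⟩)
  obtain ⟨C0, hC0⟩ := hc (m*0)
  obtain ⟨C1, hC1⟩ := hc (m*1)
  have m0 : (0:ℝ) ≤ m := m.cast_nonneg
  refine ⟨|C0| + |C1| + (m+1), by positivity, fun μ hμ j => ?_⟩
  have hj0 : (0:ℝ) ≤ j := j.cast_nonneg
  rcases j with _ | _ | j
  · have := hC0 μ hμ
    rw [Real.norm_eq_abs] at this
    have := abs_nonneg C1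
    have := le_abs_self C0
    simp only [zero_add, Nat.cast_zero]
    linarith
  · have := hC1 μ hμ
    rw [Real.norm_eq_abs] at this
    have := abs_nonneg C0
    have := le_abs_self C1
    simp only [zero_add, Nat.cast_one]
    linarith [abs_nonneg C1]
  · have hv : M + 1 ≤ m*(j+1+1) := by nlinarith [hP.M2]
    have a1 := h1.trans_le hμ.1
    have a2 := hμ.2.trans_lt h2
    have e1 := ell_pos hP.oddM a1 a2 hv
    have e2 := ell_le hP.oddM a1 a2 hv
    rw [abs_of_pos e1]
    refine e2.trans ?_
    push_cast at hj0 ⊢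
    have := abs_nonneg C1
    have := abs_nonneg C0
    have : 0 ≤ (|C0| + |C1|) * ((j:ℝ)+1+1+1) := by positivity
    nlinarith

theorem exists_min {m M : ℕ} (hP : Par m M) : ∃ μ : ℝ, (M:ℝ) < μ ∧ μ < M+1 ∧ ∃ p : XX,
    Summable (fun j : ℕ => ((j:ℝ)+1) * al j p^2) ∧
    1/2 * ∑' j, ell μ (m*j) * al j p^2 = ell μ 0 ∧
    ∀ q : XX, Summable (fun j : ℕ => ((j:ℝ)+1) * al j q^2) →
      ell μ 0 ≤ 1/2 * ∑' j, ell μ (m*j) * (al j p * al j q) := by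
  obtain ⟨l1, l2, l3⟩ := left_end hP.oddM hP.oddm hP.mM _ _ rfl rfl
  obtain ⟨r1, r2, r3⟩ := right_end hP.oddM hP.oddm hP.mM _ _ rfl rfl
  set μ1 : ℝ := M + 1/(8*(M+2)) with hμ1
  set μ2 : ℝ := M + 1 - 1/(100*(M+2)^3) with hμ2
  have hpos : ∀ μ ∈ Icc μ1 μ2, ∀ j, 2 ≤ j → 0 < ell μ (m*j) := fun μ hμ j hj =>
    ell_pos hP.oddM (l1.trans_le hμ.1) (hμ.2.trans_lt r2) (by nlinarith [hP.M2])
  have hLc : ∀ v, Continuous fun μ : Icc μ1 μ2 => ell (μ:ℝ) v := fun v =>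
    continuousOn_iff_continuous_domRestrict.1
      ((ell_continuousOn hP.oddM v).mono fun μ hμ => ⟨l1.trans_le hμ.1, hμ.2.trans_lt r2⟩)
  set EP : ℕ → Icc μ1 μ2 × XX → ℝ := fun n w =>
    1/2 * ∑ j ∈ Finset.range n, ell (w.1:ℝ) (m*j) * al j w.2^2 - ell (w.1:ℝ) 0 with hEP
  have hEPc : ∀ n, Continuous (EP n) := fun n => by
    refine Continuous.sub (continuous_const.mul (continuous_finsetSum _ fun j _ => ?_))
      ((hLc 0).comp continuous_fst)
    exact ((hLc _).comp continuous_fst).mul (((al_cont j).comp continuous_snd).pow 2)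
  have hEPm : ∀ n w, 2 ≤ n → EP n w ≤ EP (n+1) w := fun n w hn => by
    simp only [hEP, Finset.sum_range_succ]
    have := mul_nonneg (hpos w.1 w.1.2 n hn).le (sq_nonneg (al n w.2))
    linarith
  set Z : Set (Icc μ1 μ2 × XX) := {w | ∀ n, 2 ≤ n → EP n w ≤ 0} with hZ
  have hZc : IsCompact Z := by
    refine IsClosed.isCompact ?_
    have : Z = ⋂ n, ⋂ (_ : 2 ≤ n), {w | EP n w ≤ 0} := by ext w; simp [hZ]
    rw [this]
    exact isClosed_iInter fun n => isClosed_iInter fun _ => isClosed_le (hEPc n) continuous_const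
  have hZne : Z.Nonempty := by
    obtain ⟨q, q1, q2, q3⟩ := test_right
    obtain ⟨ν, hν⟩ := exists_XX q q2
    refine ⟨(⟨μ2, ⟨r1.le, le_rfl⟩⟩, ν), fun n hn => ?_⟩
    have : ∀ n, 2 ≤ n → EP n (⟨μ2, ⟨r1.le, le_rfl⟩⟩, ν) = ell μ2 0 + 1/2 * ell μ2 m := by
      intro n hn
      induction n, hn using Nat.le_induction with
      | base => simp [hEP, Finset.sum_range_succ, hν, q3]; ring
      | succ n hn ih =>
        rw [← ih]
        simp only [hEP, Finset.sum_range_succ, hν, q3]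
        rw [if_neg (by omega : ¬ n = 0), if_neg (by omega : ¬ n = 1)]; simp
    rw [this n hn]; exact r3.le
  obtain ⟨z, hz, hmin⟩ := hZc.exists_isMinOn hZne (f := fun w => (w.1:ℝ))
    (continuous_subtype_val.comp continuous_fst).continuousOn
  obtain ⟨⟨μ, hμ⟩, p⟩ := z
  have a1 := l1.trans_le hμ.1
  have a2 := hμ.2.trans_lt r2
  have hμ1' : μ1 < μ := by
    rcases hμ.1.lt_or_eq with h | h
    · exact h
    exfalso
    have := hz 2 le_rfl
    simp only [hEP, Finset.sum_range_succ, Finset.range_zero, Finset.sum_empty, mul_zero, mul_one,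
      al_zero, ← h] at this
    have e := al_abs 1 p
    have e2 : al 1 p ^2 ≤ 4 := by nlinarith [abs_le.1 e]
    have e3 := neg_abs_le (ell μ1 m)
    have e4 : ell μ1 m * al 1 p^2 ≥ - (|ell μ1 m| * 4) := by
      nlinarith [sq_nonneg (al 1 p), abs_nonneg (ell μ1 m)]
    linarith
  obtain ⟨C, hC0, hC⟩ := ell_unif hP l1 r2
  -- summability of weighted series
  have hsm : ∀ μ ∈ Icc μ1 μ2, ∀ b : ℕ → ℝ, Summable (fun j : ℕ => ((j:ℝ)+1)*|b j|) →
      Summable fun j => ell μ (m*j) * b j := by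
    intro μ hμ b hb
    refine Summable.of_norm_bounded (hb.mul_left C) fun j => ?_
    rw [norm_mul, Real.norm_eq_abs, Real.norm_eq_abs, ← mul_assoc]
    exact mul_le_mul_of_nonneg_right (hC μ hμ j) (abs_nonneg _)
  have hsm2 : ∀ μ ∈ Icc μ1 μ2, ∀ q : XX, Summable (fun j : ℕ => ((j:ℝ)+1)*al j q^2) →
      Summable fun j => ell μ (m*j) * al j q^2 := fun μ hμ q hq => by
    refine hsm μ hμ (fun j => al j q^2) (hq.congr fun j => ?_)
    rw [abs_of_nonneg (sq_nonneg _)]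
  have hEnn : ∀ q : XX, Summable (fun j : ℕ => ((j:ℝ)+1)*al j q^2) →
      ell μ 0 ≤ 1/2 * ∑' j, ell μ (m*j) * al j q^2 := by
    intro q hq
    have hcont : ContinuousOn (fun μ => 1/2 * (∑' j, ell μ (m*j) * al j q^2) - ell μ 0) (Icc μ1 μ2) := by
      have hcc : ∀ v, ContinuousOn (fun μ => ell μ v) (Icc μ1 μ2) := fun v =>
        (ell_continuousOn hP.oddM v).mono fun μ hμ => ⟨l1.trans_le hμ.1, hμ.2.trans_lt r2⟩
      refine (continuousOn_const.mul ?_).sub (hcc 0)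
      refine continuousOn_tsum (fun j => (hcc _).mul continuousOn_const) (hq.mul_left C) ?_
      intro j μ hμ
      rw [norm_mul, Real.norm_eq_abs, Real.norm_eq_abs, abs_of_nonneg (sq_nonneg (al j q)), ← mul_assoc]
      exact mul_le_mul_of_nonneg_right (hC μ hμ j) (sq_nonneg _)
    have hlt : ∀ μ' ∈ Ioo μ1 μ, 0 ≤ 1/2 * (∑' j, ell μ' (m*j) * al j q^2) - ell μ' 0 := by
      intro μ' hμ'
      have hm' : μ' ∈ Icc μ1 μ2 := ⟨hμ'.1.le, hμ'.2.le.trans hμ.2⟩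
      have hnot : ((⟨μ', hm'⟩, q) : Icc μ1 μ2 × XX) ∉ Z := fun h => by
        have := hmin h
        simp only [mem_ofPred_eq] at this
        linarith [hμ'.2]
      simp only [hZ, mem_ofPred_eq] at hnot
      push Not at hnot
      obtain ⟨n, hn, hn'⟩ := hnot
      have := (hsm2 μ' hm' q hq).sum_le_tsum (Finset.range n) (fun j hj => by
        have : 2 ≤ j := by
          have : n ≤ j := by simpa using hj
          omega
        exact mul_nonneg (hpos μ' hm' j this).le (sq_nonneg _))
      simp only [hEP] at hn'
      linarith
    have hcw := (hcont μ hμ).mono (fun y hy => ⟨hy.1.le, hy.2.le.trans hμ.2⟩ : Ioo μ1 μ ⊆ Icc μ1 μ2)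
    have hne : (nhdsWithin μ (Ioo μ1 μ)).NeBot := by
      rw [← mem_closure_iff_nhdsWithin_neBot, closure_Ioo hμ1'.ne]
      exact ⟨hμ1'.le, le_rfl⟩
    have := ge_of_tendsto hcw (by filter_upwards [self_mem_nhdsWithin] with y hy using hlt y hy)
    linarith
  -- finite energy of p
  have hsum1 : Summable fun j => ell μ (m*j) * al j p^2 := by
    rw [← summable_nat_add_iff 2]
    have hb : ∀ n, ∑ j ∈ Finset.range n, ell μ (m*(j+2)) * al (j+2) p^2 ≤
        2*ell μ 0 - ∑ j ∈ Finset.range 2, ell μ (m*j) * al j p^2 := by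
      intro n
      have := hz (2+n) (by omega)
      simp only [hEP] at this
      rw [Finset.sum_range_add] at this
      simp only [add_comm 2 _] at this
      linarith
    exact summable_of_sum_range_le (fun j => mul_nonneg (hpos μ hμ _ (by omega)).le (sq_nonneg _)) hb
  have hpe : Summable (fun j : ℕ => ((j:ℝ)+1)*al j p^2) := by
    have ht := ell_div_tendsto hP.oddM a1 a2
    have hm3 : 3 ≤ m := hP.m3
    have hsub : Tendsto (fun j : ℕ => m*j) atTop atTop :=
      tendsto_id.const_mul_atTop' (by omega)
    have h12 := (ht.comp hsub).eventually (lt_mem_nhds (by norm_num : (1/2:ℝ) < 1))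
    refine Summable.of_norm_bounded_eventually_nat (g := fun j => 2*(ell μ (m*j) * al j p^2))
      (hsum1.mul_left 2) ?_
    filter_upwards [h12, eventually_ge_atTop 1] with j hj hj1
    rw [Real.norm_eq_abs, abs_of_nonneg (by positivity), ← mul_assoc]
    refine mul_le_mul_of_nonneg_right ?_ (sq_nonneg _)
    have hj1' : (1:ℝ) ≤ j := by exact_mod_cast hj1
    have hm3' : (3:ℝ) ≤ m := by exact_mod_cast hm3
    simp only [Function.comp] at hj
    rw [lt_div_iff₀ (by push_cast; positivity)] at hj
    push_cast at hj
    nlinarith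
  have hEle : 1/2 * ∑' j, ell μ (m*j) * al j p^2 ≤ ell μ 0 := by
    have h := hsum1.hasSum.tendsto_sum_nat
    have : Tendsto (fun n => 1/2 * ∑ j ∈ Finset.range n, ell μ (m*j) * al j p^2) atTop
      (nhds (1/2 * ∑' j, ell μ (m*j) * al j p^2)) := h.const_mul _
    refine le_of_tendsto this ?_
    filter_upwards [eventually_ge_atTop 2] with n hn
    have := hz n hn
    simp only [hEP] at this
    linarith
  have hE0 := le_antisymm hEle (hEnn p hpe)
  refine ⟨μ, a1, a2, p, hpe, hE0, fun q hq => ?_⟩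
  have hpq : Summable fun j => ell μ (m*j) * (al j p * al j q) :=
    hsm μ hμ _ (summable_mul_of_sq (w := fun j => (j:ℝ)+1) (fun j => by positivity) hpe hq)
  have hqq := hsm2 μ hμ q hq
  by_contra hcon
  push Not at hcon
  set B := 1/2 * (∑' j, ell μ (m*j) * (al j p * al j q)) - ell μ 0 with hB
  set E := 1/2 * (∑' j, ell μ (m*j) * al j q^2) - ell μ 0 with hE
  have hBneg : B < 0 := by rw [hB]; linarith
  have key : ∀ t : ℝ, 0 < t → t < 1 → 0 ≤ 2*(1-t)*B + t*E := by
    intro t t0 t1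
    obtain ⟨ν, hν⟩ := exists_comb p q t0.le t1.le
    have hs0 : Summable fun j => ell μ (m*j) * al j ν^2 := by
      have := ((hsum1.mul_left ((1-t)^2)).add (hpq.mul_left (2*t*(1-t)))).add (hqq.mul_left (t^2))
      refine this.congr fun j => ?_
      rw [hν]; ring
    have hs1 : Summable (fun j : ℕ => ((j:ℝ)+1)*al j ν^2) := by
      refine Summable.of_nonneg_of_le (fun j => by positivity) (fun j => ?_) ((hpe.add hq).mul_left 2)
      rw [hν, ← mul_add]
      have : ((1-t)*al j p + t*al j q)^2 ≤ 2*(al j p^2 + al j q^2) := by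
        have e1 : (1-t)^2 ≤ 1 := by nlinarith
        have e2 : t^2 ≤ 1 := by nlinarith
        nlinarith [sq_nonneg ((1-t)*al j p - t*al j q), mul_le_mul_of_nonneg_right e1 (sq_nonneg (al j p)),
          mul_le_mul_of_nonneg_right e2 (sq_nonneg (al j q))]
      nlinarith [mul_le_mul_of_nonneg_left this (by positivity : (0:ℝ) ≤ (j:ℝ)+1)]
    have h1 := hEnn ν hs1
    have h2 : ∑' j, ell μ (m*j) * al j ν^2 = (1-t)^2 * (∑' j, ell μ (m*j) * al j p^2) +
        2*t*(1-t)*(∑' j, ell μ (m*j) * (al j p * al j q)) + t^2*(∑' j, ell μ (m*j) * al j q^2) := by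
      rw [← tsum_mul_left, ← tsum_mul_left, ← tsum_mul_left,
        ← (hsum1.mul_left _).tsum_add (hpq.mul_left _),
        ← ((hsum1.mul_left _).add (hpq.mul_left _)).tsum_add (hqq.mul_left _)]
      refine tsum_congr fun j => ?_
      rw [hν]; ring
    rw [h2] at h1
    have : 0 ≤ t*(2*(1-t)*B + t*E) := by rw [hB, hE]; nlinarith
    exact nonneg_of_mul_nonneg_right this t0
  have hc : Tendsto (fun t : ℝ => 2*(1-t)*B + t*E) (nhdsWithin 0 (Ioi 0)) (nhds (2*(1-0)*B + 0*E)) :=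
    ((by fun_prop : Continuous fun t : ℝ => 2*(1-t)*B + t*E).tendsto 0).mono_left nhdsWithin_le_nhds
  have := ge_of_tendsto hc (b := 0) (by
    filter_upwards [Ioo_mem_nhdsGT (by norm_num : (0:ℝ) < 1)] with t ht using key t ht.1 ht.2)
  linarith

/-- Existence of the extremal measure. -/
theorem exists_min' {m M : ℕ} (hP : Par m M) : ∃ μ : ℝ, (M:ℝ) < μ ∧ μ < M+1 ∧ ∃ p : Measure ℝ,
    IsProbabilityMeasure p ∧ p (Icc 0 π)ᶜ = 0 ∧
    Summable (fun j : ℕ => ((j:ℝ)+1) * aco p j^2) ∧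
    1/2 * ∑' j, ell μ (m*j) * aco p j^2 = ell μ 0 ∧
    ∀ q : Measure ℝ, IsProbabilityMeasure q → q (Icc 0 π)ᶜ = 0 →
      Summable (fun j : ℕ => ((j:ℝ)+1) * aco q j^2) →
      ell μ 0 ≤ 1/2 * ∑' j, ell μ (m*j) * (aco p j * aco q j) := by
  obtain ⟨μ, h1, h2, p, h3, h4, h5⟩ := exists_min hP
  refine ⟨μ, h1, h2, (p : Measure (Icc (0:ℝ) π)).map Subtype.val,
    Measure.isProbabilityMeasure_map measurable_subtype_coe.aemeasurable, ?_, ?_, ?_, ?_⟩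
  · rw [Measure.map_apply measurable_subtype_coe measurableSet_Icc.compl]
    have : (Subtype.val : Icc (0:ℝ) π → ℝ) ⁻¹' (Icc 0 π)ᶜ = ∅ := by
      ext s; simpa using fun _ => s.2.2
    rw [this]; simp
  · simpa only [aco_toR] using h3
  · simpa only [aco_toR] using h4
  · intro q q1 q2 q3
    obtain ⟨ν, hν⟩ := exists_XX q q2
    simp only [aco_toR, ← hν]
    exact h5 ν (by simpa only [hν] using q3)

end TO

open Real Set Filter MeasureTheory

namespace TO

lemma int_tsum (p : Measure ℝ) [IsFiniteMeasure p] {F : ℕ → ℝ → ℝ} {B : ℕ → ℝ}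
    (hF : ∀ n, Continuous (F n)) (hB : Summable B) (h : ∀ n s, |F n s| ≤ B n) :
    HasSum (fun n => ∫ s, F n s ∂p) (∫ s, ∑' n, F n s ∂p) := by
  refine hasSum_integral_of_dominated_convergence (fun n _ => B n)
    (fun n => (hF n).aestronglyMeasurable) (fun n => Eventually.of_forall fun s => h n s)
    (Eventually.of_forall fun s => hB) (integrable_const _) (Eventually.of_forall fun s => ?_)
  exact (Summable.of_norm_bounded hB fun n => h n s).hasSum

lemma summable_jgeo {r : ℝ} (h0 : 0 ≤ r) (h1 : r < 1) : Summable fun j : ℕ => ((j:ℝ)+1)*r^j := by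
  have := (summable_pow_geo h0 h1 1 1).add (summable_pow_geo h0 h1 1 0)
  refine this.congr fun j => ?_
  ring

/-- The extremal data. -/
structure Ext (m M : ℕ) (μ : ℝ) (p : Measure ℝ) : Prop where
  par : Par m M
  h1 : (M:ℝ) < μ
  h2 : μ < M+1
  prob : IsProbabilityMeasure p
  supp : p (Icc 0 π)ᶜ = 0
  en : Summable (fun j : ℕ => ((j:ℝ)+1) * aco p j^2)
  E0 : 1/2 * ∑' j, ell μ (m*j) * aco p j^2 = ell μ 0
  var : ∀ q : Measure ℝ, IsProbabilityMeasure q → q (Icc 0 π)ᶜ = 0 →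
      Summable (fun j : ℕ => ((j:ℝ)+1) * aco q j^2) →
      ell μ 0 ≤ 1/2 * ∑' j, ell μ (m*j) * (aco p j * aco q j)

lemma exists_Ext {m M : ℕ} (hP : Par m M) : ∃ μ p, Ext m M μ p := by
  obtain ⟨μ, h1, h2, p, h3, h4, h5, h6, h7⟩ := exists_min' hP
  exact ⟨μ, p, hP, h1, h2, h3, h4, h5, h6, h7⟩

noncomputable def TT (p : Measure ℝ) (r x : ℝ) : ℝ := ∫ s, s⁻¹ * LQ r x s ∂p

noncomputable def GG (m : ℕ) (μ : ℝ) (p : Measure ℝ) (r x : ℝ) : ℝ :=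
  ell μ 0 * x - ∑' j : ℕ, r^j * (yy m μ j/(j:ℝ)^2) * aco p j * sin (j*x)

noncomputable def PS (m : ℕ) (μ : ℝ) (p : Measure ℝ) (r x : ℝ) : ℝ :=
  2*m*TT p r x + GG m μ p r x

namespace Ext

variable {m M : ℕ} {μ : ℝ} {p : Measure ℝ} (H : Ext m M μ p)
include H

lemma ae_mem : ∀ᵐ s ∂p, s ∈ Icc 0 π := by rw [ae_iff]; exact H.supp

lemma aco_abs (j : ℕ) : |aco p j| ≤ 2 := by
  have := H.prob
  have := norm_integral_le_of_norm_le_const (μ := p)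
    (f := fun s => 2 * sinc (j*s)) (C := 2) (Eventually.of_forall fun s => two_sinc_le _)
  simpa [aco] using this

lemma aco_zero : aco p 0 = 2 := by
  have := H.prob
  simp [aco]

lemma Lbd : ∃ C : ℝ, 0 ≤ C ∧ ∀ j : ℕ, |ell μ (m*j)| ≤ C*(j+1) := by
  obtain ⟨C, h0, h⟩ := ell_unif H.par H.h1 H.h2
  exact ⟨C, h0, h μ ⟨le_rfl, le_rfl⟩⟩

lemma L0_pos : 0 < ell μ 0 := ell_zero_pos H.par.oddM H.h1 H.h2

lemma aco_tendsto : Tendsto (fun j => aco p j) atTop (nhds 0) := by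
  have h := H.en.tendsto_atTop_zero
  have h2 : Tendsto (fun j => aco p j^2) atTop (nhds 0) := by
    refine squeeze_zero (fun j => sq_nonneg _) (fun j => ?_) h
    have : (0:ℝ) ≤ j := j.cast_nonneg
    nlinarith [mul_nonneg this (sq_nonneg (aco p j))]
  have h3 := h2.sqrt
  simp only [Real.sqrt_sq_eq_abs, Real.sqrt_zero] at h3
  exact (tendsto_zero_iff_abs_tendsto_zero _).2 h3

lemma atom_zero : p {0} = 0 := by
  have := H.prob
  have h : Tendsto (fun j : ℕ => ∫ s, 2 * sinc (j*s) ∂p) atTop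
      (nhds (∫ s, Set.indicator {(0:ℝ)} (fun _ => (2:ℝ)) s ∂p)) := by
    refine tendsto_integral_of_dominated_convergence (fun _ => 2)
      (fun j => (cont_sinc j).aestronglyMeasurable) (integrable_const _)
      (fun j => Eventually.of_forall fun s => two_sinc_le _) (Eventually.of_forall fun s => ?_)
    by_cases hs : s = 0
    · subst hs; simp
    · simp only [mem_singleton_iff, hs, not_false_eq_true, indicator_of_notMem]
      have hz : Tendsto (fun j : ℕ => 2 / |s| * (1/(j:ℝ))) atTop (nhds (2/|s| * 0)) :=
        tendsto_one_div_atTop_nhds_zero_nat.const_mul _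
      rw [mul_zero] at hz
      refine squeeze_zero_norm' ?_ hz
      filter_upwards [eventually_gt_atTop 0] with j hj
      have hj' : (0:ℝ) < j := by exact_mod_cast hj
      have hs' : 0 < |s| := abs_pos.2 hs
      rw [sinc_of_ne_zero (by positivity), Real.norm_eq_abs, abs_mul, abs_div, abs_mul, abs_two, abs_of_pos hj']
      have := abs_sin_le_one (j*s)
      calc 2 * (|sin (j*s)|/(j*|s|)) ≤ 2 * (1/(j*|s|)) := by gcongr
        _ = _ := by field_simp
  have h0 := tendsto_nhds_unique h H.aco_tendsto
  rw [integral_indicator_const _ (measurableSet_singleton 0)] at h0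
  simp only [smul_eq_mul, mul_eq_zero, OfNat.ofNat_ne_zero, or_false] at h0
  rwa [measureReal_eq_zero_iff] at h0

lemma ae_pos : ∀ᵐ s ∂p, 0 < s ∧ s ≤ π := by
  have h2 : ∀ᵐ s ∂p, s ≠ 0 := by rw [ae_iff]; simpa using H.atom_zero
  filter_upwards [H.ae_mem, h2] with s hs hs2
  exact ⟨lt_of_le_of_ne hs.1 (Ne.symm hs2), hs.2⟩

lemma TT_series {r : ℝ} (h0 : 0 ≤ r) (h1 : r < 1) (x : ℝ) :
    HasSum (fun j : ℕ => r^j * sin (j*x) * (aco p j/2)) (TT p r x) := by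
  have := H.prob
  have hb := int_tsum p (F := fun (j : ℕ) s => r^j * sin (j*x) * sinc (j*s)) (B := fun j => r^j)
    (fun j => continuous_const.mul (continuous_sinc.comp (by fun_prop)))
    (summable_geometric_of_lt_one h0 h1) (fun j s => by
      rw [abs_mul, abs_mul, abs_of_nonneg (pow_nonneg h0 j)]
      have e1 := abs_sin_le_one (j*x)
      have e2 := abs_sinc_le_one (j*s)
      calc r^j * |sin (j*x)| * |sinc (j*s)| ≤ r^j * 1 * 1 := by gcongr
        _ = _ := by ring)
  have e : TT p r x = ∫ s, ∑' j : ℕ, r^j * sin (j*x) * sinc (j*s) ∂p := by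
    refine integral_congr_ae ?_
    filter_upwards [H.ae_pos] with s hs
    rw [← (hasSum_LQ h0 h1 x s).tsum_eq, ← tsum_mul_left]
    refine tsum_congr fun j => ?_
    rcases Nat.eq_zero_or_pos j with rfl | hj
    · simp
    · have hj' : (0:ℝ) < j := by exact_mod_cast hj
      have := hs.1
      rw [sinc_of_ne_zero (by positivity)]; field_simp
  rw [e]
  refine Eq.mp (congrArg (fun f : ℕ → ℝ => HasSum f _) (funext fun n => ?_)) hb
  rw [integral_const_mul, aco, integral_const_mul]; ring

lemma G_sum {r : ℝ} (h0 : 0 ≤ r) (h1 : r ≤ 1) (x : ℝ) :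
    Summable fun j : ℕ => r^j * (yy m μ j/(j:ℝ)^2) * aco p j * sin (j*x) := by
  obtain ⟨C, C0, hC⟩ := yy_bound H.par H.h1 H.h2
  have hs : Summable fun j : ℕ => 2*C*(1/(j:ℝ)^2) := (Real.summable_one_div_nat_pow.2 (by norm_num)).mul_left _
  refine Summable.of_norm_bounded hs fun j => ?_
  rw [Real.norm_eq_abs, abs_mul, abs_mul, abs_mul, abs_div, abs_of_nonneg (pow_nonneg h0 j),
    abs_of_nonneg (by positivity : (0:ℝ) ≤ (j:ℝ)^2)]
  have e1 := abs_sin_le_one (j*x)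
  have e2 := H.aco_abs j
  have e3 : r^j ≤ 1 := pow_le_one₀ h0 h1
  calc r^j * (|yy m μ j|/(j:ℝ)^2) * |aco p j| * |sin (j*x)| ≤ 1 * (C/(j:ℝ)^2) * 2 * 1 := by
        gcongr; exact hC j
    _ = _ := by ring

lemma PS_series {r : ℝ} (h0 : 0 ≤ r) (h1 : r < 1) (x : ℝ) :
    HasSum (fun j : ℕ => r^j * ell μ (m*j) * aco p j * sin (j*x)/j) (PS m μ p r x - ell μ 0 * x) := by
  have t1 : HasSum (fun j : ℕ => 2*(m:ℝ)*(r^j * sin (j*x) * (aco p j/2))) (2*(m:ℝ)*TT p r x) :=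
    (H.TT_series h0 h1 x).mul_left (2*(m:ℝ))
  have := t1.sub (H.G_sum h0 h1.le x).hasSum
  have e : PS m μ p r x - ell μ 0 * x = 2*m*TT p r x -
      ∑' j : ℕ, r^j * (yy m μ j/(j:ℝ)^2) * aco p j * sin (j*x) := by
    rw [PS, GG]; ring
  rw [e]
  refine Eq.mp (congrArg (fun f : ℕ → ℝ => HasSum f _) (funext fun j => ?_)) this
  rcases Nat.eq_zero_or_pos j with rfl | hj
  · simp
  · have hj' : (0:ℝ) < j := by exact_mod_cast hj
    rw [yy]; field_simp; ring

/-- The energy density of the smoothed potential. -/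
lemma gr_nonneg {r : ℝ} (h0 : 0 ≤ r) (h1 : r < 1) {x : ℝ} (hx : x ∈ Ioo 0 π) :
    ell μ 0 ≤ ∑' j : ℕ, r^j * ell μ (m*j) * aco p j * sinc (j*x) := by
  obtain ⟨q, q1, q2, q3⟩ := test_poisson h0 h1 hx
  have := H.var q q1 q2 (by
    refine Summable.of_nonneg_of_le (fun j => by positivity) (fun j => ?_) ((summable_jgeo h0 h1).mul_left 4)
    rw [q3]
    have e := abs_sinc_le_one (j*x)
    have e2 : sinc (j*x)^2 ≤ 1 := by nlinarith [abs_le.1 e]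
    have e3 : (r^j)^2 ≤ r^j := by
      have := pow_nonneg h0 j
      nlinarith [pow_le_one₀ h0 h1.le (n := j)]
    calc ((j:ℝ)+1)*(2*r^j*sinc (j*x))^2 = ((j:ℝ)+1)*4*((r^j)^2*sinc (j*x)^2) := by ring
      _ ≤ ((j:ℝ)+1)*4*(r^j*1) := by gcongr
      _ = _ := by ring)
  refine this.trans (le_of_eq ?_)
  rw [← tsum_mul_left]
  refine tsum_congr fun j => ?_
  rw [q3]; ring

lemma gr_bd : ∃ C : ℝ, 0 ≤ C ∧ ∀ r : ℝ, 0 ≤ r → ∀ j : ℕ, ∀ x, |r^j * ell μ (m*j) * aco p j * sinc (j*x)| ≤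
    C * (((j:ℝ)+1)*r^j) := by
  obtain ⟨C, C0, hC⟩ := H.Lbd
  refine ⟨2*C, by positivity, fun r h0 j x => ?_⟩
  rw [abs_mul, abs_mul, abs_mul, abs_of_nonneg (pow_nonneg h0 j)]
  have e1 := abs_sinc_le_one (j*x)
  have e2 := H.aco_abs j
  calc r^j * |ell μ (m*j)| * |aco p j| * |sinc (j*x)| ≤ r^j * (C*((j:ℝ)+1)) * 2 * 1 := by
        gcongr; exact hC j
    _ = _ := by ring

lemma PS_eq {r : ℝ} (h0 : 0 ≤ r) (h1 : r < 1) (x : ℝ) :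
    PS m μ p r x = x * (∑' j : ℕ, r^j * ell μ (m*j) * aco p j * sinc (j*x) - ell μ 0) := by
  obtain ⟨C, C0, hC⟩ := H.gr_bd
  have hs : Summable fun j : ℕ => r^j * ell μ (m*j) * aco p j * sinc (j*x) :=
    Summable.of_norm_bounded ((summable_jgeo h0 h1).mul_left C) fun j => hC r h0 j x
  have h := (H.PS_series h0 h1 x)
  have h' : HasSum (fun j : ℕ => x*(r^j * ell μ (m*j) * aco p j * sinc (j*x)) -
      (if j = 0 then 2*ell μ 0*x else 0)) (x*∑' j : ℕ, r^j * ell μ (m*j) * aco p j * sinc (j*x) - 2*ell μ 0*x) :=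
    (hs.hasSum.mul_left x).sub (hasSum_ite_eq 0 _)
  have : PS m μ p r x - ell μ 0 * x =
      x*∑' j : ℕ, r^j * ell μ (m*j) * aco p j * sinc (j*x) - 2*ell μ 0*x := by
    refine h.unique (Eq.mp (congrArg (fun f : ℕ → ℝ => HasSum f _) (funext fun j => ?_)) h')
    rcases Nat.eq_zero_or_pos j with rfl | hj
    · simp [H.aco_zero]; ring
    · rw [if_neg hj.ne']
      have := sinc_mul hj.ne' (s := x)
      calc _ = r^j * ell μ (m*j) * aco p j * (x*(2*sinc (j*x)))/2 := by ring
        _ = _ := by rw [this]; ring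
  linarith

lemma PS_pi {r : ℝ} (h0 : 0 ≤ r) (h1 : r < 1) : PS m μ p r π = ell μ 0 * π := by
  have h := H.PS_series h0 h1 π
  simp only [sin_nat_mul_pi, mul_zero, zero_div] at h
  linarith [h.unique hasSum_zero]

lemma PS_nonneg {r : ℝ} (h0 : 0 ≤ r) (h1 : r < 1) {x : ℝ} (hx : x ∈ Icc 0 π) :
    0 ≤ PS m μ p r x := by
  rcases hx.1.eq_or_lt with h | h
  · rw [H.PS_eq h0 h1, ← h]; simp
  rcases hx.2.eq_or_lt with h' | h'
  · rw [h', H.PS_pi h0 h1]; exact mul_nonneg H.L0_pos.le pi_pos.le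
  · rw [H.PS_eq h0 h1]
    exact mul_nonneg hx.1 (sub_nonneg.2 (H.gr_nonneg h0 h1 ⟨h, h'⟩))

lemma PS_cont {r : ℝ} (h0 : 0 ≤ r) (h1 : r < 1) : Continuous (PS m μ p r) := by
  obtain ⟨C, C0, hC⟩ := H.gr_bd
  have e : PS m μ p r = fun x => x * (∑' j : ℕ, r^j * ell μ (m*j) * aco p j * sinc (j*x) - ell μ 0) :=
    funext fun x => H.PS_eq h0 h1 x
  rw [e]
  refine continuous_id.mul (Continuous.sub ?_ continuous_const)
  exact continuous_tsum (fun j => continuous_const.mul (continuous_sinc.comp (by fun_prop)))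
    ((summable_jgeo h0 h1).mul_left C) fun j x => hC r h0 j x

lemma int_gr {r : ℝ} (h0 : 0 ≤ r) (h1 : r < 1) :
    ∫ x, (∑' j : ℕ, r^j * ell μ (m*j) * aco p j * sinc (j*x)) ∂p =
      1/2 * ∑' j : ℕ, r^j * (ell μ (m*j) * aco p j^2) := by
  have := H.prob
  obtain ⟨C, C0, hC⟩ := H.gr_bd
  have h := int_tsum p (F := fun (j : ℕ) x => r^j * ell μ (m*j) * aco p j * sinc (j*x))
    (fun j => continuous_const.mul (continuous_sinc.comp (by fun_prop)))
    ((summable_jgeo h0 h1).mul_left C) fun j x => hC r h0 j x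
  rw [← h.tsum_eq, ← tsum_mul_left]
  refine tsum_congr fun j => ?_
  rw [integral_const_mul]
  have : aco p j = 2 * ∫ s, sinc (j*s) ∂p := by rw [aco, integral_const_mul]
  have : ∫ s, sinc (j*s) ∂p = aco p j/2 := by linarith
  rw [this]; ring

lemma LE_summable : Summable fun j => ell μ (m*j) * aco p j^2 := by
  obtain ⟨C, C0, hC⟩ := H.Lbd
  refine Summable.of_norm_bounded (H.en.mul_left C) fun j => ?_
  rw [norm_mul, Real.norm_eq_abs, Real.norm_eq_abs, abs_of_nonneg (sq_nonneg (aco p j)), ← mul_assoc]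
  exact mul_le_mul_of_nonneg_right (hC j) (sq_nonneg _)

omit H in
lemma ev01 : ∀ᶠ r : ℝ in nhdsWithin 1 (Iio 1), 0 ≤ r ∧ r < 1 := by
  filter_upwards [Ioo_mem_nhdsLT (by norm_num : (0:ℝ) < 1)] with r hr using ⟨hr.1.le, hr.2⟩

omit H in
lemma abel_lim {b : ℕ → ℝ} (hb : Summable fun j => |b j|) :
    Tendsto (fun r : ℝ => ∑' j : ℕ, r^j * b j) (nhdsWithin 1 (Iio 1)) (nhds (∑' j, b j)) := by
  refine tendsto_tsum_of_dominated_convergence hb (fun j => ?_) ?_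
  · have : Tendsto (fun r : ℝ => r^j * b j) (nhds 1) (nhds (1^j * b j)) :=
      (by fun_prop : Continuous fun r : ℝ => r^j * b j).tendsto 1
    simpa using this.mono_left nhdsWithin_le_nhds
  · filter_upwards [ev01] with r hr j
    rw [norm_mul, norm_pow, Real.norm_eq_abs, Real.norm_eq_abs, abs_of_nonneg hr.1]
    exact mul_le_of_le_one_left (abs_nonneg _) (pow_le_one₀ hr.1 hr.2.le)

lemma int_PS_tendsto : Tendsto (fun r => ∫ x, PS m μ p r x ∂p) (nhdsWithin 1 (Iio 1)) (nhds 0) := by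
  have := H.prob
  obtain ⟨C, C0, hC⟩ := H.gr_bd
  have h1 : Tendsto (fun r : ℝ => π*(1/2 * ∑' j : ℕ, r^j * (ell μ (m*j) * aco p j^2) - ell μ 0))
      (nhdsWithin 1 (Iio 1)) (nhds (π*(1/2 * ∑' j : ℕ, (ell μ (m*j) * aco p j^2) - ell μ 0))) :=
    (((abel_lim H.LE_summable.abs).const_mul _).sub_const _).const_mul _
  rw [H.E0, sub_self, mul_zero] at h1
  refine tendsto_of_tendsto_of_tendsto_of_le_of_le' tendsto_const_nhds h1 ?_ ?_
  · filter_upwards [ev01] with r hr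
    refine integral_nonneg_of_ae ?_
    filter_upwards [H.ae_mem] with x hx using H.PS_nonneg hr.1 hr.2 hx
  · filter_upwards [ev01] with r hr
    have hc : Continuous fun x => ∑' j : ℕ, r^j * ell μ (m*j) * aco p j * sinc (j*x) :=
      continuous_tsum (fun j => continuous_const.mul (continuous_sinc.comp (by fun_prop)))
        ((summable_jgeo hr.1 hr.2).mul_left C) fun j x => hC r hr.1 j x
    have hi : Integrable (fun x => ∑' j : ℕ, r^j * ell μ (m*j) * aco p j * sinc (j*x)) p := by
      refine Integrable.of_bound hc.aestronglyMeasurable (∑' j : ℕ, C * (((j:ℝ)+1)*r^j))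
        (Eventually.of_forall fun x => ?_)
      exact tsum_of_norm_bounded ((summable_jgeo hr.1 hr.2).mul_left C).hasSum fun j => hC r hr.1 j x
    have hi2 := (hi.sub (integrable_const (ell μ 0))).const_mul π
    rw [← H.int_gr hr.1 hr.2]
    have e : π * (∫ x, (∑' j : ℕ, r^j * ell μ (m*j) * aco p j * sinc (j*x)) ∂p - ell μ 0) =
        ∫ x, π * ((∑' j : ℕ, r^j * ell μ (m*j) * aco p j * sinc (j*x)) - ell μ 0) ∂p := by
      rw [integral_const_mul, integral_sub hi (integrable_const _)]; simp
    rw [e]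
    have key : ∀ᵐ x ∂p, 0 ≤ (∑' j : ℕ, r^j * ell μ (m*j) * aco p j * sinc (j*x)) - ell μ 0 ∧ 0 < x ∧ x ≤ π := by
      filter_upwards [H.ae_pos] with x hx
      refine ⟨?_, hx⟩
      have := H.PS_nonneg hr.1 hr.2 (x := x) ⟨hx.1.le, hx.2⟩
      rw [H.PS_eq hr.1 hr.2] at this
      exact nonneg_of_mul_nonneg_right this hx.1
    refine integral_mono_of_nonneg ?_ hi2 ?_
    · filter_upwards [H.ae_mem] with x hx using H.PS_nonneg hr.1 hr.2 hx
    · filter_upwards [key] with x hx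
      rw [H.PS_eq hr.1 hr.2]
      exact mul_le_mul_of_nonneg_right hx.2.2 hx.1

end Ext
end TO

open Real Set Filter MeasureTheory

namespace TO

lemma convexOn_of_tendsto {ι : Type*} {l : Filter ι} [l.NeBot] {D : Set ℝ} {F : ι → ℝ → ℝ} {f : ℝ → ℝ}
    (hF : ∀ᶠ i in l, ConvexOn ℝ D (F i)) (hl : ∀ x ∈ D, Tendsto (fun i => F i x) l (nhds (f x))) :
    ConvexOn ℝ D f := by
  have hD : Convex ℝ D := by
    obtain ⟨i, hi⟩ := hF.exists
    exact hi.1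
  refine ⟨hD, fun x hx y hy a b ha hb hab => ?_⟩
  refine le_of_tendsto_of_tendsto (hl _ (hD hx hy ha hb hab))
    (((hl x hx).const_smul a).add ((hl y hy).const_smul b)) ?_
  filter_upwards [hF] with i hi using hi.2 hx hy ha hb hab

lemma Dn_one (t : ℝ) : Dn 1 t = 2 * (1 - cos t) := by unfold Dn; ring

lemma one_sub_cos_pos {x s : ℝ} (hx : x ∈ Icc 0 π) (hs : s ∈ Icc 0 π) (h : x ≠ s) : 0 < 1 - cos (x-s) := by
  have := pi_pos
  have : cos (x-s) ≠ 1 := fun h' => by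
    rw [Real.cos_eq_one_iff_of_lt_of_lt (by linarith [hx.1, hs.2]) (by linarith [hx.2, hs.1])] at h'
    exact h (by linarith)
  have h2 := cos_le_one (x-s)
  rcases h2.lt_or_eq with h3 | h3
  · linarith
  · exact absurd h3 this

lemma cos_prod (x s : ℝ) : (1 - cos (x-s)) * (1 - cos (x+s)) = (cos x - cos s)^2 := by
  rw [cos_add, cos_sub]
  nlinarith [sin_sq_add_cos_sq x, sin_sq_add_cos_sq s, sin_sq x, sin_sq s,
    (by rw [sin_sq, sin_sq] : sin x^2 * sin s^2 = (1 - cos x^2)*(1-cos s^2))]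

lemma LQ_one_eq {x s : ℝ} (hx : x ∈ Ioo 0 π) (hs : s ∈ Ioo 0 π) (h : x ≠ s) :
    LQ 1 x s = 1/4 * (log (1 - cos (x+s)) - log (1 - cos (x-s))) := by
  have a := one_sub_cos_pos (Ioo_subset_Icc_self hx) (Ioo_subset_Icc_self hs) h
  have e : 1 - cos (x+s) = 1 - cos (x-s) + 2 * sin x * sin s := by rw [cos_add, cos_sub]; ring
  have h2 := mul_pos (sin_pos_of_mem_Ioo hx) (sin_pos_of_mem_Ioo hs)
  have b : 0 < 1 - cos (x+s) := by rw [e]; nlinarith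
  unfold LQ
  rw [← Real.log_div b.ne' a.ne', Dn_one, e]
  congr 2; field_simp; ring

lemma LQ_convex {α β s : ℝ} (hα : 0 ≤ α) (hβ : β ≤ π) (hs : s ∈ Icc 0 π) (hn : s ∉ Icc α β) :
    ConvexOn ℝ (Icc α β) (fun x => LQ 1 x s + 1/8 * (sin x * sin s)) := by
  by_cases hs0 : sin s = 0
  · have : (fun x => LQ 1 x s + 1/8 * (sin x * sin s)) = fun _ => 0 := by
      funext x; simp [LQ, hs0]
    rw [this]; exact convexOn_const 0 (convex_Icc _ _)
  have hs' : s ∈ Ioo 0 π := by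
    refine ⟨lt_of_le_of_ne hs.1 fun h => hs0 (by simp [← h]), lt_of_le_of_ne hs.2 fun h => hs0 (by simp [h])⟩
  have hsp := sin_pos_of_mem_Ioo hs'
  have hxs : ∀ x ∈ Icc α β, x ∈ Icc 0 π ∧ x ≠ s := fun x hx =>
    ⟨⟨hα.trans hx.1, hx.2.trans hβ⟩, fun h => hn (h ▸ hx)⟩
  have hin : ∀ x ∈ Ioo α β, x ∈ Ioo 0 π ∧ x ≠ s := fun x hx =>
    ⟨⟨hα.trans_lt hx.1, hx.2.trans_le hβ⟩, fun h => hn (h ▸ Ioo_subset_Icc_self hx)⟩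
  have hA : ∀ x ∈ Ioo α β, 0 < 1 - cos (x-s) := fun x hx =>
    one_sub_cos_pos (Ioo_subset_Icc_self (hin x hx).1) hs (hin x hx).2
  have hB : ∀ x ∈ Ioo α β, 0 < 1 - cos (x+s) := fun x hx => by
    have e : 1 - cos (x+s) = 1 - cos (x-s) + 2 * sin x * sin s := by rw [cos_add, cos_sub]; ring
    have := mul_pos (sin_pos_of_mem_Ioo (hin x hx).1) hsp
    rw [e]; nlinarith [hA x hx]
  refine convexOn_of_hasDerivWithinAt2_nonneg (convex_Icc _ _)
    (f' := fun x => 1/4 * (sin (x+s)/(1 - cos (x+s)) - sin (x-s)/(1-cos (x-s))) + 1/8*(cos x * sin s))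
    (f'' := fun x => 1/4 * (1/(1-cos (x-s)) - 1/(1-cos (x+s))) - 1/8 * (sin x * sin s)) ?_ ?_ ?_ ?_
  · refine ContinuousOn.add ?_ (by fun_prop)
    unfold LQ
    refine continuousOn_const.mul (ContinuousOn.log ?_ ?_)
    · refine continuousOn_const.add ((by fun_prop : Continuous fun x => 4 * sin x * sin s).continuousOn.mul ?_)
      refine continuousOn_const.div (by unfold Dn; fun_prop) fun x hx => ?_
      rw [Dn_one]
      have := one_sub_cos_pos (hxs x hx).1 hs (hxs x hx).2
      positivity
    · intro x hx
      have e1 := mul_nonneg (sin_nonneg_of_mem_Icc (hxs x hx).1) hsp.le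
      have e2 : 0 ≤ 1 / Dn 1 (x-s) := by
        rw [Dn_one]
        have := one_sub_cos_pos (hxs x hx).1 hs (hxs x hx).2
        positivity
      have := mul_nonneg e1 e2
      have : 0 < 1 + 4 * sin x * sin s * (1 / Dn 1 (x-s)) := by nlinarith
      exact this.ne'
  · intro x hx
    rw [interior_Icc] at hx ⊢
    have h1 : HasDerivAt (fun x => 1/4 * (log (1 - cos (x+s)) - log (1 - cos (x-s))) + 1/8*(sin x * sin s))
        (1/4 * (sin (x+s)/(1 - cos (x+s)) - sin (x-s)/(1-cos (x-s))) + 1/8*(cos x * sin s)) x := by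
      have d1 := (((hasDerivAt_id x).add_const s).cos.const_sub 1).log (hB x hx).ne'
      have d2 := (((hasDerivAt_id x).sub_const s).cos.const_sub 1).log (hA x hx).ne'
      have := ((d1.sub d2).const_mul (1/4)).add (((hasDerivAt_sin x).mul_const (sin s)).const_mul (1/8))
      refine this.congr_deriv ?_
      simp
    refine (h1.hasDerivWithinAt).congr_of_mem (fun y hy => ?_) hx
    rw [LQ_one_eq (hin y hy).1 hs' (hin y hy).2]
  · intro x hx
    rw [interior_Icc] at hx ⊢
    have a := hA x hx
    have b := hB x hx
    have d1 := ((hasDerivAt_id x).add_const s).sin.div (((hasDerivAt_id x).add_const s).cos.const_sub 1) b.ne'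
    have d2 := ((hasDerivAt_id x).sub_const s).sin.div (((hasDerivAt_id x).sub_const s).cos.const_sub 1) a.ne'
    have := ((d1.sub d2).const_mul (1/4)).add (((hasDerivAt_cos x).mul_const (sin s)).const_mul (1/8))
    refine (this.congr_deriv ?_).hasDerivWithinAt
    simp only [id]
    have e1 : (cos (x+s) * 1 * (1 - cos (x+s)) - sin (x+s) * -(-sin (x+s) * 1))/(1 - cos (x+s))^2 =
        - (1/(1 - cos (x+s))) := by
      field_simp; nlinarith [sin_sq_add_cos_sq (x+s)]
    have e2 : (cos (x-s) * 1 * (1 - cos (x-s)) - sin (x-s) * -(-sin (x-s) * 1))/(1 - cos (x-s))^2 =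
        - (1/(1 - cos (x-s))) := by
      field_simp; nlinarith [sin_sq_add_cos_sq (x-s)]
    rw [e1, e2]; ring
  · intro x hx
    rw [interior_Icc] at hx
    have a := hA x hx
    have b := hB x hx
    have hsx := mul_pos (sin_pos_of_mem_Ioo (hin x hx).1) hsp
    have e : 1/(1-cos (x-s)) - 1/(1-cos (x+s)) = 2 * (sin x * sin s)/((cos x - cos s)^2) := by
      rw [← cos_prod, div_sub_div _ _ a.ne' b.ne']
      congr 1; rw [cos_add, cos_sub]; ring
    rw [e]
    have hp : 0 < (cos x - cos s)^2 := by rw [← cos_prod]; positivity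
    have h4 : (cos x - cos s)^2 ≤ 4 := by
      nlinarith [cos_le_one x, neg_one_le_cos x, cos_le_one s, neg_one_le_cos s]
    have : sin x * sin s / 2 ≤ 2 * (sin x * sin s)/((cos x - cos s)^2) := by
      rw [le_div_iff₀ hp]; nlinarith
    linarith

lemma LQ_tend {x s : ℝ} (hs : 0 ≤ sin x * sin s) (h : 0 < 1 - cos (x-s)) :
    Tendsto (fun r => LQ r x s) (nhdsWithin 1 (Iio 1)) (nhds (LQ 1 x s)) := by
  refine Tendsto.mono_left ?_ nhdsWithin_le_nhds
  have hD : Dn 1 (x-s) ≠ 0 := by rw [Dn_one]; positivity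
  have e2 : 0 ≤ 1 / Dn 1 (x-s) := by rw [Dn_one]; positivity
  have hc : ContinuousAt (fun r => LQ r x s) 1 := by
    unfold LQ
    refine continuousAt_const.mul (ContinuousAt.log ?_ ?_)
    · refine continuousAt_const.add (continuousAt_const.mul (continuousAt_id.div ?_ hD))
      unfold Dn; fun_prop
    · have : 0 < 1 + 4 * sin x * sin s * (1 / Dn 1 (x-s)) := by nlinarith [mul_nonneg hs e2]
      exact this.ne'
  exact hc

lemma LQ_le_one {r x s : ℝ} (h0 : 0 ≤ r) (h1 : r ≤ 1) (hs : 0 ≤ sin x * sin s) (h : 0 < 1 - cos (x-s)) :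
    LQ r x s ≤ LQ 1 x s := by
  refine LQ_mono h0 h1 le_rfl hs ?_ (by rw [Dn_one]; positivity)
  have : cos (x-s) < 1 := by linarith
  unfold Dn
  rcases h0.eq_or_lt with h | h
  · rw [← h]; norm_num
  · nlinarith [sq_nonneg (1-r)]

lemma LQ_meas (r x : ℝ) : Measurable fun s => s⁻¹ * LQ r x s := by
  unfold LQ Dn
  fun_prop

namespace Ext
variable {m M : ℕ} {μ : ℝ} {p : Measure ℝ} (H : Ext m M μ p)
include H

lemma GG_tendsto : ∃ δ : ℝ → ℝ, Tendsto δ (nhdsWithin 1 (Iio 1)) (nhds 0) ∧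
    ∀ r, 0 ≤ r → r ≤ 1 → ∀ x, |GG m μ p r x - GG m μ p 1 x| ≤ δ r := by
  obtain ⟨C, C0, hC⟩ := yy_bound H.par H.h1 H.h2
  have hs : Summable fun j : ℕ => 2*C*(1/(j:ℝ)^2) := (Real.summable_one_div_nat_pow.2 (by norm_num)).mul_left _
  have hsr : ∀ r : ℝ, 0 ≤ r → r ≤ 1 → Summable fun j : ℕ => r^j * (2*C*(1/(j:ℝ)^2)) := fun r h0 h1 => by
    refine Summable.of_nonneg_of_le (fun j => by positivity) (fun j => ?_) hs
    exact mul_le_of_le_one_left (by positivity) (pow_le_one₀ h0 h1)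
  refine ⟨fun r => ∑' j : ℕ, 2*C*(1/(j:ℝ)^2) - ∑' j : ℕ, r^j * (2*C*(1/(j:ℝ)^2)), ?_, ?_⟩
  · have := (abel_lim hs.abs).const_sub (∑' j : ℕ, 2*C*(1/(j:ℝ)^2))
    simpa using this
  · intro r h0 h1 x
    have e : GG m μ p r x - GG m μ p 1 x = ∑' j : ℕ, (1 - r^j) * (yy m μ j/(j:ℝ)^2) * aco p j * sin (j*x) := by
      have := (H.G_sum zero_le_one le_rfl x).hasSum.sub (H.G_sum h0 h1 x).hasSum
      rw [GG, GG]
      have e2 : ∀ A B : ℝ, ell μ 0 * x - A - (ell μ 0 * x - B) = B - A := by intros; ring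
      rw [e2, ← this.tsum_eq]
      refine tsum_congr fun j => ?_
      rw [one_pow]; ring
    beta_reduce
    rw [e, ← hs.tsum_sub (hsr r h0 h1), ← Real.norm_eq_abs]
    refine tsum_of_norm_bounded (hs.sub (hsr r h0 h1)).hasSum fun j => ?_
    have e3 : r^j ≤ 1 := pow_le_one₀ h0 h1
    rw [Real.norm_eq_abs, abs_mul, abs_mul, abs_mul, abs_div, abs_of_nonneg (sub_nonneg.2 e3),
      abs_of_nonneg (by positivity : (0:ℝ) ≤ (j:ℝ)^2)]
    have e1 := abs_sin_le_one (j*x)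
    have e2 := H.aco_abs j
    have e4 := sub_nonneg.2 e3
    calc (1-r^j) * (|yy m μ j|/(j:ℝ)^2) * |aco p j| * |sin (j*x)| ≤ (1-r^j) * (C/(j:ℝ)^2) * 2 * 1 := by
          gcongr; exact hC j
      _ = _ := by ring

lemma GG_lim (x : ℝ) : Tendsto (fun r => GG m μ p r x) (nhdsWithin 1 (Iio 1)) (nhds (GG m μ p 1 x)) := by
  obtain ⟨δ, h1, h2⟩ := H.GG_tendsto
  rw [tendsto_iff_norm_sub_tendsto_zero]
  refine squeeze_zero' (Eventually.of_forall fun _ => norm_nonneg _) ?_ h1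
  filter_upwards [ev01] with r hr using h2 r hr.1 hr.2.le x

lemma GG_cont {r : ℝ} (h0 : 0 ≤ r) (h1 : r ≤ 1) : Continuous (GG m μ p r) := by
  obtain ⟨C, C0, hC⟩ := yy_bound H.par H.h1 H.h2
  have hs : Summable fun j : ℕ => 2*C*(1/(j:ℝ)^2) := (Real.summable_one_div_nat_pow.2 (by norm_num)).mul_left _
  unfold GG
  refine (continuous_const.mul continuous_id).sub (continuous_tsum (fun j => by fun_prop) hs fun j x => ?_)
  rw [Real.norm_eq_abs, abs_mul, abs_mul, abs_mul, abs_div, abs_of_nonneg (pow_nonneg h0 j),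
    abs_of_nonneg (by positivity : (0:ℝ) ≤ (j:ℝ)^2)]
  have e1 := abs_sin_le_one (j*x)
  have e2 := H.aco_abs j
  have e3 : r^j ≤ 1 := pow_le_one₀ h0 h1
  calc r^j * (|yy m μ j|/(j:ℝ)^2) * |aco p j| * |sin (j*x)| ≤ 1 * (C/(j:ℝ)^2) * 2 * 1 := by
        gcongr; exact hC j
    _ = _ := by ring

lemma aco_one_pos : 0 < aco p 1 := by
  have h0 : 0 ≤ aco p 1 := by
    refine integral_nonneg_of_ae ?_
    filter_upwards [H.ae_pos] with s hs
    have := hs.1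
    simp only [Nat.cast_one, one_mul, Pi.zero_apply]
    rw [sinc_of_ne_zero hs.1.ne']
    have := sin_nonneg_of_mem_Icc ⟨hs.1.le, hs.2⟩
    positivity
  rcases h0.lt_or_eq with h | h
  · exact h
  exfalso
  have hs := H.LE_summable.sum_le_tsum (Finset.range 2) (fun j hj => by
    have h2 : 2 ≤ j := by simp at hj; omega
    exact mul_nonneg (ell_pos H.par.oddM H.h1 H.h2 (by nlinarith [H.par.M2])).le (sq_nonneg _))
  rw [Finset.sum_range_succ, Finset.sum_range_one, ← h, H.aco_zero, mul_zero] at hs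
  have := H.E0
  have := H.L0_pos
  linarith

lemma GG_convex : ∃ d : ℝ, 0 < d ∧
    ConvexOn ℝ (Icc 0 π) (fun x => GG m μ p 1 x - (m/8*aco p 1 - d) * sin x) := by
  have := H.prob
  obtain ⟨c, c0, cm, hc⟩ := K_bound H.par H.h1 H.h2
  obtain ⟨C, C0, hC⟩ := yy_bound H.par H.h1 H.h2
  have ha := H.aco_one_pos
  refine ⟨(m/8 - c) * aco p 1, mul_pos (by linarith) ha, ?_⟩
  have e0 : (m/8*aco p 1 - (m/8 - c) * aco p 1) = c * aco p 1 := by ring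
  rw [e0]
  refine convexOn_of_tendsto (l := nhdsWithin (1:ℝ) (Iio 1))
    (F := fun r x => GG m μ p r x - c * aco p 1 * sin x) ?_ (fun x _ => (H.GG_lim x).sub_const _)
  filter_upwards [ev01] with r hr
  obtain ⟨h0, h1⟩ := hr
  have hy : ∀ j, |yy m μ j / (j:ℝ)^2| ≤ C := fun j => by
    rw [div_eq_mul_inv, abs_mul]
    calc |yy m μ j| * |((j:ℝ)^2)⁻¹| ≤ C * 1 := by
          gcongr
          · exact hC j
          · exact inv_pow_le_one j 2
      _ = C := mul_one C
  have hb : Summable fun j : ℕ => (j:ℝ)^2 * |r^j * (yy m μ j/(j:ℝ)^2) * aco p j| := by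
    refine summable_of_le_geo h0 h1 (2*C) 2 fun j => ?_
    rw [abs_mul, abs_abs, abs_mul, abs_mul, abs_of_nonneg (pow_nonneg h0 j), abs_of_nonneg (sq_nonneg (j:ℝ))]
    have e2 := H.aco_abs j
    have e3 := hy j
    calc (j:ℝ)^2 * (r^j * |yy m μ j/(j:ℝ)^2| * |aco p j|) ≤ (j:ℝ)^2 * (r^j * C * 2) := by gcongr
      _ = _ := by ring
  have hconv := sine_convex hb (c := c * aco p 1) (fun x hx => by
    have hI := int_tsum p (F := fun (j : ℕ) s => r^j * yy m μ j * sin (j*x) * (2 * sinc (j*s)))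
      (B := fun j => 2*C*r^j) (fun j => continuous_const.mul (cont_sinc j))
      ((summable_geometric_of_lt_one h0 h1).mul_left _) (fun j s => by
        rw [abs_mul, abs_mul, abs_mul, abs_of_nonneg (pow_nonneg h0 j)]
        have e1 := abs_sin_le_one (j*x)
        have e2 := two_sinc_le (j*s)
        calc r^j * |yy m μ j| * |sin (j*x)| * |2 * sinc (j*s)| ≤ r^j * C * 1 * 2 := by
              gcongr; exact hC j
          _ = _ := by ring)
    have e1 : ∑' j : ℕ, (j:ℝ)^2 * (r^j * (yy m μ j/(j:ℝ)^2) * aco p j) * sin (j*x) =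
        ∫ s, ∑' j : ℕ, r^j * yy m μ j * sin (j*x) * (2 * sinc (j*s)) ∂p := by
      rw [← hI.tsum_eq]
      refine tsum_congr fun j => ?_
      rw [integral_const_mul]
      rcases Nat.eq_zero_or_pos j with rfl | hj
      · simp
      · have hj' : (0:ℝ) < j := by exact_mod_cast hj
        rw [aco]; field_simp
    have e2 : -(c * aco p 1) * sin x = ∫ s, -c * sin x * (2 * sinc ((1:ℕ)*s)) ∂p := by
      rw [integral_const_mul, aco]; ring
    rw [e1, e2]
    have hcont : Continuous fun s => ∑' j : ℕ, r^j * yy m μ j * sin (j*x) * (2 * sinc (j*s)) := by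
      refine continuous_tsum (fun j => continuous_const.mul (cont_sinc j))
        ((summable_geometric_of_lt_one h0 h1).mul_left (2*C)) (fun j s => ?_)
      rw [Real.norm_eq_abs, abs_mul, abs_mul, abs_mul, abs_of_nonneg (pow_nonneg h0 j)]
      have e1 := abs_sin_le_one (j*x)
      have e2 := two_sinc_le (j*s)
      calc r^j * |yy m μ j| * |sin (j*x)| * |2 * sinc (j*s)| ≤ r^j * C * 1 * 2 := by
            gcongr; exact hC j
        _ = _ := by ring
    have hIntg : ∀ f : ℝ → ℝ, Continuous f → Integrable f p := fun f hf => by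
      obtain ⟨B, hB⟩ := isCompact_Icc.exists_bound_of_continuousOn (s := Icc 0 π) hf.continuousOn
      refine Integrable.of_bound hf.aestronglyMeasurable B ?_
      filter_upwards [H.ae_mem] with s hs using hB s hs
    refine integral_mono_ae (hIntg _ (continuous_const.mul (cont_sinc 1))) (hIntg _ hcont) ?_
    filter_upwards [H.ae_pos] with s hs
    have hk := hc r h0 h1 x (Ioo_subset_Icc_self hx) s ⟨hs.1.le, hs.2⟩
    have hs0 := hs.1
    have e3 : ∑' j : ℕ, r^j * yy m μ j * sin (j*x) * (2 * sinc (j*s)) =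
        2*s⁻¹ * ∑' j : ℕ, r^j*(yy m μ j/j)*sin (j*s)*sin (j*x) := by
      rw [← tsum_mul_left]
      refine tsum_congr fun j => ?_
      rcases Nat.eq_zero_or_pos j with rfl | hj
      · simp
      · have hj' : (0:ℝ) < j := by exact_mod_cast hj
        rw [sinc_of_ne_zero (by positivity)]; field_simp
    rw [e3, Nat.cast_one, one_mul, sinc_of_ne_zero hs0.ne']
    calc -c * sin x * (2*(sin s/s)) = 2*s⁻¹*(-c*(sin x * sin s)) := by field_simp
      _ ≤ _ := by gcongr)
  have hlin : ConvexOn ℝ (Icc 0 π) (fun x => ell μ 0 * x) := by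
    refine ⟨convex_Icc _ _, fun x _ y _ a b _ _ _ => ?_⟩
    simp only [smul_eq_mul]
    exact le_of_eq (by ring)
  refine (hlin.add hconv).congr fun x _ => ?_
  simp only [Pi.add_apply, GG]; ring

end Ext
end TO

open Real Set Filter MeasureTheory

namespace TO

/-- The coincidence set on the circle. -/
def SS (m : ℕ) (μ : ℝ) (p : Measure ℝ) : Set ℝ :=
  {x | x ∈ Icc 0 π ∧ ∀ r : ℝ, 0 ≤ r → r < 1 → 2*m*TT p r x + GG m μ p 1 x ≤ 0}

namespace Ext
variable {m M : ℕ} {μ : ℝ} {p : Measure ℝ} (H : Ext m M μ p)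
include H

lemma cont_int {f : ℝ → ℝ} (hf : Continuous f) : Integrable f p := by
  have := H.prob
  obtain ⟨B, hB⟩ := isCompact_Icc.exists_bound_of_continuousOn (s := Icc 0 π) hf.continuousOn
  refine Integrable.of_bound hf.aestronglyMeasurable B ?_
  filter_upwards [H.ae_mem] with s hs using hB s hs

lemma mpos : (0:ℝ) < m := by
  have := H.par.m3
  exact_mod_cast (by omega : 0 < m)

lemma LQ_int {r : ℝ} (h0 : 0 ≤ r) (h1 : r < 1) (x : ℝ) : Integrable (fun s => s⁻¹ * LQ r x s) p := by
  have := H.prob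
  refine Integrable.of_bound (LQ_meas r x).aestronglyMeasurable (∑' j : ℕ, r^j) ?_
  filter_upwards [H.ae_pos] with s hs
  rw [← (hasSum_LQ h0 h1 x s).tsum_eq, ← tsum_mul_left]
  refine tsum_of_norm_bounded (summable_geometric_of_lt_one h0 h1).hasSum fun j => ?_
  rcases Nat.eq_zero_or_pos j with rfl | hj
  · simp
  · have hj' : (0:ℝ) < j := by exact_mod_cast hj
    have hs0 := hs.1
    have e : s⁻¹ * (r^j * (sin (j*x) * sin (j*s))/j) = r^j * sin (j*x) * sinc (j*s) := by
      rw [sinc_of_ne_zero (by positivity)]; field_simp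
    rw [e, norm_mul, norm_mul, norm_pow, Real.norm_eq_abs, Real.norm_eq_abs, Real.norm_eq_abs, abs_of_nonneg h0]
    have e1 := abs_sin_le_one (j*x)
    have e2 := abs_sinc_le_one (j*s)
    calc r^j * |sin (j*x)| * |sinc (j*s)| ≤ r^j * 1 * 1 := by gcongr
      _ = _ := by ring

lemma ae_ker {x : ℝ} (hx : x ∈ Icc 0 π) : ∀ᵐ s ∂p, 0 < s ∧ s ∈ Icc 0 π ∧ 0 ≤ sin x * sin s := by
  filter_upwards [H.ae_pos] with s hs
  exact ⟨hs.1, ⟨hs.1.le, hs.2⟩, mul_nonneg (sin_nonneg_of_mem_Icc hx) (sin_nonneg_of_mem_Icc ⟨hs.1.le, hs.2⟩)⟩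

lemma TT_nonneg {r : ℝ} (h0 : 0 ≤ r) {x : ℝ} (hx : x ∈ Icc 0 π) : 0 ≤ TT p r x := by
  refine integral_nonneg_of_ae ?_
  filter_upwards [H.ae_ker hx] with s hs
  exact mul_nonneg (inv_nonneg.2 hs.1.le) (LQ_nonneg h0 hs.2.2)

lemma TT_mono {r r' : ℝ} (h0 : 0 ≤ r) (h : r ≤ r') (h1 : r' < 1) {x : ℝ} (hx : x ∈ Icc 0 π) :
    TT p r x ≤ TT p r' x := by
  refine integral_mono_ae (H.LQ_int h0 (h.trans_lt h1) x) (H.LQ_int (h0.trans h) h1 x) ?_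
  filter_upwards [H.ae_ker hx] with s hs
  exact mul_le_mul_of_nonneg_left (LQ_mono h0 h h1.le hs.2.2 (Dn_pos h0 (h.trans_lt h1))
    (Dn_pos (h0.trans h) h1)) (inv_nonneg.2 hs.1.le)

lemma F_cont {r : ℝ} (h0 : 0 ≤ r) (h1 : r < 1) : Continuous fun x => 2*m*TT p r x + GG m μ p 1 x := by
  have : (fun x => 2*m*TT p r x + GG m μ p 1 x) = fun x => PS m μ p r x - GG m μ p r x + GG m μ p 1 x := by
    funext x; rw [PS]; ring
  rw [this]
  exact ((H.PS_cont h0 h1).sub (H.GG_cont h0 h1.le)).add (H.GG_cont zero_le_one le_rfl)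

lemma key_ae {r : ℝ} (h0 : 0 ≤ r) (h1 : r < 1) : ∀ᵐ x ∂p, 2*m*TT p r x + GG m μ p 1 x ≤ 0 := by
  have := H.prob
  obtain ⟨δ, d1, d2⟩ := H.GG_tendsto
  have hF := H.F_cont h0 h1
  have hi := H.cont_int (hF.max continuous_const : Continuous fun x => max (2*m*TT p r x + GG m μ p 1 x) 0)
  have hle : ∫ x, max (2*m*TT p r x + GG m μ p 1 x) 0 ∂p ≤ 0 := by
    have hl := H.int_PS_tendsto.add d1
    rw [add_zero] at hl
    refine ge_of_tendsto hl ?_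
    filter_upwards [Ioo_mem_nhdsLT h1] with r' hr'
    have h0' := h0.trans hr'.1.le
    have e : ∫ x, PS m μ p r' x ∂p + δ r' = ∫ x, (PS m μ p r' x + δ r') ∂p := by
      rw [integral_add (H.cont_int (H.PS_cont h0' hr'.2)) (integrable_const _)]; simp
    rw [e]
    refine integral_mono_ae hi ((H.cont_int (H.PS_cont h0' hr'.2)).add (integrable_const _)) ?_
    filter_upwards [H.ae_mem] with x hx
    have a := d2 r' h0' hr'.2.le x
    have b := H.TT_mono h0 hr'.1.le hr'.2 hx
    have c := H.PS_nonneg h0' hr'.2 hx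
    have mp := H.mpos
    have := abs_le.1 a
    refine max_le ?_ ?_
    · rw [PS]; nlinarith [mul_le_mul_of_nonneg_left b mp.le]
    · have : 0 ≤ δ r' := (abs_nonneg _).trans a
      linarith
  have h00 : ∫ x, max (2*m*TT p r x + GG m μ p 1 x) 0 ∂p = 0 :=
    le_antisymm hle (integral_nonneg fun x => le_max_right _ _)
  have h00' := (integral_eq_zero_iff_of_nonneg (f := fun x => max (2*m*TT p r x + GG m μ p 1 x) 0)
    (by intro x; exact le_max_right _ _) hi).1 h00
  filter_upwards [h00'] with x hx
  have := le_max_left (2*m*TT p r x + GG m μ p 1 x) 0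
  have e : max (2*m*TT p r x + GG m μ p 1 x) 0 = 0 := hx
  linarith

lemma SS_closed : IsClosed (SS m μ p) := by
  have : SS m μ p = Icc 0 π ∩ ⋂ r : ℝ, ⋂ (_ : 0 ≤ r), ⋂ (_ : r < 1), {x | 2*m*TT p r x + GG m μ p 1 x ≤ 0} := by
    ext x; simp [SS]
  rw [this]
  exact isClosed_Icc.inter (isClosed_iInter fun r => isClosed_iInter fun h0 => isClosed_iInter fun h1 =>
    isClosed_le (H.F_cont h0 h1) continuous_const)

lemma SS_ae : ∀ᵐ x ∂p, x ∈ SS m μ p := by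
  have h : ∀ᵐ x ∂p, ∀ n : ℕ, 2*m*TT p (1 - 1/((n:ℝ)+1)) x + GG m μ p 1 x ≤ 0 := by
    rw [ae_all_iff]
    intro n
    have : (0:ℝ) < (n:ℝ)+1 := by positivity
    refine H.key_ae ?_ ?_
    · rw [sub_nonneg, div_le_one this]; linarith [(n.cast_nonneg : (0:ℝ) ≤ n)]
    · have : 0 < 1/((n:ℝ)+1) := by positivity
      linarith
  filter_upwards [h, H.ae_mem] with x hx hx2
  refine ⟨hx2, fun r h0 h1 => ?_⟩
  obtain ⟨n, hn⟩ := exists_nat_one_div_lt (sub_pos.2 h1)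
  have hp : 0 < 1/((n:ℝ)+1) := by positivity
  have a := H.TT_mono h0 (by linarith : r ≤ 1 - 1/((n:ℝ)+1)) (by linarith) hx2
  have := hx n
  have mp := H.mpos
  nlinarith [mul_le_mul_of_nonneg_left a mp.le]

lemma zero_mem : (0:ℝ) ∈ SS m μ p := by
  refine ⟨⟨le_rfl, pi_pos.le⟩, fun r h0 h1 => ?_⟩
  simp [TT, GG, LQ]

lemma GG_pi : GG m μ p 1 π = ell μ 0 * π := by simp [GG, sin_nat_mul_pi]

lemma pi_notMem : π ∉ SS m μ p := by
  intro h
  have := h.2 0 le_rfl one_pos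
  rw [H.GG_pi] at this
  simp only [TT, LQ, sin_pi] at this
  simp at this
  nlinarith [mul_pos H.L0_pos pi_pos]

lemma atoms (x : ℝ) : p {x} = 0 := by
  have := H.prob
  by_contra hne
  have hxS : x ∈ SS m μ p := by
    by_contra hx
    exact hne (measure_mono_null (fun y hy => by rw [mem_singleton_iff.1 hy]; exact hx) (ae_iff.1 H.SS_ae))
  have hx0 : x ≠ 0 := fun h => hne (h ▸ H.atom_zero)
  have hx1 : x ≠ π := fun h => H.pi_notMem (h ▸ hxS)
  have hx : x ∈ Ioo 0 π := ⟨lt_of_le_of_ne hxS.1.1 hx0.symm, lt_of_le_of_ne hxS.1.2 hx1⟩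
  have hsx := sin_pos_of_mem_Ioo hx
  set w := p.real {x} with hw
  have hwp : 0 < w := by
    rw [hw, measureReal_def]; exact ENNReal.toReal_pos hne (measure_ne_top _ _)
  set K := -GG m μ p 1 x/(2*m) * x / w with hK
  have mp := H.mpos
  have hx0' := hx.1
  have hb : ∀ r : ℝ, 0 ≤ r → r < 1 → LQ r x x ≤ K := by
    intro r h0 h1
    have a : ∫ s in {x}, s⁻¹ * LQ r x s ∂p ≤ TT p r x := by
      refine setIntegral_le_integral (H.LQ_int h0 h1 x) ?_
      filter_upwards [H.ae_ker hxS.1] with s hs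
      exact mul_nonneg (inv_nonneg.2 hs.1.le) (LQ_nonneg h0 hs.2.2)
    rw [integral_singleton, smul_eq_mul, ← hw] at a
    have b := hxS.2 r h0 h1
    have c : TT p r x ≤ -GG m μ p 1 x/(2*m) := by
      rw [le_div_iff₀ (by positivity)]; linarith
    rw [hK, le_div_iff₀ hwp]
    have d := a.trans c
    have e : LQ r x x * w = w * (x⁻¹ * LQ r x x) * x := by field_simp
    rw [e]
    exact mul_le_mul_of_nonneg_right d hx0'.le
  have hb2 : ∀ r : ℝ, 0 ≤ r → r < 1 → 4 * sin x * sin x * r ≤ exp (4*K) * (1-r)^2 := by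
    intro r h0 h1
    have := hb r h0 h1
    unfold LQ at this
    have hD : Dn r (x-x) = (1-r)^2 := by rw [sub_self]; unfold Dn; rw [cos_zero]; ring
    rw [hD] at this
    have h1r : (1-r) ≠ 0 := (sub_pos.2 h1).ne'
    have h1' : 0 < (1-r)^2 := by positivity
    have hq : 0 ≤ 4 * sin x * sin x * (r/(1-r)^2) := by positivity
    have h2 : log (1 + 4 * sin x * sin x * (r/(1-r)^2)) ≤ 4*K := by linarith
    rw [Real.log_le_iff_le_exp (by linarith)] at h2
    have h3 : 4 * sin x * sin x * r = 4 * sin x * sin x * (r/(1-r)^2) * (1-r)^2 := by field_simp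
    rw [h3]
    refine mul_le_mul_of_nonneg_right ?_ h1'.le
    linarith
  have hl : Tendsto (fun r : ℝ => exp (4*K) * (1-r)^2 - 4 * sin x * sin x * r) (nhdsWithin 1 (Iio 1))
      (nhds (exp (4*K) * (1-1)^2 - 4 * sin x * sin x * 1)) :=
    ((by fun_prop : Continuous fun r : ℝ => exp (4*K) * (1-r)^2 - 4 * sin x * sin x * r).tendsto 1).mono_left
      nhdsWithin_le_nhds
  have := ge_of_tendsto hl (b := 0) (by
    filter_upwards [ev01] with r hr
    have := hb2 r hr.1 hr.2
    linarith)
  nlinarith [mul_pos hsx hsx]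

lemma ae_ne (x : ℝ) : ∀ᵐ s ∂p, s ≠ x := by rw [ae_iff]; simpa using H.atoms x

lemma T1_int {x : ℝ} (hx : x ∈ Icc 0 π) {K : ℝ} (hK : ∀ r : ℝ, 0 ≤ r → r < 1 → TT p r x ≤ K) :
    Integrable (fun s => s⁻¹ * LQ 1 x s) p := by
  set rn : ℕ → ℝ := fun n => 1 - 1/((n:ℝ)+1) with hrn
  have hr0 : ∀ n, 0 ≤ rn n := fun n => by
    have : (0:ℝ) < (n:ℝ)+1 := by positivity
    rw [hrn]; simp only
    rw [sub_nonneg, div_le_one this]; linarith [(n.cast_nonneg : (0:ℝ) ≤ n)]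
  have hr1 : ∀ n, rn n < 1 := fun n => by
    have : 0 < 1/((n:ℝ)+1) := by positivity
    rw [hrn]; simp only; linarith
  have hrl : Tendsto rn atTop (nhdsWithin 1 (Iio 1)) := by
    refine tendsto_nhdsWithin_iff.2 ⟨?_, Eventually.of_forall hr1⟩
    have := tendsto_one_div_add_atTop_nhds_zero_nat (𝕜 := ℝ).const_sub 1
    simpa [hrn] using this
  refine integrable_of_tendsto (G := fun n s => s⁻¹ * LQ (rn n) x s) ?_
    (fun n => (LQ_meas _ x).aestronglyMeasurable) ?_
  · filter_upwards [H.ae_ker hx, H.ae_ne x] with s hs hsx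
    exact ((LQ_tend hs.2.2 (one_sub_cos_pos hx hs.2.1 (Ne.symm hsx))).comp hrl).const_mul _
  · have hb : ∀ n, ∫⁻ s, ‖s⁻¹ * LQ (rn n) x s‖ₑ ∂p ≤ ENNReal.ofReal K := by
      intro n
      rw [← ofReal_integral_norm_eq_lintegral_enorm (H.LQ_int (hr0 n) (hr1 n) x)]
      refine ENNReal.ofReal_le_ofReal (le_trans (le_of_eq ?_) (hK _ (hr0 n) (hr1 n)))
      refine integral_congr_ae ?_
      filter_upwards [H.ae_ker hx] with s hs
      rw [Real.norm_eq_abs, abs_of_nonneg]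
      exact mul_nonneg (inv_nonneg.2 hs.1.le) (LQ_nonneg (hr0 n) hs.2.2)
    refine ne_top_of_le_ne_top ENNReal.ofReal_ne_top
      (liminf_le_of_le (by isBoundedDefault) fun b hb' => ?_) (b := ENNReal.ofReal K)
    obtain ⟨n, hn⟩ := hb'.exists
    exact hn.trans (hb n)

lemma T1_lim {x : ℝ} (hx : x ∈ Icc 0 π) (hi : Integrable (fun s => s⁻¹ * LQ 1 x s) p) :
    Tendsto (fun r => TT p r x) (nhdsWithin 1 (Iio 1)) (nhds (TT p 1 x)) := by
  refine tendsto_integral_filter_of_dominated_convergence _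
    (Eventually.of_forall fun r => (LQ_meas r x).aestronglyMeasurable) ?_ hi ?_
  · filter_upwards [ev01] with r hr
    filter_upwards [H.ae_ker hx, H.ae_ne x] with s hs hsx
    rw [Real.norm_eq_abs, abs_of_nonneg (mul_nonneg (inv_nonneg.2 hs.1.le) (LQ_nonneg hr.1 hs.2.2))]
    exact mul_le_mul_of_nonneg_left (LQ_le_one hr.1 hr.2.le hs.2.2
      (one_sub_cos_pos hx hs.2.1 (Ne.symm hsx))) (inv_nonneg.2 hs.1.le)
  · filter_upwards [H.ae_ker hx, H.ae_ne x] with s hs hsx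
    exact (LQ_tend hs.2.2 (one_sub_cos_pos hx hs.2.1 (Ne.symm hsx))).const_mul _

lemma PS_lim {x : ℝ} (hx : x ∈ Icc 0 π) (hi : Integrable (fun s => s⁻¹ * LQ 1 x s) p) :
    Tendsto (fun r => PS m μ p r x) (nhdsWithin 1 (Iio 1)) (nhds (PS m μ p 1 x)) :=
  ((H.T1_lim hx hi).const_mul _).add (H.GG_lim x)

lemma PS_one_nonneg {x : ℝ} (hx : x ∈ Icc 0 π) (hi : Integrable (fun s => s⁻¹ * LQ 1 x s) p) :
    0 ≤ PS m μ p 1 x := by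
  refine ge_of_tendsto (H.PS_lim hx hi) ?_
  filter_upwards [ev01] with r hr using H.PS_nonneg hr.1 hr.2 hx

lemma S_int {x : ℝ} (hx : x ∈ SS m μ p) : Integrable (fun s => s⁻¹ * LQ 1 x s) p := by
  refine H.T1_int hx.1 (K := -GG m μ p 1 x/(2*m)) fun r h0 h1 => ?_
  have mp := H.mpos
  rw [le_div_iff₀ (by positivity)]
  linarith [hx.2 r h0 h1]

lemma PS_S {x : ℝ} (hx : x ∈ SS m μ p) : PS m μ p 1 x = 0 := by
  refine le_antisymm ?_ (H.PS_one_nonneg hx.1 (H.S_int hx))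
  have := ((H.T1_lim hx.1 (H.S_int hx)).const_mul (2*(m:ℝ))).add_const (GG m μ p 1 x)
  refine le_of_tendsto this ?_
  filter_upwards [ev01] with r hr using hx.2 r hr.1 hr.2

/-- Strict convexity of the potential off the support. -/
lemma conv : ∃ d : ℝ, 0 < d ∧ ∀ α β : ℝ, 0 ≤ α → α ≤ β → β ≤ π → (∀ᵐ s ∂p, s ∉ Icc α β) →
    Integrable (fun s => s⁻¹ * LQ 1 α s) p → Integrable (fun s => s⁻¹ * LQ 1 β s) p →
    (∀ x ∈ Icc α β, Integrable (fun s => s⁻¹ * LQ 1 x s) p) ∧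
    ConvexOn ℝ (Icc α β) (fun x => PS m μ p 1 x + d * sin x) := by
  have := H.prob
  obtain ⟨d, d0, hd⟩ := H.GG_convex
  refine ⟨d, d0, fun α β hα hαβ hβ hae iα iβ => ?_⟩
  have hker : ∀ᵐ s ∂p, 0 < s ∧ s ∈ Icc 0 π ∧
      ConvexOn ℝ (Icc α β) (fun x => LQ 1 x s + 1/8 * (sin x * sin s)) := by
    filter_upwards [H.ae_pos, hae] with s hs hs2
    exact ⟨hs.1, ⟨hs.1.le, hs.2⟩, LQ_convex hα hβ ⟨hs.1.le, hs.2⟩ hs2⟩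
  have hsub : ∀ x ∈ Icc α β, x ∈ Icc 0 π := fun x hx => ⟨hα.trans hx.1, hx.2.trans hβ⟩
  have hsin : ∀ x : ℝ, Integrable (fun s => s⁻¹ * (1/8 * (sin x * sin s))) p := by
    intro x
    have := (H.cont_int (cont_sinc 1)).const_mul (1/16*sin x)
    refine this.congr ?_
    filter_upwards [H.ae_pos] with s hs
    have := hs.1
    simp only [Nat.cast_one, one_mul]
    rw [sinc_of_ne_zero hs.1.ne']; field_simp; ring
  have hIntg : ∀ x ∈ Icc α β, Integrable (fun s => s⁻¹ * LQ 1 x s) p := by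
    intro x hx
    obtain ⟨a, b, ha, hb, hab, rfl⟩ := (segment_eq_Icc hαβ ▸ hx : x ∈ segment ℝ α β)
    have hg := ((iα.add (hsin α)).const_mul a).add ((iβ.add (hsin β)).const_mul b)
    refine hg.mono' (LQ_meas 1 _).aestronglyMeasurable ?_
    filter_upwards [hker, H.ae_ker (hsub _ hx)] with s hs hs2
    have e := hs.2.2.2 (left_mem_Icc.2 hαβ) (right_mem_Icc.2 hαβ) ha hb hab
    rw [Real.norm_eq_abs, abs_of_nonneg (mul_nonneg (inv_nonneg.2 hs.1.le) (LQ_nonneg zero_le_one hs2.2.2))]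
    have e2 := mul_le_mul_of_nonneg_left e (inv_nonneg.2 hs.1.le)
    simp only [smul_eq_mul, Pi.add_apply] at e2 ⊢
    have e3 : 0 ≤ s⁻¹ * (1/8 * (sin (a*α+b*β) * sin s)) :=
      mul_nonneg (inv_nonneg.2 hs.1.le) (by have := hs2.2.2; simp only [smul_eq_mul] at this; linarith)
    nlinarith
  refine ⟨hIntg, ?_⟩
  have hTT : ConvexOn ℝ (Icc α β) (fun x => TT p 1 x + 1/16 * aco p 1 * sin x) := by
    have e : ∀ x ∈ Icc α β, ∫ s, (s⁻¹ * (LQ 1 x s + 1/8 * (sin x * sin s))) ∂p =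
        TT p 1 x + 1/16 * aco p 1 * sin x := by
      intro x hx
      simp_rw [mul_add]
      rw [integral_add (hIntg x hx) (hsin x), TT]
      congr 1
      rw [aco, mul_assoc, mul_comm _ (sin x), ← mul_assoc, ← integral_const_mul]
      refine integral_congr_ae ?_
      filter_upwards [H.ae_pos] with s hs
      have := hs.1
      simp only [Nat.cast_one, one_mul]
      rw [sinc_of_ne_zero hs.1.ne']; field_simp; ring
    have hc : ConvexOn ℝ (Icc α β) (fun x => ∫ s, (s⁻¹ * (LQ 1 x s + 1/8 * (sin x * sin s))) ∂p) := by
      have hi : ∀ x ∈ Icc α β, Integrable (fun s => s⁻¹ * (LQ 1 x s + 1/8 * (sin x * sin s))) p :=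
        fun x hx => by simp_rw [mul_add]; exact (hIntg x hx).add (hsin x)
      refine ⟨convex_Icc _ _, fun x hx y hy a b ha hb hab => ?_⟩
      simp only [smul_eq_mul]
      rw [← integral_const_mul, ← integral_const_mul, ← integral_add ((hi x hx).const_mul _) ((hi y hy).const_mul _)]
      refine integral_mono_ae (hi _ (convex_Icc _ _ hx hy ha hb hab)) (((hi x hx).const_mul _).add ((hi y hy).const_mul _)) ?_
      filter_upwards [hker] with s hs
      have e := hs.2.2.2 hx hy ha hb hab
      have e2 := mul_le_mul_of_nonneg_left e (inv_nonneg.2 hs.1.le)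
      simp only [smul_eq_mul] at e2 ⊢
      refine e2.trans (le_of_eq ?_)
      ring
    exact hc.congr e
  have mp := H.mpos
  have := (hTT.smul (by positivity : (0:ℝ) ≤ 2*m)).add (hd.subset hsub (convex_Icc _ _))
  refine this.congr fun x _ => ?_
  simp only [Pi.add_apply, smul_eq_mul, PS]; ring

end Ext
end TO

open Real Set Filter MeasureTheory
namespace TO
namespace Ext
section
variable {m M : ℕ} {μ : ℝ} {p : Measure ℝ} (H : Ext m M μ p)
include H

lemma hole {α β : ℝ} (h : α < β) (hα : α ∈ SS m μ p) (hβ : β ∈ SS m μ p)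
    (hae : ∀ᵐ s ∂p, s ∉ Icc α β) : False := by
  obtain ⟨d, d0, hd⟩ := H.conv
  obtain ⟨hi, hc⟩ := hd α β hα.1.1 h.le hβ.1.2 hae (H.S_int hα) (H.S_int hβ)
  have hmid : (α+β)/2 ∈ Icc α β := ⟨by linarith, by linarith⟩
  have h0 := H.PS_one_nonneg ⟨hα.1.1.trans hmid.1, hmid.2.trans hβ.1.2⟩ (hi _ hmid)
  have e := hc.2 (left_mem_Icc.2 h.le) (right_mem_Icc.2 h.le) (by norm_num : (0:ℝ) ≤ 1/2)
    (by norm_num : (0:ℝ) ≤ 1/2) (by norm_num)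
  have e2 := strictConcaveOn_sin_Icc.2 hα.1 hβ.1 h.ne (by norm_num : (0:ℝ) < 1/2)
    (by norm_num : (0:ℝ) < 1/2) (by norm_num)
  simp only [smul_eq_mul] at e e2
  have em : 1/2*α+1/2*β = (α+β)/2 := by ring
  rw [em] at e e2
  rw [H.PS_S hα, H.PS_S hβ] at e
  nlinarith

lemma exists_b : ∃ b, 0 < b ∧ b < π ∧ SS m μ p = Icc 0 b ∧
    ∀ x', 0 ≤ x' → x' < b → ¬ ∀ᵐ s ∂p, s ∉ Icc x' b := by
  have := H.prob
  have hsub : SS m μ p ⊆ Icc 0 π := fun x hx => hx.1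
  have hc : IsCompact (SS m μ p) := isCompact_Icc.of_isClosed_subset H.SS_closed hsub
  have hne : (SS m μ p).Nonempty := ⟨0, H.zero_mem⟩
  have hb := hc.sSup_mem hne
  set b := sSup (SS m μ p) with hbdef
  have hle : ∀ x ∈ SS m μ p, x ≤ b := fun x hx => le_csSup hc.bddAbove hx
  have hS : SS m μ p = Icc 0 b := by
    refine Subset.antisymm (fun x hx => ⟨hx.1.1, hle x hx⟩) fun x hx => ?_
    by_contra hxn
    have hcA : IsCompact (SS m μ p ∩ Iic x) := hc.inter_right isClosed_Iic
    have hcB : IsCompact (SS m μ p ∩ Ici x) := hc.inter_right isClosed_Ici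
    have hA := hcA.sSup_mem ⟨0, H.zero_mem, hx.1⟩
    have hB := hcB.sInf_mem ⟨b, hb, hx.2⟩
    set α := sSup (SS m μ p ∩ Iic x)
    set β := sInf (SS m μ p ∩ Ici x)
    have h1 : α < x := lt_of_le_of_ne hA.2 (fun e => hxn (e ▸ hA.1))
    have h2 : x < β := lt_of_le_of_ne hB.2 (fun e => hxn (e ▸ hB.1))
    refine H.hole (h1.trans h2) hA.1 hB.1 ?_
    filter_upwards [H.SS_ae, H.ae_ne α, H.ae_ne β] with s hs h3 h4 h5
    rcases le_total s x with h6 | h6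
    · exact h3 (le_antisymm (le_csSup hcA.bddAbove ⟨hs, h6⟩) h5.1)
    · exact h4 (le_antisymm h5.2 (csInf_le hcB.bddBelow ⟨hs, h6⟩))
  refine ⟨b, ?_, ?_, hS, ?_⟩
  · obtain ⟨s, hs, hs2⟩ := (H.SS_ae.and H.ae_pos).exists
    exact hs2.1.trans_le (hle s hs)
  · exact lt_of_le_of_ne hb.1.2 (fun e => H.pi_notMem (e ▸ hb))
  · intro x' h0 h1 hae
    exact H.hole h1 (by rw [hS]; exact ⟨h0, h1.le⟩) hb hae

lemma GG_lip : ∃ C : ℝ, 0 ≤ C ∧ ∀ x ∈ Icc 0 π, GG m μ p 1 π - GG m μ p 1 x ≤ C * (π - x) := by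
  obtain ⟨C, C0, hC⟩ := yy_bound H.par H.h1 H.h2
  have hs : Summable fun j : ℕ => C * (((j:ℝ)+1) * aco p j^2 + 1/(j:ℝ)^2) :=
    (H.en.add (Real.summable_one_div_nat_pow.2 (by norm_num))).mul_left _
  set K := ∑' j : ℕ, C * (((j:ℝ)+1) * aco p j^2 + 1/(j:ℝ)^2)
  have K0 : 0 ≤ K := tsum_nonneg fun j => by positivity
  refine ⟨ell μ 0 + K, by linarith [H.L0_pos], fun x hx => ?_⟩
  have e : GG m μ p 1 π - GG m μ p 1 x = ell μ 0 * (π - x) +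
      (∑' j : ℕ, 1^j * (yy m μ j/(j:ℝ)^2) * aco p j * sin (j*x)) := by
    rw [H.GG_pi, GG]; ring
  have hb : ∑' j : ℕ, 1^j * (yy m μ j/(j:ℝ)^2) * aco p j * sin (j*x) ≤
      ∑' j : ℕ, (C * (((j:ℝ)+1) * aco p j^2 + 1/(j:ℝ)^2)) * (π - x) := by
    refine (H.G_sum zero_le_one le_rfl x).tsum_le_tsum (fun j => ?_) (hs.mul_right _)
    refine (le_abs_self _).trans ?_
    rw [one_pow, one_mul, abs_mul, abs_mul, abs_div, abs_of_nonneg (by positivity : (0:ℝ) ≤ (j:ℝ)^2)]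
    have hpx : 0 ≤ π - x := sub_nonneg.2 hx.2
    have e1 : |sin (j*x)| ≤ j * (π - x) := by
      have : sin (j*x) = -(sin (j*(π - x)) * cos (j*π)) := by
        have : (j:ℝ)*x = j*π - j*(π-x) := by ring
        rw [this, sin_sub, sin_nat_mul_pi]; ring
      rw [this, abs_neg, abs_mul]
      have a := abs_sin_le_one (j*(π-x))
      have c : |sin (j*(π-x))| ≤ j*(π-x) := (abs_sin_le_abs (x := j*(π-x))).trans_eq (abs_of_nonneg (by positivity))
      calc _ ≤ |sin (j*(π-x))| * 1 := by gcongr; exact abs_cos_le_one _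
        _ ≤ _ := by linarith
    rcases Nat.eq_zero_or_pos j with rfl | hj
    · simp; positivity
    have hj' : (0:ℝ) < j := by exact_mod_cast hj
    have e2 : |aco p j| / j ≤ ((j:ℝ)+1) * aco p j^2 + 1/(j:ℝ)^2 := by
      have : 0 ≤ (|aco p j| - 1/j)^2 := sq_nonneg _
      have h4 : |aco p j| ^2 = aco p j^2 := sq_abs _
      have h3 : |aco p j| / j ≤ aco p j^2 + 1/(j:ℝ)^2 := by
        have : |aco p j| / j = |aco p j| * (1/j) := by ring
        have h5 : (1/(j:ℝ))^2 = 1/(j:ℝ)^2 := by rw [div_pow, one_pow]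
        nlinarith [sq_nonneg (|aco p j| ), sq_nonneg (1/(j:ℝ)), sq_nonneg (|aco p j| - 1/j)]
      nlinarith [sq_nonneg (aco p j)]
    calc |yy m μ j|/(j:ℝ)^2 * |aco p j| * |sin (j*x)| ≤ C/(j:ℝ)^2 * |aco p j| * (j*(π-x)) := by
          gcongr; exact hC j
      _ = C * (|aco p j|/j) * (π-x) := by field_simp
      _ ≤ _ := by gcongr
  rw [tsum_mul_right] at hb
  rw [e]; nlinarith

/-- the limiting potential: regularity package -/
lemma psi_pack : ∃ b C : ℝ, 0 < b ∧ b < π ∧ 0 ≤ C ∧ (∀ᵐ s ∂p, s ∈ Icc 0 b) ∧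
    (∀ x', 0 ≤ x' → x' < b → ¬ ∀ᵐ s ∂p, s ∉ Icc x' b) ∧
    (∀ x ∈ Icc 0 π, Integrable (fun s => s⁻¹ * LQ 1 x s) p) ∧
    (∀ x ∈ Icc 0 b, PS m μ p 1 x = 0) ∧ ConvexOn ℝ (Icc 0 π) (PS m μ p 1) ∧
    MonotoneOn (PS m μ p 1) (Icc 0 π) ∧ PS m μ p 1 π = ell μ 0 * π ∧
    (∀ x ∈ Icc 0 π, ∀ y ∈ Icc 0 π, x ≤ y → PS m μ p 1 y - PS m μ p 1 x ≤ C * (y - x)) := by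
  obtain ⟨b, b0, bpi, hS, hpos⟩ := H.exists_b
  obtain ⟨C, C0, hC⟩ := H.GG_lip
  obtain ⟨d, d0, hd⟩ := H.conv
  have hbS : b ∈ SS m μ p := by rw [hS]; exact right_mem_Icc.2 b0.le
  have hz : ∀ x ∈ Icc 0 b, PS m μ p 1 x = 0 := fun x hx => H.PS_S (by rw [hS]; exact hx)
  have hae : ∀ᵐ s ∂p, s ∈ Icc 0 b := by filter_upwards [H.SS_ae] with s hs; rwa [hS] at hs
  have hpiz : ∀ s, s⁻¹ * LQ 1 π s = 0 := by intro s; simp [LQ]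
  have hpi : Integrable (fun s => s⁻¹ * LQ 1 π s) p := by simp [hpiz]
  obtain ⟨hi, hc⟩ := hd b π b0.le bpi.le le_rfl (by
    filter_upwards [hae, H.ae_ne b] with s h1 h2 h3
    exact h2 (le_antisymm h1.2 h3.1)) (H.S_int hbS) hpi
  have hIntg : ∀ x ∈ Icc 0 π, Integrable (fun s => s⁻¹ * LQ 1 x s) p := by
    intro x hx
    rcases le_total x b with h | h
    · exact H.S_int (by rw [hS]; exact ⟨hx.1, h⟩)
    · exact hi x ⟨h, hx.2⟩
  have hPpi : PS m μ p 1 π = ell μ 0 * π := by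
    rw [PS, H.GG_pi, TT]; simp [hpiz]
  have hnn : ∀ x ∈ Icc 0 π, 0 ≤ PS m μ p 1 x := fun x hx => H.PS_one_nonneg hx (hIntg x hx)
  have hc1 : ConvexOn ℝ (Icc b π) (PS m μ p 1) := by
    have hsin : ConcaveOn ℝ (Icc b π) (fun x => d * sin x) :=
      (strictConcaveOn_sin_Icc.concaveOn.subset (Icc_subset_Icc_left b0.le) (convex_Icc _ _)).smul d0.le
    have := hc.add hsin.neg
    refine this.congr fun x _ => ?_
    simp
  have hm1 : ∀ x ∈ Icc b π, ∀ y ∈ Icc b π, x ≤ y → PS m μ p 1 x ≤ PS m μ p 1 y := by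
    intro x hx y hy hxy
    rcases hx.1.eq_or_lt with h | h
    · rw [← h, H.PS_S hbS]; exact hnn y ⟨b0.le.trans hy.1, hy.2⟩
    rcases hxy.eq_or_lt with h2 | h2
    · rw [h2]
    have := hc1.slope_mono_adjacent (left_mem_Icc.2 bpi.le) hy h h2
    have h3 : 0 ≤ (PS m μ p 1 x - PS m μ p 1 b)/(x - b) := by
      rw [H.PS_S hbS]; exact div_nonneg (by simpa using hnn x ⟨b0.le.trans hx.1, hx.2⟩) (by linarith)
    have h4 := h3.trans this
    rw [le_div_iff₀ (by linarith)] at h4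
    linarith
  have hmax : ∀ x ∈ Icc 0 π, max b x ∈ Icc b π := fun x hx => ⟨le_max_left _ _, max_le bpi.le hx.2⟩
  have hPm : ∀ x ∈ Icc 0 π, PS m μ p 1 x = PS m μ p 1 (max b x) := by
    intro x hx
    rcases le_total x b with h | h
    · rw [max_eq_left h, hz x ⟨hx.1, h⟩, H.PS_S hbS]
    · rw [max_eq_right h]
  have hc0 : ConvexOn ℝ (Icc 0 π) (PS m μ p 1) := by
    refine ⟨convex_Icc _ _, fun x hx y hy s t hs ht hst => ?_⟩
    have hxy := (convex_Icc 0 π) hx hy hs ht hst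
    rw [hPm _ hxy, hPm x hx, hPm y hy]
    refine le_trans (hm1 _ (hmax _ hxy) _ ((convex_Icc b π) (hmax x hx) (hmax y hy) hs ht hst) ?_)
      (hc1.2 (hmax x hx) (hmax y hy) hs ht hst)
    simp only [smul_eq_mul]
    have a1 := mul_le_mul_of_nonneg_left (le_max_left b x) hs
    have a2 := mul_le_mul_of_nonneg_left (le_max_left b y) ht
    have a3 := mul_le_mul_of_nonneg_left (le_max_right b x) hs
    have a4 := mul_le_mul_of_nonneg_left (le_max_right b y) ht
    refine max_le ?_ (by linarith)
    have : b = s*b+t*b := by rw [← add_mul, hst, one_mul]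
    linarith
  have hpipos := Real.pi_pos
  have hpimem : π ∈ Icc 0 π := ⟨hpipos.le, le_rfl⟩
  refine ⟨b, C, b0, bpi, C0, hae, hpos, hIntg, hz, hc0, ?_, hPpi, ?_⟩
  · intro x hx y hy hxy
    rw [hPm x hx, hPm y hy]
    exact hm1 _ (hmax x hx) _ (hmax y hy) (max_le_max le_rfl hxy)
  · intro x hx y hy hxy
    have key : ∀ z ∈ Icc 0 π, PS m μ p 1 π - PS m μ p 1 z ≤ C * (π - z) := by
      intro z hz
      refine le_trans ?_ (hC z hz)
      rw [hPpi, H.GG_pi, PS]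
      have := mul_nonneg (mul_nonneg (zero_le_two (α := ℝ)) H.mpos.le) (H.TT_nonneg zero_le_one hz)
      linarith
    rcases hy.2.eq_or_lt with h | h
    · rw [h]; exact key x hx
    rcases hxy.eq_or_lt with h2 | h2
    · rw [h2]; simp
    have := hc0.slope_mono_adjacent hx hpimem h2 h
    have h3 : (PS m μ p 1 π - PS m μ p 1 y)/(π - y) ≤ C := by
      rw [div_le_iff₀ (by linarith)]; exact key y hy
    have h4 := this.trans h3
    rwa [div_le_iff₀ (by linarith)] at h4

end
end Ext
end TO

open Real Set Filter MeasureTheory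
namespace TO

lemma exists_rd {F : ℝ → ℝ} {b C : ℝ} (b0 : 0 < b) (bpi : b < π) (C0 : 0 ≤ C)
    (hz : ∀ x ∈ Icc 0 b, F x = 0) (hc : ConvexOn ℝ (Icc 0 π) F) 
    (hC : ∀ x ∈ Icc 0 π, ∀ y ∈ Icc 0 π, x ≤ y → F y - F x ≤ C * (y - x)) :
    ∃ ψ : ℝ → ℝ, Monotone ψ ∧ (∀ x, 0 ≤ ψ x) ∧ (∀ x, ψ x ≤ C) ∧ (∀ x < b, ψ x = 0) ∧
      ∀ x ∈ Ioo 0 π, HasDerivWithinAt F (ψ x) (Ioi x) x := by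
  classical
  set D : ℝ → ℝ := fun x => derivWithin F (Ioi x) x with hD
  have hIntg : interior (Icc (0:ℝ) π) = Ioo 0 π := interior_Icc
  have hmem : ∀ x ∈ Ioo (0:ℝ) π, x ∈ interior (Icc (0:ℝ) π) := fun x hx => by rwa [hIntg]
  have hDm : ∀ x ∈ Ioo (0:ℝ) π, ∀ y ∈ Ioo (0:ℝ) π, x ≤ y → D x ≤ D y := fun x hx y hy hxy =>
    hc.monotoneOn_rightDeriv (hmem x hx) (hmem y hy) hxy
  have hDC : ∀ x ∈ Ioo (0:ℝ) π, D x ≤ C := by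
    intro x hx
    have hpi : π ∈ Icc (0:ℝ) π := right_mem_Icc.2 pi_pos.le
    refine (hc.rightDeriv_le_slope_of_mem_interior (hmem x hx) hpi hx.2).trans ?_
    rw [slope_def_field, div_le_iff₀ (sub_pos.2 hx.2)]
    exact hC x ⟨hx.1.le, hx.2.le⟩ π hpi hx.2.le
  have hDz : ∀ x ∈ Ioo (0:ℝ) b, D x = 0 := by
    intro x hx
    have h0 : HasDerivAt F 0 x := by
      refine (hasDerivAt_const x (0:ℝ)).congr_of_eventuallyEq ?_
      filter_upwards [Ioo_mem_nhds hx.1 hx.2] with y hy using hz y ⟨hy.1.le, hy.2.le⟩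
    exact (h0.hasDerivWithinAt (s := Ioi x)).derivWithin (uniqueDiffWithinAt_Ioi x)
  have hD0 : ∀ x ∈ Ioo (0:ℝ) π, 0 ≤ D x := by
    intro x hx
    have hm' : min x b / 2 ∈ Ioo (0:ℝ) b := by
      have h1 : 0 < min x b := lt_min hx.1 b0
      exact ⟨by linarith, by linarith [min_le_right x b]⟩
    rw [← hDz _ hm']
    refine hDm _ ⟨hm'.1, hm'.2.trans bpi⟩ x hx ?_
    linarith [min_le_left x b, hm'.1]
  refine ⟨fun x => if x ≤ 0 then 0 else if x < π then D x else C, ?_, ?_, ?_, ?_, ?_⟩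
  · intro x y hxy
    beta_reduce
    by_cases h1 : x ≤ 0
    · rw [if_pos h1]
      split_ifs with h2 h3
      · rfl
      · exact hD0 y ⟨not_le.1 h2, h3⟩
      · exact C0
    have h2 : ¬ y ≤ 0 := by linarith [not_le.1 h1]
    rw [if_neg h1, if_neg h2]
    split_ifs with h3 h4 h4
    · exact hDm x ⟨not_le.1 h1, h3⟩ y ⟨not_le.1 h2, h4⟩ hxy
    · exact hDC x ⟨not_le.1 h1, h3⟩
    · linarith
    · rfl
  · intro x; beta_reduce
    split_ifs with h2 h3
    · rfl
    · exact hD0 x ⟨not_le.1 h2, h3⟩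
    · exact C0
  · intro x; beta_reduce
    split_ifs with h2 h3
    · exact C0
    · exact hDC x ⟨not_le.1 h2, h3⟩
    · rfl
  · intro x hx; beta_reduce
    split_ifs with h2 h3
    · rfl
    · exact hDz x ⟨not_le.1 h2, hx⟩
    · linarith
  · intro x hx; beta_reduce
    rw [if_neg (not_le.2 hx.1), if_pos hx.2]
    exact hc.hasDerivWithinAt_rightDeriv_of_mem_interior (hmem x hx)

structure Dat (m M : ℕ) (μ b C : ℝ) (ψ : ℝ → ℝ) (a : ℕ → ℝ) : Prop where
  par : Par m M
  h1 : (M:ℝ) < μ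
  h2 : μ < M+1
  b0 : 0 < b
  bpi : b < π
  mono : Monotone ψ
  nn : ∀ x, 0 ≤ ψ x
  bd : ∀ x, ψ x ≤ C
  zero : ∀ x < b, ψ x = 0
  a0 : a 0 = 2
  suma : Summable fun j => |a j|
  int0 : ∫ x in (0:ℝ)..π, ψ x = π * ell μ 0
  intj : ∀ j : ℕ, j ≠ 0 → ∫ x in (0:ℝ)..π, ψ x * cos (j*x) = π/2 * (ell μ (m*j) * a j)
  f0 : ∀ x ∈ Icc b π, ∑' j : ℕ, a j * cos (j*x) = 1
  fpos : ∀ x ∈ Ico 0 b, 1 < ∑' j : ℕ, a j * cos (j*x)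

lemma bessel {ψ : ℝ → ℝ} (hm : Monotone ψ) {C : ℝ} (h0 : ∀ x, 0 ≤ ψ x) (hC : ∀ x, ψ x ≤ C)
    {c : ℕ → ℝ} (hc : ∀ j : ℕ, j ≠ 0 → ∫ x in (0:ℝ)..π, ψ x * cos (j*x) = π/2 * c j) :
    Summable fun j => c j^2 := by
  have C0 : 0 ≤ C := (h0 0).trans (hC 0)
  have hiψ : ∀ g : ℝ → ℝ, Continuous g → IntervalIntegrable (fun x => ψ x * g x) volume 0 π := fun g hg =>
    (hm.intervalIntegrable).mul_continuousOn hg.continuousOn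
  have hψ2 : IntervalIntegrable (fun x => ψ x * ψ x) volume 0 π := by
    have : Monotone fun x => ψ x * ψ x := fun x y h => mul_le_mul (hm h) (hm h) (h0 x) (h0 y)
    exact this.intervalIntegrable
  have key : ∀ N : ℕ, ∑ j ∈ Finset.range N, c (j+1)^2 ≤ 2*C^2 := by
    intro N
    set T : ℝ → ℝ := fun x => ∑ j ∈ Finset.range N, c (j+1) * cos (((j+1:ℕ):ℝ)*x) with hT
    have hTc : Continuous T := by rw [hT]; fun_prop
    have e1 : ∫ x in (0:ℝ)..π, ψ x * T x = π/2 * ∑ j ∈ Finset.range N, c (j+1)^2 := by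
      have : ∀ x, ψ x * T x = ∑ j ∈ Finset.range N, c (j+1) * (ψ x * cos (((j+1:ℕ):ℝ)*x)) := by
        intro x; rw [hT, Finset.mul_sum]; exact Finset.sum_congr rfl fun j _ => by ring
      simp_rw [this]
      rw [intervalIntegral.integral_finsetSum fun j _ => (hiψ _ (by fun_prop)).const_mul _, Finset.mul_sum]
      refine Finset.sum_congr rfl fun j _ => ?_
      rw [intervalIntegral.integral_const_mul, hc _ (by omega)]; ring
    have e2 : ∫ x in (0:ℝ)..π, T x * T x = π/2 * ∑ j ∈ Finset.range N, c (j+1)^2 := by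
      have : ∀ x, T x * T x = ∑ j ∈ Finset.range N, ∑ i ∈ Finset.range N,
          (c (j+1) * c (i+1)) * (cos (((j+1:ℕ):ℝ)*x) * cos (((i+1:ℕ):ℝ)*x)) := by
        intro x; rw [hT, Finset.sum_mul_sum]
        exact Finset.sum_congr rfl fun j _ => Finset.sum_congr rfl fun i _ => by ring
      simp_rw [this]
      rw [intervalIntegral.integral_finsetSum fun j _ => Continuous.intervalIntegrable (by fun_prop) _ _, Finset.mul_sum]
      refine Finset.sum_congr rfl fun j hj => ?_
      rw [intervalIntegral.integral_finsetSum fun j _ => Continuous.intervalIntegrable (by fun_prop) _ _]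
      rw [Finset.sum_eq_single_of_mem j hj]
      · rw [intervalIntegral.integral_const_mul, int_cos_cos (by omega), if_pos rfl]; ring
      · intro i _ hij
        rw [intervalIntegral.integral_const_mul, int_cos_cos (by omega), if_neg (by omega)]; ring
    have e3 : ∫ x in (0:ℝ)..π, ψ x * ψ x ≤ π * C^2 := by
      calc _ ≤ ∫ x in (0:ℝ)..π, C^2 := by
            refine intervalIntegral.integral_mono_on pi_pos.le hψ2 (by simp) fun x _ => ?_
            have := hC x; have := h0 x; nlinarith
        _ = _ := by simp
    have e4 : 0 ≤ ∫ x in (0:ℝ)..π, (ψ x - T x)^2 :=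
      intervalIntegral.integral_nonneg pi_pos.le fun x _ => sq_nonneg _
    have e5 : ∫ x in (0:ℝ)..π, (ψ x - T x)^2 = (∫ x in (0:ℝ)..π, ψ x * ψ x) - 2 * (∫ x in (0:ℝ)..π, ψ x * T x)
        + ∫ x in (0:ℝ)..π, T x * T x := by
      have : ∀ x, (ψ x - T x)^2 = ψ x * ψ x - 2 * (ψ x * T x) + T x * T x := fun x => by ring
      simp_rw [this]
      rw [intervalIntegral.integral_add (hψ2.sub ((hiψ _ hTc).const_mul 2)) (Continuous.intervalIntegrable (u := fun x => T x * T x) (by fun_prop) _ _),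
        intervalIntegral.integral_sub hψ2 ((hiψ _ hTc).const_mul 2), intervalIntegral.integral_const_mul]
    rw [e5, e1, e2] at e4
    have := pi_pos
    have h6 : π * (∑ j ∈ Finset.range N, c (j+1)^2) ≤ π * (2*C^2) := by nlinarith
    exact le_of_mul_le_mul_left h6 this
  rw [← summable_nat_add_iff 1]
  exact summable_of_sum_range_le (fun j => sq_nonneg _) key

namespace Ext
section
variable {m M : ℕ} {μ : ℝ} {p : Measure ℝ} (H : Ext m M μ p)
include H

lemma suma_of (hs : Summable fun j => (ell μ (m*j) * aco p j)^2) : Summable fun j => |aco p j| := by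
  have hm : 0 < m := by have := H.par.m3; omega
  have ht := (ell_div_tendsto H.par.oddM H.h1 H.h2).comp (tendsto_id.const_mul_atTop' hm : Tendsto (fun j : ℕ => m * j) atTop atTop)
  have hev : ∀ᶠ j : ℕ in atTop, 1/2 < ell μ (m*j) / ((m*j:ℕ):ℝ) := ht.eventually (lt_mem_nhds (by norm_num))
  have hb : Summable fun j : ℕ => (ell μ (m*j) * aco p j)^2 + 4 * (1/(j:ℝ)^2) :=
    hs.add ((Real.summable_one_div_nat_pow.2 (by norm_num)).mul_left 4)
  refine Summable.of_norm_bounded_eventually_nat hb ?_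
  filter_upwards [hev, eventually_gt_atTop 0] with j hj hj0
  have hj' : (0:ℝ) < j := by exact_mod_cast hj0
  have hm' : (1:ℝ) ≤ m := by exact_mod_cast hm
  rw [lt_div_iff₀ (by positivity)] at hj
  have hl : (j:ℝ)/2 ≤ ell μ (m*j) := by push_cast at hj; nlinarith
  have hl0 : 0 < ell μ (m*j) := by linarith [half_pos hj']
  simp only [Real.norm_eq_abs, abs_abs]
  have h1 : |aco p j| = (ell μ (m*j) * |aco p j|) * (1/ell μ (m*j)) := by field_simp
  have h2 : 1/ell μ (m*j) ≤ 2 * (1/j) := by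
    rw [← mul_div_assoc, mul_one, div_le_div_iff₀ hl0 hj']; linarith
  have h3 : (ell μ (m*j) * aco p j)^2 = (ell μ (m*j) * |aco p j|)^2 := by rw [mul_pow, mul_pow, sq_abs]
  have h4 : 4 * (1/(j:ℝ)^2) = (2*(1/j))^2 := by field_simp; ring
  rw [h3, h4, h1]
  have h6 : ell μ (m*j) * (ell μ (m*j) * |aco p j| * (1/ell μ (m*j))) = ell μ (m*j) * |aco p j| := by field_simp
  rw [h6]
  have h5 : 0 ≤ ell μ (m*j) * |aco p j| := by positivity
  have := mul_le_mul_of_nonneg_left h2 h5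
  nlinarith [sq_nonneg (ell μ (m*j) * |aco p j| - 2*(1/j)), sq_nonneg (ell μ (m*j) * |aco p j|), sq_nonneg (2*(1/(j:ℝ)))]

/-- Fourier coefficients of `Ψ_r`. -/
lemma int_PSr {r : ℝ} (h0 : 0 ≤ r) (h1 : r < 1) {j : ℕ} (hj : j ≠ 0) :
    ∫ x in (0:ℝ)..π, PS m μ p r x * sin (j*x) =
      ell μ 0 * (-π * cos (j*π) / j) + r^j * (π/2 * (ell μ (m*j) * aco p j / j)) := by
  obtain ⟨C, C0, hC⟩ := H.gr_bd
  have hS : ∀ x, HasSum (fun n : ℕ => r^n * ell μ (m*n) * aco p n * sin (n*x)/n * sin (j*x))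
      ((PS m μ p r x - ell μ 0 * x) * sin (j*x)) := fun x => (H.PS_series h0 h1 x).mul_right _
  obtain ⟨K, K0, hK⟩ := H.Lbd
  have hsum : HasSum (fun n : ℕ => ∫ x in (0:ℝ)..π, r^n * ell μ (m*n) * aco p n * sin (n*x)/n * sin (j*x))
      (∫ x in (0:ℝ)..π, (PS m μ p r x - ell μ 0 * x) * sin (j*x)) := by
    refine intervalIntegral.hasSum_integral_of_dominated_convergence
      (fun n _ => 2*K*(((n:ℝ)+1)*r^n)) (fun n => (Continuous.aestronglyMeasurable (by fun_prop))) ?_ ?_ ?_ ?_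
    · intro n
      refine Eventually.of_forall fun x _ => ?_
      rw [Real.norm_eq_abs, abs_mul, abs_div, abs_mul, abs_mul, abs_mul, abs_of_nonneg (pow_nonneg h0 n), Nat.abs_cast]
      have a1 := abs_sin_le_one (n*x)
      have a2 := abs_sin_le_one (j*x)
      have a3 := H.aco_abs n
      have a4 := hK n
      rcases Nat.eq_zero_or_pos n with rfl | hn
      · simp; positivity
      have hn' : (1:ℝ) ≤ n := by exact_mod_cast hn
      calc r^n * |ell μ (m*n)| * |aco p n| * |sin (n*x)| / n * |sin (j*x)| ≤
          r^n * (K*(n+1)) * 2 * 1 / 1 * 1 := by gcongr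
        _ = _ := by ring
    · exact Eventually.of_forall fun x _ => (summable_jgeo h0 h1).mul_left _
    · simp
    · exact Eventually.of_forall fun x _ => hS x
  have hterm : ∀ n : ℕ, ∫ x in (0:ℝ)..π, r^n * ell μ (m*n) * aco p n * sin (n*x)/n * sin (j*x) =
      if n = j then r^j * (π/2 * (ell μ (m*j) * aco p j / j)) else 0 := by
    intro n
    have : ∀ x, r^n * ell μ (m*n) * aco p n * sin (n*x)/n * sin (j*x) =
      r^n * ell μ (m*n) * aco p n / n * (sin (j*x) * sin (n*x)) := fun x => by ring
    simp_rw [this]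
    rw [intervalIntegral.integral_const_mul, int_sin_sin hj]
    split_ifs with h
    · subst h; ring
    · ring
  simp_rw [hterm] at hsum
  have h2 := hsum.unique (hasSum_ite_eq j _)
  have e : ∀ x, (PS m μ p r x - ell μ 0 * x) * sin (j*x) = PS m μ p r x * sin (j*x) - ell μ 0 * (x * sin (j*x)) :=
    fun x => by ring
  simp_rw [e] at h2
  rw [intervalIntegral.integral_sub (Continuous.intervalIntegrable (u := fun x => PS m μ p r x * sin (j*x)) (by have := H.PS_cont h0 h1; fun_prop) _ _)
    (Continuous.intervalIntegrable (by fun_prop) _ _), intervalIntegral.integral_const_mul, int_id_sin hj] at h2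
  linarith

end
end Ext
end TO

open Real Set Filter MeasureTheory
namespace TO

/-- `H_r` -/
noncomputable def HH (r x s : ℝ) : ℝ := s + AA r (s+x) + AA r (s-x)

lemma HH_zero (r x : ℝ) : HH r x 0 = 0 := by
  unfold HH AA
  rw [zero_add, zero_add, zero_sub, sin_neg, cos_neg, mul_neg, neg_div, arctan_neg]; ring

lemma HH_deriv {r : ℝ} (h0 : 0 ≤ r) (h1 : r < 1) (x s : ℝ) :
    HasDerivAt (HH r x) ((PP r (s+x) + PP r (s-x))/2) s := by
  have a := (AA_hasDerivAt h0 h1 (s+x)).comp_add_const s x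
  have b := (AA_hasDerivAt h0 h1 (s-x)).comp_sub_const s x
  have := ((hasDerivAt_id s).add a).add b
  refine (this.congr_deriv ?_)
  ring

lemma HH_mono {r : ℝ} (h0 : 0 ≤ r) (h1 : r < 1) (x : ℝ) : Monotone (HH r x) := by
  refine monotone_of_deriv_nonneg (fun s => (HH_deriv h0 h1 x s).differentiableAt) fun s => ?_
  rw [(HH_deriv h0 h1 x s).deriv]
  have := PP_pos h0 h1 (s+x)
  have := PP_pos h0 h1 (s-x)
  linarith

lemma HH_cont {r : ℝ} (h0 : 0 ≤ r) (h1 : r < 1) (x : ℝ) : Continuous (HH r x) :=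
  continuous_iff_continuousAt.2 fun s => (HH_deriv h0 h1 x s).continuousAt

lemma PP_le {r : ℝ} (h0 : 0 ≤ r) (h1 : r < 1) {t c : ℝ} (h : cos t ≤ cos c) : PP r t ≤ PP r c := by
  unfold PP
  have a := Dn_pos (t := c) h0 h1
  refine div_le_div_of_nonneg_left (by nlinarith) a ?_
  unfold Dn; nlinarith

lemma PP_tend {c : ℝ} (hc : cos c < 1) : Tendsto (fun r => PP r c) (nhdsWithin 1 (Iio 1)) (nhds 0) := by
  have : Tendsto (fun r => PP r c) (nhds 1) (nhds ((1-1^2)/Dn 1 c)) := by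
    have hne : Dn 1 c ≠ 0 := by unfold Dn; nlinarith
    refine ContinuousAt.div (by fun_prop) ?_ hne
    unfold Dn; fun_prop
  simpa using this.mono_left nhdsWithin_le_nhds

lemma HH_le {r : ℝ} (h0 : 0 ≤ r) (h1 : r < 1) {b x s : ℝ} (hs0 : 0 ≤ s) (hs : s ≤ b) (hb : b < x) (hx : x ≤ π) :
    HH r x s ≤ s * PP r (x-b) := by
  have hb0 : 0 ≤ b := hs0.trans hs
  have := (convex_Icc 0 s).image_sub_le_mul_sub_of_deriv_le (f := HH r x) (C := PP r (x-b))
    (HH_cont h0 h1 x).continuousOn (fun t _ => (HH_deriv h0 h1 x t).differentiableAt.differentiableWithinAt)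
    (fun t ht => by
      rw [interior_Icc] at ht
      rw [(HH_deriv h0 h1 x t).deriv]
      have e1 : cos (t - x) ≤ cos (x-b) := by
        rw [← cos_neg (t-x)]
        exact cos_le_cos_of_nonneg_of_le_pi (by linarith) (by linarith [ht.1]) (by linarith [ht.2])
      have e2 : cos (t+x) ≤ cos (t-x) := by
        rw [cos_add, cos_sub]
        have := sin_nonneg_of_mem_Icc (⟨ht.1.le, by linarith [ht.2]⟩ : t ∈ Icc 0 π)
        have := sin_nonneg_of_mem_Icc (⟨by linarith, hx⟩ : x ∈ Icc 0 π)
        nlinarith [mul_nonneg ‹0 ≤ sin t› this]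
      have := PP_le h0 h1 e1
      have := PP_le h0 h1 (e2.trans e1)
      linarith) 0 ⟨le_rfl, hs0⟩ s ⟨hs0, le_rfl⟩ hs0
  rw [HH_zero] at this
  linarith

lemma HH_tend {x s : ℝ} (h0 : 0 ≤ x) (h : x < s) (hs : s < π) :
    Tendsto (fun r => HH r x s) (nhdsWithin 1 (Iio 1)) (nhds π) := by
  have a := AA_tendsto (t := s+x) (by linarith) (by linarith)
  have b := AA_tendsto (t := s-x) (by linarith) (by linarith)
  have := ((tendsto_const_nhds (x := s)).add a).add b
  have e : s + (π - (s+x))/2 + (π - (s-x))/2 = π := by ring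
  rw [e] at this
  exact this

namespace Ext
section
variable {m M : ℕ} {μ : ℝ} {p : Measure ℝ} (H : Ext m M μ p)
include H

lemma HH_aux {r : ℝ} (h0 : 0 ≤ r) (h1 : r < 1) (x : ℝ) :
    (∀ᵐ s ∂p, ∑' j : ℕ, r^j * cos (j*x) * (2 * sinc (j*s)) = 1 + s⁻¹ * HH r x s) ∧
    Integrable (fun s => s⁻¹ * HH r x s) p := by
  have := H.prob
  have e2 : ∀ᵐ s ∂p, ∑' j : ℕ, r^j * cos (j*x) * (2 * sinc (j*s)) = 1 + s⁻¹ * HH r x s := by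
    filter_upwards [H.ae_pos] with s hs
    have s0 := hs.1
    have hsum := ((hasSum_sin_div h0 h1 (s+x)).add (hasSum_sin_div h0 h1 (s-x))).mul_left s⁻¹
    have h2 := hsum.add (hasSum_ite_eq 0 (2:ℝ))
    have : ∀ j : ℕ, r^j * cos (j*x) * (2 * sinc (j*s)) =
        s⁻¹ * (r^j * sin (j*(s+x))/j + r^j * sin (j*(s-x))/j) + if j = 0 then (2:ℝ) else 0 := by
      intro j
      rcases Nat.eq_zero_or_pos j with rfl | hj
      · simp
      have hj' : (0:ℝ) < j := by exact_mod_cast hj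
      rw [if_neg hj.ne', sinc_of_ne_zero (by positivity), mul_add (j:ℝ), mul_sub (j:ℝ), sin_add, sin_sub]
      field_simp; ring
    simp_rw [this]
    rw [h2.tsum_eq, HH]
    field_simp; ring
  refine ⟨e2, ?_⟩
  have h3 : Integrable (fun s => ∑' j : ℕ, r^j * cos (j*x) * (2 * sinc (j*s))) p := by
    refine H.cont_int ?_
    refine continuous_tsum (u := fun j => 2 * r^j) (fun j => continuous_const.mul (cont_sinc j))
      ((summable_geometric_of_lt_one h0 h1).mul_left 2) fun j s => ?_
    rw [Real.norm_eq_abs, abs_mul, abs_mul, abs_of_nonneg (pow_nonneg h0 j)]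
    have a := two_sinc_le (j*s)
    have b := abs_cos_le_one (j*x)
    calc _ ≤ r^j * 1 * 2 := by gcongr
      _ = _ := by ring
  refine ((h3.congr e2).sub (integrable_const 1)).congr (Eventually.of_forall fun s => ?_)
  simp

lemma HH_int {r : ℝ} (h0 : 0 ≤ r) (h1 : r < 1) (x : ℝ) : Integrable (fun s => s⁻¹ * HH r x s) p :=
  (H.HH_aux h0 h1 x).2

lemma fr_eq {r : ℝ} (h0 : 0 ≤ r) (h1 : r < 1) (x : ℝ) :
    ∑' j : ℕ, r^j * (aco p j * cos (j*x)) = 1 + ∫ s, s⁻¹ * HH r x s ∂p := by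
  have := H.prob
  have hs := int_tsum p (F := fun j s => r^j * cos (j*x) * (2 * sinc (j*s))) (B := fun j => 2 * r^j)
    (fun j => continuous_const.mul (cont_sinc j)) ((summable_geometric_of_lt_one h0 h1).mul_left 2)
    (fun j s => by
      rw [abs_mul, abs_mul, abs_of_nonneg (pow_nonneg h0 j)]
      have a := two_sinc_le (j*s)
      have b := abs_cos_le_one (j*x)
      calc _ ≤ r^j * 1 * 2 := by gcongr
        _ = _ := by ring)
  have e1 : ∀ j : ℕ, ∫ s, r^j * cos (j*x) * (2 * sinc (j*s)) ∂p = r^j * (aco p j * cos (j*x)) := by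
    intro j; rw [integral_const_mul, aco]; ring
  simp_rw [e1] at hs
  rw [hs.tsum_eq]
  have e2 := (H.HH_aux h0 h1 x).1
  rw [integral_congr_ae e2]
  have hi := (H.HH_aux h0 h1 x).2
  rw [integral_add (integrable_const 1) hi]; simp

lemma fr_lim (hs : Summable fun j => |aco p j|) (x : ℝ) :
    Tendsto (fun r : ℝ => ∫ s, s⁻¹ * HH r x s ∂p) (nhdsWithin 1 (Iio 1))
      (nhds ((∑' j : ℕ, aco p j * cos (j*x)) - 1)) := by
  have h : Summable fun j : ℕ => |aco p j * cos (j*x)| := by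
    refine hs.of_nonneg_of_le (fun j => abs_nonneg _) fun j => ?_
    rw [abs_mul]; exact mul_le_of_le_one_right (abs_nonneg _) (abs_cos_le_one _)
  refine ((abel_lim h).sub_const 1).congr' ?_
  filter_upwards [ev01] with r hr
  rw [H.fr_eq hr.1 hr.2]; ring

lemma f_zero (hs : Summable fun j => |aco p j|) {b : ℝ} (b0 : 0 < b) (hae : ∀ᵐ s ∂p, s ∈ Icc 0 b)
    {x : ℝ} (hx : b < x) (hx2 : x ≤ π) : ∑' j : ℕ, aco p j * cos (j*x) = 1 := by
  have := H.prob
  have hc : cos (x-b) < 1 := by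
    rw [← cos_zero]
    exact cos_lt_cos_of_nonneg_of_le_pi le_rfl (by linarith) (by linarith)
  have h2 : Tendsto (fun r : ℝ => ∫ s, s⁻¹ * HH r x s ∂p) (nhdsWithin 1 (Iio 1)) (nhds 0) := by
    refine squeeze_zero' ?_ ?_ (PP_tend hc)
    · filter_upwards [ev01] with r hr
      refine integral_nonneg_of_ae ?_
      filter_upwards [H.ae_pos] with s hs
      refine mul_nonneg (inv_nonneg.2 hs.1.le) ?_
      rw [← HH_zero r x]; exact HH_mono hr.1 hr.2 x hs.1.le
    · filter_upwards [ev01] with r hr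
      have : ∫ s, PP r (x-b) ∂p = PP r (x-b) := by simp
      rw [← this]
      refine integral_mono_of_nonneg ?_ (integrable_const _) ?_
      · filter_upwards [H.ae_pos] with s hs
        refine mul_nonneg (inv_nonneg.2 hs.1.le) ?_
        rw [← HH_zero r x]; exact HH_mono hr.1 hr.2 x hs.1.le
      · filter_upwards [H.ae_pos, hae] with s hs hs2
        have := HH_le hr.1 hr.2 hs.1.le hs2.2 hx hx2
        rw [inv_mul_le_iff₀ hs.1]; exact this
  have := tendsto_nhds_unique h2 (H.fr_lim hs x)
  linarith

lemma f_pos (hs : Summable fun j => |aco p j|) {b : ℝ} (bpi : b < π) (hae : ∀ᵐ s ∂p, s ∈ Icc 0 b)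
    (hpos : ∀ x', 0 ≤ x' → x' < b → ¬ ∀ᵐ s ∂p, s ∉ Icc x' b)
    {x : ℝ} (hx0 : 0 ≤ x) (hx : x < b) : 1 < ∑' j : ℕ, aco p j * cos (j*x) := by
  have := H.prob
  obtain ⟨x', hx', hx'b⟩ := exists_between hx
  have hp : 0 < p.real (Icc x' b) := by
    have := hpos x' (hx0.trans hx'.le) hx'b
    rw [ae_iff] at this
    simp only [not_not, ofPred_mem_eq] at this
    exact ENNReal.toReal_pos this (measure_ne_top _ _)
  have hlim := H.fr_lim hs x
  have hl2 := ((HH_tend hx0 hx' (hx'b.trans bpi)).div_const π).const_mul (p.real (Icc x' b))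
  have hle := le_of_tendsto_of_tendsto hl2 hlim (by
    filter_upwards [ev01] with r hr
    have e : ∫ s, (Icc x' b).indicator (fun _ => HH r x x' / π) s ∂p = p.real (Icc x' b) * (HH r x x' / π) := by
      rw [integral_indicator measurableSet_Icc]; simp
    rw [← e]
    have hx'0 : 0 ≤ HH r x x' := by
      rw [← HH_zero r x]; exact HH_mono hr.1 hr.2 x (hx0.trans hx'.le)
    · have hi := H.HH_int hr.1 hr.2 x
      refine integral_mono_of_nonneg (Eventually.of_forall fun s => indicator_nonneg (fun _ _ => by positivity) s) hi ?_
      filter_upwards [H.ae_pos] with s hs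
      have a : 0 ≤ HH r x s := by rw [← HH_zero r x]; exact HH_mono hr.1 hr.2 x hs.1.le
      by_cases hmem : s ∈ Icc x' b
      · rw [indicator_of_mem hmem, div_eq_inv_mul]
        refine mul_le_mul (inv_anti₀ hs.1 hs.2) (HH_mono hr.1 hr.2 x hmem.1) hx'0 (inv_nonneg.2 hs.1.le)
      · rw [indicator_of_notMem hmem]; exact mul_nonneg (inv_nonneg.2 hs.1.le) a
    )
  have : p.real (Icc x' b) * (π/π) = p.real (Icc x' b) := by rw [div_self pi_pos.ne', mul_one]
  linarith

lemma int_PS_one (hIntg : ∀ x ∈ Icc 0 π, Integrable (fun s => s⁻¹ * LQ 1 x s) p)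
    (hmono : MonotoneOn (PS m μ p 1) (Icc 0 π)) {j : ℕ} (hj : j ≠ 0) :
    ∫ x in (0:ℝ)..π, PS m μ p 1 x * sin (j*x) =
      ell μ 0 * (-π * cos (j*π) / j) + (π/2 * (ell μ (m*j) * aco p j / j)) := by
  obtain ⟨δ, d1, d2⟩ := H.GG_tendsto
  have hp : (0:ℝ) ≤ π := pi_pos.le
  have hδ : ∀ᶠ r in nhdsWithin (1:ℝ) (Iio 1), δ r < 1 := d1.eventually (gt_mem_nhds one_pos)
  have hlim : Tendsto (fun r => ∫ x in (0:ℝ)..π, PS m μ p r x * sin (j*x)) (nhdsWithin 1 (Iio 1))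
      (nhds (∫ x in (0:ℝ)..π, PS m μ p 1 x * sin (j*x))) := by
    refine intervalIntegral.tendsto_integral_filter_of_dominated_convergence (fun _ => PS m μ p 1 π + 1) ?_ ?_ (by simp) ?_
    · filter_upwards [ev01] with r hr
      have := H.PS_cont hr.1 hr.2
      exact Continuous.aestronglyMeasurable (by fun_prop)
    · filter_upwards [ev01, hδ] with r hr hd
      refine Eventually.of_forall fun x hx => ?_
      rw [uIoc_of_le hp] at hx
      have hxI : x ∈ Icc 0 π := ⟨hx.1.le, hx.2⟩
      rw [Real.norm_eq_abs, abs_mul, abs_of_nonneg (H.PS_nonneg hr.1 hr.2 hxI)]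
      have a := H.PS_nonneg hr.1 hr.2 hxI
      have b := abs_sin_le_one (j*x)
      have c := abs_le.1 (d2 r hr.1 hr.2.le x)
      have d : TT p r x ≤ TT p 1 x := by
        refine integral_mono_ae (H.LQ_int hr.1 hr.2 x) (hIntg x hxI) ?_
        filter_upwards [H.ae_ker hxI, H.ae_ne x] with s hs hsx
        exact mul_le_mul_of_nonneg_left (LQ_le_one hr.1 hr.2.le hs.2.2 (one_sub_cos_pos hxI hs.2.1 (Ne.symm hsx)))
          (inv_nonneg.2 hs.1.le)
      have e := hmono hxI ⟨hp, le_rfl⟩ hx.2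
      have f : PS m μ p r x ≤ PS m μ p 1 x + 1 := by
        rw [PS, PS]; nlinarith [mul_le_mul_of_nonneg_left d H.mpos.le]
      calc _ ≤ PS m μ p r x * 1 := by gcongr
        _ ≤ _ := by linarith
    · refine Eventually.of_forall fun x hx => ?_
      rw [uIoc_of_le hp] at hx
      exact (H.PS_lim ⟨hx.1.le, hx.2⟩ (hIntg x ⟨hx.1.le, hx.2⟩)).mul_const _
  have hl2 : Tendsto (fun r : ℝ => ell μ 0 * (-π * cos (j*π) / j) + r^j * (π/2 * (ell μ (m*j) * aco p j / j)))
      (nhdsWithin 1 (Iio 1)) (nhds (ell μ 0 * (-π * cos (j*π) / j) + 1^j * (π/2 * (ell μ (m*j) * aco p j / j)))) :=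
    ((by fun_prop : Continuous fun r : ℝ => ell μ 0 * (-π * cos (j*π) / j) +
      r^j * (π/2 * (ell μ (m*j) * aco p j / j))).tendsto 1).mono_left nhdsWithin_le_nhds
  rw [one_pow, one_mul] at hl2
  refine tendsto_nhds_unique hlim (hl2.congr' ?_)
  filter_upwards [ev01] with r hr using (H.int_PSr hr.1 hr.2 hj).symm

lemma exists_Dat : ∃ b C ψ, Dat m M μ b C ψ (aco p) := by
  obtain ⟨b, C, b0, bpi, C0, hae, hpos, hIntg, hz, hc, hm, hPpi, hC⟩ := H.psi_pack
  obtain ⟨ψ, ψm, ψ0, ψC, ψz, ψd⟩ := exists_rd b0 bpi C0 hz hc hC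
  have hp : (0:ℝ) ≤ π := pi_pos.le
  have hcont : ContinuousOn (PS m μ p 1) (Icc 0 π) := by
    have : LipschitzOnWith (Real.toNNReal C) (PS m μ p 1) (Icc 0 π) := by
      refine LipschitzOnWith.of_le_add_mul _ fun x hx y hy => ?_
      rw [Real.coe_toNNReal _ C0, Real.dist_eq]
      rcases le_total x y with h | h
      · have := hm hx hy h
        have := mul_nonneg C0 (abs_nonneg (x-y))
        linarith
      · have := hC y hy x hx h
        rw [abs_of_nonneg (by linarith)]; linarith
    exact this.continuousOn
  have hP0 : PS m μ p 1 0 = 0 := hz 0 ⟨le_rfl, b0.le⟩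
  have int0 : ∫ x in (0:ℝ)..π, ψ x = π * ell μ 0 := by
    rw [intervalIntegral.integral_eq_sub_of_hasDeriv_right_of_le hp hcont ψd ψm.intervalIntegrable, hPpi, hP0]
    ring
  have intj : ∀ j : ℕ, j ≠ 0 → ∫ x in (0:ℝ)..π, ψ x * cos (j*x) = π/2 * (ell μ (m*j) * aco p j) := by
    intro j hj
    have hj' : (j:ℝ) ≠ 0 := by exact_mod_cast hj
    have hi1 : IntervalIntegrable (fun x => ψ x * cos (j*x)) volume 0 π :=
      (ψm.intervalIntegrable).mul_continuousOn (Continuous.continuousOn (by fun_prop))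
    have hi2 : IntervalIntegrable (fun x => PS m μ p 1 x * sin (j*x)) volume 0 π := by
      refine ContinuousOn.intervalIntegrable ?_
      rw [uIcc_of_le hp]
      exact hcont.mul (Continuous.continuousOn (by fun_prop))
    have := intervalIntegral.integral_eq_sub_of_hasDeriv_right_of_le (f := fun x => PS m μ p 1 x * cos (j*x))
      (f' := fun x => ψ x * cos (j*x) - j * (PS m μ p 1 x * sin (j*x))) hp
      (hcont.mul (Continuous.continuousOn (by fun_prop))) (fun x hx => by
        have h1 : HasDerivAt (fun x : ℝ => cos (j*x)) (-sin (j*x) * (j*1)) x :=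
          (Real.hasDerivAt_cos (j*x)).comp x ((hasDerivAt_id x).const_mul (j:ℝ))
        refine ((ψd x hx).mul h1.hasDerivWithinAt).congr_deriv ?_
        ring) (hi1.sub (hi2.const_mul j))
    rw [intervalIntegral.integral_sub hi1 (hi2.const_mul j), intervalIntegral.integral_const_mul,
      H.int_PS_one hIntg hm hj, hPpi, hP0] at this
    field_simp at this ⊢
    linarith
  have hsum : Summable fun j => |aco p j| := H.suma_of (bessel ψm ψ0 ψC intj)
  refine ⟨b, C, ψ, H.par, H.h1, H.h2, b0, bpi, ψm, ψ0, ψC, ψz, H.aco_zero, hsum, int0, intj, ?_, ?_⟩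
  · have hcf : Continuous fun x : ℝ => ∑' j : ℕ, aco p j * cos (j*x) := by
      refine continuous_tsum (u := fun j => |aco p j|) (fun j => by fun_prop) hsum fun j x => ?_
      rw [Real.norm_eq_abs, abs_mul]; exact mul_le_of_le_one_right (abs_nonneg _) (abs_cos_le_one _)
    have hcl : IsClosed {x : ℝ | ∑' j : ℕ, aco p j * cos (j*x) = 1} := isClosed_eq hcf continuous_const
    have hsub : Ioc b π ⊆ {x : ℝ | ∑' j : ℕ, aco p j * cos (j*x) = 1} := fun x hx => H.f_zero hsum b0 hae hx.1 hx.2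
    have := hcl.closure_subset_iff.2 hsub
    rw [closure_Ioc bpi.ne] at this
    exact this
  · intro x hx
    exact H.f_pos hsum bpi hae hpos hx.1 hx.2

end
end Ext
end TO

open Real Set Filter

namespace TO

/-! ### Part D0 : power series -/

def PGrow (c : ℕ → ℝ) : Prop := ∃ (C : ℝ) (k : ℕ), 0 ≤ C ∧ ∀ n, |c n| ≤ C * ((n:ℝ)+1)^k
noncomputable def PW (c : ℕ → ℝ) (x : ℝ) : ℝ := ∑' n, c n * x^n
noncomputable def dc (c : ℕ → ℝ) (n : ℕ) : ℝ := ((n:ℝ)+1) * c (n+1)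

lemma PGrow.dc {c : ℕ → ℝ} (h : PGrow c) : PGrow (dc c) := by
  obtain ⟨C, k, hC, hb⟩ := h
  refine ⟨C * 2^k, k+1, by positivity, fun n => ?_⟩
  unfold TO.dc
  rw [abs_mul, abs_of_nonneg (by positivity : (0:ℝ) ≤ (n:ℝ)+1)]
  calc ((n:ℝ)+1) * |c (n+1)| ≤ ((n:ℝ)+1) * (C * (((n+1:ℕ):ℝ)+1)^k) := by gcongr; exact hb _
    _ ≤ ((n:ℝ)+1) * (C * (2*((n:ℝ)+1))^k) := by gcongr; push_cast; linarith [Nat.cast_nonneg (α := ℝ) n]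
    _ = _ := by rw [mul_pow, pow_succ]; ring

lemma PGrow.summable_abs {c : ℕ → ℝ} (h : PGrow c) {r : ℝ} (h0 : 0 ≤ r) (h1 : r < 1) :
    Summable (fun n => |c n| * r^n) := by
  obtain ⟨C, k, hC, hb⟩ := h
  have hs : Summable fun n : ℕ => C * ((n:ℝ)+1)^k * r^n := by
    rcases eq_or_lt_of_le h0 with h | hr
    · subst h
      apply summable_of_ne_finset_zero (s := {0})
      intro n hn; simp at hn; simp [hn]
    · have := (summable_nat_add_iff 1).2 (summable_pow_geo h0 h1 C k)
      refine (this.mul_right r⁻¹).congr fun n => ?_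
      push_cast; rw [pow_succ]; field_simp
  refine Summable.of_nonneg_of_le (fun n => by positivity) (fun n => ?_) hs
  gcongr; exact hb n

lemma PGrow.summable {c : ℕ → ℝ} (h : PGrow c) {x : ℝ} (hx : |x| < 1) :
    Summable (fun n => c n * x^n) := by
  refine Summable.of_norm ((h.summable_abs (abs_nonneg x) hx).congr fun n => ?_)
  rw [Real.norm_eq_abs, abs_mul, abs_pow]

lemma PGrow.hasDerivAt {c : ℕ → ℝ} (h : PGrow c) {x : ℝ} (hx : |x| < 1) :
    HasDerivAt (PW c) (PW (TO.dc c) x) x := by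
  obtain ⟨r, hr1, hr2⟩ := exists_between hx
  have hr0 : 0 ≤ r := (abs_nonneg x).trans hr1.le
  have hsum : Summable fun n : ℕ => |c n| * (n * r^(n-1)) := by
    rw [← summable_nat_add_iff 1]
    refine (h.dc.summable_abs hr0 hr2).congr fun n => ?_
    unfold TO.dc
    rw [abs_mul, abs_of_nonneg (by positivity : (0:ℝ) ≤ (n:ℝ)+1)]; push_cast; ring
  have key := hasDerivAt_tsum_of_isPreconnected (g := fun n y => c n * y^n)
    (g' := fun n y => c n * (n * y^(n-1))) hsum (Metric.isOpen_ball (x := (0:ℝ)) (ε := r))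
    (convex_ball (0:ℝ) r).isPreconnected (fun n y _ => (hasDerivAt_pow n y).const_mul (c n))
    (fun n y hy => by
      rw [Real.norm_eq_abs, abs_mul, abs_mul, abs_pow, Nat.abs_cast]
      have : |y| ≤ r := by simpa using (mem_ball_zero_iff.1 hy).le
      gcongr) (y₀ := x) (by simpa using hr1) (h.summable hx) (y := x) (by simpa using hr1)
  refine (key : HasDerivAt (PW c) _ x).congr_deriv ?_
  have hs2 : Summable fun n : ℕ => c n * (n * x^(n-1)) := by
    refine Summable.of_norm_bounded hsum fun n => ?_
    rw [Real.norm_eq_abs, abs_mul, abs_mul, abs_pow, Nat.abs_cast]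
    gcongr
  rw [hs2.tsum_eq_zero_add]
  simp only [PW, TO.dc]; simp
  refine tsum_congr fun n => ?_
  ring

lemma PGrow.contOn {c : ℕ → ℝ} (h : PGrow c) {x : ℝ} (hx : |x| < 1) : ContinuousAt (PW c) x :=
  (h.hasDerivAt hx).continuousAt

lemma cc_grow {M : ℕ} {μ : ℝ} (h1 : (M:ℝ) ≤ μ) (h2 : μ ≤ M+1) : PGrow (cc μ) := by
  obtain ⟨C, hC, hb⟩ := cc_bound M
  refine ⟨C, 0, hC.le, fun n => (hb μ h1 h2 n).trans ?_⟩
  rw [pow_zero, mul_one]; exact div_le_self hC.le (by linarith [Nat.cast_nonneg (α := ℝ) n])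

/-- shift identities -/
lemma PW_mul_x {c : ℕ → ℝ} (h : PGrow c) {x : ℝ} (hx : |x| < 1) :
    x * PW (dc c) x = ∑' n, (n * c n) * x^n := by
  have hs : Summable fun n : ℕ => (n * c n) * x^n := by
    rw [← summable_nat_add_iff 1]
    refine ((h.dc.summable hx).mul_left x).congr fun n => ?_
    unfold dc; push_cast; ring
  rw [hs.tsum_eq_zero_add, PW, ← tsum_mul_left]; simp
  refine tsum_congr fun n => ?_
  unfold dc; ring

lemma PGrow.natmul {c : ℕ → ℝ} (h : PGrow c) : PGrow (fun n => (n:ℝ) * c n) := by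
  obtain ⟨C, k, hC, hb⟩ := h
  refine ⟨C, k+1, hC, fun n => ?_⟩
  rw [abs_mul, Nat.abs_cast, pow_succ]
  calc (n:ℝ) * |c n| ≤ ((n:ℝ)+1) * (C * ((n:ℝ)+1)^k) := by gcongr; linarith; exact hb n
    _ = _ := by ring

/-- ODE -/
lemma K_ode {M : ℕ} {μ : ℝ} (h1 : (M:ℝ) ≤ μ) (h2 : μ ≤ M+1) {x : ℝ} (hx : |x| < 1) :
    x*(1-x)*PW (dc (dc (cc μ))) x + (1-2*x) * PW (dc (cc μ)) x + μ*(μ+1) * PW (cc μ) x = 0 := by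
  have g := cc_grow h1 h2
  have e1 : x * PW (dc (dc (cc μ))) x = ∑' n, (n * dc (cc μ) n) * x^n := PW_mul_x g.dc hx
  have e2 : x * PW (dc (cc μ)) x = ∑' n, (n * cc μ n) * x^n := PW_mul_x g hx
  -- x² K'' = Σ n(n-1)c x^n
  have e3 : x * (x * PW (dc (dc (cc μ))) x) = ∑' n, (n * (n-1) * cc μ n) * x^n := by
    rw [e1, ← tsum_mul_left]
    have hs : Summable fun n : ℕ => (n * (n-1) * cc μ n) * x^n := by
      refine ((g.natmul.natmul.summable hx).sub (g.natmul.summable hx)).congr fun n => ?_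
      ring
    rw [hs.tsum_eq_zero_add]; simp
    refine tsum_congr fun n => ?_
    unfold dc; ring
  have s1 := g.dc.natmul.summable hx
  have s2 := g.natmul.summable hx
  have s0 := g.summable hx
  have s3 := g.dc.summable hx
  have s4 : Summable fun n : ℕ => (n * (n-1) * cc μ n) * x^n := by
    refine ((g.natmul.natmul.summable hx).sub (g.natmul.summable hx)).congr fun n => ?_
    ring
  have : x*(1-x)*PW (dc (dc (cc μ))) x + (1-2*x) * PW (dc (cc μ)) x + μ*(μ+1) * PW (cc μ) x
    = (x * PW (dc (dc (cc μ))) x) - x * (x * PW (dc (dc (cc μ))) x) + PW (dc (cc μ)) x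
      - 2 * (x * PW (dc (cc μ)) x) + μ*(μ+1) * PW (cc μ) x := by ring
  rw [this, e3, e1, e2, PW, PW, ← tsum_mul_left, ← tsum_mul_left, ← s1.tsum_sub s4,
    ← (s1.sub s4).tsum_add s3, ← ((s1.sub s4).add s3).tsum_sub (s2.mul_left 2),
    ← (((s1.sub s4).add s3).sub (s2.mul_left 2)).tsum_add (s0.mul_left _)]
  rw [← tsum_zero (α := ℝ) (β := ℕ)]
  refine tsum_congr fun n => ?_
  have := cc_rec μ n
  unfold dc
  linear_combination x^n * this

/-- the boundary function -/
noncomputable def dj (μ : ℝ) (n : ℕ) : ℝ := - (μ*(μ+1)) * cc μ n / (n+1)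

lemma dj_eq (μ : ℝ) (n : ℕ) : dj μ n = ((n+1:ℕ):ℝ) * cc μ (n+1) - n * cc μ n := by
  have := cc_rec μ n
  unfold dj
  have h : (n:ℝ) + 1 ≠ 0 := by positivity
  field_simp
  push_cast
  linear_combination -this

lemma dj_summable {M : ℕ} {μ : ℝ} (h1 : (M:ℝ) ≤ μ) (h2 : μ ≤ M+1) : Summable fun n => |dj μ n| := by
  obtain ⟨C, hC, hb⟩ := cc_bound M
  have : Summable fun n : ℕ => |μ*(μ+1)| * C * (1/ ((n+1:ℕ):ℝ)^2) :=
    (((summable_nat_add_iff 1).2 (Real.summable_one_div_nat_pow.2 one_lt_two))).mul_left _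
  refine Summable.of_nonneg_of_le (fun n => abs_nonneg _) (fun n => ?_) this
  unfold dj
  rw [abs_div, abs_mul, abs_neg, abs_of_nonneg (by positivity : (0:ℝ) ≤ (n:ℝ)+1)]
  calc _ ≤ |μ*(μ+1)| * (C/((n:ℝ)+1)) / ((n:ℝ)+1) := by gcongr; exact hb μ h1 h2 n
    _ = _ := by push_cast; field_simp

lemma dj_cont {M : ℕ} {μ : ℝ} (h1 : (M:ℝ) ≤ μ) (h2 : μ ≤ M+1) : ContinuousOn (PW (dj μ)) (Icc (-1) 1) := by
  refine continuousOn_tsum (fun n => by fun_prop) (dj_summable h1 h2) fun n x hx => ?_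
  rw [Real.norm_eq_abs, abs_mul, abs_pow]
  exact mul_le_of_le_one_right (abs_nonneg _) (pow_le_one₀ (abs_nonneg _) (abs_le.2 hx))

lemma dj_one {M : ℕ} (hM : Odd M) {μ : ℝ} (h1 : (M:ℝ) < μ) (h2 : μ < M+1) : 0 ≤ PW (dj μ) 1 := by
  have hs : Summable fun n => dj μ n * 1^n := by simpa using (dj_summable h1.le h2.le).of_abs
  refine ge_of_tendsto hs.hasSum.tendsto_sum_nat ?_
  filter_upwards [eventually_ge_atTop (M+1)] with n hn
  have : ∑ i ∈ Finset.range n, dj μ i * 1^i = n * cc μ n := by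
    simp only [one_pow, mul_one, dj_eq]
    rw [Finset.sum_range_sub (fun n : ℕ => (n:ℝ) * cc μ n)]; simp
  rw [this]
  have := cc_sign hM h1 h2 n hn
  positivity

lemma dj_PS {M : ℕ} {μ : ℝ} (h1 : (M:ℝ) ≤ μ) (h2 : μ ≤ M+1) {x : ℝ} (hx : |x| < 1) :
    (1-x) * PW (dc (cc μ)) x = PW (dj μ) x := by
  have g := cc_grow h1 h2
  have e2 : x * PW (dc (cc μ)) x = ∑' n, (n * cc μ n) * x^n := PW_mul_x g hx
  rw [sub_mul, one_mul, e2, PW, ← (g.dc.summable hx).tsum_sub (g.natmul.summable hx), PW]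
  refine tsum_congr fun n => ?_
  rw [dj_eq, dc]; push_cast; ring

end TO

open Real Set Filter MeasureTheory

namespace TO

/-! ### Part D1 : parametric integrals -/

/-- partial derivative (copy of the statement's notion) -/
noncomputable def pq (i : Fin 3) (f : (Fin 3 → ℝ) → ℝ) (x : Fin 3 → ℝ) : ℝ :=
  fderiv ℝ f x (Pi.single i 1)

noncomputable def lin (c : Fin 3 → ℝ) : (Fin 3 → ℝ) →L[ℝ] ℝ := ∑ i, c i • ContinuousLinearMap.proj i

lemma lin_apply (c v : Fin 3 → ℝ) : lin c v = c 0 * v 0 + c 1 * v 1 + c 2 * v 2 := by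
  simp [lin, Fin.sum_univ_three]

lemma lin_single (c : Fin 3 → ℝ) (i : Fin 3) : lin c (Pi.single i 1) = c i := by
  rw [lin_apply]; fin_cases i <;> simp

lemma lin_of (l : (Fin 3 → ℝ) →L[ℝ] ℝ) : l = lin (fun i => l (Pi.single i 1)) := by
  ext v
  rw [lin_apply]
  conv_lhs => rw [show v = v 0 • Pi.single 0 1 + v 1 • Pi.single 1 1 + v 2 • (Pi.single 2 1 : Fin 3 → ℝ) by
    ext i; fin_cases i <;> simp]
  rw [map_add, map_add, map_smul, map_smul, map_smul]; simp [mul_comm]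

lemma contDiffOn_of_pq {V : Set (Fin 3 → ℝ)} (hV : IsOpen V) {f : (Fin 3 → ℝ) → ℝ} {n : ℕ}
    (hd : ∀ x ∈ V, DifferentiableAt ℝ f x) (h : ∀ i, ContDiffOn ℝ n (pq i f) V) :
    ContDiffOn ℝ ((n:ℕ) + 1) f V := by
  rw [contDiffOn_succ_iff_fderiv_of_isOpen hV]
  refine ⟨fun x hx => (hd x hx).differentiableWithinAt, by simp, ?_⟩
  have : fderiv ℝ f = fun x => ∑ i, pq i f x • (ContinuousLinearMap.proj i : (Fin 3 → ℝ) →L[ℝ] ℝ) := by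
    ext1 x; exact lin_of _
  rw [this]
  exact ContDiffOn.sum fun i _ => (h i).smul contDiffOn_const

noncomputable def dq (i : Fin 3) (Φ : (Fin 3 → ℝ) × ℝ → ℝ) (p : (Fin 3 → ℝ) × ℝ) : ℝ :=
  fderiv ℝ Φ p (Pi.single i 1, 0)

noncomputable def JJ (K : Set ℝ) (w : ℝ → ℝ) (Φ : (Fin 3 → ℝ) × ℝ → ℝ) (x : Fin 3 → ℝ) : ℝ :=
  ∫ θ in K, w θ * Φ (x, θ)

section par
variable {K : Set ℝ} (hK : IsCompact K) {w : ℝ → ℝ} (hw : Measurable w) {C : ℝ}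
  (hC : ∀ θ, |w θ| ≤ C) {V : Set (Fin 3 → ℝ)} (hV : IsOpen V) {W : Set ((Fin 3 → ℝ) × ℝ)} (hW : IsOpen W)
  (hVW : V ×ˢ K ⊆ W)

include hC hV hVW hK in
lemma unif_bound {Φ : (Fin 3 → ℝ) × ℝ → ℝ} (hΦ : ContinuousOn Φ W) {x : Fin 3 → ℝ} (hx : x ∈ V) :
    ∃ ε > 0, Metric.ball x ε ⊆ V ∧ ∃ B, ∀ y ∈ Metric.ball x ε, ∀ θ ∈ K, |Φ (y,θ)| ≤ B ∧ |w θ * Φ (y,θ)| ≤ C * B := by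
  obtain ⟨ε, he, hb⟩ := Metric.nhds_basis_closedBall.mem_iff.1 (hV.mem_nhds hx)
  obtain ⟨B, hB⟩ := ((isCompact_closedBall x ε).prod hK).exists_bound_of_continuousOn
    (hΦ.mono ((prod_mono hb (le_refl K)).trans hVW))
  refine ⟨ε, he, Metric.ball_subset_closedBall.trans hb, B, fun y hy θ hθ => ?_⟩
  have h1 := hB (y,θ) ⟨Metric.ball_subset_closedBall hy, hθ⟩
  rw [Real.norm_eq_abs] at h1
  refine ⟨h1, ?_⟩
  rw [abs_mul]
  exact mul_le_mul (hC θ) h1 (abs_nonneg _) ((abs_nonneg _).trans (hC θ))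

include hw hVW hK in
lemma meas_slice {Φ : (Fin 3 → ℝ) × ℝ → ℝ} (hΦ : ContinuousOn Φ W) {x : Fin 3 → ℝ} (hx : x ∈ V) :
    AEStronglyMeasurable (fun θ => w θ * Φ (x,θ)) (volume.restrict K) := by
  refine hw.aestronglyMeasurable.mul (ContinuousOn.aestronglyMeasurable ?_ hK.measurableSet)
  exact hΦ.comp (by fun_prop) fun θ hθ => hVW ⟨hx, hθ⟩

include hw hC hV hVW hK in
lemma JJ_cont {Φ : (Fin 3 → ℝ) × ℝ → ℝ} (hW : IsOpen W) (hΦ : ContinuousOn Φ W) : ContinuousOn (JJ K w Φ) V := by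
  intro x hx
  refine ContinuousAt.continuousWithinAt ?_
  obtain ⟨ε, he, hb, B, hB⟩ := unif_bound hK hC hV hVW hΦ hx
  have : IsFiniteMeasure (volume.restrict K) := ⟨by simpa using hK.measure_lt_top⟩
  refine continuousAt_of_dominated (bound := fun _ => C * B) ?_ ?_ (integrable_const _) ?_
  · filter_upwards [hV.mem_nhds hx] with y hy using meas_slice hK hw hVW hΦ hy
  · filter_upwards [Metric.ball_mem_nhds x he] with y hy
    rw [ae_restrict_iff' hK.measurableSet]
    exact Eventually.of_forall fun θ hθ => (hB y hy θ hθ).2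
  · rw [ae_restrict_iff' hK.measurableSet]
    refine Eventually.of_forall fun θ hθ => ?_
    have : ContinuousAt Φ (x,θ) := hΦ.continuousAt (hW.mem_nhds (hVW (⟨hx, hθ⟩ : (x,θ) ∈ V ×ˢ K)))
    exact continuousAt_const.mul (ContinuousAt.comp (f := fun y => (y,θ)) this (by fun_prop))

include hw hC hV hVW hK in
lemma JJ_deriv {Φ : (Fin 3 → ℝ) × ℝ → ℝ} (hW : IsOpen W) (hΦ : ContDiffOn ℝ 1 Φ W) {x : Fin 3 → ℝ} (hx : x ∈ V) :
    HasFDerivAt (JJ K w Φ) (lin (fun i => JJ K w (dq i Φ) x)) x := by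
  have : IsFiniteMeasure (volume.restrict K) := ⟨by simpa using hK.measure_lt_top⟩
  have hc : ∀ i, ContinuousOn (dq i Φ) W := fun i =>
    (hΦ.continuousOn_fderiv_of_isOpen hW (le_refl _)).clm_apply continuousOn_const
  obtain ⟨ε, he, hb, B, hB⟩ := unif_bound hK hC hV hVW hΦ.continuousOn hx
  choose e' he' hb' B' hB' using fun i => unif_bound hK hC hV hVW (hc i) hx
  set δ := min ε (min (e' 0) (min (e' 1) (e' 2))) with hδ
  have hδ0 : 0 < δ := by simp [hδ, he, he']
  have hδi : ∀ i, δ ≤ e' i := by intro i; fin_cases i <;> simp [hδ]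
  let F' : (Fin 3 → ℝ) → ℝ → ((Fin 3 → ℝ) →L[ℝ] ℝ) := fun y θ => ∑ i, (w θ * dq i Φ (y,θ)) • ContinuousLinearMap.proj i
  have hmeas : ∀ y ∈ V, AEStronglyMeasurable (F' y) (volume.restrict K) := by
    intro y hy
    simp only [F']
    refine Finset.aestronglyMeasurable_fun_sum _ fun i _ => ?_
    exact (meas_slice hK hw hVW (hc i) hy).smul_const _
  have hIntg : ∀ i, Integrable (fun θ => w θ * dq i Φ (x,θ)) (volume.restrict K) := fun i =>
    Integrable.mono' (integrable_const (C * B' i)) (meas_slice hK hw hVW (hc i) hx) (by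
      rw [ae_restrict_iff' hK.measurableSet]
      exact Eventually.of_forall fun θ hθ => (hB' i x (Metric.mem_ball_self (he' i)) θ hθ).2)
  have key := hasFDerivAt_integral_of_dominated_of_fderiv_le (μ := volume.restrict K) (𝕜 := ℝ)
    (F := fun y θ => w θ * Φ (y,θ)) (F' := F') (x₀ := x) (s := Metric.ball x δ)
    (bound := fun _ => ∑ i, C * B' i * ‖(ContinuousLinearMap.proj i : (Fin 3 → ℝ) →L[ℝ] ℝ)‖)
    (Metric.ball_mem_nhds x hδ0) ?_ ?_ (hmeas x hx) ?_ (integrable_const _) ?_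
  · refine (key : HasFDerivAt (JJ K w Φ) _ x).congr_fderiv ?_
    simp only [F', lin]
    rw [integral_finsetSum _ (fun i _ => (hIntg i).smul_const _)]
    refine Finset.sum_congr rfl fun i _ => ?_
    rw [integral_smul_const]; rfl
  · filter_upwards [hV.mem_nhds hx] with y hy using meas_slice hK hw hVW hΦ.continuousOn hy
  · exact Integrable.mono' (integrable_const (C * B)) (meas_slice hK hw hVW hΦ.continuousOn hx) (by
      rw [ae_restrict_iff' hK.measurableSet]
      exact Eventually.of_forall fun θ hθ => (hB x (Metric.mem_ball_self he) θ hθ).2)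
  · rw [ae_restrict_iff' hK.measurableSet]
    refine Eventually.of_forall fun θ hθ y hy => ?_
    refine (norm_sum_le _ _).trans (Finset.sum_le_sum fun i _ => ?_)
    rw [norm_smul]
    gcongr
    exact (hB' i y (Metric.ball_subset_ball (hδi i) hy) θ hθ).2
  · rw [ae_restrict_iff' hK.measurableSet]
    refine Eventually.of_forall fun θ hθ y hy => ?_
    have hyV : y ∈ V := hb (Metric.ball_subset_ball (min_le_left _ _) hy)
    have h1 : HasFDerivAt Φ (fderiv ℝ Φ (y,θ)) (y,θ) :=
      ((hΦ.contDiffAt (hW.mem_nhds (hVW ⟨hyV, hθ⟩))).differentiableAt (by simp)).hasFDerivAt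
    have h2 : HasFDerivAt (fun y : Fin 3 → ℝ => (y,θ)) (ContinuousLinearMap.inl ℝ (Fin 3 → ℝ) ℝ) y :=
      hasFDerivAt_prodMk_left y θ
    have h3 := (h1.comp y h2).const_mul (w θ)
    refine h3.congr_fderiv ?_
    rw [lin_of ((w θ) • _)]
    simp [F', lin, dq]

include hw hC hV hVW hK in
lemma JJ_pq {Φ : (Fin 3 → ℝ) × ℝ → ℝ} (hW : IsOpen W) (hΦ : ContDiffOn ℝ 1 Φ W) {x : Fin 3 → ℝ} (hx : x ∈ V) (i : Fin 3) :
    pq i (JJ K w Φ) x = JJ K w (dq i Φ) x := by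
  rw [pq, (JJ_deriv hK hw hC hV hVW hW hΦ hx).fderiv, lin_single]

lemma dq_contDiff {W : Set ((Fin 3 → ℝ) × ℝ)} (hW : IsOpen W) {Φ : (Fin 3 → ℝ) × ℝ → ℝ} {n : ℕ} (hΦ : ContDiffOn ℝ ((n:ℕ)+1) Φ W) (i : Fin 3) :
    ContDiffOn ℝ n (dq i Φ) W :=
  (hΦ.fderiv_of_isOpen hW (le_refl _)).clm_apply contDiffOn_const

include hw hC hV hVW hK in
lemma JJ_contDiff (hW : IsOpen W) (n : ℕ) : ∀ {Φ : (Fin 3 → ℝ) × ℝ → ℝ}, ContDiffOn ℝ n Φ W →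
    ContDiffOn ℝ n (JJ K w Φ) V := by
  induction n with
  | zero =>
    intro Φ hΦ
    simp only [Nat.cast_zero, contDiffOn_zero] at hΦ ⊢
    exact JJ_cont hK hw hC hV hVW hW hΦ
  | succ n ih =>
    intro Φ hΦ
    push_cast at hΦ ⊢
    have h1 : ContDiffOn ℝ 1 Φ W := hΦ.of_le (by simp)
    refine contDiffOn_of_pq hV (fun x hx => (JJ_deriv hK hw hC hV hVW hW h1 hx).differentiableAt) fun i => ?_
    exact (ih (dq_contDiff hW hΦ i)).congr fun x hx => JJ_pq hK hw hC hV hVW hW h1 hx i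

include hw hC hV hVW hK in
lemma JJ_pq_pq {Φ : (Fin 3 → ℝ) × ℝ → ℝ} (hW : IsOpen W) (hΦ : ContDiffOn ℝ 2 Φ W) {x : Fin 3 → ℝ} (hx : x ∈ V) (i : Fin 3) :
    pq i (pq i (JJ K w Φ)) x = JJ K w (dq i (dq i Φ)) x := by
  have h1 : ContDiffOn ℝ 1 Φ W := hΦ.of_le (by norm_num)
  have h2 : ContDiffOn ℝ ((1:ℕ)+1) Φ W := by simpa [one_add_one_eq_two] using hΦ
  have h3 : ContDiffOn ℝ 1 (dq i Φ) W := by simpa using dq_contDiff hW h2 i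
  rw [← JJ_pq hK hw hC hV hVW hW h3 hx i]
  have : pq i (JJ K w Φ) =ᶠ[nhds x] JJ K w (dq i Φ) := by
    filter_upwards [hV.mem_nhds hx] with y hy using JJ_pq hK hw hC hV hVW hW h1 hy i
  unfold pq at this ⊢
  rw [this.fderiv_eq]

end par

lemma dq_eq {Φ : (Fin 3 → ℝ) × ℝ → ℝ} {p : (Fin 3 → ℝ) × ℝ} (h : DifferentiableAt ℝ Φ p) (i : Fin 3) :
    dq i Φ p = pq i (fun y => Φ (y, p.2)) p.1 := by
  have h2 : HasFDerivAt (fun y : Fin 3 → ℝ => (y,p.2)) (ContinuousLinearMap.inl ℝ (Fin 3 → ℝ) ℝ) p.1 :=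
    hasFDerivAt_prodMk_left p.1 p.2
  have h1 : HasFDerivAt Φ (fderiv ℝ Φ p) (p.1, p.2) := h.hasFDerivAt
  have h3 := h1.comp p.1 h2
  unfold pq dq
  rw [show (fun y => Φ (y, p.2)) = Φ ∘ (fun y : Fin 3 → ℝ => (y,p.2)) from rfl, h3.fderiv]
  simp

end TO

open Real Set Filter MeasureTheory

namespace TO

/-! ### Part D2 : the kernel -/

noncomputable def NN (y : Fin 3 → ℝ) : ℝ := √(y 0^2 + y 1^2 + y 2^2)
noncomputable def qv (θ : ℝ) : Fin 3 → ℝ := ![cos θ, sin θ, 0]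
noncomputable def dt (y : Fin 3 → ℝ) (θ : ℝ) : ℝ := y 0 * cos θ + y 1 * sin θ

lemma NN_sq (y : Fin 3 → ℝ) : NN y^2 = y 0^2 + y 1^2 + y 2^2 := Real.sq_sqrt (by positivity)
lemma NN_nonneg (y : Fin 3 → ℝ) : 0 ≤ NN y := Real.sqrt_nonneg _
lemma NN_cont : Continuous NN := by unfold NN; fun_prop
lemma NN_zero : NN 0 = 0 := by simp [NN]
lemma NN_pos {y : Fin 3 → ℝ} (h : y ≠ 0) : 0 < NN y := by
  refine lt_of_le_of_ne (NN_nonneg y) fun h0 => h ?_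
  have := NN_sq y
  rw [← h0] at this
  ext i
  have e0 : y 0 = 0 := by nlinarith [sq_nonneg (y 0), sq_nonneg (y 1), sq_nonneg (y 2)]
  have e1 : y 1 = 0 := by nlinarith [sq_nonneg (y 0), sq_nonneg (y 1), sq_nonneg (y 2)]
  have e2 : y 2 = 0 := by nlinarith [sq_nonneg (y 0), sq_nonneg (y 1), sq_nonneg (y 2)]
  fin_cases i <;> simpa
lemma NN_smul {r : ℝ} (hr : 0 ≤ r) (y : Fin 3 → ℝ) : NN (r • y) = r * NN y := by
  unfold NN
  rw [show (r•y) 0^2 + (r•y) 1^2 + (r•y) 2^2 = r^2 * (y 0^2+y 1^2+y 2^2) by simp; ring,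
    Real.sqrt_mul (by positivity), Real.sqrt_sq hr]

lemma dt_abs_sq (y : Fin 3 → ℝ) (θ : ℝ) : dt y θ^2 ≤ y 0^2 + y 1^2 := by
  unfold dt
  nlinarith [sq_nonneg (y 0 * sin θ - y 1 * cos θ), sin_sq_add_cos_sq θ]

lemma dt_abs (y : Fin 3 → ℝ) (θ : ℝ) : |dt y θ| ≤ NN y :=
  abs_le_of_sq_le_sq (by rw [NN_sq]; nlinarith [dt_abs_sq y θ, sq_nonneg (y 2)]) (NN_nonneg y)

lemma PW_contDiff (n : ℕ) : ∀ {c : ℕ → ℝ}, PGrow c → ContDiffOn ℝ n (PW c) (Ioo (-1) 1) := by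
  induction n with
  | zero =>
    intro c hc
    simp only [Nat.cast_zero, contDiffOn_zero]
    exact fun x hx => (hc.contOn (abs_lt.2 hx)).continuousWithinAt
  | succ n ih =>
    intro c hc
    push_cast
    rw [contDiffOn_succ_iff_deriv_of_isOpen isOpen_Ioo]
    refine ⟨fun x hx => (hc.hasDerivAt (abs_lt.2 hx)).differentiableAt.differentiableWithinAt, by simp, ?_⟩
    exact (ih hc.dc).congr fun x hx => (hc.hasDerivAt (abs_lt.2 hx)).deriv

/-- the general homogeneous zonal function -/
noncomputable def Az (θ a : ℝ) (g : ℝ → ℝ) (y : Fin 3 → ℝ) : ℝ := NN y ^ a * g (dt y θ / NN y)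

lemma proj_d (i : Fin 3) (y : Fin 3 → ℝ) :
    HasFDerivAt (fun y : Fin 3 → ℝ => y i) (ContinuousLinearMap.proj (R := ℝ) (φ := fun _ : Fin 3 => ℝ) i) y :=
  (ContinuousLinearMap.proj (R := ℝ) (φ := fun _ : Fin 3 => ℝ) i).hasFDerivAt

lemma NN_d {y : Fin 3 → ℝ} (h : 0 < NN y) : HasFDerivAt NN (lin fun i => y i / NN y) y := by
  have h0 : y 0^2 + y 1^2 + y 2^2 ≠ 0 := by rw [← NN_sq]; positivity
  have := ((((proj_d 0 y).pow 2).add ((proj_d 1 y).pow 2)).add ((proj_d 2 y).pow 2)).sqrt h0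
  refine (this : HasFDerivAt NN _ y).congr_fderiv ?_
  ext v
  rw [lin_apply]
  have : √(y 0^2 + y 1^2 + y 2^2) = NN y := rfl
  simp [this]
  field_simp

lemma dt_d (y : Fin 3 → ℝ) (θ : ℝ) : HasFDerivAt (fun y => dt y θ) (lin (qv θ)) y := by
  have := ((proj_d 0 y).mul_const (cos θ)).add ((proj_d 1 y).mul_const (sin θ))
  refine (this : HasFDerivAt (fun y => dt y θ) _ y).congr_fderiv ?_
  ext v
  rw [lin_apply]; simp [qv]

lemma Az_d {θ a : ℝ} {g : ℝ → ℝ} {g' : ℝ} {y : Fin 3 → ℝ} (h : 0 < NN y)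
    (hg : HasDerivAt g g' (dt y θ / NN y)) :
    HasFDerivAt (Az θ a g) (lin fun i => y i * (NN y^(a-2) * (a * g (dt y θ/NN y) - dt y θ/NN y*g'))
      + qv θ i * (NN y^(a-1) * g')) y := by
  have h1 := (NN_d h).rpow_const (p := a) (Or.inl h.ne')
  have h2 := ((dt_d y θ).mul ((hasDerivAt_inv h.ne').comp_hasFDerivAt y (NN_d h))).congr_of_eventuallyEq
    (f₁ := fun z => dt z θ / NN z) (Eventually.of_forall fun z => div_eq_mul_inv _ _)
  have h3 := hg.comp_hasFDerivAt y h2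
  refine (h1.mul h3 : HasFDerivAt (Az θ a g) _ y).congr_fderiv ?_
  ext v
  have e1 : NN y^(a-1) = NN y^(a-2) * NN y := by
    rw [← Real.rpow_add_one h.ne']; congr 1; ring
  have e0 : NN y^a = NN y^(a-2) * NN y^2 := by
    rw [← Real.rpow_natCast, ← Real.rpow_add h]; congr 1; push_cast; ring
  simp [lin_apply, e1, e0]
  field_simp
  ring

lemma Az_pq {θ a : ℝ} {g : ℝ → ℝ} {g' : ℝ} {y : Fin 3 → ℝ} (h : 0 < NN y)
    (hg : HasDerivAt g g' (dt y θ / NN y)) (i : Fin 3) :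
    pq i (Az θ a g) y = y i * (NN y^(a-2) * (a * g (dt y θ/NN y) - dt y θ/NN y*g'))
      + qv θ i * (NN y^(a-1) * g') := by
  rw [pq, (Az_d h hg).fderiv, lin_single]

lemma Az_lap {θ a : ℝ} {g g1 g2 : ℝ → ℝ} {y : Fin 3 → ℝ} (h : 0 < NN y) {I : Set ℝ} (hI : IsOpen I)
    (hy : dt y θ / NN y ∈ I) (hg : ∀ s ∈ I, HasDerivAt g (g1 s) s) (hg1 : ∀ s ∈ I, HasDerivAt g1 (g2 s) s)
    (hode : ∀ s ∈ I, a*(a+1)*g s - 2*s*g1 s + (1-s^2)*g2 s = 0) :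
    ∑ i, pq i (pq i (Az θ a g)) y = 0 := by
  have hev : ∀ᶠ z in nhds y, 0 < NN z ∧ dt z θ / NN z ∈ I := by
    refine (NN_cont.continuousAt.eventually (lt_mem_nhds h)).and ?_
    have : ContinuousAt (fun z => dt z θ / NN z) y :=
      ((dt_d y θ).continuousAt).div NN_cont.continuousAt h.ne'
    exact this.eventually (hI.mem_nhds hy)
  set τ := dt y θ / NN y with hτ
  have h1 : HasDerivAt (fun s => a * g s - s * g1 s) (a * g1 τ - (1 * g1 τ + τ * g2 τ)) τ :=
    ((hg τ hy).const_mul a).sub ((hasDerivAt_id τ).mul (hg1 τ hy))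
  have key : ∀ i, pq i (pq i (Az θ a g)) y =
      Az θ (a-2) (fun s => a * g s - s * g1 s) y + y i *
        (y i * (NN y^(a-2-2) * ((a-2) * (a * g τ - τ * g1 τ) - τ*(a * g1 τ - (1 * g1 τ + τ * g2 τ))))
         + qv θ i * (NN y^(a-2-1) * (a * g1 τ - (1 * g1 τ + τ * g2 τ))))
      + qv θ i * (y i * (NN y^(a-1-2) * ((a-1) * g1 τ - τ * g2 τ)) + qv θ i * (NN y^(a-1-1) * g2 τ)) := by
    intro i
    have e : pq i (Az θ a g) =ᶠ[nhds y] fun z => z i * Az θ (a-2) (fun s => a * g s - s * g1 s) z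
        + qv θ i * Az θ (a-1) g1 z := by
      filter_upwards [hev] with z hz
      rw [Az_pq hz.1 (hg _ hz.2)]; rfl
    rw [pq, e.fderiv_eq]
    have hd := ((proj_d i y).mul (Az_d (a := a-2) h h1)).add ((Az_d (a := a-1) h (hg1 τ hy)).const_mul (qv θ i))
    have hd' : HasFDerivAt (fun z => z i * Az θ (a-2) (fun s => a * g s - s * g1 s) z
        + qv θ i * Az θ (a-1) g1 z) _ y := hd
    rw [hd'.fderiv]
    simp [lin_single]
    ring
  have q2 : ∑ i, qv θ i * qv θ i = 1 := by
    simp [qv, Fin.sum_univ_three]; nlinarith [sin_sq_add_cos_sq θ]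
  have e4 : NN y^(a-2) = NN y^(a-2-2) * NN y^2 := by
    rw [← Real.rpow_natCast, ← Real.rpow_add h]; congr 1; push_cast; ring
  have e3 : NN y^(a-2-1) = NN y^(a-2-2) * NN y := by
    rw [← Real.rpow_add_one h.ne']; congr 1; ring
  have e5 : a-1-2 = a-2-1 := by ring
  have e6 : a-1-1 = a-2 := by ring
  have hdt : dt y θ = τ * NN y := by rw [hτ]; field_simp
  have hdt' : y 0 * cos θ + y 1 * sin θ = τ * NN y := hdt
  rw [Finset.sum_congr rfl fun i _ => key i]
  simp only [Az, Fin.sum_univ_three, qv, e5, e6, e3, e4, ← hτ]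
  simp
  have ode := hode τ hy
  have hs := NN_sq y
  have hsc := sin_sq_add_cos_sq θ
  set P := NN y^(a-2-2)
  set n := NN y
  linear_combination (P * ((a-2) * (a * g τ - τ * g1 τ) - τ*(a * g1 τ - (1 * g1 τ + τ * g2 τ)))) * (-hs)
    + P * n * ((a * g1 τ - (1 * g1 τ + τ * g2 τ)) + ((a-1) * g1 τ - τ * g2 τ)) * hdt'
    + P * n^2 * g2 τ * hsc + P * n^2 * ode

/-- the kernel -/
noncomputable def kk (μ s : ℝ) : ℝ := PW (cc μ) ((1+s)/2)
noncomputable def kk1 (μ s : ℝ) : ℝ := PW (dc (cc μ)) ((1+s)/2) / 2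
noncomputable def kk2 (μ s : ℝ) : ℝ := PW (dc (dc (cc μ))) ((1+s)/2) / 4

lemma half_abs {s : ℝ} (hs : s ∈ Ioo (-3) 1) : |(1+s)/2| < 1 := by
  rw [abs_lt]; constructor <;> linarith [hs.1, hs.2]

lemma kk_d {M : ℕ} {μ : ℝ} (h1 : (M:ℝ) ≤ μ) (h2 : μ ≤ M+1) {s : ℝ} (hs : s ∈ Ioo (-3) 1) :
    HasDerivAt (kk μ) (kk1 μ s) s := by
  have := ((cc_grow h1 h2).hasDerivAt (half_abs hs)).comp s (((hasDerivAt_id s).const_add 1).div_const 2)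
  refine (this : HasDerivAt (kk μ) _ s).congr_deriv ?_
  unfold kk1; ring

lemma kk1_d {M : ℕ} {μ : ℝ} (h1 : (M:ℝ) ≤ μ) (h2 : μ ≤ M+1) {s : ℝ} (hs : s ∈ Ioo (-3) 1) :
    HasDerivAt (kk1 μ) (kk2 μ s) s := by
  have := (((cc_grow h1 h2).dc.hasDerivAt (half_abs hs)).comp s (((hasDerivAt_id s).const_add 1).div_const 2)).div_const 2
  refine (this : HasDerivAt (kk1 μ) _ s).congr_deriv ?_
  unfold kk2; ring

lemma kk_ode {M : ℕ} {μ : ℝ} (h1 : (M:ℝ) ≤ μ) (h2 : μ ≤ M+1) {s : ℝ} (hs : s ∈ Ioo (-3) 1) :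
    μ*(μ+1)*kk μ s - 2*s*kk1 μ s + (1-s^2)*kk2 μ s = 0 := by
  have := K_ode h1 h2 (half_abs hs)
  unfold kk kk1 kk2
  linear_combination this

noncomputable def Ph (μ : ℝ) (p : (Fin 3 → ℝ) × ℝ) : ℝ := Az p.2 μ (kk μ) p.1

def WW : Set ((Fin 3 → ℝ) × ℝ) := {p | dt p.1 p.2 < NN p.1}

lemma WW_open : IsOpen WW := by
  refine isOpen_lt ?_ (NN_cont.comp continuous_fst)
  unfold dt; fun_prop

lemma WW_pos {p : (Fin 3 → ℝ) × ℝ} (hp : p ∈ WW) : 0 < NN p.1 := by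
  refine NN_pos fun h => ?_
  have : dt p.1 p.2 < NN p.1 := hp
  rw [h, NN_zero] at this; simp [dt] at this

lemma WW_tau {p : (Fin 3 → ℝ) × ℝ} (hp : p ∈ WW) : dt p.1 p.2 / NN p.1 ∈ Ioo (-3) 1 := by
  have h0 := WW_pos hp
  have : dt p.1 p.2 < NN p.1 := hp
  refine ⟨?_, (div_lt_one h0).2 this⟩
  rw [lt_div_iff₀ h0]
  have := (abs_le.1 (dt_abs p.1 p.2)).1
  linarith

lemma Ph_contDiff {M : ℕ} {μ : ℝ} (h1 : (M:ℝ) ≤ μ) (h2 : μ ≤ M+1) (n : ℕ) : ContDiffOn ℝ n (Ph μ) WW := by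
  intro p hp
  refine ContDiffAt.contDiffWithinAt ?_
  have hpos := WW_pos hp
  have hN : ContDiffAt ℝ n (fun p : (Fin 3 → ℝ) × ℝ => NN p.1) p := by
    have h0 : p.1 0^2 + p.1 1^2 + p.1 2^2 ≠ 0 := by rw [← NN_sq]; positivity
    unfold NN
    exact ContDiffAt.sqrt (by fun_prop) h0
  have hd : ContDiffAt ℝ n (fun p : (Fin 3 → ℝ) × ℝ => dt p.1 p.2) p := by unfold dt; fun_prop
  have hk : ContDiffAt ℝ n (PW (cc μ)) ((1 + dt p.1 p.2 / NN p.1)/2) :=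
    (PW_contDiff n (cc_grow h1 h2)).contDiffAt (isOpen_Ioo.mem_nhds (abs_lt.1 (half_abs (WW_tau hp))))
  have hin : ContDiffAt ℝ n (fun p : (Fin 3 → ℝ) × ℝ => (1 + dt p.1 p.2 / NN p.1)/2) p :=
    (contDiffAt_const.add (hd.div hN hpos.ne')).div_const 2
  exact (hN.rpow_const_of_ne hpos.ne').mul (hk.comp p hin)

lemma Ph_lap {M : ℕ} {μ : ℝ} (h1 : (M:ℝ) ≤ μ) (h2 : μ ≤ M+1) {p : (Fin 3 → ℝ) × ℝ} (hp : p ∈ WW) :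
    ∑ i, dq i (dq i (Ph μ)) p = 0 := by
  have hc2 : ContDiffOn ℝ ((1:ℕ)+1) (Ph μ) WW := by exact_mod_cast Ph_contDiff h1 h2 2
  have key : ∀ i, dq i (dq i (Ph μ)) p = pq i (pq i (Az p.2 μ (kk μ))) p.1 := by
    intro i
    have hd := dq_contDiff WW_open hc2 i
    rw [dq_eq ((hd.contDiffAt (WW_open.mem_nhds hp)).differentiableAt (by simp))]
    unfold pq
    congr 1
    apply Filter.EventuallyEq.fderiv_eq
    have : ∀ᶠ y in nhds p.1, (y, p.2) ∈ WW :=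
      (by fun_prop : ContinuousAt (fun y : Fin 3 → ℝ => (y,p.2)) p.1).eventually (WW_open.mem_nhds hp)
    filter_upwards [this] with y hy
    rw [dq_eq ((hc2.contDiffAt (WW_open.mem_nhds hy)).differentiableAt (by simp))]
    rfl
  rw [Finset.sum_congr rfl fun i _ => key i]
  exact Az_lap (WW_pos hp) isOpen_Ioo (WW_tau hp) (fun s hs => kk_d h1 h2 hs) (fun s hs => kk1_d h1 h2 hs)
    (fun s hs => kk_ode h1 h2 hs)

end TO

open Real Set Filter MeasureTheory
namespace TO

/-! ### Part D3 : Fourier expansion of the kernel, definition of the solution -/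

lemma hasSum_congr' {f g : ℤ → ℝ} {a : ℝ} (h : ∀ v, g v = f v) (hf : HasSum f a) : HasSum g a := by
  rwa [funext h]

lemma hasSum_cosn (n : ℕ) (φ : ℝ) : HasSum (fun v : ℤ => bt n v * cos (v*φ)) (((1+cos φ)/2)^n) := by
  induction n with
  | zero =>
    have := hasSum_ite_eq (0:ℤ) (1:ℝ)
    simp only [pow_zero]
    convert this using 2 with v
    simp only [bt]
    split_ifs with h
    · simp [h]
    · simp
  | succ n ih =>
    -- sum of bt n v cos ((v-1)φ) etc
    have e : ∀ s : ℤ, (s = 1 ∨ s = -1) → HasSum (fun v : ℤ => bt n v * sin (v*φ)) 0 := by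
      intro s _
      have hs : Summable (fun v : ℤ => bt n v * sin (v*φ)) := by
        apply summable_of_ne_finset_zero (s := Finset.Icc (-(n:ℤ)) n)
        intro v hv
        rw [Finset.mem_Icc, not_and_or, not_le, not_le] at hv
        rcases hv with hv | hv
        · rw [← bt_neg, bt_zero_of_lt n (-v) (by linarith)]; simp
        · rw [bt_zero_of_lt n v hv]; simp
      have h2 := (Equiv.neg ℤ).hasSum_iff.2 hs.hasSum
      have h3 := hs.hasSum.neg
      have : (fun v : ℤ => bt n v * sin (v*φ)) ∘ (Equiv.neg ℤ) = fun v => -(bt n v * sin (v*φ)) := by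
        ext v; simp [bt_neg]
      rw [this] at h2
      have := h2.unique h3
      have h0 : ∑' v : ℤ, bt n v * sin (v*φ) = 0 := by linarith
      rw [← h0]; exact hs.hasSum
    have hsin := e 1 (Or.inl rfl)
    have hp : HasSum (fun v : ℤ => bt n v * cos ((v-1:ℤ)*φ)) (((1+cos φ)/2)^n * cos φ) := by
      have := (ih.mul_right (cos φ)).add (hsin.mul_right (sin φ))
      rw [zero_mul, add_zero] at this
      refine hasSum_congr' (fun v => ?_) this
      push_cast; rw [sub_mul, one_mul, cos_sub]; ring
    have hm : HasSum (fun v : ℤ => bt n v * cos ((v+1:ℤ)*φ)) (((1+cos φ)/2)^n * cos φ) := by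
      have := (ih.mul_right (cos φ)).sub (hsin.mul_right (sin φ))
      rw [zero_mul, sub_zero] at this
      refine hasSum_congr' (fun v => ?_) this
      push_cast; rw [add_mul, one_mul, cos_add]; ring
    have h1 := (Equiv.addRight (1:ℤ)).hasSum_iff.2 hp
    have h2 := (Equiv.subRight (1:ℤ)).hasSum_iff.2 hm
    have h3 := ((ih.mul_left (1/2)).add (h1.mul_left (1/4))).add (h2.mul_left (1/4))
    rw [show ((1+cos φ)/2)^(n+1) = 1/2 * ((1+cos φ)/2)^n + 1/4 * (((1+cos φ)/2)^n * cos φ)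
      + 1/4 * (((1+cos φ)/2)^n * cos φ) by rw [pow_succ]; ring]
    refine hasSum_congr' (fun v => ?_) h3
    rw [bt_succ]; simp; ring

lemma cosn_pow (n : ℕ) (φ : ℝ) : ((1+cos φ)/2)^n = ∑ v ∈ Finset.Icc (-(n:ℤ)) n, bt n v * cos (v*φ) := by
  refine (hasSum_cosn n φ).unique (hasSum_sum_of_ne_finset_zero ?_)
  intro v hv
  rw [Finset.mem_Icc, not_and_or, not_le, not_le] at hv
  rcases hv with hv | hv
  · rw [← bt_neg, bt_zero_of_lt n (-v) (by linarith)]; simp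
  · rw [bt_zero_of_lt n v hv]; simp

/-- cosine coefficients of a weight -/
noncomputable def Psi (w : ℝ → ℝ) (v : ℤ) : ℝ := ∫ θ in Icc (-π) π, w θ * cos (v*θ)

lemma intK {f : ℝ → ℝ} {w : ℝ → ℝ} (hw : Measurable w) {C : ℝ} (hC : ∀ θ, |w θ| ≤ C) (hf : Continuous f) (a b : ℝ) :
    IntegrableOn (fun θ => w θ * f θ) (Icc a b) :=
  (hf.continuousOn.integrableOn_compact isCompact_Icc).bdd_mul hw.aestronglyMeasurable
    (Eventually.of_forall fun θ => (hC θ : ‖w θ‖ ≤ C))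

lemma Icc_eq (f : ℝ → ℝ) : ∫ θ in Icc (-π) π, f θ = ∫ θ in (-π)..π, f θ := by
  rw [integral_Icc_eq_integral_Ioc, intervalIntegral.integral_of_le (by linarith [pi_pos])]

lemma int_odd {f : ℝ → ℝ} (h : ∀ x, f (-x) = - f x) : ∫ θ in Icc (-π) π, f θ = 0 := by
  rw [Icc_eq]
  have := intervalIntegral.integral_comp_neg (a := -π) (b := π) f
  simp only [h, neg_neg, intervalIntegral.integral_neg] at this
  linarith

lemma int_ring {w : ℝ → ℝ} (hw : Measurable w) {C : ℝ} (hC : ∀ θ, |w θ| ≤ C) (he : ∀ θ, w (-θ) = w θ)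
    (n : ℕ) (θ0 : ℝ) : ∫ θ in Icc (-π) π, w θ * ((1+cos (θ-θ0))/2)^n
      = ∑ v ∈ Finset.Icc (-(n:ℤ)) n, bt n v * (cos (v*θ0) * Psi w v) := by
  simp only [cosn_pow, Finset.mul_sum]
  rw [integral_finsetSum]
  · refine Finset.sum_congr rfl fun v _ => ?_
    have e : ∀ θ, w θ * (bt n v * cos (v*(θ-θ0))) = bt n v * cos (v*θ0) * (w θ * cos (v*θ))
       + bt n v * sin (v*θ0) * (w θ * sin (v*θ)) := by
      intro θ; rw [mul_sub, cos_sub]; ring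
    simp only [e]
    rw [integral_add, integral_const_mul, integral_const_mul,
      int_odd (f := fun θ => w θ * sin (v*θ)) (fun x => by simp [he]), Psi]
    · ring
    · exact (intK hw hC (by fun_prop) _ _).const_mul _
    · exact (intK hw hC (by fun_prop) _ _).const_mul _
  · intro v _
    exact intK hw hC (by fun_prop) _ _

lemma int_ring_one (n : ℕ) (θ0 : ℝ) : ∫ θ in Icc (-π) π, ((1+cos (θ-θ0))/2)^n = 2*π*bt n 0 := by
  have := int_ring (w := fun _ => 1) measurable_const (C := 1) (by simp) (by simp) n θ0
  simp only [one_mul] at this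
  rw [this, Finset.sum_eq_single 0]
  · have : Psi (fun _ => 1) 0 = 2*π := by
      unfold Psi; rw [Icc_eq]; simp; ring
    rw [this]; simp; ring
  · intro v _ hv
    have : Psi (fun _ => 1) v = 0 := by
      unfold Psi; rw [Icc_eq]
      simp only [one_mul]
      rw [intervalIntegral.integral_comp_mul_left (f := cos) (by exact_mod_cast hv)]
      simp
    rw [this]; simp
  · intro h; exact absurd (Finset.mem_Icc.2 ⟨by simp, by simp⟩) h

lemma polar (y : Fin 3 → ℝ) : ∃ R θ0, 0 ≤ R ∧ y 0 = R * cos θ0 ∧ y 1 = R * sin θ0 := by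
  refine ⟨‖(⟨y 0, y 1⟩ : ℂ)‖, Complex.arg ⟨y 0, y 1⟩, norm_nonneg _, ?_, ?_⟩
  · rw [Complex.norm_mul_cos_arg]
  · rw [Complex.norm_mul_sin_arg]

lemma ring_pt {c ρ : ℝ} (h0 : 0 ≤ ρ) (h1 : ρ ≤ 1) (hc : |c| ≤ 1) (n : ℕ) :
    |((1+ρ*c)/2)^n| ≤ ((1+c)/2)^n + ((1-c)/2)^n := by
  obtain ⟨c1, c2⟩ := abs_le.1 hc
  have e0 : 0 ≤ (1+ρ*c)/2 := by nlinarith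
  rw [abs_of_nonneg (by positivity)]
  have p1 : 0 ≤ ((1+c)/2)^n := pow_nonneg (by linarith) n
  have p2 : 0 ≤ ((1-c)/2)^n := pow_nonneg (by linarith) n
  rcases le_total 0 c with h | h
  · have : ((1+ρ*c)/2)^n ≤ ((1+c)/2)^n := pow_le_pow_left₀ e0 (by nlinarith) n
    linarith
  · have : ((1+ρ*c)/2)^n ≤ ((1-c)/2)^n := pow_le_pow_left₀ e0 (by nlinarith) n
    linarith

/-- kernel power -/
noncomputable def Fn (n : ℕ) (p : (Fin 3 → ℝ) × ℝ) : ℝ := ((1 + dt p.1 p.2 / NN p.1)/2)^n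

lemma tau_form (y : Fin 3 → ℝ) : ∃ ρ θ0, 0 ≤ ρ ∧ ρ ≤ 1 ∧ ∀ θ, dt y θ / NN y = ρ * cos (θ - θ0) := by
  obtain ⟨R, θ0, hR, h0, h1⟩ := polar y
  refine ⟨R / NN y, θ0, div_nonneg hR (NN_nonneg y), ?_, fun θ => ?_⟩
  · refine div_le_one_of_le₀ (abs_le_of_sq_le_sq' ?_ (NN_nonneg y)).2 (NN_nonneg y)
    rw [NN_sq, h0, h1]; nlinarith [sin_sq_add_cos_sq θ0, sq_nonneg (y 2)]
  · rw [dt, h0, h1, cos_sub]; ring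

lemma Fn_slice_cont (n : ℕ) (y : Fin 3 → ℝ) : Continuous fun θ => Fn n (y,θ) := by
  have h : Continuous fun θ => dt y θ := by unfold dt; fun_prop
  exact ((continuous_const.add (h.div_const (NN y))).div_const 2).pow n

lemma int_Fn {w : ℝ → ℝ} {C : ℝ} (hC : ∀ θ, |w θ| ≤ C) (n : ℕ) (y : Fin 3 → ℝ) :
    |JJ (Icc (-π) π) w (Fn n) y| ≤ C * (4*π) * (1/√(n+1)) := by
  obtain ⟨ρ, θ0, h0, h1, h⟩ := tau_form y
  have hC0 : 0 ≤ C := (abs_nonneg _).trans (hC 0)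
  have hb : ∫ θ in Icc (-π) π, C * (((1+cos (θ-θ0))/2)^n + ((1+cos (θ-(θ0+π)))/2)^n) = C * (4*π*bt n 0) := by
    rw [integral_const_mul, integral_add, int_ring_one, int_ring_one]
    · ring
    all_goals exact (by fun_prop : Continuous _).continuousOn.integrableOn_compact isCompact_Icc
  have : |JJ (Icc (-π) π) w (Fn n) y| ≤ C * (4*π*bt n 0) := by
    rw [← hb, ← Real.norm_eq_abs]
    refine norm_integral_le_of_norm_le ?_ (Eventually.of_forall fun θ => ?_)
    · exact (by fun_prop : Continuous _).continuousOn.integrableOn_compact isCompact_Icc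
    · rw [Real.norm_eq_abs, abs_mul]
      refine mul_le_mul (hC θ) ?_ (abs_nonneg _) hC0
      simp only [Fn, h]
      have := ring_pt h0 h1 (abs_cos_le_one (θ-θ0)) n
      rwa [show cos (θ-(θ0+π)) = - cos (θ-θ0) by rw [← sub_sub, cos_sub_pi]]
  refine this.trans ?_
  have := bt_zero_le n
  have h4 : 0 ≤ C * (4*π) := by positivity
  calc C * (4*π*bt n 0) = C*(4*π) * bt n 0 := by ring
    _ ≤ _ := mul_le_mul_of_nonneg_left this h4

/-- the solution -/
noncomputable def sol (μ : ℝ) (w : ℝ → ℝ) (x : Fin 3 → ℝ) : ℝ :=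
  NN x ^ μ * ∑' n, cc μ n * JJ (Icc (-π) π) w (Fn n) x

section sol
variable {M : ℕ} {μ : ℝ} (h1 : (M:ℝ) ≤ μ) (h2 : μ ≤ M+1) {w : ℝ → ℝ} (hw : Measurable w) {C : ℝ}
  (hC : ∀ θ, |w θ| ≤ C)

include h1 h2 hC in
lemma sol_bound : ∃ B : ℕ → ℝ, Summable B ∧ ∀ n x, |cc μ n * JJ (Icc (-π) π) w (Fn n) x| ≤ B n := by
  obtain ⟨A, hA, hb⟩ := cc_bound M
  refine ⟨fun n => C*(4*π) * (A / ((n:ℝ)+1) * (1/√(n+1))), (summable_bd A).mul_left _, fun n x => ?_⟩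
  rw [abs_mul]
  have e1 := hb μ h1 h2 n
  have e2 := int_Fn hC n x
  calc _ ≤ (A / ((n:ℝ)+1)) * (C * (4*π) * (1/√(n+1))) := mul_le_mul e1 e2 (abs_nonneg _) (by positivity)
    _ = _ := by ring

include hw hC in
lemma JJ_Fn_cont (n : ℕ) : ContinuousOn (JJ (Icc (-π) π) w (Fn n)) {0}ᶜ := by
  refine JJ_cont (W := {0}ᶜ ×ˢ univ) isCompact_Icc hw hC isOpen_compl_singleton (prod_mono (le_refl _) (subset_univ _))
    (isOpen_compl_singleton.prod isOpen_univ) ?_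
  intro p hp
  refine ContinuousAt.continuousWithinAt ?_
  have hN : NN p.1 ≠ 0 := (NN_pos hp.1).ne'
  have hc : ContinuousAt (fun p : (Fin 3 → ℝ) × ℝ => NN p.1) p := (NN_cont.comp continuous_fst).continuousAt
  have hd : ContinuousAt (fun p : (Fin 3 → ℝ) × ℝ => dt p.1 p.2) p := by unfold dt; fun_prop
  exact ((continuousAt_const.add (hd.div hc hN)).div_const 2).pow n

include h1 h2 hw hC in
lemma sol_cont (hμ : 0 < μ) : Continuous (sol μ w) := by
  obtain ⟨B, hB, hb⟩ := sol_bound h1 h2 hC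
  have hS : ContinuousOn (fun x => ∑' n, cc μ n * JJ (Icc (-π) π) w (Fn n) x) {0}ᶜ :=
    continuousOn_tsum (fun n => continuousOn_const.mul (JJ_Fn_cont hw hC n)) hB (fun n x _ => hb n x)
  rw [continuous_iff_continuousAt]
  intro x
  by_cases hx : x = 0
  · subst hx
    unfold ContinuousAt
    have e0 : sol μ w 0 = 0 := by unfold sol; rw [NN_zero, Real.zero_rpow hμ.ne', zero_mul]
    rw [e0]
    have hN : Tendsto (fun x => (NN x)^μ * ∑' n, B n) (nhds 0) (nhds 0) := by
      have : ContinuousAt (fun x => (NN x)^μ * ∑' n, B n) 0 :=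
        (NN_cont.continuousAt.rpow_const (Or.inr hμ.le)).mul continuousAt_const
      have h := this.tendsto
      simp only [NN_zero, Real.zero_rpow hμ.ne', zero_mul] at h
      exact h
    refine squeeze_zero_norm (fun x => ?_) hN
    unfold sol
    rw [Real.norm_eq_abs, abs_mul, abs_of_nonneg (Real.rpow_nonneg (NN_nonneg x) _)]
    refine mul_le_mul_of_nonneg_left ?_ (Real.rpow_nonneg (NN_nonneg x) _)
    exact tsum_of_norm_bounded (f := fun n => cc μ n * JJ (Icc (-π) π) w (Fn n) x) hB.hasSum fun n => hb n x
  · exact (NN_cont.continuousAt.rpow_const (Or.inr hμ.le)).mul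
      (hS.continuousAt (isOpen_compl_singleton.mem_nhds hx))

end sol

lemma Fn_smul (n : ℕ) {r : ℝ} (hr : 0 < r) (x : Fin 3 → ℝ) (θ : ℝ) : Fn n (r • x, θ) = Fn n (x,θ) := by
  unfold Fn
  rw [NN_smul hr.le, show dt (r • x) θ = r * dt x θ by simp [dt]; ring, mul_div_mul_left _ _ hr.ne']

lemma sol_homog (μ : ℝ) (w : ℝ → ℝ) {r : ℝ} (hr : 0 < r) (x : Fin 3 → ℝ) : sol μ w (r • x) = r^μ * sol μ w x := by
  unfold sol
  simp only [JJ, Fn_smul _ hr]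
  rw [NN_smul hr.le, Real.mul_rpow hr.le (NN_nonneg x), mul_assoc]

lemma sol_congr (μ : ℝ) (w : ℝ → ℝ) {x y : Fin 3 → ℝ} (e0 : x 0 = y 0) (e1 : x 1 = y 1) (e2 : x 2^2 = y 2^2) :
    sol μ w x = sol μ w y := by
  have hN : NN x = NN y := by unfold NN; rw [e0, e1, e2]
  have hd : ∀ θ, dt x θ = dt y θ := fun θ => by unfold dt; rw [e0, e1]
  unfold sol
  simp only [JJ, Fn, hN, hd]

end TO

open Real Set Filter MeasureTheory

namespace TO

/-! ### Part D4 : values on the plane -/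

noncomputable def wt (m : ℕ) (ψ : ℝ → ℝ) (θ : ℝ) : ℝ := ψ (arccos (-cos (m*θ)))

lemma wt_even (m : ℕ) (ψ : ℝ → ℝ) (θ : ℝ) : wt m ψ (-θ) = wt m ψ θ := by simp [wt]

lemma wt_shift {m : ℕ} (hm : m ≠ 0) (ψ : ℝ → ℝ) (θ : ℝ) : wt m ψ (θ + 2*π/m) = wt m ψ θ := by
  unfold wt
  rw [mul_add, mul_div_cancel₀ _ (by exact_mod_cast hm : (m:ℝ) ≠ 0), cos_add_two_pi]

lemma wt_per (m : ℕ) (ψ : ℝ → ℝ) (θ : ℝ) : wt m ψ (θ + 2*π) = wt m ψ θ := by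
  unfold wt
  rw [mul_add, cos_add_nat_mul_two_pi]

lemma cos_nat_congr {x y : ℝ} (h : cos x = cos y) (j : ℕ) : cos (j*x) = cos (j*y) := by
  have h1 := Polynomial.Chebyshev.T_real_cos x j
  have h2 := Polynomial.Chebyshev.T_real_cos y j
  rw [h] at h1
  rw [h1] at h2
  exact_mod_cast h2

lemma cos_ge_iff {t c : ℝ} (h0 : 0 ≤ c) (h1 : c ≤ π) : cos c ≤ cos t ↔ ∃ k : ℤ, |t - 2*π*k| ≤ c := by
  constructor
  · intro h
    refine ⟨round (t/(2*π)), ?_⟩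
    have hr := abs_sub_round (t/(2*π))
    have hp := pi_pos
    have e : t - 2*π*(round (t/(2*π)):ℤ) = 2*π*(t/(2*π) - round (t/(2*π))) := by field_simp
    have hle : |t - 2*π*(round (t/(2*π)):ℤ)| ≤ π := by
      rw [e, abs_mul, abs_of_pos (by positivity)]; nlinarith
    have hcos : cos |t - 2*π*(round (t/(2*π)):ℤ)| = cos t := by
      rw [cos_abs, mul_comm, cos_sub_int_mul_two_pi]
    by_contra hlt
    push Not at hlt
    have := cos_lt_cos_of_nonneg_of_le_pi h0 hle hlt
    linarith
  · rintro ⟨k, hk⟩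
    have hcos : cos |t - 2*π*k| = cos t := by
      rw [cos_abs, mul_comm, cos_sub_int_mul_two_pi]
    rw [← hcos]
    exact cos_le_cos_of_nonneg_of_le_pi (abs_nonneg _) h1 hk

namespace Dat
variable {m M : ℕ} {μ b C : ℝ} {ψ : ℝ → ℝ} {a : ℕ → ℝ} (D : Dat m M μ b C ψ a)

include D in
lemma m0 : m ≠ 0 := by have := D.par.m3; omega

include D in
lemma wt_meas : Measurable (wt m ψ) := by
  have : Continuous fun θ : ℝ => arccos (-cos (m*θ)) := by fun_prop
  exact D.mono.measurable.comp this.measurable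

include D in
lemma wt_bd (θ : ℝ) : |wt m ψ θ| ≤ C := by
  unfold wt; rw [abs_of_nonneg (D.nn _)]; exact D.bd _

include D in
lemma Psi_zero {v : ℤ} (hv : ¬ (m:ℤ) ∣ v) : Psi (wt m ψ) v = 0 := by
  set δ := 2*π/m with hδ
  have hm : (m:ℝ) ≠ 0 := by exact_mod_cast D.m0
  let f := fun θ => wt m ψ θ * cos (v*θ)
  have hper : Function.Periodic f (2*π) := by
    intro θ
    simp only [f]
    rw [wt_per, mul_add, cos_add_int_mul_two_pi]
  have e1 : ∫ θ in (-π)..π, f (θ + δ) = Psi (wt m ψ) v := by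
    rw [intervalIntegral.integral_comp_add_right, Psi, Icc_eq]
    have := hper.intervalIntegral_add_eq (-π+δ) (-π)
    rw [show -π+δ+2*π = π+δ by ring, show -π+2*π=π by ring] at this
    exact this
  have hiS := intK D.wt_meas D.wt_bd (f := fun θ => sin (v*θ)) (by fun_prop) (-π) π
  have hiC := intK D.wt_meas D.wt_bd (f := fun θ => cos (v*θ)) (by fun_prop) (-π) π
  have e2 : ∫ θ in (-π)..π, f (θ + δ) = cos (v*δ) * Psi (wt m ψ) v := by
    rw [← Icc_eq]
    have : ∀ θ, f (θ+δ) = cos (v*δ) * (wt m ψ θ * cos (v*θ)) - sin (v*δ) * (wt m ψ θ * sin (v*θ)) := by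
      intro θ
      simp only [f]
      rw [hδ, wt_shift D.m0, mul_add, cos_add]; ring
    simp only [this]
    rw [integral_sub (hiC.const_mul _) (hiS.const_mul _), integral_const_mul, integral_const_mul,
      int_odd (f := fun θ => wt m ψ θ * sin (v*θ)) (fun x => by simp [wt_even]), Psi]
    ring
  have e3 : cos (v*δ) ≠ 1 := by
    intro h
    obtain ⟨n, hn⟩ := (Real.cos_eq_one_iff _).1 h
    apply hv
    refine ⟨n, ?_⟩
    have : (n:ℝ) * m = v := by
      rw [hδ] at hn; field_simp at hn; exact hn
    have : n * (m:ℤ) = v := by exact_mod_cast this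
    linarith
  rw [e1] at e2
  have : (1 - cos (v*δ)) * Psi (wt m ψ) v = 0 := by linarith
  rcases mul_eq_zero.1 this with h | h
  · exact absurd (by linarith) e3
  · exact h

include D in
lemma Psi_mul (j : ℕ) : Psi (wt m ψ) (m*j : ℕ) = (-1)^j * (π * (ell μ (m*j) * a j)) := by
  have hm : (m:ℝ) ≠ 0 := by exact_mod_cast D.m0
  let g := fun t => ψ (arccos (-cos t)) * cos (j*t)
  have hper : Function.Periodic g (2*π) := by
    intro θ
    simp only [g]
    rw [cos_add_two_pi, mul_add, cos_add_nat_mul_two_pi]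
  have hIntg : ∀ c d, IntervalIntegrable g volume c d := by
    intro c d
    have hme : Measurable fun t => ψ (arccos (-cos t)) :=
      D.mono.measurable.comp (by fun_prop : Continuous fun t : ℝ => arccos (-cos t)).measurable
    have hcos : Continuous fun t : ℝ => cos (j*t) := by fun_prop
    exact ⟨(intK hme (C := C) (fun t => by rw [abs_of_nonneg (D.nn _)]; exact D.bd _) hcos c d).mono_set
      Ioc_subset_Icc_self, (intK hme (C := C) (fun t => by rw [abs_of_nonneg (D.nn _)]; exact D.bd _) hcos d c).mono_set
      Ioc_subset_Icc_self⟩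
  have e1 : Psi (wt m ψ) (m*j : ℕ) = ∫ t in (-π)..π, g t := by
    rw [Psi, Icc_eq]
    have : ∀ θ, wt m ψ θ * cos (((m*j:ℕ):ℤ)*θ) = g (m*θ) := by
      intro θ; simp only [g, wt]; congr 2; push_cast; ring
    simp only [this]
    rw [intervalIntegral.integral_comp_mul_left _ hm]
    have h2 := hper.intervalIntegral_add_zsmul_eq m (m * -π) hIntg
    have h3 := hper.intervalIntegral_add_eq (m * -π) (-π)
    rw [show -π+2*π=π by ring] at h3
    rw [h3] at h2
    rw [show (m:ℝ) * -π + (m:ℤ) • (2*π) = m * π by simp; ring] at h2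
    rw [h2]
    simp; field_simp
  have e2 : ∫ t in (-π)..π, g t = 2 * ∫ t in (0:ℝ)..π, g t := by
    rw [← intervalIntegral.integral_add_adjacent_intervals (hIntg (-π) 0) (hIntg 0 π)]
    have := intervalIntegral.integral_comp_neg (a := 0) (b := π) g
    rw [neg_zero] at this
    rw [← this]
    have : ∀ t, g (-t) = g t := fun t => by simp [g]
    simp only [this]; ring
  have e3 : ∫ t in (0:ℝ)..π, g t = (-1)^j * ∫ x in (0:ℝ)..π, ψ x * cos (j*x) := by
    have h := intervalIntegral.integral_comp_sub_left (a := 0) (b := π) (fun x => ψ x * cos (j*(π-x))) π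
    have h' : ∫ t in (0:ℝ)..π, g t = ∫ x in (0:ℝ)..π, ψ (π-x) * cos (j*(π-(π-x))) := by
      refine intervalIntegral.integral_congr fun t ht => ?_
      rw [uIcc_of_le pi_pos.le] at ht
      simp only [g]
      rw [← cos_pi_sub, arccos_cos (by linarith [ht.2]) (by linarith [ht.1])]
      congr 2; ring
    rw [h', h, ← intervalIntegral.integral_const_mul]
    simp only [sub_self, sub_zero]
    refine intervalIntegral.integral_congr fun x _ => ?_
    beta_reduce
    rw [mul_sub, cos_nat_mul_pi_sub]; ring
  rw [e1, e2, e3]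
  by_cases hj : j = 0
  · subst hj
    have := D.int0
    simp [this, D.a0]; ring
  · rw [D.intj j hj]; ring

include D in
lemma abs_term {v : ℕ} (hv : M+1 ≤ v) (n : ℕ) : |cc μ n * bt n v| = cc μ n * bt n v := by
  refine abs_of_nonneg ?_
  by_cases h : n < v
  · rw [bt_zero_of_lt n v (by exact_mod_cast h), mul_zero]
  · exact mul_nonneg (cc_sign D.par.oddM D.h1 D.h2 n (by omega)).le (bt_nonneg _ _)

end Dat

lemma hasSum_congrN {f g : ℕ → ℝ} {s : ℝ} (h : ∀ v, g v = f v) (hf : HasSum f s) : HasSum g s := by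
  rw [funext h]; exact hf

/-- coefficients of the plane expansion -/
noncomputable def Gj (m : ℕ) (μ : ℝ) (a : ℕ → ℝ) (θ0 : ℝ) (j : ℕ) : ℝ :=
  2 * cos (((m*j:ℕ):ℤ)*θ0) * ((-1)^j * (π * (ell μ (m*j) * a j)))

/-- double series term -/
noncomputable def Fj (m : ℕ) (μ : ℝ) (a : ℕ → ℝ) (θ0 : ℝ) (p : ℕ × ℕ) : ℝ :=
  (cc μ p.2 * bt p.2 (m*p.1:ℕ)) * Gj m μ a θ0 p.1

namespace Dat
variable {m M : ℕ} {μ b C : ℝ} {ψ : ℝ → ℝ} {a : ℕ → ℝ} (D : Dat m M μ b C ψ a)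

include D in
lemma plane_J (θ0 : ℝ) (n : ℕ) : HasSum (fun j : ℕ => bt n (m*j:ℕ) * Gj m μ a θ0 j)
      ((∫ θ in Icc (-π) π, wt m ψ θ * ((1+cos (θ-θ0))/2)^n) + bt n 0 * (2*π*ell μ 0)) := by
  have hm : (m:ℤ) ≠ 0 := by exact_mod_cast D.m0
  rw [int_ring D.wt_meas D.wt_bd (wt_even m ψ)]
  have h1 : HasSum (fun v : ℤ => bt n v * (cos (v*θ0) * Psi (wt m ψ) v))
      (∑ v ∈ Finset.Icc (-(n:ℤ)) n, bt n v * (cos (v*θ0) * Psi (wt m ψ) v)) := by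
    refine hasSum_sum_of_ne_finset_zero ?_
    intro v hv
    rw [Finset.mem_Icc, not_and_or, not_le, not_le] at hv
    rcases hv with hv | hv
    · rw [← bt_neg, bt_zero_of_lt n (-v) (by linarith)]; simp
    · rw [bt_zero_of_lt n v hv]; simp
  have hinj : Function.Injective (fun j : ℤ => (m:ℤ) * j) := mul_right_injective₀ hm
  have h2 := (hinj.hasSum_iff (f := fun v : ℤ => bt n v * (cos (v*θ0) * Psi (wt m ψ) v)) (by
    intro v hv
    rw [D.Psi_zero]; · simp
    rintro ⟨k, hk⟩; exact hv ⟨k, hk.symm⟩)).2 h1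
  have h3 := h2.nat_add_neg
  have e0 : ((fun v : ℤ => bt n v * (cos (v*θ0) * Psi (wt m ψ) v)) ∘ fun j : ℤ => (m:ℤ) * j) 0
      = bt n 0 * (2*π*ell μ 0) := by
    have := D.Psi_mul 0
    simp [D.a0] at this
    simp [this]; left; ring
  rw [e0] at h3
  refine hasSum_congrN (fun j => ?_) h3
  have e : Psi (wt m ψ) (-((m:ℤ)*j)) = Psi (wt m ψ) ((m:ℤ)*j) := by simp [Psi]
  have e' := D.Psi_mul j
  push_cast at e'
  simp only [Function.comp, Gj, mul_neg, bt_neg, e, e', Int.cast_neg, neg_mul, cos_neg]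
  push_cast; ring

include D in
lemma plane_F1 (θ0 : ℝ) (j : ℕ) (hmj : M+1 ≤ m*j) :
    ∑' n, |Fj m μ a θ0 (j,n)| ≤ 2*π*√(kap μ) * |a j| := by
  have h0 : ∀ n, |Fj m μ a θ0 (j,n)| = (cc μ n * bt n (m*j:ℕ)) * |Gj m μ a θ0 j| := by
    intro n
    rw [Fj, abs_mul]; rw [D.abs_term hmj]
  rw [tsum_congr h0, tsum_mul_right]
  have hss : ∑' n, cc μ n * bt n (m*j:ℕ) = ss μ (m*j:ℕ) := rfl
  rw [hss]
  have hl := ell_mul_ss D.par.oddM D.h1 D.h2 (m*j)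
  have hk : 0 ≤ √(kap μ) := Real.sqrt_nonneg _
  have hsp := ss_pos D.par.oddM D.h1 D.h2 hmj
  rw [← abs_of_pos hsp, ← abs_mul]
  have e : ss μ (m*j:ℕ) * Gj m μ a θ0 j = 2*π*√(kap μ) * a j * (cos (((m*j:ℕ):ℤ)*θ0) * (-1)^j) := by
    rw [Gj, ← hl]; ring
  have hpi := pi_pos
  rw [e, abs_mul, abs_mul, abs_of_nonneg (by positivity : 0 ≤ 2*π*√(kap μ)), abs_mul, abs_pow, abs_neg, abs_one,
    one_pow, mul_one]
  exact mul_le_of_le_one_right (by positivity) (abs_cos_le_one _)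

include D in
lemma plane_F (θ0 : ℝ) : Summable (Fj m μ a θ0) := by
  rw [← summable_abs_iff, summable_prod_of_nonneg (fun p => abs_nonneg _)]
  constructor
  · intro j
    have h : Summable fun n => (cc μ n * bt n (m*j:ℕ)) * Gj m μ a θ0 j :=
      (ss_summable D.h1.le D.h2.le ((m*j:ℕ):ℤ)).mul_right _
    exact h.abs
  · refine Summable.of_norm_bounded_eventually_nat (g := fun j => 2*π*√(kap μ) * |a j|) (D.suma.mul_left _) ?_
    filter_upwards [eventually_ge_atTop (M+1)] with j hj
    have hmj : M+1 ≤ m*j := by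
      have := D.par.m3; nlinarith
    rw [norm_eq_abs, abs_of_nonneg (tsum_nonneg fun n => abs_nonneg _)]
    exact D.plane_F1 θ0 j hmj

include D in
lemma plane_e1 (θ0 : ℝ) (j : ℕ) :
    ∑' n, Fj m μ a θ0 (j,n) = 2*π*√(kap μ) * (a j * cos (j*(m*θ0+π))) := by
  have hss : ∑' n, cc μ n * bt n (m*j:ℕ) = ss μ (m*j:ℕ) := rfl
  have hl := ell_mul_ss D.par.oddM D.h1 D.h2 (m*j)
  have h0 : ∀ n, Fj m μ a θ0 (j,n) = (cc μ n * bt n (m*j:ℕ)) * Gj m μ a θ0 j := fun n => rfl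
  rw [tsum_congr h0, tsum_mul_right, hss, ← hl]
  have hc : cos (j*(m*θ0+π)) = (-1)^j * cos (((m*j:ℕ):ℤ)*θ0) := by
    rw [mul_add, cos_add_nat_mul_pi]; congr 2; push_cast; ring
  rw [hc, Gj]; ring

include D in
lemma plane (θ0 : ℝ) : ∑' n, cc μ n * ∫ θ in Icc (-π) π, wt m ψ θ * ((1+cos (θ-θ0))/2)^n
    = 2*π*√(kap μ) * (∑' j, a j * cos (j*(m*θ0+π)) - 1) := by
  have hF := D.plane_F θ0
  have hJe : ∀ n, cc μ n * ∫ θ in Icc (-π) π, wt m ψ θ * ((1+cos (θ-θ0))/2)^n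
      = (∑' j, Fj m μ a θ0 (j,n)) - 2*π*ell μ 0 * (cc μ n * bt n 0) := by
    intro n
    have h := (D.plane_J θ0 n).tsum_eq
    have h2 : ∀ j, Fj m μ a θ0 (j,n) = cc μ n * (bt n (m*j:ℕ) * Gj m μ a θ0 j) := by
      intro j; rw [Fj, mul_assoc]
    rw [tsum_congr h2, tsum_mul_left, h]; ring
  rw [tsum_congr hJe]
  have hsw : Summable fun n => ∑' j, Fj m μ a θ0 (j,n) := (hF.prod_symm).prod
  have hs0 : Summable fun n => cc μ n * bt n 0 := ss_summable D.h1.le D.h2.le 0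
  rw [hsw.tsum_sub (hs0.mul_left _), tsum_mul_left]
  have hss0 : ∑' n, cc μ n * bt n 0 = ss μ 0 := rfl
  have hcomm : ∑' n, ∑' j, Fj m μ a θ0 (j,n) = ∑' j, ∑' n, Fj m μ a θ0 (j,n) :=
    Summable.tsum_comm (f := fun (j n : ℕ) => Fj m μ a θ0 (j,n)) hF
  rw [hss0, hcomm, tsum_congr (D.plane_e1 θ0), tsum_mul_left]
  have hl := ell_mul_ss D.par.oddM D.h1 D.h2 0
  simp only [Nat.cast_zero] at hl
  linear_combination (-2*π)*hl

/-- the folded angle -/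
noncomputable def _root_.TO.ang (m : ℕ) (θ : ℝ) : ℝ := arccos (-cos (m*θ))

include D in
lemma sol_plane {R : ℝ} (hR : 0 < R) (θ0 : ℝ) : sol μ (wt m ψ) ![R*cos θ0, R*sin θ0, 0]
    = R^μ * (2*π*√(kap μ) * (∑' j, a j * cos (j*ang m θ0) - 1)) := by
  have hN : NN ![R*cos θ0, R*sin θ0, 0] = R := by
    unfold NN
    rw [show (![R*cos θ0, R*sin θ0, 0] : Fin 3 → ℝ) 0^2 + (![R*cos θ0, R*sin θ0, 0] : Fin 3 → ℝ) 1^2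
      + (![R*cos θ0, R*sin θ0, 0] : Fin 3 → ℝ) 2^2 = R^2 by
        simp; nlinarith [sin_sq_add_cos_sq θ0], Real.sqrt_sq hR.le]
  have hF : ∀ n θ, Fn n (![R*cos θ0, R*sin θ0, 0], θ) = ((1+cos (θ-θ0))/2)^n := by
    intro n θ
    unfold Fn
    rw [hN]; congr 3
    simp [dt, cos_sub]; field_simp
  unfold sol
  simp only [JJ, hF]
  rw [hN, D.plane]
  have : ∀ j : ℕ, cos (j*(m*θ0+π)) = cos (j*ang m θ0) := by
    intro j
    refine cos_nat_congr ?_ j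
    rw [ang, cos_arccos (by linarith [cos_le_one (m*θ0)]) (by linarith [neg_one_le_cos (m*θ0)]), cos_add_pi]
  simp only [this]

include D in
lemma ang_val (θ : ℝ) : (ang m θ < b → 1 < ∑' j, a j * cos (j*ang m θ)) ∧
    (b ≤ ang m θ → ∑' j, a j * cos (j*ang m θ) = 1) :=
  ⟨fun h => D.fpos _ ⟨arccos_nonneg _, h⟩, fun h => D.f0 _ ⟨h, arccos_le_pi _⟩⟩

include D in
lemma ang_iff (θ : ℝ) : b ≤ ang m θ ↔ ∃ k : ℤ, |θ - 2*π*k/m| ≤ ((π-b)/π)*π/m := by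
  have hm : (0:ℝ) < m := by exact_mod_cast Nat.pos_of_ne_zero D.m0
  have h1 : b ≤ ang m θ ↔ cos (π-b) ≤ cos (m*θ) := by
    have hc : cos (ang m θ) = -cos (m*θ) := by
      rw [ang, cos_arccos (by linarith [cos_le_one (m*θ)]) (by linarith [neg_one_le_cos (m*θ)])]
    rw [cos_pi_sub]
    have := (strictAntiOn_cos.le_iff_ge (a := ang m θ) (b := b) ⟨arccos_nonneg _, arccos_le_pi _⟩ ⟨D.b0.le, D.bpi.le⟩)
    rw [hc] at this
    rw [← this]
    constructor <;> intro h <;> linarith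
  rw [h1, cos_ge_iff (by linarith [D.bpi]) (by linarith [D.b0])]
  refine exists_congr fun k => ?_
  rw [div_mul_cancel₀ _ pi_pos.ne', le_div_iff₀ hm, ← abs_of_pos hm, ← abs_mul, abs_of_pos hm]
  congr! 2
  field_simp

include D in
lemma kpos : 0 < 2*π*√(kap μ) := by
  have := Real.sqrt_pos.2 (kap_pos D.par.oddM D.h1 D.h2)
  have := pi_pos
  positivity

include D in
lemma mu_pos : 0 < μ := lt_of_le_of_lt (Nat.cast_nonneg M) D.h1

include D in
lemma sol_zero : sol μ (wt m ψ) 0 = 0 := by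
  unfold sol; rw [NN_zero, Real.zero_rpow D.mu_pos.ne', zero_mul]

lemma plane_form (x : Fin 3 → ℝ) (hx : x 2 = 0) : ∃ R θ0, 0 ≤ R ∧ x = ![R*cos θ0, R*sin θ0, 0] := by
  obtain ⟨R, θ0, hR, h0, h1⟩ := polar x
  refine ⟨R, θ0, hR, ?_⟩
  ext i; fin_cases i <;> simp [h0, h1, hx]

include D in
lemma sol_nonneg (x : Fin 3 → ℝ) (hx : x 2 = 0) : 0 ≤ sol μ (wt m ψ) x := by
  obtain ⟨R, θ0, hR, rfl⟩ := plane_form x hx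
  rcases hR.eq_or_lt with h | h
  · rw [← h]
    have : (![0 * cos θ0, 0 * sin θ0, 0] : Fin 3 → ℝ) = 0 := by ext i; fin_cases i <;> simp
    rw [this, D.sol_zero]
  · rw [D.sol_plane h]
    have hk := D.kpos
    have : 0 ≤ ∑' j, a j * cos (j*ang m θ0) - 1 := by
      rcases lt_or_ge (ang m θ0) b with h | h
      · linarith [(D.ang_val θ0).1 h]
      · linarith [(D.ang_val θ0).2 h]
    positivity

include D in
lemma sol_zero_iff {R : ℝ} (hR : 0 < R) (θ0 : ℝ) : sol μ (wt m ψ) ![R*cos θ0, R*sin θ0, 0] = 0 ↔ b ≤ ang m θ0 := by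
  rw [D.sol_plane hR]
  have hk := D.kpos
  constructor
  · intro h
    by_contra hb
    push Not at hb
    have := (D.ang_val θ0).1 hb
    have : 0 < R^μ * (2*π*√(kap μ) * (∑' j, a j * cos (j*ang m θ0) - 1)) :=
      mul_pos (Real.rpow_pos_of_pos hR _) (mul_pos hk (by linarith))
    linarith
  · intro h
    rw [(D.ang_val θ0).2 h]; simp

include D in
lemma contact_iff (x : Fin 3 → ℝ) : (x 2 = 0 ∧ sol μ (wt m ψ) x = 0) ↔
    ∃ r : ℝ, 0 ≤ r ∧ ∃ θ : ℝ, (∃ k : ℤ, |θ - 2 * π * k / m| ≤ ((π-b)/π) * π / m) ∧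
      x = ![r * Real.cos θ, r * Real.sin θ, 0] := by
  constructor
  · rintro ⟨h0, h1⟩
    obtain ⟨R, θ0, hR, rfl⟩ := plane_form x h0
    rcases hR.eq_or_lt with h | h
    · refine ⟨0, le_refl _, 0, ⟨0, ?_⟩, ?_⟩
      · have := D.bpi
        have := pi_pos
        simp; exact div_nonneg (by linarith) (Nat.cast_nonneg m)
      · rw [← h]; ext i; fin_cases i <;> simp
    · exact ⟨R, hR, θ0, (D.ang_iff θ0).1 ((D.sol_zero_iff h θ0).1 h1), rfl⟩
  · rintro ⟨R, hR, θ0, hk, rfl⟩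
    refine ⟨by simp, ?_⟩
    rcases hR.eq_or_lt with h | h
    · rw [← h]
      have : (![0 * cos θ0, 0 * sin θ0, 0] : Fin 3 → ℝ) = 0 := by ext i; fin_cases i <;> simp
      rw [this, D.sol_zero]
    · exact (D.sol_zero_iff h θ0).2 ((D.ang_iff θ0).2 hk)

include D in
lemma sol_ne : sol μ (wt m ψ) ≠ 0 := by
  intro h
  have hm : (m:ℝ) ≠ 0 := by exact_mod_cast D.m0
  have := (D.sol_zero_iff one_pos (π/m)).1 (by rw [h]; rfl)
  rw [ang, mul_div_cancel₀ _ hm] at this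
  simp at this
  linarith [D.b0]

end Dat
end TO

open Real Set Filter MeasureTheory

namespace TO

/-! ### Part D5 : the integral representation off the contact set -/

lemma ang_cont (m : ℕ) : Continuous (ang m) := by unfold ang; fun_prop

/-- angular support of the density -/
def KK (m : ℕ) (b : ℝ) : Set ℝ := Icc (-π) π ∩ {θ | b ≤ ang m θ}

lemma KK_compact (m : ℕ) (b : ℝ) : IsCompact (KK m b) :=
  isCompact_Icc.inter_right (isClosed_le continuous_const (ang_cont m))

/-- complement of the contact set -/
def VV (m : ℕ) (μ : ℝ) (ψ : ℝ → ℝ) : Set (Fin 3 → ℝ) := {x | x 2 = 0 ∧ sol μ (wt m ψ) x = 0}ᶜ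

namespace Dat
variable {m M : ℕ} {μ b C : ℝ} {ψ : ℝ → ℝ} {a : ℕ → ℝ} (D : Dat m M μ b C ψ a)

include D in
lemma cont : Continuous (sol μ (wt m ψ)) := sol_cont D.h1.le D.h2.le D.wt_meas D.wt_bd D.mu_pos

include D in
lemma VV_open : IsOpen (VV m μ ψ) := by
  refine isOpen_compl_iff.2 ?_
  exact (isClosed_eq (continuous_apply 2) continuous_const).inter (isClosed_eq D.cont continuous_const)

include D in
lemma VV_WW : VV m μ ψ ×ˢ KK m b ⊆ WW := by
  rintro ⟨x, θ⟩ ⟨hx, hθ⟩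
  refine lt_of_le_of_ne ((le_abs_self _).trans (dt_abs x θ)) fun h => hx ?_
  have h1 := NN_sq x
  have h2 : x 2 = 0 ∧ x 0 * sin θ = x 1 * cos θ := by
    have e : x 0^2+x 1^2 - dt x θ^2 = (x 0 * sin θ - x 1 * cos θ)^2 := by
      unfold dt
      linear_combination (-(x 0^2+x 1^2)) * sin_sq_add_cos_sq θ
    rw [h] at e
    have hs : x 2^2 + (x 0 * sin θ - x 1 * cos θ)^2 = 0 := by linarith
    constructor
    · nlinarith [sq_nonneg (x 2), sq_nonneg (x 0 * sin θ - x 1 * cos θ)]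
    · nlinarith [sq_nonneg (x 2), sq_nonneg (x 0 * sin θ - x 1 * cos θ)]
  have hsc := sin_sq_add_cos_sq θ
  have e0 : x 0 = NN x * cos θ := by
    rw [← h, dt]; linear_combination (-x 0) * hsc + sin θ * h2.2
  have e1 : x 1 = NN x * sin θ := by
    rw [← h, dt]; linear_combination (-x 1) * hsc - cos θ * h2.2
  have hxe : x = ![NN x * cos θ, NN x * sin θ, 0] := by
    ext i; fin_cases i
    · simpa using e0
    · simpa using e1
    · simpa using h2.1
  exact (D.contact_iff x).2 ⟨NN x, NN_nonneg x, θ, (D.ang_iff θ).1 hθ.2, hxe⟩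

include D in
lemma JJ_K (Φ : (Fin 3 → ℝ) × ℝ → ℝ) (x : Fin 3 → ℝ) : JJ (Icc (-π) π) (wt m ψ) Φ x = JJ (KK m b) (wt m ψ) Φ x := by
  unfold JJ
  refine (setIntegral_eq_of_subset_of_forall_sdiff_eq_zero measurableSet_Icc inter_subset_left ?_)
  rintro θ ⟨h1, h2⟩
  have : ang m θ < b := by
    by_contra h; push Not at h; exact h2 ⟨h1, h⟩
  have hz := D.zero _ this
  rw [show wt m ψ θ = ψ (ang m θ) from rfl, hz, zero_mul]

include D in
lemma rep_aux {x : Fin 3 → ℝ} (hx : ∀ θ ∈ KK m b, (x,θ) ∈ WW) :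
    ∃ r, 0 ≤ r ∧ r < 1 ∧ ∀ θ ∈ KK m b, |(1+dt x θ/NN x)/2| ≤ r := by
  have hc : Continuous fun θ => |(1+dt x θ/NN x)/2| := by unfold dt; fun_prop
  rcases (KK m b).eq_empty_or_nonempty with h | h
  · exact ⟨0, le_refl _, one_pos, by simp [h]⟩
  · obtain ⟨θ, hθ, hmax⟩ := (KK_compact m b).exists_isMaxOn h hc.continuousOn
    exact ⟨_, abs_nonneg _, half_abs (WW_tau (hx θ hθ)), fun t ht => hmax ht⟩

include D in
lemma rep {x : Fin 3 → ℝ} (hx : ∀ θ ∈ KK m b, (x,θ) ∈ WW) :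
    sol μ (wt m ψ) x = JJ (KK m b) (wt m ψ) (Ph μ) x := by
  obtain ⟨r, h0, h1, hr⟩ := D.rep_aux hx
  have : IsFiniteMeasure (volume.restrict (KK m b)) := ⟨by simpa using (KK_compact m b).measure_lt_top⟩
  have hg := cc_grow D.h1.le D.h2.le
  have hC0 : 0 ≤ C := (abs_nonneg _).trans (D.wt_bd 0)
  have hsum := (hg.summable_abs h0 h1).mul_left C
  have key := hasSum_integral_of_dominated_convergence (μ := volume.restrict (KK m b))
    (F := fun n θ => cc μ n * (wt m ψ θ * Fn n (x,θ))) (f := fun θ => wt m ψ θ * kk μ (dt x θ/NN x))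
    (fun n _ => C * (|cc μ n| * r^n)) ?_ ?_ ?_ ?_ ?_
  · unfold sol
    have e1 : ∀ n, cc μ n * JJ (Icc (-π) π) (wt m ψ) (Fn n) x = ∫ θ in KK m b, cc μ n * (wt m ψ θ * Fn n (x,θ)) := by
      intro n; rw [D.JJ_K, JJ, integral_const_mul]
    rw [tsum_congr e1, key.tsum_eq, ← integral_const_mul, JJ]
    refine integral_congr_ae (Eventually.of_forall fun θ => ?_)
    simp only [Ph, Az]; ring
  · intro n
    exact ((D.wt_meas.mul (Fn_slice_cont n x).measurable).const_mul _).aestronglyMeasurable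
  · intro n
    rw [ae_restrict_iff' (KK_compact m b).measurableSet]
    refine Eventually.of_forall fun θ hθ => ?_
    rw [norm_eq_abs, abs_mul, abs_mul, Fn, abs_pow]
    have e1 := pow_le_pow_left₀ (abs_nonneg _) (hr θ hθ) n
    have e2 := mul_le_mul (D.wt_bd θ) e1 (by positivity) hC0
    calc |cc μ n| * (|wt m ψ θ| * |(1+dt x θ/NN x)/2|^n) ≤ |cc μ n| * (C * r^n) := by
          exact mul_le_mul_of_nonneg_left e2 (abs_nonneg _)
      _ = _ := by ring
  · exact Eventually.of_forall fun _ => hsum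
  · exact integrable_const _
  · rw [ae_restrict_iff' (KK_compact m b).measurableSet]
    refine Eventually.of_forall fun θ hθ => ?_
    have hs := (hg.summable ((hr θ hθ).trans_lt h1)).hasSum.mul_left (wt m ψ θ)
    refine hasSum_congrN (fun n => ?_) hs
    rw [Fn]; ring

include D in
lemma repV {x : Fin 3 → ℝ} (hx : x ∈ VV m μ ψ) : sol μ (wt m ψ) x = JJ (KK m b) (wt m ψ) (Ph μ) x :=
  D.rep fun _ hθ => D.VV_WW ⟨hx, hθ⟩

include D in
lemma smooth : ContDiffOn ℝ 2 (sol μ (wt m ψ)) (VV m μ ψ) := by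
  have h := JJ_contDiff (KK_compact m b) D.wt_meas D.wt_bd D.VV_open D.VV_WW WW_open 2 (Ph_contDiff D.h1.le D.h2.le 2)
  exact (h.congr fun x hx => D.repV hx)

include D in
lemma harm {x : Fin 3 → ℝ} (hx : x ∈ VV m μ ψ) : ∑ i, pq i (pq i (sol μ (wt m ψ))) x = 0 := by
  have hev : ∀ y ∈ VV m μ ψ, sol μ (wt m ψ) =ᶠ[nhds y] JJ (KK m b) (wt m ψ) (Ph μ) := by
    intro y hy
    filter_upwards [D.VV_open.mem_nhds hy] with z hz using D.repV hz
  have hPh : ContDiffOn ℝ 2 (Ph μ) WW := Ph_contDiff D.h1.le D.h2.le 2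
  have hPh2 : ContDiffOn ℝ ((1:ℕ)+1) (Ph μ) WW := by simpa [one_add_one_eq_two] using hPh
  have e : ∀ i, pq i (pq i (sol μ (wt m ψ))) x = JJ (KK m b) (wt m ψ) (dq i (dq i (Ph μ))) x := by
    intro i
    rw [← JJ_pq_pq (KK_compact m b) D.wt_meas D.wt_bd D.VV_open D.VV_WW WW_open hPh hx i]
    have : pq i (sol μ (wt m ψ)) =ᶠ[nhds x] pq i (JJ (KK m b) (wt m ψ) (Ph μ)) := by
      filter_upwards [D.VV_open.mem_nhds hx] with y hy
      rw [pq, (hev y hy).fderiv_eq, pq]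
    rw [pq, this.fderiv_eq, pq]
  have hcd : ∀ i, ContinuousOn (dq i (dq i (Ph μ))) WW := by
    intro i
    have h1 : ContDiffOn ℝ ((0:ℕ)+1) (dq i (Ph μ)) WW := by simpa using dq_contDiff WW_open hPh2 i
    exact (dq_contDiff WW_open h1 i).continuousOn
  have hIntg : ∀ i ∈ (Finset.univ : Finset (Fin 3)), Integrable (fun θ => wt m ψ θ * dq i (dq i (Ph μ)) (x,θ)) (volume.restrict (KK m b)) := by
    intro i _
    have : IsFiniteMeasure (volume.restrict (KK m b)) := ⟨by simpa using (KK_compact m b).measure_lt_top⟩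
    obtain ⟨ε, he, hb, B, hB⟩ := unif_bound (KK_compact m b) D.wt_bd D.VV_open D.VV_WW (hcd i) hx
    refine Integrable.of_bound (meas_slice (KK_compact m b) D.wt_meas D.VV_WW (hcd i) hx) (C*B) ?_
    rw [ae_restrict_iff' (KK_compact m b).measurableSet]
    exact Eventually.of_forall fun θ hθ => (hB x (Metric.mem_ball_self he) θ hθ).2
  rw [Finset.sum_congr rfl fun i _ => e i]
  unfold JJ
  rw [← integral_finsetSum _ hIntg]
  refine setIntegral_eq_zero_of_forall_eq_zero fun θ hθ => ?_
  rw [← Finset.mul_sum, Ph_lap D.h1.le D.h2.le (D.VV_WW ⟨hx, hθ⟩), mul_zero]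

end Dat
end TO

open Real Set Filter MeasureTheory

namespace TO

/-! ### Part D6 : Poisson limits -/

lemma int_cosn (n : ℕ) : ∫ t in (0:ℝ)..π, cos (n*t) = if n = 0 then π else 0 := by
  split_ifs with h
  · subst h; simp
  · have hn : (n:ℝ) ≠ 0 := by exact_mod_cast h
    rw [intervalIntegral.integral_comp_mul_left (fun t => cos t) hn, integral_cos]
    simp [sin_nat_mul_pi]

lemma int_PP {r : ℝ} (h0 : 0 ≤ r) (h1 : r < 1) : ∫ t in (0:ℝ)..π, PP r t = π := by
  have key := intervalIntegral.hasSum_integral_of_dominated_convergence (μ := volume) (a := 0) (b := π)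
    (F := fun (n:ℕ) t => r^n * cos (n*t)) (f := fun t => (PP r t+1)/2) (fun n _ => r^n) ?_ ?_ ?_ ?_ ?_
  · have e : ∀ n : ℕ, ∫ t in (0:ℝ)..π, r^n * cos (n*t) = if n = 0 then π else 0 := by
      intro n
      rw [intervalIntegral.integral_const_mul, int_cosn]
      split_ifs with h
      · subst h; simp
      · simp
    have h2 := key.unique (hasSum_congrN e (hasSum_ite_eq 0 π))
    have hi : IntervalIntegrable (PP r) volume 0 π := (PP_cont h0 h1).intervalIntegrable _ _
    rw [intervalIntegral.integral_div, intervalIntegral.integral_add hi (by simp)] at h2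
    simp at h2
    linarith
  · intro n; exact (by fun_prop : Continuous fun t : ℝ => r^n * cos (n*t)).aestronglyMeasurable
  · intro n
    refine Eventually.of_forall fun t _ => ?_
    rw [norm_eq_abs, abs_mul, abs_pow, abs_of_nonneg h0]
    exact mul_le_of_le_one_right (by positivity) (abs_cos_le_one _)
  · exact Eventually.of_forall fun t _ => summable_geometric_of_lt_one h0 h1
  · simp
  · exact Eventually.of_forall fun t _ => hasSum_cos h0 h1 t

lemma poisson_lim {l : Filter ℝ} {r : ℝ → ℝ} {h : ℝ → ℝ → ℝ} {B L : ℝ} (hr : ∀ᶠ i in l, 0 ≤ r i ∧ r i < 1)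
    (hrt : Tendsto r l (nhds 1)) (hm : ∀ᶠ i in l, Measurable (h i)) (hB : ∀ᶠ i in l, ∀ α, |h i α| ≤ B)
    (hlim : Tendsto (fun p : ℝ × ℝ => h p.1 p.2) (l ×ˢ nhdsWithin 0 (Ioi 0)) (nhds L)) :
    Tendsto (fun i => ∫ α in (0:ℝ)..π, h i α * PP (r i) α) l (nhds (π * L)) := by
  have hpi := pi_pos
  rw [Metric.tendsto_nhds]
  intro ε he
  have hlim' := (Metric.tendsto_nhds.1 hlim) (ε/(4*π)) (by positivity)
  rw [eventually_prod_iff] at hlim'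
  obtain ⟨pa, hpa, pb, hpb, hab⟩ := hlim'
  obtain ⟨δ', hδ', hsub⟩ := mem_nhdsGT_iff_exists_Ioo_subset.1 hpb
  have hδ0 : 0 < δ' := hδ'
  set δ := min δ' π with hδ
  have hd0 : 0 < δ := lt_min hδ' hpi
  have hcd : cos δ < 1 := by
    have := cos_lt_cos_of_nonneg_of_le_pi (le_refl (0:ℝ)) (min_le_right δ' π) hd0
    simpa using this
  have hrt' : Tendsto r l (nhdsWithin 1 (Iio 1)) :=
    tendsto_nhdsWithin_iff.2 ⟨hrt, hr.mono fun i hi => hi.2⟩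
  have hP := (PP_tend hcd).comp hrt'
  have hP2 : Tendsto (fun i => (|B|+|L|) * (π * PP (r i) δ)) l (nhds ((|B|+|L|)*(π * 0))) :=
    (hP.const_mul π).const_mul _
  simp only [mul_zero] at hP2
  filter_upwards [hpa, hr, hm, hB, hP2.eventually (gt_mem_nhds (half_pos he))] with i h1 h2 h3 h4 h5
  have hint0 : IntervalIntegrable (PP (r i)) volume 0 π := (PP_cont h2.1 h2.2).intervalIntegrable _ _
  have hIntg : IntervalIntegrable (fun α => h i α * PP (r i) α) volume 0 π :=
    ⟨(intK h3 h4 (PP_cont h2.1 h2.2) _ _).mono_set Ioc_subset_Icc_self,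
     (intK h3 h4 (PP_cont h2.1 h2.2) _ _).mono_set Ioc_subset_Icc_self⟩
  have e1 : (∫ α in (0:ℝ)..π, h i α * PP (r i) α) - π * L = ∫ α in (0:ℝ)..π, (h i α * PP (r i) α - L * PP (r i) α) := by
    rw [intervalIntegral.integral_sub hIntg (hint0.const_mul L), intervalIntegral.integral_const_mul, int_PP h2.1 h2.2]
    ring
  rw [Real.dist_eq, e1, ← norm_eq_abs]
  have e2 : ‖∫ α in (0:ℝ)..π, (h i α * PP (r i) α - L * PP (r i) α)‖
      ≤ ∫ α in (0:ℝ)..π, (ε/(4*π) * PP (r i) α + (|B|+|L|) * PP (r i) δ) := by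
    refine intervalIntegral.norm_integral_le_of_norm_le hpi.le ?_ ((hint0.const_mul _).add (by simp))
    refine Eventually.of_forall fun α hα => ?_
    rw [← sub_mul, norm_eq_abs, abs_mul, abs_of_pos (PP_pos h2.1 h2.2 α)]
    have p1 := PP_pos h2.1 h2.2 α
    have p2 := PP_pos h2.1 h2.2 δ
    rcases lt_or_ge α δ with hc | hc
    · have hh : dist (h i α) L < ε/(4*π) := hab h1 (hsub ⟨hα.1, hc.trans_le (min_le_left _ _)⟩)
      rw [Real.dist_eq] at hh
      have := mul_le_mul_of_nonneg_right hh.le p1.le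
      have : 0 ≤ (|B|+|L|) * PP (r i) δ := by positivity
      linarith
    · have hh : PP (r i) α ≤ PP (r i) δ :=
        PP_le h2.1 h2.2 (cos_le_cos_of_nonneg_of_le_pi hd0.le hα.2 hc)
      have hb : |h i α - L| ≤ |B| + |L| := (abs_sub _ _).trans (by linarith [h4 α, le_abs_self B])
      have := mul_le_mul hb hh p1.le (by positivity)
      have : 0 ≤ ε/(4*π) * PP (r i) α := by positivity
      linarith
  refine e2.trans_lt ?_
  rw [intervalIntegral.integral_add (hint0.const_mul _) (by simp), intervalIntegral.integral_const_mul, int_PP h2.1 h2.2,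
    intervalIntegral.integral_const]
  have : ε/(4*π)*π = ε/4 := by field_simp
  rw [this, smul_eq_mul, sub_zero]
  linarith [mul_left_comm π (|B|+|L|) (PP (r i) δ)]

lemma cos_mono_near (β : ℝ) : (∀ᶠ h in nhdsWithin (0:ℝ) (Ioi 0), cos (β+h) < cos β) ∨
    (∀ᶠ h in nhdsWithin (0:ℝ) (Ioi 0), cos β < cos (β+h)) := by
  have hpi := pi_pos
  have hsin : ∀ᶠ h in nhdsWithin (0:ℝ) (Ioi 0), 0 < sin (h/2) := by
    filter_upwards [Ioo_mem_nhdsGT hpi] with h hh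
    exact sin_pos_of_pos_of_lt_pi (by linarith [hh.1]) (by linarith [hh.2, hh.1])
  have hid : ∀ h, cos (β+h) - cos β = -2 * sin (β+h/2) * sin (h/2) := by
    intro h; rw [cos_sub_cos]; congr 3 <;> ring
  have hs : (∀ᶠ h in nhdsWithin (0:ℝ) (Ioi 0), 0 < sin (β+h/2)) ∨ (∀ᶠ h in nhdsWithin (0:ℝ) (Ioi 0), sin (β+h/2) < 0) := by
    have hc : Tendsto (fun h : ℝ => sin (β+h/2)) (nhdsWithin 0 (Ioi 0)) (nhds (sin β)) := by
      have : Continuous fun h : ℝ => sin (β+h/2) := by fun_prop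
      have := this.tendsto 0
      simp only [zero_div, add_zero] at this
      exact this.mono_left nhdsWithin_le_nhds
    rcases lt_trichotomy (sin β) 0 with h | h | h
    · right; exact hc.eventually (gt_mem_nhds h)
    · have hcos : cos β ≠ 0 := by
        intro h0; have := sin_sq_add_cos_sq β; rw [h, h0] at this; norm_num at this
      rcases lt_or_gt_of_ne hcos with h1 | h1
      · right; filter_upwards [hsin] with t ht
        rw [sin_add, h]; nlinarith
      · left; filter_upwards [hsin] with t ht
        rw [sin_add, h, zero_mul, zero_add]; positivity
    · left; exact hc.eventually (lt_mem_nhds h)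
  rcases hs with h | h
  · left; filter_upwards [h, hsin] with t h1 h2
    nlinarith [hid t, mul_pos h1 h2]
  · right; filter_upwards [h, hsin] with t h1 h2
    nlinarith [hid t, mul_neg_of_neg_of_pos h1 h2]

namespace Dat
variable {m M : ℕ} {μ b C : ℝ} {ψ : ℝ → ℝ} {a : ℕ → ℝ} (D : Dat m M μ b C ψ a)

include D in
lemma wt_lim (θ0 : ℝ) : ∃ L, 0 ≤ L ∧ Tendsto (fun α => wt m ψ (θ0+α)) (nhdsWithin 0 (Ioi 0)) (nhds L) := by
  have hm : (0:ℝ) < m := by exact_mod_cast Nat.pos_of_ne_zero D.m0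
  suffices h : ∃ L, Tendsto (fun α => wt m ψ (θ0+α)) (nhdsWithin 0 (Ioi 0)) (nhds L) by
    obtain ⟨L, hL⟩ := h
    exact ⟨L, ge_of_tendsto hL (Eventually.of_forall fun α => D.nn _), hL⟩
  have hmt : Tendsto (fun α : ℝ => m*α) (nhdsWithin 0 (Ioi 0)) (nhdsWithin 0 (Ioi 0)) := by
    refine tendsto_nhdsWithin_iff.2 ⟨?_, ?_⟩
    · have : Continuous fun α : ℝ => m*α := by fun_prop
      have := this.tendsto 0
      simp only [mul_zero] at this
      exact this.mono_left nhdsWithin_le_nhds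
    · filter_upwards [self_mem_nhdsWithin] with α hα
      exact mul_pos hm hα
  have hat : Tendsto (fun α => ang m (θ0+α)) (nhdsWithin 0 (Ioi 0)) (nhds (ang m θ0)) := by
    have : Continuous fun α => ang m (θ0+α) := (ang_cont m).comp (by fun_prop)
    have := this.tendsto 0
    simp only [add_zero] at this
    exact this.mono_left nhdsWithin_le_nhds
  have hmem : ∀ t, -cos t ∈ Icc (-1:ℝ) 1 := fun t => ⟨by linarith [cos_le_one t], by linarith [neg_one_le_cos t]⟩
  rcases cos_mono_near (m*θ0) with h | h
  · refine ⟨_, (D.mono.tendsto_leftLim (ang m θ0)).comp (tendsto_nhdsWithin_iff.2 ⟨hat, ?_⟩)⟩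
    filter_upwards [hmt.eventually h] with α hα
    refine Real.strictAntiOn_arccos (hmem _) (hmem _) ?_
    rw [mul_add]; linarith
  · refine ⟨_, (D.mono.tendsto_rightLim (ang m θ0)).comp (tendsto_nhdsWithin_iff.2 ⟨hat, ?_⟩)⟩
    filter_upwards [hmt.eventually h] with α hα
    refine Real.strictAntiOn_arccos (hmem _) (hmem _) ?_
    rw [mul_add]; linarith

end Dat
end TO

open Real Set Filter MeasureTheory

namespace TO

/-! ### Part D7 : the one-sided derivative at contact points -/

/-- vertical line -/
noncomputable def vl (R θ0 t : ℝ) : Fin 3 → ℝ := ![R*cos θ0, R*sin θ0, t]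

lemma vl_add (R θ0 t : ℝ) : vl R θ0 0 + t • (Pi.single 2 1 : Fin 3 → ℝ) = vl R θ0 t := by
  ext i; fin_cases i <;> simp [vl]

lemma vl_d (R θ0 t : ℝ) : HasDerivAt (vl R θ0) (Pi.single 2 1) t := by
  rw [hasDerivAt_pi]
  intro i; fin_cases i
  · simpa [vl] using hasDerivAt_const t (R*cos θ0)
  · simpa [vl] using hasDerivAt_const t (R*sin θ0)
  · simpa [vl] using hasDerivAt_id' t

lemma vl_NN (R θ0 t : ℝ) : NN (vl R θ0 t) = √(R^2+t^2) := by
  unfold NN vl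
  congr 1
  simp
  linear_combination R^2 * sin_sq_add_cos_sq θ0

lemma vl_dt (R θ0 t θ : ℝ) : dt (vl R θ0 t) θ = R * cos (θ-θ0) := by
  simp [dt, vl, cos_sub]; ring

/-- boundary kernel -/
noncomputable def Qf (μ s : ℝ) : ℝ := s * PW (dj μ) ((1+s)/2)

lemma Qf_cont {M : ℕ} {μ : ℝ} (h1 : (M:ℝ) ≤ μ) (h2 : μ ≤ M+1) : ContinuousOn (Qf μ) (Icc (-1) 1) := by
  unfold Qf
  refine continuousOn_id.mul ((dj_cont h1 h2).comp (by fun_prop) ?_)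
  intro s hs
  exact ⟨by linarith [hs.1], by linarith [hs.2]⟩

lemma PP_form {R t N : ℝ} (hR : 0 < R) (ht : 0 < t) (hN : 0 < N) (hN2 : N^2 = R^2+t^2) (α : ℝ) :
    t / (N - R * cos α) = PP ((N-t)/R) α := by
  have hNR : R < N := by nlinarith
  have hNt : t < N := by nlinarith
  have h0 : 0 ≤ (N-t)/R := div_nonneg (by linarith) hR.le
  have h1 : (N-t)/R < 1 := by rw [div_lt_one hR]; nlinarith
  have hD := Dn_pos (t := α) h0 h1
  have hpos : 0 < N - R * cos α := by nlinarith [cos_le_one α]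
  rw [PP, div_eq_div_iff hpos.ne' hD.ne', Dn]
  have hr : (N-t)/R*R = N-t := div_mul_cancel₀ _ hR.ne'
  have hr2 : ((N-t)/R)^2*R^2 = (N-t)^2 := by rw [← mul_pow, hr]
  set r := (N-t)/R
  have hR2 : R^2 ≠ 0 := by positivity
  refine mul_right_cancel₀ hR2 ?_
  have e1 : t*(1-2*r*cos α+r^2)*R^2 = t*(R^2 - 2*(r*R)*R*cos α + r^2*R^2) := by ring
  have e2 : (1-r^2)*(N-R*cos α)*R^2 = (R^2-r^2*R^2)*(N-R*cos α) := by ring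
  rw [e1, e2, hr2, hr]
  linear_combination (-t+N-R*cos α) * hN2

namespace Dat
variable {m M : ℕ} {μ b C : ℝ} {ψ : ℝ → ℝ} {a : ℕ → ℝ} (D : Dat m M μ b C ψ a)

lemma vl_VV {t : ℝ} (ht : 0 < t) (R θ0 : ℝ) : vl R θ0 t ∈ VV m μ ψ := by
  rintro ⟨h, _⟩
  simp [vl] at h
  exact ht.ne' h

include D in
lemma vert_d {x : Fin 3 → ℝ} (hx : x ∈ VV m μ ψ) : HasFDerivAt (sol μ (wt m ψ)) (fderiv ℝ (sol μ (wt m ψ)) x) x :=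
  ((D.smooth.contDiffAt (D.VV_open.mem_nhds hx)).differentiableAt (by norm_num)).hasFDerivAt

include D in
lemma vert_pq {x : Fin 3 → ℝ} (hx : x ∈ VV m μ ψ) : pq 2 (sol μ (wt m ψ)) x = JJ (KK m b) (wt m ψ) (dq 2 (Ph μ)) x := by
  rw [← JJ_pq (KK_compact m b) D.wt_meas D.wt_bd D.VV_open D.VV_WW WW_open (Ph_contDiff D.h1.le D.h2.le 1) hx 2]
  have : sol μ (wt m ψ) =ᶠ[nhds x] JJ (KK m b) (wt m ψ) (Ph μ) := by
    filter_upwards [D.VV_open.mem_nhds hx] with z hz using D.repV hz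
  rw [pq, this.fderiv_eq, pq]

include D in
lemma vert_pt {R t : ℝ} (hR : 0 < R) (ht : 0 < t) (θ0 : ℝ) {θ : ℝ} (hθ : θ ∈ KK m b) :
    dq 2 (Ph μ) (vl R θ0 t, θ) = μ * t * (√(R^2+t^2))^(-2:ℝ) * Ph μ (vl R θ0 t, θ)
      - (√(R^2+t^2))^(μ-1) * (PP ((√(R^2+t^2)-t)/R) (θ-θ0) * Qf μ (R/√(R^2+t^2) * cos (θ-θ0))) := by
  have hW : (vl R θ0 t, θ) ∈ WW := D.VV_WW ⟨vl_VV ht R θ0, hθ⟩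
  have hd : DifferentiableAt ℝ (Ph μ) (vl R θ0 t, θ) :=
    ((Ph_contDiff D.h1.le D.h2.le 1).contDiffAt (WW_open.mem_nhds hW)).differentiableAt (by norm_num)
  have htau := WW_tau hW
  have hp := WW_pos hW
  simp only at htau hp
  have hk := kk_d D.h1.le D.h2.le htau
  rw [dq_eq hd]
  change pq 2 (Az θ μ (kk μ)) (vl R θ0 t) = _
  rw [Az_pq hp hk]
  simp only [Ph, Az]
  rw [vl_dt, vl_NN] at *
  set N := √(R^2+t^2) with hN
  have hN2 : N^2 = R^2+t^2 := Real.sq_sqrt (by positivity)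
  rw [← PP_form hR ht hp hN2]
  have hq : qv θ 2 = 0 := by simp [qv]
  have hy : vl R θ0 t 2 = t := by simp [vl]
  have hτ : R / N * cos (θ-θ0) = R * cos (θ-θ0) / N := by ring
  rw [hq, hy, hτ, Qf]
  have hps := dj_PS D.h1.le D.h2.le (half_abs htau)
  set τ := R * cos (θ-θ0) / N with hτd
  have hRc : R * cos (θ-θ0) = N * τ := by rw [hτd]; field_simp
  rw [hRc, ← hps, kk1]
  have h1τ : 1 - τ ≠ 0 := by linarith [htau.2]
  have hp1 : N^(μ-2) = N^(-2:ℝ) * N^μ := by rw [← Real.rpow_add hp]; congr 1; ring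
  have hp2 : N^(μ-1) = N * N^(μ-2) := by
    nth_rewrite 2 [← Real.rpow_one N]; rw [← Real.rpow_add hp]; congr 1; ring
  rw [hp2]
  have e3 : t/(N-N*τ) = t / (N * (1-τ)) := by congr 1; ring
  rw [e3]
  have e4 : N * N^(μ-2) * (t/(N*(1-τ)) * (τ * ((1-(1+τ)/2) * PW (dc (cc μ)) ((1+τ)/2))))
      = N^(μ-2) * (t * τ * (PW (dc (cc μ)) ((1+τ)/2)/2)) := by
    field_simp; ring
  rw [e4, hp1]; ring

include D in
lemma vert_int {R t : ℝ} (hR : 0 < R) (ht : 0 < t) (θ0 : ℝ) :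
    pq 2 (sol μ (wt m ψ)) (vl R θ0 t) = μ * t * (√(R^2+t^2))^(-2:ℝ) * sol μ (wt m ψ) (vl R θ0 t)
      - (√(R^2+t^2))^(μ-1) * ∫ α in (0:ℝ)..π, (wt m ψ (θ0+α) + wt m ψ (-θ0+α)) * Qf μ (R/√(R^2+t^2) * cos α)
        * PP ((√(R^2+t^2)-t)/R) α := by
  have hx : vl R θ0 t ∈ VV m μ ψ := vl_VV ht R θ0
  rw [D.vert_pq hx, D.repV hx]
  set N := √(R^2+t^2) with hN
  have hN2 : N^2 = R^2+t^2 := Real.sq_sqrt (by positivity)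
  have hN0 : 0 < N := Real.sqrt_pos.2 (by positivity)
  have hNR : R < N := by nlinarith
  have hNt : t < N := by nlinarith
  set r := (N-t)/R with hr
  have h0 : 0 ≤ r := div_nonneg (by linarith) hR.le
  have h1 : r < 1 := by rw [hr, div_lt_one hR]; nlinarith
  set g : ℝ → ℝ := fun α => PP r α * Qf μ (R/N * cos α) with hg
  have hρ : 0 ≤ R/N ∧ R/N ≤ 1 := ⟨by positivity, (div_le_one hN0).2 hNR.le⟩
  have hgc : Continuous g := by
    refine (PP_cont h0 h1).mul ((Qf_cont D.h1.le D.h2.le).comp_continuous (by fun_prop) fun α => ?_)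
    have := neg_one_le_cos α; have := cos_le_one α
    exact ⟨by nlinarith, by nlinarith⟩
  have hgc' : Continuous fun θ => g (θ-θ0) := hgc.comp (by fun_prop)
  have hsub : KK m b ⊆ Icc (-π) π := inter_subset_left
  have hi2 : Integrable (fun θ => wt m ψ θ * g (θ-θ0)) (volume.restrict (KK m b)) :=
    (intK D.wt_meas D.wt_bd hgc' (-π) π).mono_set hsub
  have hPc : ContinuousOn (Ph μ) WW := (Ph_contDiff D.h1.le D.h2.le 1).continuousOn
  have hi1 : Integrable (fun θ => wt m ψ θ * Ph μ (vl R θ0 t, θ)) (volume.restrict (KK m b)) := by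
    have : IsFiniteMeasure (volume.restrict (KK m b)) := ⟨by simpa using (KK_compact m b).measure_lt_top⟩
    obtain ⟨ε, he, hb, B, hB⟩ := unif_bound (KK_compact m b) D.wt_bd D.VV_open D.VV_WW hPc hx
    refine Integrable.of_bound (meas_slice (KK_compact m b) D.wt_meas D.VV_WW hPc hx) (C*B) ?_
    rw [ae_restrict_iff' (KK_compact m b).measurableSet]
    exact Eventually.of_forall fun θ hθ => (hB _ (Metric.mem_ball_self he) θ hθ).2
  have e1 : JJ (KK m b) (wt m ψ) (dq 2 (Ph μ)) (vl R θ0 t)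
      = μ * t * N^(-2:ℝ) * JJ (KK m b) (wt m ψ) (Ph μ) (vl R θ0 t)
        - N^(μ-1) * ∫ θ in KK m b, wt m ψ θ * g (θ-θ0) := by
    unfold JJ
    rw [← integral_const_mul, ← integral_const_mul, ← integral_sub (hi1.const_mul _) (hi2.const_mul _)]
    refine setIntegral_congr_fun (KK_compact m b).measurableSet fun θ hθ => ?_
    beta_reduce
    rw [D.vert_pt hR ht θ0 hθ]
    simp only [hg]; ring
  rw [e1]
  congr 2
  have e2 : ∫ θ in KK m b, wt m ψ θ * g (θ-θ0) = ∫ θ in (-π)..π, wt m ψ θ * g (θ-θ0) := by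
    rw [← Icc_eq]
    exact (D.JJ_K (fun p => g (p.2-θ0)) 0).symm
  set F : ℝ → ℝ := fun θ => wt m ψ θ * g (θ-θ0) with hF
  have hgper : ∀ α, g (α+2*π) = g α := by
    intro α; simp only [hg, PP, Dn, cos_add_two_pi]
  have hper : Function.Periodic F (2*π) := by
    intro θ
    simp only [hF]
    rw [wt_per, show θ+2*π-θ0 = (θ-θ0)+2*π by ring, hgper]
  have e3 : ∫ θ in (-π)..π, F θ = ∫ α in (-π)..π, F (θ0+α) := by
    have h3 := hper.intervalIntegral_add_eq (-π) (θ0-π)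
    rw [show -π+2*π=π by ring, show θ0-π+2*π = θ0+π by ring] at h3
    rw [h3, intervalIntegral.integral_comp_add_left (fun x => F x) θ0]
    congr 1
  rw [e2, e3]
  have hIntg : ∀ c d, IntervalIntegrable (fun α => F (θ0+α)) volume c d := by
    intro c d
    have hme : Measurable fun α => wt m ψ (θ0+α) := D.wt_meas.comp (by fun_prop)
    have hf : (fun α => F (θ0+α)) = fun α => wt m ψ (θ0+α) * g α := by
      funext α; simp only [hF, add_sub_cancel_left]
    rw [hf]
    exact ⟨(intK hme (fun α => D.wt_bd _) hgc c d).mono_set Ioc_subset_Icc_self,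
      (intK hme (fun α => D.wt_bd _) hgc d c).mono_set Ioc_subset_Icc_self⟩
  have hIntg' : IntervalIntegrable (fun α => F (θ0+-α)) volume 0 π := by
    have hme : Measurable fun α => wt m ψ (θ0+-α) := D.wt_meas.comp (by fun_prop)
    have hgn : Continuous fun α => g (-α) := hgc.comp (by fun_prop)
    have hf : (fun α => F (θ0+-α)) = fun α => wt m ψ (θ0+-α) * g (-α) := by
      funext α; simp only [hF, add_sub_cancel_left]
    rw [hf]
    exact ⟨(intK hme (fun α => D.wt_bd _) hgn 0 π).mono_set Ioc_subset_Icc_self,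
      (intK hme (fun α => D.wt_bd _) hgn π 0).mono_set Ioc_subset_Icc_self⟩
  rw [← intervalIntegral.integral_add_adjacent_intervals (hIntg (-π) 0) (hIntg 0 π)]
  have h4 := intervalIntegral.integral_comp_neg (a := 0) (b := π) (fun α => F (θ0+α))
  rw [neg_zero] at h4
  rw [← h4, ← intervalIntegral.integral_add hIntg' (hIntg 0 π)]
  refine intervalIntegral.integral_congr fun α _ => ?_
  simp only [hF, hg, add_sub_cancel_left]
  have h5 : wt m ψ (θ0+-α) = wt m ψ (-θ0+α) := by rw [← wt_even]; congr 1; ring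
  have h6 : PP r (-α) = PP r α := by simp [PP, Dn]
  rw [h5, h6, cos_neg]; ring

include D in
lemma upper_contact {R : ℝ} (hR : 0 < R) (θ0 : ℝ) (h0 : sol μ (wt m ψ) (vl R θ0 0) = 0) :
    ∃ d, d ≤ 0 ∧ Tendsto (fun t => (sol μ (wt m ψ) (vl R θ0 t) - sol μ (wt m ψ) (vl R θ0 0))/t)
      (nhdsWithin 0 (Ioi 0)) (nhds d) := by
  obtain ⟨L1, hL1, ht1⟩ := D.wt_lim θ0
  obtain ⟨L2, hL2, ht2⟩ := D.wt_lim (-θ0)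
  have hQc := Qf_cont D.h1.le D.h2.le
  obtain ⟨BQ, hBQ⟩ := isCompact_Icc.exists_bound_of_continuousOn hQc
  have hQ1 : 0 ≤ Qf μ 1 := by
    have := dj_one D.par.oddM D.h1 D.h2
    rw [Qf, show ((1:ℝ)+1)/2 = 1 by norm_num, one_mul]; exact this
  have hpi := pi_pos
  have hyc : Continuous (vl R θ0) := continuous_iff_continuousAt.2 fun t => (vl_d R θ0 t).continuousAt
  have hNc : Continuous fun t : ℝ => √(R^2+t^2) := by fun_prop
  have hN0 : √(R^2+0^2) = R := by simp [Real.sqrt_sq hR.le]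
  have hNt : Tendsto (fun t : ℝ => √(R^2+t^2)) (nhdsWithin 0 (Ioi 0)) (nhds R) := by
    have := hNc.tendsto 0
    rw [hN0] at this
    exact this.mono_left nhdsWithin_le_nhds
  have htt : Tendsto (fun t : ℝ => t) (nhdsWithin 0 (Ioi 0)) (nhds 0) := tendsto_id.mono_left nhdsWithin_le_nhds
  have hev : ∀ᶠ t : ℝ in nhdsWithin 0 (Ioi 0), 0 < t := self_mem_nhdsWithin
  have hfac : ∀ t : ℝ, 0 < t → R < √(R^2+t^2) ∧ t < √(R^2+t^2) ∧ √(R^2+t^2) < R + t := by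
    intro t ht
    refine ⟨Real.lt_sqrt_of_sq_lt (by nlinarith), Real.lt_sqrt_of_sq_lt (by nlinarith), ?_⟩
    rw [Real.sqrt_lt' (by linarith)]; nlinarith
  have hρm : ∀ t : ℝ, 0 < t → ∀ α, R/√(R^2+t^2) * cos α ∈ Icc (-1:ℝ) 1 := by
    intro t ht α
    have h1 := (hfac t ht).1
    have h2 : R/√(R^2+t^2) ≤ 1 := (div_le_one (by linarith)).2 h1.le
    have h3 : 0 ≤ R/√(R^2+t^2) := by positivity
    have := neg_one_le_cos α; have := cos_le_one α
    exact ⟨by nlinarith, by nlinarith⟩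
  have hPlim := poisson_lim (l := nhdsWithin 0 (Ioi 0)) (r := fun t => (√(R^2+t^2)-t)/R)
    (h := fun t α => (wt m ψ (θ0+α) + wt m ψ (-θ0+α)) * Qf μ (R/√(R^2+t^2) * cos α)) (B := (C+C)*BQ)
    (L := (L1+L2) * Qf μ 1) ?_ ?_ ?_ ?_ ?_
  · have hcs : Tendsto (fun t => sol μ (wt m ψ) (vl R θ0 t)) (nhdsWithin 0 (Ioi 0)) (nhds 0) := by
      have := (D.cont.comp hyc).tendsto 0
      simp only [Function.comp, h0] at this
      exact this.mono_left nhdsWithin_le_nhds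
    have hA : Tendsto (fun t => pq 2 (sol μ (wt m ψ)) (vl R θ0 t)) (nhdsWithin 0 (Ioi 0))
        (nhds (μ * 0 * R^(-2:ℝ) * 0 - R^(μ-1) * (π * ((L1+L2) * Qf μ 1)))) := by
      have hlim := (((htt.const_mul μ).mul (hNt.rpow_const (p := -2) (Or.inl hR.ne'))).mul hcs).sub
        ((hNt.rpow_const (p := μ-1) (Or.inl hR.ne')).mul hPlim)
      refine hlim.congr' ?_
      filter_upwards [hev] with t ht
      rw [D.vert_int hR ht θ0]
    refine ⟨μ * 0 * R^(-2:ℝ) * 0 - R^(μ-1) * (π * ((L1+L2) * Qf μ 1)), ?_, ?_⟩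
    · have : 0 ≤ R^(μ-1) * (π * ((L1+L2) * Qf μ 1)) := by positivity
      linarith [mul_zero (μ * 0 * R^(-2:ℝ))]
    · have hder : ∀ t : ℝ, 0 < t → HasDerivAt (fun t => sol μ (wt m ψ) (vl R θ0 t)) (pq 2 (sol μ (wt m ψ)) (vl R θ0 t)) t := by
        intro t ht
        exact (D.vert_d (vl_VV ht R θ0)).comp_hasDerivAt t (vl_d R θ0 t)
      have hW := hasDerivWithinAt_Ici_of_tendsto_deriv (s := Ioi 0) (a := 0) (f := fun t => sol μ (wt m ψ) (vl R θ0 t))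
        (e := μ * 0 * R^(-2:ℝ) * 0 - R^(μ-1) * (π * ((L1+L2) * Qf μ 1)))
        (fun t ht => (hder t ht).differentiableAt.differentiableWithinAt)
        (D.cont.comp hyc).continuousWithinAt self_mem_nhdsWithin (hA.congr' (by
          filter_upwards [hev] with t ht
          exact (hder t ht).deriv.symm))
      have hW2 := (hasDerivWithinAt_iff_tendsto_slope' (by simp)).1 (hW.mono Ioi_subset_Ici_self)
      refine hW2.congr fun t => ?_
      rw [slope_def_field, sub_zero]
  · filter_upwards [hev] with t ht
    obtain ⟨h1, h2, h3⟩ := hfac t ht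
    exact ⟨div_nonneg (by linarith) hR.le, by rw [div_lt_one hR]; linarith⟩
  · have := (hNt.sub htt).div_const R
    rwa [sub_zero, div_self hR.ne'] at this
  · filter_upwards [hev] with t ht
    refine Measurable.mul ?_ ?_
    · exact (D.wt_meas.comp (by fun_prop)).add (D.wt_meas.comp (by fun_prop))
    · exact (hQc.comp_continuous (by fun_prop) (hρm t ht)).measurable
  · filter_upwards [hev] with t ht α
    rw [abs_mul]
    have h1 := hBQ _ (hρm t ht α)
    have h2 : |wt m ψ (θ0+α) + wt m ψ (-θ0+α)| ≤ C + C := (abs_add_le _ _).trans (add_le_add (D.wt_bd _) (D.wt_bd _))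
    exact mul_le_mul h2 h1 (abs_nonneg _) ((abs_nonneg _).trans h2)
  · refine Tendsto.mul ((ht1.add ht2).comp tendsto_snd) ?_
    have hc1 : Tendsto (Qf μ) (nhdsWithin 1 (Icc (-1) 1)) (nhds (Qf μ 1)) := hQc 1 (by norm_num)
    refine hc1.comp (tendsto_nhdsWithin_iff.2 ⟨?_, ?_⟩)
    · have hρt : Tendsto (fun t : ℝ => R/√(R^2+t^2)) (nhdsWithin 0 (Ioi 0)) (nhds 1) := by
        have := (tendsto_const_nhds (x := R)).div hNt hR.ne'
        rwa [div_self hR.ne'] at this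
      have hct : Tendsto cos (nhdsWithin 0 (Ioi 0)) (nhds 1) := by
        have := continuous_cos.tendsto 0
        rw [cos_zero] at this
        exact this.mono_left nhdsWithin_le_nhds
      have := (hρt.comp (tendsto_fst (g := nhdsWithin (0:ℝ) (Ioi 0)))).mul (hct.comp (tendsto_snd (f := nhdsWithin (0:ℝ) (Ioi 0))))
      rwa [one_mul] at this
    · filter_upwards [tendsto_fst.eventually hev] with p hp
      exact hρm _ hp _

end Dat
end TO

open Real Set Filter MeasureTheory

namespace TO

/-! ### Part D8 : the solution for `m ≥ 3` -/

lemma upper_even {u : (Fin 3 → ℝ) → ℝ} {x : Fin 3 → ℝ} (hd : DifferentiableAt ℝ u x)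
    (he : ∀ t : ℝ, u (x + (-t) • (Pi.single 2 1 : Fin 3 → ℝ)) = u (x + t • (Pi.single 2 1 : Fin 3 → ℝ))) :
    HasUpperDeriv u 2 x 0 := by
  set f : ℝ → ℝ := fun t => u (x + t • (Pi.single 2 1 : Fin 3 → ℝ)) with hf
  have h1 : HasDerivAt (fun t : ℝ => x + t • (Pi.single 2 1 : Fin 3 → ℝ)) ((1:ℝ) • (Pi.single 2 1 : Fin 3 → ℝ)) 0 :=
    ((hasDerivAt_id' (0:ℝ)).smul_const _).const_add x
  have hd' : HasFDerivAt u (fderiv ℝ u x) (x + (0:ℝ) • (Pi.single 2 1 : Fin 3 → ℝ)) := by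
    rw [zero_smul, add_zero]; exact hd.hasFDerivAt
  have h2 : DifferentiableAt ℝ f 0 := (hd'.comp_hasDerivAt (0:ℝ) h1).differentiableAt
  have h3 : HasDerivAt f (deriv f 0) 0 := h2.hasDerivAt
  have h4 : HasDerivAt (fun t => f (-t)) (-deriv f 0) 0 := by
    have h3' : HasDerivAt f (deriv f 0) (-0) := by rw [neg_zero]; exact h3
    have h8 := h3'.comp (0:ℝ) (hasDerivAt_neg' (0:ℝ))
    refine (h8 : HasDerivAt (fun t => f (-t)) _ 0).congr_deriv (by ring)
  have h5 : (fun t => f (-t)) = f := funext he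
  rw [h5] at h4
  have h6 : deriv f 0 = 0 := by have := h3.unique h4; linarith
  rw [h6] at h3
  have h7 := (hasDerivWithinAt_iff_tendsto_slope' (s := Ioi (0:ℝ)) (by simp)).1 h3.hasDerivWithinAt
  refine h7.congr fun t => ?_
  rw [slope_def_field, sub_zero, hf]
  simp

lemma upper_zero {u : (Fin 3 → ℝ) → ℝ} {μ : ℝ} (hμ : 1 < μ) (h0 : u 0 = 0)
    (hh : ∀ r : ℝ, 0 < r → ∀ x, u (r • x) = r^μ * u x) : HasUpperDeriv u 2 0 0 := by
  have h1 : Tendsto (fun t : ℝ => t^(μ-1) * u (Pi.single 2 1)) (nhdsWithin 0 (Ioi 0)) (nhds (0^(μ-1) * u (Pi.single 2 1))) := by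
    refine Tendsto.mul_const _ ?_
    exact ((Real.continuous_rpow_const (by linarith)).tendsto 0).mono_left nhdsWithin_le_nhds
  rw [Real.zero_rpow (by linarith), zero_mul] at h1
  refine h1.congr' ?_
  filter_upwards [self_mem_nhdsWithin] with t ht
  have ht' : (0:ℝ) < t := ht
  rw [zero_add, hh t ht', h0, sub_zero, Real.rpow_sub_one ht'.ne']
  ring

namespace Dat
variable {m M : ℕ} {μ b C : ℝ} {ψ : ℝ → ℝ} {a : ℕ → ℝ} (D : Dat m M μ b C ψ a)

include D in
lemma upper (x : Fin 3 → ℝ) (hx : x 2 = 0) : ∃ d, d ≤ 0 ∧ HasUpperDeriv (sol μ (wt m ψ)) 2 x d := by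
  by_cases hV : x ∈ VV m μ ψ
  · refine ⟨0, le_refl _, upper_even (D.vert_d hV).differentiableAt fun t => ?_⟩
    refine sol_congr μ _ ?_ ?_ ?_ <;> simp [hx]
  · have hc : x 2 = 0 ∧ sol μ (wt m ψ) x = 0 := by
      by_contra h; exact hV h
    obtain ⟨R, θ0, hR, hxe⟩ := plane_form x hx
    rcases hR.eq_or_lt with h | h
    · have hx0 : x = 0 := by
        rw [hxe, ← h]; ext i; fin_cases i <;> simp
      rw [hx0]
      have hμ : 1 < μ := by
        have := D.h1
        have h3 : 3 ≤ M := D.par.m3.trans D.par.mM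
        have : (3:ℝ) ≤ M := by exact_mod_cast h3
        linarith
      exact ⟨0, le_refl _, upper_zero hμ D.sol_zero fun r hr y => sol_homog μ _ hr y⟩
    · have hxv : x = vl R θ0 0 := hxe
      rw [hxv] at hc ⊢
      obtain ⟨d, hd, ht⟩ := D.upper_contact h θ0 hc.2
      refine ⟨d, hd, ?_⟩
      unfold HasUpperDeriv
      simp only [vl_add]
      exact ht

include D in
lemma isSol : IsTOPSol μ (sol μ (wt m ψ)) 2 where
  cont := D.cont
  symm x := by
    refine sol_congr μ _ ?_ ?_ ?_ <;> simp
  homog r hr x := sol_homog μ _ hr x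
  smooth := D.smooth
  harm x hx := D.harm hx
  nonneg := D.sol_nonneg
  upper := D.upper

include D in
lemma contact_eq : contactSet (sol μ (wt m ψ)) 2 = slitCone m ((π-b)/π) := by
  ext x
  exact D.contact_iff x

end Dat

lemma main_ge3 {m k : ℕ} (hm : Odd m) (h3 : 3 ≤ m) (hk : 1 ≤ k) (hkm : (k:ℝ) ≤ 1 + 1/100*m/2) :
    ∃ (μ σ : ℝ) (u : (Fin 3 → ℝ) → ℝ),
        (m : ℝ) + 2 * k - 2 ≤ μ ∧ μ ≤ (m : ℝ) + 2 * k - 1 ∧ 0 < σ ∧ σ < 1 ∧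
        IsTOPSol μ u 2 ∧ u ≠ 0 ∧ contactSet u 2 = slitCone m σ := by
  have hP := par_of hm h3 hk hkm
  obtain ⟨μ, p, H⟩ := exists_Ext hP
  obtain ⟨b, C, ψ, D⟩ := H.exists_Dat
  have hM : ((m+2*k-2 : ℕ):ℝ) = m+2*k-2 := by
    rw [Nat.cast_sub (by omega)]; push_cast; ring
  have h1 := D.h1
  have h2 := D.h2
  rw [hM] at h1 h2
  have hpi := pi_pos
  refine ⟨μ, (π-b)/π, sol μ (wt m ψ), h1.le, by linarith, ?_, ?_, D.isSol, D.sol_ne, D.contact_eq⟩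
  · exact div_pos (by linarith [D.bpi]) hpi
  · rw [div_lt_one hpi]; linarith [D.b0]

end TO

open Real Set Filter MeasureTheory

namespace TO

/-! ### Part E : the explicit solution for `m = 1` -/

noncomputable def rr (x : Fin 3 → ℝ) : ℝ := √(x 0^2 + x 2^2)
noncomputable def pp (x : Fin 3 → ℝ) : ℝ := √((rr x - x 0)/2)
noncomputable def u1 (x : Fin 3 → ℝ) : ℝ := -(pp x * (rr x + 2 * x 0))

lemma rr_sq (x : Fin 3 → ℝ) : rr x^2 = x 0^2 + x 2^2 := Real.sq_sqrt (by positivity)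
lemma rr_nonneg (x : Fin 3 → ℝ) : 0 ≤ rr x := Real.sqrt_nonneg _
lemma rr_cont : Continuous rr := by unfold rr; fun_prop
lemma rr_ge (x : Fin 3 → ℝ) : |x 0| ≤ rr x := Real.abs_le_sqrt (by nlinarith [sq_nonneg (x 2)])
lemma pp_nonneg (x : Fin 3 → ℝ) : 0 ≤ pp x := Real.sqrt_nonneg _
lemma pp_sq (x : Fin 3 → ℝ) : 2 * pp x^2 = rr x - x 0 := by
  have := (abs_le.1 (rr_ge x)).2
  unfold pp; rw [Real.sq_sqrt (by linarith)]; ring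
lemma pp_cont : Continuous pp := by
  unfold pp
  have := rr_cont
  fun_prop
lemma u1_cont : Continuous u1 := by
  unfold u1
  have := rr_cont
  have := pp_cont
  fun_prop

lemma rr_plane {x : Fin 3 → ℝ} (h : x 2 = 0) : rr x = |x 0| := by
  unfold rr; rw [h]; simp [Real.sqrt_sq_eq_abs]

def V1 : Set (Fin 3 → ℝ) := {x | x 0 < rr x}

lemma V1_open : IsOpen V1 := isOpen_lt (by fun_prop) rr_cont

lemma V1_r {x : Fin 3 → ℝ} (h : x ∈ V1) : 0 < rr x := by
  have h1 : x 0 < rr x := h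
  rcases (rr_nonneg x).eq_or_lt with h2 | h2
  · have := (abs_le.1 (rr_ge x)).1; linarith
  · exact h2

lemma V1_p {x : Fin 3 → ℝ} (h : x ∈ V1) : 0 < pp x := by
  have h1 : x 0 < rr x := h
  exact Real.sqrt_pos.2 (by linarith)

lemma u1_zero {x : Fin 3 → ℝ} (h : x 2 = 0) (h0 : 0 ≤ x 0) : u1 x = 0 := by
  have h1 : pp x = 0 := by unfold pp; rw [rr_plane h, abs_of_nonneg h0]; simp
  unfold u1; rw [h1]; ring

lemma u1_pos {x : Fin 3 → ℝ} (h : x 2 = 0) (h0 : x 0 < 0) : 0 < u1 x := by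
  have h2 : x ∈ V1 := by
    show x 0 < rr x
    exact lt_of_lt_of_le h0 (rr_nonneg x)
  have h1 := V1_p h2
  unfold u1; rw [rr_plane h, abs_of_neg h0]; nlinarith

lemma u1_contact (x : Fin 3 → ℝ) : x ∈ contactSet u1 2 ↔ x 2 = 0 ∧ 0 ≤ x 0 := by
  constructor
  · rintro ⟨h1, h2⟩
    refine ⟨h1, ?_⟩
    by_contra h
    exact (u1_pos h1 (not_le.1 h)).ne' h2
  · rintro ⟨h1, h2⟩
    exact ⟨h1, u1_zero h1 h2⟩

lemma V1_of {x : Fin 3 → ℝ} (h : x ∈ (contactSet u1 2)ᶜ) : x ∈ V1 := by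
  by_contra h1
  have h2 : rr x ≤ x 0 := not_lt.1 h1
  refine h ((u1_contact x).2 ⟨?_, (rr_nonneg x).trans h2⟩)
  have := rr_sq x
  have := rr_nonneg x
  have : x 2^2 ≤ 0 := by nlinarith
  nlinarith [sq_nonneg (x 2), pow_eq_zero_iff (two_ne_zero) |>.1 (le_antisymm this (sq_nonneg _))]

lemma rr_d {x : Fin 3 → ℝ} (h : x ∈ V1) : HasFDerivAt rr (lin ![x 0 / rr x, 0, x 2 / rr x]) x := by
  have hr := V1_r h
  have h0 : x 0^2 + x 2^2 ≠ 0 := by rw [← rr_sq]; positivity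
  have h1 := (((proj_d 0 x).pow 2).add ((proj_d 2 x).pow 2)).sqrt h0
  refine h1.congr_fderiv ?_
  ext v
  have e : √(x 0^2 + x 2^2) = rr x := rfl
  simp [lin_apply, e]
  field_simp

lemma pp_d {x : Fin 3 → ℝ} (h : x ∈ V1) :
    HasFDerivAt pp (lin ![-pp x / (2*rr x), 0, x 2 / (4 * pp x * rr x)]) x := by
  have hr := V1_r h
  have hp := V1_p h
  have hx : x 0 < rr x := h
  have h0 : (1/2:ℝ) * (rr x - x 0) ≠ 0 := by linarith
  have h1 := (((rr_d h).sub (proj_d 0 x)).const_mul (1/2:ℝ)).sqrt h0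
  have e2 : pp = fun y => √((1/2:ℝ) * (rr y - y 0)) := by
    funext y; unfold pp; congr 1; ring
  have e : √((1/2:ℝ) * (rr - fun y : Fin 3 → ℝ => y 0) x) = pp x := by rw [e2]; rfl
  have h2 := h1.congr_of_eventuallyEq (f₁ := pp) (Eventually.of_forall fun y => congrFun e2 y)
  refine HasFDerivAt.congr_fderiv h2 ?_
  ext v
  have hq := pp_sq x
  have hx0 : x 0 = rr x - 2 * pp x^2 := by linarith
  rw [e]
  simp only [lin_apply, ContinuousLinearMap.smul_apply, ContinuousLinearMap.sub_apply,
    ContinuousLinearMap.proj_apply, smul_eq_mul, Matrix.cons_val]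
  rw [hx0]
  field_simp
  ring

lemma u1_d {x : Fin 3 → ℝ} (h : x ∈ V1) :
    HasFDerivAt u1 (lin ![-(3/2) * pp x, 0, -(3/2) * (x 2 / (2 * pp x))]) x := by
  have hr := V1_r h
  have hp := V1_p h
  have hq := pp_sq x
  have h1 := ((pp_d h).mul ((rr_d h).add ((proj_d 0 x).const_mul 2))).neg
  refine HasFDerivAt.congr_fderiv h1 ?_
  ext v
  have hx0 : x 0 = rr x - 2 * pp x^2 := by linarith
  simp [lin_apply]
  rw [hx0]
  field_simp
  ring

lemma q1_d {x : Fin 3 → ℝ} (h : x ∈ V1) :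
    ∃ c, HasFDerivAt (fun y => -(3/2) * (y 2 / (2 * pp y))) (lin ![c, 0, -(3/2) * (pp x / (2 * rr x))]) x := by
  have hr := V1_r h
  have hp := V1_p h
  have hq := pp_sq x
  have hs := rr_sq x
  have h1 := (((proj_d 2 x).mul ((hasDerivAt_inv (by positivity : 2 * pp x ≠ 0)).comp_hasFDerivAt x ((pp_d h).const_mul 2))).const_mul (-(3/2):ℝ))
  refine ⟨-(3/2) * (x 2 / (4 * pp x * rr x)), ?_⟩
  have e2 : (fun y : Fin 3 → ℝ => -(3/2) * (y 2 / (2 * pp y))) = fun y => -(3/2) * (y 2 * (2 * pp y)⁻¹) := by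
    funext y; congr 1
  rw [e2]
  refine HasFDerivAt.congr_fderiv h1 ?_
  ext v
  have hx0 : x 0 = rr x - 2 * pp x^2 := by linarith
  have hx2 : x 2^2 = 2 * pp x^2 * (2 * rr x - 2 * pp x^2) := by rw [hx0] at hs; linarith
  simp [lin_apply]
  field_simp
  linear_combination (2 * v 2) * hx2

lemma u1_pd {x : Fin 3 → ℝ} (h : x ∈ V1) (i : Fin 3) :
    pd i u1 =ᶠ[nhds x] fun y => (![-(3/2) * pp y, 0, -(3/2) * (y 2 / (2 * pp y))] : Fin 3 → ℝ) i := by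
  filter_upwards [V1_open.mem_nhds h] with y hy
  unfold pd
  rw [(u1_d hy).fderiv, lin_single]

lemma u1_harm {x : Fin 3 → ℝ} (h : x ∈ V1) : lap u1 x = 0 := by
  have hr := V1_r h
  unfold lap
  rw [Fin.sum_univ_three]
  have h0 : pd 0 (pd 0 u1) x = -(3/2) * (-pp x / (2*rr x)) := by
    show fderiv ℝ (pd 0 u1) x (Pi.single 0 1) = _
    rw [(u1_pd h 0).fderiv_eq]
    have := ((pp_d h).const_mul (-(3/2):ℝ)).fderiv
    simp only [Matrix.cons_val_zero]
    rw [this]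
    simp [lin_single]
  have h1 : pd 1 (pd 1 u1) x = 0 := by
    show fderiv ℝ (pd 1 u1) x (Pi.single 1 1) = _
    rw [(u1_pd h 1).fderiv_eq]
    simp
  have h2 : pd 2 (pd 2 u1) x = -(3/2) * (pp x / (2*rr x)) := by
    show fderiv ℝ (pd 2 u1) x (Pi.single 2 1) = _
    rw [(u1_pd h 2).fderiv_eq]
    obtain ⟨c, hc⟩ := q1_d h
    have e : (fun y : Fin 3 → ℝ => (![-(3/2) * pp y, 0, -(3/2) * (y 2 / (2 * pp y))] : Fin 3 → ℝ) 2)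
      = fun y => -(3/2) * (y 2 / (2 * pp y)) := by funext y; simp
    rw [e, hc.fderiv, lin_single]
    simp
  rw [h0, h1, h2]; ring

lemma u1_smooth {x : Fin 3 → ℝ} (h : x ∈ V1) : ContDiffAt ℝ 2 u1 x := by
  have hr := V1_r h
  have hx : x 0 < rr x := h
  have hR : ContDiffAt ℝ 2 rr x := by
    have h0 : x 0^2 + x 2^2 ≠ 0 := by rw [← rr_sq]; positivity
    unfold rr
    exact ContDiffAt.sqrt (by fun_prop) h0
  have hP : ContDiffAt ℝ 2 pp x := by
    have h0 : (rr x - x 0)/2 ≠ 0 := by linarith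
    unfold pp
    exact ContDiffAt.sqrt (by fun_prop) h0
  unfold u1
  fun_prop

lemma u1_homog {r : ℝ} (hr : 0 < r) (x : Fin 3 → ℝ) : u1 (r • x) = r ^ (3/2:ℝ) * u1 x := by
  have h1 : rr (r • x) = r * rr x := by
    unfold rr
    rw [← Real.sqrt_sq hr.le, ← Real.sqrt_mul (sq_nonneg _), Real.sqrt_sq hr.le]
    congr 1; simp; ring
  have h2 : pp (r • x) = √r * pp x := by
    unfold pp
    rw [h1, ← Real.sqrt_mul hr.le]
    congr 1; simp; ring
  have h3 : r ^ (3/2:ℝ) = r * √r := by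
    rw [Real.sqrt_eq_rpow, show (3/2:ℝ) = 1 + 1/2 by norm_num, Real.rpow_add hr, Real.rpow_one]
  unfold u1
  rw [h1, h2, h3]; simp; ring

lemma u1_upper (x : Fin 3 → ℝ) (hx : x 2 = 0) : ∃ d, d ≤ 0 ∧ HasUpperDeriv u1 2 x d := by
  rcases lt_trichotomy (x 0) 0 with h | h | h
  · have h2 : x ∈ V1 := lt_of_lt_of_le h (rr_nonneg x)
    refine ⟨0, le_refl _, upper_even (u1_d h2).differentiableAt fun t => ?_⟩
    simp [u1, pp, rr, hx]
  · refine ⟨0, le_refl _, ?_⟩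
    have h1 : Tendsto (fun t : ℝ => -√(t/2)) (nhdsWithin 0 (Ioi 0)) (nhds (-√(0/2))) :=
      ((by fun_prop : Continuous fun t : ℝ => -√(t/2)).tendsto 0).mono_left nhdsWithin_le_nhds
    rw [zero_div, Real.sqrt_zero, neg_zero] at h1
    refine h1.congr' ?_
    filter_upwards [self_mem_nhdsWithin] with t ht
    have ht' : (0:ℝ) < t := ht
    rw [u1_zero hx h.ge]
    simp [u1, pp, rr, hx, h, Real.sqrt_sq ht'.le]
    field_simp
  · have h1 : Tendsto (fun t : ℝ => -(√(x 0^2+t^2) + 2 * x 0) / √(2*(√(x 0^2+t^2) + x 0))) (nhdsWithin 0 (Ioi 0))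
        (nhds (-(√(x 0^2+0^2) + 2 * x 0) / √(2*(√(x 0^2+0^2) + x 0)))) := by
      refine Tendsto.mono_left ?_ nhdsWithin_le_nhds
      refine ContinuousAt.tendsto (f := fun t : ℝ => -(√(x 0^2+t^2) + 2 * x 0) / √(2*(√(x 0^2+t^2) + x 0))) ?_
      refine ContinuousAt.div (by fun_prop) (by fun_prop) ?_
      exact (Real.sqrt_pos.2 (by have := Real.sqrt_nonneg (x 0^2+0^2); linarith)).ne'
    refine ⟨_, ?_, h1.congr' ?_⟩
    · refine div_nonpos_of_nonpos_of_nonneg ?_ (Real.sqrt_nonneg _)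
      have := Real.sqrt_nonneg (x 0^2+0^2); linarith
    · filter_upwards [self_mem_nhdsWithin] with t ht
      have ht' : (0:ℝ) < t := ht
      rw [u1_zero hx h.le, sub_zero]
      set y : Fin 3 → ℝ := x + t • (Pi.single 2 1 : Fin 3 → ℝ) with hy
      have y0 : y 0 = x 0 := by simp [hy]
      have y2 : y 2 = t := by simp [hy, hx]
      have er : √(x 0^2+t^2) = rr y := by unfold rr; rw [y0, y2]
      rw [er]
      have hs := rr_sq y
      rw [y0, y2] at hs
      have hrn := rr_nonneg y
      have hyV : y ∈ V1 := by
        show y 0 < rr y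
        rw [y0]; nlinarith
      have hp := V1_p hyV
      have hq := pp_sq y
      rw [y0] at hq
      have e2 : √(2*(rr y + x 0)) = t / pp y := by
        rw [Real.sqrt_eq_iff_mul_self_eq (by linarith) (by positivity)]
        field_simp
        nlinarith
      rw [e2]
      unfold u1
      rw [y0]
      field_simp

lemma u1_sol : IsTOPSol (3/2) u1 2 where
  cont := u1_cont
  symm x := by simp [u1, pp, rr]
  homog r hr x := u1_homog hr x
  smooth x hx := (u1_smooth (V1_of hx)).contDiffWithinAt
  harm x hx := u1_harm (V1_of hx)
  nonneg x hx := by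
    rcases lt_or_ge (x 0) 0 with h | h
    · exact (u1_pos hx h).le
    · exact (u1_zero hx h).ge
  upper := u1_upper

lemma u1_set : contactSet u1 2 = slitCone 1 (1/2) := by
  have key : ∀ θ : ℝ, (∃ k : ℤ, |θ - 2 * π * k / ((1:ℕ):ℝ)| ≤ 1/2 * π / ((1:ℕ):ℝ)) ↔ 0 ≤ cos θ := by
    intro θ
    have := cos_ge_iff (t := θ) (c := π/2) (by positivity) (by linarith [pi_pos])
    rw [cos_pi_div_two] at this
    rw [this]
    refine exists_congr fun k => ?_
    rw [Nat.cast_one, div_one, div_one, show 1/2*π = π/2 by ring]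
  ext x
  rw [u1_contact]
  constructor
  · rintro ⟨h1, h2⟩
    obtain ⟨R, θ, hR, hxe⟩ := Dat.plane_form x h1
    rcases hR.eq_or_lt with h | h
    · refine ⟨0, le_refl _, 0, (key 0).2 (by simp), ?_⟩
      rw [hxe, ← h]; ext i; fin_cases i <;> simp
    · refine ⟨R, hR, θ, (key θ).2 ?_, hxe⟩
      rw [hxe] at h2
      exact nonneg_of_mul_nonneg_right (by simpa using h2) h
  · rintro ⟨R, hR, θ, hk, rfl⟩
    refine ⟨by simp, ?_⟩
    simpa using mul_nonneg hR ((key θ).1 hk)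

lemma main_one : ∃ (μ σ : ℝ) (u : (Fin 3 → ℝ) → ℝ),
        ((1:ℕ) : ℝ) + 2 * (1:ℕ) - 2 ≤ μ ∧ μ ≤ ((1:ℕ) : ℝ) + 2 * (1:ℕ) - 1 ∧ 0 < σ ∧ σ < 1 ∧
        IsTOPSol μ u 2 ∧ u ≠ 0 ∧ contactSet u 2 = slitCone 1 σ := by
  refine ⟨3/2, 1/2, u1, by norm_num, by norm_num, by norm_num, by norm_num, u1_sol, ?_, u1_set⟩
  intro h
  have h1 := u1_pos (x := ![-1, 0, 0]) (by simp) (by simp)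
  rw [h] at h1
  simp at h1

end TO

/-- **Variant of the construction (Section 4).** There is `γ > 0` such that for every odd
positive `m` and every integer `1 ≤ k ≤ 1 + γm/2` there are `μ ∈ [m+2k-2, m+2k-1]`,
`σ ∈ (0,1)` and a nontrivial `μ`-homogeneous solution of the thin obstacle problem in `ℝ³`
whose contact set is the slit cone `slitCone m σ`. -/
theorem thin_obstacle_higher_eigenfunctions :
    ∃ γ : ℝ, 0 < γ ∧ ∀ m : ℕ, Odd m → 0 < m → ∀ k : ℕ, 1 ≤ k → (k : ℝ) ≤ 1 + γ * m / 2 →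
      ∃ (μ σ : ℝ) (u : (Fin 3 → ℝ) → ℝ),
        (m : ℝ) + 2 * k - 2 ≤ μ ∧ μ ≤ (m : ℝ) + 2 * k - 1 ∧ 0 < σ ∧ σ < 1 ∧
        IsTOPSol μ u 2 ∧ u ≠ 0 ∧ contactSet u 2 = slitCone m σ := by
  refine ⟨1/100, by norm_num, fun m hm hm0 k hk hkm => ?_⟩
  by_cases h1 : m = 1
  · subst h1
    have hk1 : k = 1 := by
      have h2 : (k:ℝ) < 2 := by
        rw [Nat.cast_one] at hkm; linarith
      have h3 : k < 2 := by exact_mod_cast h2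
      omega
    subst hk1
    exact TO.main_one
  · have h3 : 3 ≤ m := by
      obtain ⟨j, hj⟩ := hm
      omega
    exact TO.main_ge3 hm h3 hk hkm
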